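/- Let K be a global function field of characteristic different from 2, i.e. a finite extension of 𝔽_q(t) where q is odd, and let m ≥ 1 be a natural number. Then the set {(a₁, …, a_m) ∈ (Kˣ)^m : the quadratic form a₁x₁² + ⋯ + a_mx_m² is anisotropic over K, i.e. a₁x₁² + ⋯ + a_mx_m² = 0 has no nonzero solution (x₁, …, x_m) ∈ K^m} is diophantine over K. -/

import Mathlib

/-- A subset `S ⊆ K^ι` is diophantine over `K` if there are `m ∈ ℕ` and a polynomial
`f` in the variables `y_i` (`i : ι`) and `x_1, …, x_m` with coefficients in `K` such that
`a ∈ S` iff `f(a, x) = 0` has a solution `x ∈ K^m`. -/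
def IsDiophantine {K : Type*} [Field K] {ι : Type*} [Fintype ι] (S : Set (ι → K)) : Prop :=
  ∃ (m : ℕ) (f : MvPolynomial (ι ⊕ Fin m) K),
    ∀ a : ι → K, a ∈ S ↔ ∃ x : Fin m → K, MvPolynomial.eval (Sum.elim a x) f = 0

section PA
namespace GFF

/-- `d` is represented by the ternary form `⟨a, b, -ab⟩`. -/
def Rep {K : Type*} [Field K] (a b d : K) : Prop :=
  ∃ X Y Z : K, d = a * X ^ 2 + b * Y ^ 2 - a * b * Z ^ 2

/-- Local symbol data on a field: classes modulo local squares. -/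
structure LSym (K : Type*) [Field K] where
  p : K → ZMod 2
  r : K → ZMod 2
  n : ZMod 2
  p_mul : ∀ a b : K, a ≠ 0 → b ≠ 0 → p (a * b) = p a + p b
  r_mul : ∀ a b : K, a ≠ 0 → b ≠ 0 → r (a * b) = r a + r b
  p_neg : p (-1) = 0
  r_neg : r (-1) = n
  stein : ∀ a b : K, a ≠ 0 → b ≠ 0 → a + b = 1 →
    n * p a * p b + r a * p b + r b * p a = 0

lemma z2_add_self (x : ZMod 2) : x + x = 0 := CharTwo.add_self_eq_zero x

lemma z2_cases (x : ZMod 2) : x = 0 ∨ x = 1 := by revert x; decide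

lemma z2_mul_self (x : ZMod 2) : x * x = x := by revert x; decide

namespace LSym

variable {K : Type*} [Field K] (S : LSym K)

/-- The local symbol. -/
def h (a b : K) : ZMod 2 := S.n * S.p a * S.p b + S.r a * S.p b + S.r b * S.p a

/-- Being a local square. -/
def Sq (a : K) : Prop := S.p a = 0 ∧ S.r a = 0

lemma p_one : S.p 1 = 0 := by
  have := S.p_mul 1 1 one_ne_zero one_ne_zero
  simpa using this

lemma r_one : S.r 1 = 0 := by
  have := S.r_mul 1 1 one_ne_zero one_ne_zero
  simpa using this

lemma h_comm (a b : K) : S.h a b = S.h b a := by unfold h; ring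

lemma h_mul_right {a b c : K} (hb : b ≠ 0) (hc : c ≠ 0) :
    S.h a (b * c) = S.h a b + S.h a c := by
  unfold h; rw [S.p_mul b c hb hc, S.r_mul b c hb hc]; ring

lemma h_mul_left {a b c : K} (hb : b ≠ 0) (hc : c ≠ 0) :
    S.h (b * c) a = S.h b a + S.h c a := by
  rw [h_comm, S.h_mul_right hb hc, S.h_comm a b, S.h_comm a c]

lemma p_sq {a : K} (ha : a ≠ 0) : S.p (a ^ 2) = 0 := by
  rw [pow_two, S.p_mul a a ha ha, z2_add_self]

lemma r_sq {a : K} (ha : a ≠ 0) : S.r (a ^ 2) = 0 := by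
  rw [pow_two, S.r_mul a a ha ha, z2_add_self]

lemma sq_sq {a : K} (ha : a ≠ 0) : S.Sq (a ^ 2) := ⟨S.p_sq ha, S.r_sq ha⟩

lemma sq_one : S.Sq 1 := ⟨S.p_one, S.r_one⟩

lemma h_of_sq_left {a b : K} (ha : S.Sq a) : S.h a b = 0 := by
  unfold h; rw [ha.1, ha.2]; ring

lemma h_of_sq_right {a b : K} (ha : S.Sq a) : S.h b a = 0 := by
  rw [h_comm, S.h_of_sq_left ha]

lemma h_one_right (a : K) : S.h a 1 = 0 := S.h_of_sq_right S.sq_one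

lemma h_neg_self {a : K} (ha : a ≠ 0) : S.h a (-a) = 0 := by
  have e : -a = (-1) * a := by ring
  have hn : (-1 : K) ≠ 0 := neg_ne_zero.mpr one_ne_zero
  unfold h
  rw [e, S.p_mul _ _ hn ha, S.r_mul _ _ hn ha, S.p_neg, S.r_neg]
  rcases z2_cases (S.p a) with h1 | h1 <;> rcases z2_cases (S.r a) with h2 | h2 <;>
    rcases z2_cases S.n with h3 | h3 <;> rw [h1, h2, h3] <;> decide

lemma h_self {a : K} (ha : a ≠ 0) : S.h a a = S.h a (-1) := by
  have h1 := S.h_neg_self ha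
  have e : -a = (-1) * a := by ring
  rw [e, S.h_mul_right (neg_ne_zero.mpr one_ne_zero) ha] at h1
  rcases z2_cases (S.h a a) with h2 | h2 <;> rcases z2_cases (S.h a (-1)) with h3 | h3 <;>
    rw [h2, h3] at h1 ⊢ <;> revert h1 <;> decide

lemma h_inv_right {a b : K} (hb : b ≠ 0) : S.h a b⁻¹ = S.h a b := by
  have h1 := S.h_mul_right (a := a) hb (inv_ne_zero hb)
  rw [mul_inv_cancel₀ hb, S.h_one_right] at h1
  rcases z2_cases (S.h a b) with h2 | h2 <;> rcases z2_cases (S.h a b⁻¹) with h3 | h3 <;>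
    rw [h2, h3] at h1 ⊢ <;> revert h1 <;> decide

lemma h_inv_left {a b : K} (hb : b ≠ 0) : S.h b⁻¹ a = S.h b a := by
  rw [h_comm, S.h_inv_right hb, h_comm]

lemma h_mul_sq_right {a b c : K} (hb : b ≠ 0) (hc : c ≠ 0) : S.h a (b * c ^ 2) = S.h a b := by
  rw [S.h_mul_right hb (pow_ne_zero 2 hc), S.h_of_sq_right (S.sq_sq hc), add_zero]

lemma sq_mul {a b : K} (ha : a ≠ 0) (hb : b ≠ 0) (h1 : S.Sq a) (h2 : S.Sq b) : S.Sq (a * b) := by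
  unfold Sq; rw [S.p_mul a b ha hb, S.r_mul a b ha hb, h1.1, h1.2, h2.1, h2.2]; decide

lemma sq_mul_iff {a b : K} (ha : a ≠ 0) (hb : b ≠ 0) :
    S.Sq (a * b) ↔ S.p a = S.p b ∧ S.r a = S.r b := by
  unfold Sq; rw [S.p_mul a b ha hb, S.r_mul a b ha hb]
  generalize S.p a = x; generalize S.p b = y; generalize S.r a = z; generalize S.r b = w
  revert x y z w; decide

lemma h_congr_left {a a' b : K} (h1 : S.p a = S.p a') (h2 : S.r a = S.r a') :
    S.h a b = S.h a' b := by unfold h; rw [h1, h2]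

lemma h_congr_right {a a' b : K} (h1 : S.p a = S.p a') (h2 : S.r a = S.r a') :
    S.h b a = S.h b a' := by unfold h; rw [h1, h2]

/-- The symbol of a sum. -/
lemma h_add {a e : K} (ha : a ≠ 0) (he : e ≠ 0) (hc : a + e ≠ 0) :
    S.h a e = S.h (a + e) (-(a * e)) := by
  have h1 := S.stein (a * (a + e)⁻¹) (e * (a + e)⁻¹) (mul_ne_zero ha (inv_ne_zero hc))
    (mul_ne_zero he (inv_ne_zero hc)) (by field_simp)
  change S.h _ _ = 0 at h1
  have hi := inv_ne_zero hc
  rw [S.h_mul_right he hi, S.h_mul_left ha hi, S.h_mul_left ha hi, S.h_inv_left hc,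
    S.h_inv_left hc, S.h_inv_right hc, S.h_inv_right hc, S.h_self hc] at h1
  have e1 : -(a * e) = (-1) * (a * e) := by ring
  have hn : (-1 : K) ≠ 0 := neg_ne_zero.mpr one_ne_zero
  rw [e1, S.h_mul_right hn (mul_ne_zero ha he), S.h_mul_right ha he]
  rw [S.h_comm a (a + e)] at h1
  generalize S.h a e = x at *
  generalize S.h (a + e) e = y at *
  generalize S.h (a + e) a = z at *
  generalize S.h (a + e) (-1) = w at *
  revert h1 x y z w; decide

/-- Norms have trivial symbol. -/
lemma h_norm {a X Y : K} (ha : a ≠ 0) (hN : X ^ 2 - a * Y ^ 2 ≠ 0) :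
    S.h a (X ^ 2 - a * Y ^ 2) = 0 := by
  by_cases hY : Y = 0
  · subst hY
    have hX : X ≠ 0 := by rintro rfl; simp at hN
    have : X ^ 2 - a * 0 ^ 2 = X ^ 2 := by ring
    rw [this, S.h_of_sq_right (S.sq_sq hX)]
  by_cases hX : X = 0
  · subst hX
    have : (0:K) ^ 2 - a * Y ^ 2 = -a * Y ^ 2 := by ring
    rw [this, S.h_mul_sq_right (neg_ne_zero.mpr ha) hY, S.h_neg_self ha]
  have h1 := S.h_add (a := a * Y ^ 2) (e := X ^ 2 - a * Y ^ 2)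
    (mul_ne_zero ha (pow_ne_zero 2 hY)) hN (by simpa using hX)
  rw [add_sub_cancel, S.h_of_sq_left (S.sq_sq hX)] at h1
  rwa [S.h_comm, S.h_mul_sq_right ha hY, S.h_comm] at h1

/-- If `a` is nonsquare locally, there is a class with nontrivial symbol. -/
lemma h_ne_of_rep {a b d : K} (ha : a ≠ 0) (hb : b ≠ 0) (hd : d ≠ 0) (hr : Rep a b d) :
    ∃ f : K, f ≠ 0 ∧ ∀ S : LSym K, S.h d f = S.h a b := by
  obtain ⟨X, Y, Z, rfl⟩ := hr
  by_cases he : Y ^ 2 - a * Z ^ 2 = 0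
  · by_cases hZ : Z = 0
    · subst hZ
      have hY : Y = 0 := by simpa using he
      subst hY
      have hX : X ≠ 0 := by rintro rfl; simp at hd
      refine ⟨b, hb, fun S => ?_⟩
      have : a * X ^ 2 + b * 0 ^ 2 - a * b * 0 ^ 2 = a * X ^ 2 := by ring
      rw [this, S.h_comm, S.h_mul_sq_right ha hX, S.h_comm]
    · refine ⟨1, one_ne_zero, fun S => ?_⟩
      have hY : Y ≠ 0 := by
        rintro rfl
        apply hZ
        have : a * Z ^ 2 = 0 := by linear_combination -he
        rcases mul_eq_zero.mp this with h | h
        · exact absurd h ha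
        · simpa using h
      have ea : a = (Y / Z) ^ 2 := by
        field_simp; linear_combination -he
      have : S.h a b = 0 := by
        rw [ea]; exact S.h_of_sq_left (S.sq_sq (div_ne_zero hY hZ))
      rw [S.h_one_right, this]
  · have he' : b * (Y ^ 2 - a * Z ^ 2) ≠ 0 := mul_ne_zero hb he
    set e := b * (Y ^ 2 - a * Z ^ 2) with hedef
    have hc : a * X ^ 2 + b * Y ^ 2 - a * b * Z ^ 2 = a * X ^ 2 + e := by rw [hedef]; ring
    rw [hc] at hd ⊢
    refine ⟨-(a * e), neg_ne_zero.mpr (mul_ne_zero ha he'), fun S => ?_⟩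
    have h0 : S.h a e = S.h a b := by
      rw [hedef, S.h_mul_right hb he, S.h_norm ha he, add_zero]
    rw [← h0]
    by_cases hX : X = 0
    · subst hX
      have : a * 0 ^ 2 + e = e := by ring
      rw [this]
      have e2 : -(a * e) = a * (-e) := by ring
      rw [e2, S.h_mul_right ha (neg_ne_zero.mpr he'), S.h_neg_self he', add_zero, S.h_comm]
    · have h1 := S.h_add (mul_ne_zero ha (pow_ne_zero 2 hX)) he' hd
      have e3 : -(a * X ^ 2 * e) = -(a * e) * X ^ 2 := by ring
      rw [e3, S.h_mul_sq_right (neg_ne_zero.mpr (mul_ne_zero ha he')) hX, S.h_comm,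
        S.h_mul_sq_right ha hX, S.h_comm] at h1
      exact h1.symm

/-- Soundness of `Rep`. -/
lemma not_sq_of_rep {a b d : K} (ha : a ≠ 0) (hb : b ≠ 0) (hd : d ≠ 0) (hr : Rep a b d)
    (hh : S.h a b ≠ 0) : ¬ S.Sq d := by
  intro hs
  obtain ⟨f, hf, hS⟩ := h_ne_of_rep ha hb hd hr
  exact hh (by rw [← hS S, S.h_of_sq_left hs])

end LSym

section forms
variable {K : Type*} [Field K]

/-- isotropy of the diagonal quaternary form. -/
def Iso4 (a b c d : K) : Prop :=
  ∃ x y z w : K, ¬ (x = 0 ∧ y = 0 ∧ z = 0 ∧ w = 0) ∧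
    a * x ^ 2 + b * y ^ 2 + c * z ^ 2 + d * w ^ 2 = 0

lemma rep_of_isotropic3 (h2 : (2 : K) ≠ 0) {a b c : K} {X Y Z : K} (hn : ¬ (X = 0 ∧ Y = 0 ∧ Z = 0))
    (ha : a ≠ 0) (hb : b ≠ 0) (hc : c ≠ 0)
    (h : a * X ^ 2 + b * Y ^ 2 + c * Z ^ 2 = 0) (d : K) :
    ∃ X Y Z : K, d = a * X ^ 2 + b * Y ^ 2 + c * Z ^ 2 := by
  have key : ∀ U V W : K, a * X * U + b * Y * V + c * Z * W ≠ 0 →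
      ∃ X Y Z : K, d = a * X ^ 2 + b * Y ^ 2 + c * Z ^ 2 := by
    intro U V W hB
    set B := a * X * U + b * Y * V + c * Z * W with hBdef
    set q := a * U ^ 2 + b * V ^ 2 + c * W ^ 2 with hq
    refine ⟨U + (d - q) / (2 * B) * X, V + (d - q) / (2 * B) * Y,
      W + (d - q) / (2 * B) * Z, ?_⟩
    have e1 : (d - q) / (2 * B) * (2 * B) = d - q := div_mul_cancel₀ _ (mul_ne_zero h2 hB)
    generalize (d - q) / (2 * B) = t at *
    linear_combination -e1 - t^2 * h + 2 * t * hBdef  + hq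
  by_cases hX : X = 0
  · by_cases hY : Y = 0
    · have hZ : Z ≠ 0 := fun h => hn ⟨hX, hY, h⟩
      exact key 0 0 1 (by simpa using ⟨hc, hZ⟩)
    · exact key 0 1 0 (by simpa using ⟨hb, hY⟩)
  · exact key 1 0 0 (by simpa using ⟨ha, hX⟩)

lemma rep_of_iso (h2 : (2 : K) ≠ 0) {a b d : K} (ha : a ≠ 0) (hb : b ≠ 0)
    (h : Iso4 (-d) a b (-(a * b))) : Rep a b d := by
  obtain ⟨x, y, z, w, hn, he⟩ := h
  by_cases hx : x = 0
  · subst hx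
    obtain ⟨X, Y, Z, hh⟩ := rep_of_isotropic3 h2 (a := a) (b := b) (c := -(a * b))
      (X := y) (Y := z) (Z := w) (by tauto) ha hb
      (neg_ne_zero.mpr (mul_ne_zero ha hb)) (by linear_combination he) d
    exact ⟨X, Y, Z, by linear_combination hh⟩
  · refine ⟨y / x, z / x, w / x, ?_⟩
    field_simp
    linear_combination -he

lemma iso4_iff_rep (h2 : (2 : K) ≠ 0) {b1 b2 b3 b4 : K} (h1 : b1 ≠ 0) (hb2 : b2 ≠ 0)
    (h3 : b3 ≠ 0) (h4 : b4 ≠ 0) :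
    Iso4 b1 b2 b3 b4 ↔ Rep (-(b1 * b2)) (-(b1 * b3)) (b1 * b2 * b3 * b4) := by
  constructor
  · rintro ⟨x, y, z, w, hn, he⟩
    apply rep_of_iso h2 (by simpa using ⟨h1, hb2⟩) (by simpa using ⟨h1, h3⟩)
    refine ⟨w, b3 * z, b2 * y, x, ?_, ?_⟩
    · rintro ⟨ha, hb, hc, hd⟩
      apply hn
      simp only [mul_eq_zero, h3, hb2, false_or] at *
      exact ⟨hd, hc, hb, ha⟩
    · linear_combination -(b1 * b2 * b3) * he
  · rintro ⟨X, Y, Z, h⟩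
    refine ⟨b1 * b2 * b3 * Z, b3 * Y * b1, b2 * X * b1, b2 * b3 * b1, ?_, ?_⟩
    · rintro ⟨-, -, -, h⟩
      simp only [mul_eq_zero] at h
      tauto
    · linear_combination (b1 * b2 * b3) * h
end forms
end GFF
end PA

section PA2
namespace GFF
section forms2
variable {K : Type*} [Field K]

lemma rep_of_pure_isotropic (h2 : (2 : K) ≠ 0) {a b : K} (ha : a ≠ 0) (hb : b ≠ 0) {X Y Z : K}
    (hn : ¬ (X = 0 ∧ Y = 0 ∧ Z = 0)) (h : a * X ^ 2 + b * Y ^ 2 - a * b * Z ^ 2 = 0) (d : K) :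
    Rep a b d := by
  obtain ⟨X, Y, Z, hh⟩ := rep_of_isotropic3 h2 (a := a) (b := b) (c := -(a * b))
      hn ha hb
      (neg_ne_zero.mpr (mul_ne_zero ha hb)) (by linear_combination h) d
  exact ⟨X, Y, Z, by linear_combination hh⟩

lemma pure_isotropic_of_rep_one {a b : K} (ha : a ≠ 0) (hb : b ≠ 0)
    (h : Rep a b 1) : ∃ X Y Z : K, ¬ (X = 0 ∧ Y = 0 ∧ Z = 0) ∧
      a * X ^ 2 + b * Y ^ 2 - a * b * Z ^ 2 = 0 := by
  obtain ⟨X, Y, Z, h⟩ := h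
  by_cases h1 : a * X ^ 2 + b * Y ^ 2 = 0
  · by_cases h0 : X = 0 ∧ Y = 0
    · obtain ⟨rfl, rfl⟩ := h0
      refine ⟨1, - (a * Z), 0, by simp, ?_⟩
      linear_combination a * h
    · exact ⟨X, Y, 0, by tauto, by linear_combination h1⟩
  · refine ⟨b * Y - a * b * X * Z, -(a * X) - a * b * Y * Z, a * X ^ 2 + b * Y ^ 2, by tauto, ?_⟩
    linear_combination a * b * (a * X ^ 2 + b * Y ^ 2) * h

/-- If the quaternion algebra splits over `K(√d)`, then `d` is represented. -/
lemma rep_of_rep_quadratic (h2 : (2 : K) ≠ 0) {E : Type*} [Field E] [Algebra K E] {s : E} {d : K}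
    (hs : s ^ 2 = algebraMap K E d)
    (hgen : ∀ z : E, ∃ x y : K, z = algebraMap K E x + algebraMap K E y * s)
    (hind : ∀ x y : K, algebraMap K E x + algebraMap K E y * s = 0 → x = 0 ∧ y = 0)
    {a b : K} (ha : a ≠ 0) (hb : b ≠ 0)
    (h : Rep (algebraMap K E a) (algebraMap K E b) 1) : Rep a b d := by
  have inj := (algebraMap K E).injective
  obtain ⟨X, Y, Z, hn, h⟩ := pure_isotropic_of_rep_one
    (by simpa using ha) (by simpa using hb) h
  obtain ⟨x1, y1, rfl⟩ := hgen X
  obtain ⟨x2, y2, rfl⟩ := hgen Y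
  obtain ⟨x3, y3, rfl⟩ := hgen Z
  have := hind ((a * x1 ^ 2 + b * x2 ^ 2 - a * b * x3 ^ 2) +
      d * (a * y1 ^ 2 + b * y2 ^ 2 - a * b * y3 ^ 2))
    (2 * (a * x1 * y1 + b * x2 * y2 - a * b * x3 * y3)) (by
      simp only [map_add, map_mul, map_sub, map_pow, map_ofNat]
      rw [← hs]
      linear_combination h)
  obtain ⟨e1, e2⟩ := this
  have e2' : a * x1 * y1 + b * x2 * y2 - a * b * x3 * y3 = 0 := by
    rcases mul_eq_zero.mp e2 with h | h
    · exact absurd h h2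
    · exact h
  by_cases hy : y1 = 0 ∧ y2 = 0 ∧ y3 = 0
  · obtain ⟨rfl, rfl, rfl⟩ := hy
    apply rep_of_pure_isotropic h2 ha hb (X := x1) (Y := x2) (Z := x3)
    · rintro ⟨rfl, rfl, rfl⟩; simp at hn
    · linear_combination e1
  by_cases hq : a * y1 ^ 2 + b * y2 ^ 2 - a * b * y3 ^ 2 = 0
  · exact rep_of_pure_isotropic h2 ha hb hy hq d
  set q := a * y1 ^ 2 + b * y2 ^ 2 - a * b * y3 ^ 2 with hqd
  refine ⟨b * (x3 * y2 - x2 * y3) / q, a * (x1 * y3 - x3 * y1) / q, (x1 * y2 - x2 * y1) / q, ?_⟩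
  field_simp
  have : d * q = -(a * x1 ^ 2 + b * x2 ^ 2 - a * b * x3 ^ 2) := by linear_combination e1
  rw [pow_two, ← mul_assoc, this, hqd]
  linear_combination -(a * x1 * y1 + b * x2 * y2 - a * b * x3 * y3) * e2'

lemma rep_of_sq {a b s : K} (hs : s ≠ 0) (h : Rep a b (s ^ 2)) : Rep a b 1 := by
  obtain ⟨X, Y, Z, h⟩ := h
  refine ⟨X / s, Y / s, Z / s, ?_⟩
  field_simp
  linear_combination h

lemma rep_mul_sq {a b d s : K} (h : Rep a b d) : Rep a b (d * s ^ 2) := by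
  obtain ⟨X, Y, Z, h⟩ := h
  exact ⟨X * s, Y * s, Z * s, by rw [h]; ring⟩

/-- splitting in terms of norms -/
lemma rep_one_of_norm {a b x y : K} (hb : b ≠ 0) (h : b = x ^ 2 - a * y ^ 2) : Rep a b 1 := by
  refine ⟨0, x / b, y / b, ?_⟩
  field_simp
  linear_combination h

/-- symbols over all local data, for comparing slots -/
lemma exists_link {c x e f : K} (hc : c ≠ 0) (hx : x ≠ 0) (he : e ≠ 0) (hf : f ≠ 0)
    (h : Rep c (x * f) (c * e)) :
    ∃ y : K, y ≠ 0 ∧ ∀ S : LSym K, S.h c x = S.h e f →  S.h c y = S.h c x ∧ S.h e y = S.h e f := by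
  obtain ⟨X, Y, Z, h⟩ := h
  by_cases h0 : X ^ 2 - e = 0
  · refine ⟨x, hx, fun S hS => ⟨rfl, ?_⟩⟩
    have : e = X ^ 2 := by linear_combination -h0
    have hX : X ≠ 0 := by rintro rfl; simp at this; exact he this
    rw [this, S.h_of_sq_left (S.sq_sq hX), S.h_of_sq_left (S.sq_sq hX)]
  · refine ⟨f * (X ^ 2 - e * 1 ^ 2), mul_ne_zero hf (by simpa using h0), fun S _ => ⟨?_, ?_⟩⟩
    · have hN : Y ^ 2 - c * Z ^ 2 ≠ 0 := by
        intro hN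
        apply h0
        have : c * (X ^ 2 - e) = 0 := by linear_combination -h - x * f * hN
        exact (mul_eq_zero.mp this).resolve_left hc
      have e1 : f * (X ^ 2 - e * 1 ^ 2) = x * f ^ 2 * (Y ^ 2 - c * Z ^ 2) * (-c)⁻¹ := by
        rw [eq_mul_inv_iff_mul_eq₀ (neg_ne_zero.mpr hc)]
        linear_combination -f * -h
      have hxf := mul_ne_zero hx (pow_ne_zero 2 hf)
      rw [e1, S.h_mul_right (mul_ne_zero hxf hN) (inv_ne_zero (neg_ne_zero.mpr hc)),
        S.h_mul_right hxf hN, S.h_mul_sq_right hx hf, S.h_norm hc hN,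
        S.h_inv_right (neg_ne_zero.mpr hc), S.h_neg_self hc]
      simp
    · rw [S.h_mul_right hf (by simpa using h0), S.h_norm he (by simpa using h0), add_zero]
end forms2
end GFF
end PA2

section PB1
namespace GFF
open IntermediateField Polynomial
open scoped IntermediateField.algebraAdjoinAdjoin

/-- Function fields in one variable over `F`. -/
class FF (F L : Type*) [Field F] [Field L] [Algebra F L] : Prop where
  exists_tr : ∃ x : L, Transcendental F x
  findim : ∀ x : L, Transcendental F x → FiniteDimensional F⟮x⟯ L

section
variable {F L : Type*} [Field F] [Field L] [Algebra F L]

lemma FF.of_finite (t : L) (ht : Transcendental F t) (hfin : FiniteDimensional F⟮t⟯ L) :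
    FF F L := by
  refine ⟨⟨t, ht⟩, fun x hx => ?_⟩
  have h1 : Algebra.trdeg F L ≤ 1 := by
    have : Algebra.IsAlgebraic (Algebra.adjoin F {t}) L := by
      rw [IsFractionRing.comap_isAlgebraic_iff (A := Algebra.adjoin F {t}) (K := F⟮t⟯)
        (C := L)]
      infer_instance
    have h2 := Algebra.IsAlgebraic.trdeg_le_cardinalMk F ({t} : Set L)
    simpa using h2
  have hx' : AlgebraicIndependent F (fun _ : Fin 1 => x) :=
    (algebraicIndependent_unique_type_iff).2 hx
  have hb : IsTranscendenceBasis F (fun _ : Fin 1 => x) :=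
    hx'.isTranscendenceBasis_of_lift_trdeg_le_of_finite (by simpa using h1)
  have ha := hb.isAlgebraic_field
  rw [Set.range_const] at ha
  have e1 : Algebra.EssFiniteType F F⟮t⟯ := by
    rw [essFiniteType_iff]
    exact ⟨{t}, by simp⟩
  have e2 : Algebra.EssFiniteType F L := Algebra.EssFiniteType.comp F F⟮t⟯ L
  have e3 : Algebra.EssFiniteType F⟮x⟯ L := Algebra.EssFiniteType.of_comp F F⟮x⟯ L
  exact Algebra.finite_of_essFiniteType_of_isAlgebraic

lemma FF.of_ratFunc [Algebra (RatFunc F) L] [FiniteDimensional (RatFunc F) L]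
    [IsScalarTower F (RatFunc F) L] : FF F L := by
  have hX : Transcendental F (algebraMap (RatFunc F) L RatFunc.X) := by
    have : Transcendental F (RatFunc.X : RatFunc F) := by
      exact RatFunc.transcendental_X
    exact (transcendental_algebraMap_iff (algebraMap (RatFunc F) L).injective).2 this
  refine FF.of_finite _ hX ?_
  have hmem : ∀ c : RatFunc F, algebraMap (RatFunc F) L c ∈ F⟮algebraMap (RatFunc F) L RatFunc.X⟯ := by
    intro c
    have h : c ∈ F⟮(RatFunc.X : RatFunc F)⟯ := by
      rw [RatFunc.adjoin_X]; trivial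
    have := IntermediateField.adjoin_map F {(RatFunc.X : RatFunc F)}
      (IsScalarTower.toAlgHom F (RatFunc F) L)
    rw [Set.image_singleton] at this
    have h3 : (IsScalarTower.toAlgHom F (RatFunc F) L) c ∈ F⟮(RatFunc.X : RatFunc F)⟯.map
      (IsScalarTower.toAlgHom F (RatFunc F) L) := ⟨c, h, rfl⟩
    rw [this] at h3
    exact h3
  obtain ⟨s, hs⟩ := (Module.finite_def (R := RatFunc F) (M := L)).1 inferInstance
  refine ⟨s, ?_⟩
  rw [eq_top_iff]
  intro y _
  have hy : y ∈ Submodule.span (RatFunc F) (s : Set L) := by rw [hs]; trivial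
  induction hy using Submodule.span_induction with
  | mem x h => exact Submodule.subset_span h
  | zero => exact Submodule.zero_mem _
  | add x y _ _ hx hy => exact Submodule.add_mem _ (hx trivial) (hy trivial)
  | smul a x _ hx =>
    have := Submodule.smul_mem _ (⟨_, hmem a⟩ : F⟮algebraMap (RatFunc F) L RatFunc.X⟯) (hx trivial)
    rw [Algebra.smul_def] at this ⊢
    exact this

lemma FF.of_extension {K : Type*} [Field K] [Algebra F K] [Algebra K L] [IsScalarTower F K L]
    [FF F K] [FiniteDimensional K L] : FF F L := by
  obtain ⟨t, ht⟩ := FF.exists_tr (F := F) (L := K)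
  have hft := FF.findim t ht
  have ht' : Transcendental F (algebraMap K L t) :=
    (transcendental_algebraMap_iff (algebraMap K L).injective).2 ht
  refine FF.of_finite _ ht' ?_
  have : FiniteDimensional F⟮t⟯ L := FiniteDimensional.trans F⟮t⟯ K L
  have hmem : ∀ c : F⟮t⟯, algebraMap K L c ∈ F⟮algebraMap K L t⟯ := by
    intro c
    have := IntermediateField.adjoin_map F {t} (IsScalarTower.toAlgHom F K L)
    rw [Set.image_singleton] at this
    have h3 : (IsScalarTower.toAlgHom F K L) c ∈ F⟮t⟯.map
      (IsScalarTower.toAlgHom F K L) := ⟨c, c.2, rfl⟩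
    rw [this] at h3
    exact h3
  obtain ⟨s, hs⟩ := (Module.finite_def (R := F⟮t⟯) (M := L)).1 inferInstance
  refine ⟨s, ?_⟩
  rw [eq_top_iff]
  intro y _
  have hy : y ∈ Submodule.span F⟮t⟯ (s : Set L) := by rw [hs]; trivial
  induction hy using Submodule.span_induction with
  | mem x h => exact Submodule.subset_span h
  | zero => exact Submodule.zero_mem _
  | add x y _ _ hx hy => exact Submodule.add_mem _ (hx trivial) (hy trivial)
  | smul a x _ hx =>
    have := Submodule.smul_mem _ (⟨_, hmem a⟩ : F⟮algebraMap K L t⟯) (hx trivial)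
    rw [Algebra.smul_def] at this ⊢
    exact this

/-- degree of `L` over `F(x)` -/
noncomputable def ndeg (F : Type*) {L : Type*} [Field F] [Field L] [Algebra F L] (x : L) : ℕ :=
  Module.finrank F⟮x⟯ L

lemma exists_aeval_of_mem_adjoin (x : L) (a : Algebra.adjoin F {x}) :
    ∃ p : F[X], aeval x p = (a : L) := by
  have h := a.2
  exact (AlgHom.mem_range _).1 (by rw [← Algebra.adjoin_singleton_eq_range_aeval]; exact h)

lemma exists_dep [FF F L] {x : L} (hx : Transcendental F x) {k : ℕ} (hk : ndeg F x < k)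
    (y : Fin k → L) : ∃ p : Fin k → F[X], p ≠ 0 ∧ ∑ i, aeval x (p i) * y i = 0 := by
  have := FF.findim x hx
  have h1 : ¬ LinearIndependent F⟮x⟯ y := by
    intro h
    have := h.fintype_card_le_finrank
    simp only [Fintype.card_fin] at this
    unfold ndeg at hk; omega
  rw [← LinearIndependent.iff_fractionRing (R := Algebra.adjoin F {x}),
    Fintype.linearIndependent_iff] at h1
  push Not at h1
  obtain ⟨g, hg, i, hi⟩ := h1
  choose p hp using fun i => exists_aeval_of_mem_adjoin x (g i)
  refine ⟨p, fun h => hi ?_, ?_⟩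
  · apply Subtype.ext
    rw [← hp i, h]; simp
  · rw [← hg]
    refine Finset.sum_congr rfl fun i _ => ?_
    rw [hp]; rfl

lemma exists_indep [FF F L] {x : L} (hx : Transcendental F x) :
    ∃ u : Fin (ndeg F x) → L, ∀ p : Fin (ndeg F x) → F[X],
      ∑ i, aeval x (p i) * u i = 0 → p = 0 := by
  have := FF.findim x hx
  let b := Module.finBasis F⟮x⟯ L
  refine ⟨b, fun p hp => ?_⟩
  have h1 := b.linearIndependent
  rw [← LinearIndependent.iff_fractionRing (R := Algebra.adjoin F {x}),
    Fintype.linearIndependent_iff] at h1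
  funext i
  have h2 := h1 (fun i => ⟨aeval x (p i), by
    rw [Algebra.adjoin_singleton_eq_range_aeval]; exact ⟨_, rfl⟩⟩) (by
      rw [← hp]; refine Finset.sum_congr rfl fun i _ => rfl) i
  have h3 : aeval x (p i) = 0 := congrArg Subtype.val h2
  exact (transcendental_iff_injective.1 hx) (by simpa using h3)

lemma exists_pow_eq_one [Finite F] {x : L} (hx : x ≠ 0) (ha : IsAlgebraic F x) :
    ∃ n : ℕ, 0 < n ∧ x ^ n = 1 := by
  have : FiniteDimensional F F⟮x⟯ := adjoin.finiteDimensional ha.isIntegral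
  have : Finite F⟮x⟯ := Module.finite_of_finite F
  let y : F⟮x⟯ := ⟨x, mem_adjoin_simple_self F x⟩
  have hy : y ≠ 0 := fun h => hx (congrArg Subtype.val h)
  obtain ⟨n, hn, h⟩ := isOfFinOrder_iff_pow_eq_one.1 (isOfFinOrder_of_finite (Units.mk0 y hy))
  refine ⟨n, hn, ?_⟩
  have := congrArg (fun u : F⟮x⟯ˣ => ((u : F⟮x⟯) : L)) h
  simpa [y] using this
end
end GFF
end PB1

section PB2
namespace GFF
open IntermediateField Polynomial

/-- A place of `L`: a normalized discrete valuation. -/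
@[ext]
structure Place (F L : Type*) [Field F] [Field L] [Algebra F L] where
  ord : L → ℤ
  ord_zero : ord 0 = 0
  ord_mul : ∀ {x y}, x ≠ 0 → y ≠ 0 → ord (x * y) = ord x + ord y
  ord_add : ∀ {x y}, x ≠ 0 → y ≠ 0 → x + y ≠ 0 → min (ord x) (ord y) ≤ ord (x + y)
  exists_unif : ∃ x, x ≠ 0 ∧ ord x = 1

section indep
variable {F L : Type*} [Field F] [Field L] [Algebra F L]

lemma tr_ne_zero {x : L} (hx : Transcendental F x) : x ≠ 0 :=
  fun h => hx (h ▸ isAlgebraic_zero)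

lemma indep_crit_aux {x : L} (hx0 : x ≠ 0) (R : Subring L) (hF : ∀ c : F, algebraMap F L c ∈ R)
    (hxR : x ∈ R) {k : ℕ} (y : Fin k → L) (hy : ∀ i, y i ∈ R)
    (h : ∀ c : Fin k → F, (∃ z ∈ R, ∑ i, algebraMap F L (c i) * y i = x * z) → c = 0) :
    ∀ n : ℕ, ∀ p : Fin k → F[X], (∀ i, (p i).natDegree < n) →
      ∑ i, aeval x (p i) * y i = 0 → p = 0 := by
  have hev : ∀ p : F[X], aeval x p ∈ R := by
    intro p
    rw [aeval_eq_sum_range]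
    refine Subring.sum_mem _ fun i _ => ?_
    rw [Algebra.smul_def]
    exact R.mul_mem (hF _) (R.pow_mem hxR _)
  have key : ∀ p : Fin k → F[X], ∑ i, aeval x (p i) * y i = 0 →
      (∀ i, (p i).coeff 0 = 0) ∧ ∑ i, aeval x (divX (p i)) * y i = 0 := by
    intro p hp
    have e : ∀ i, aeval x (p i) * y i = algebraMap F L ((p i).coeff 0) * y i +
        x * (aeval x (divX (p i)) * y i) := by
      intro i
      conv_lhs => rw [← divX_mul_X_add (p i)]
      simp; ring
    have e2 : ∑ i, algebraMap F L ((p i).coeff 0) * y i +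
        x * ∑ i, aeval x (divX (p i)) * y i = 0 := by
      rw [← hp, Finset.mul_sum, ← Finset.sum_add_distrib]
      exact Finset.sum_congr rfl fun i _ => (e i).symm
    have e3 := h (fun i => (p i).coeff 0) ⟨-∑ i, aeval x (divX (p i)) * y i,
      R.neg_mem (R.sum_mem fun i _ => R.mul_mem (hev _) (hy _)), by linear_combination e2⟩
    have e4 : ∀ i, (p i).coeff 0 = 0 := fun i => congrFun e3 i
    refine ⟨e4, ?_⟩
    simp only [e4, map_zero, zero_mul, Finset.sum_const_zero, zero_add] at e2
    exact (mul_eq_zero.1 e2).resolve_left hx0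
  intro n
  induction n with
  | zero =>
    intro p hp _
    funext i; exact absurd (hp i) (by omega)
  | succ n ih =>
    intro p hp hs
    obtain ⟨h0, h1⟩ := key p hs
    have hz : ∀ i, p i = divX (p i) * X := by
      intro i
      conv_lhs => rw [← divX_mul_X_add (p i), h0 i]
      simp
    by_cases hn : n = 0
    · subst hn
      funext i
      have := hp i
      rw [eq_C_of_natDegree_eq_zero (p := p i) (by omega), h0 i]; simp
    · have := ih (fun i => divX (p i)) (fun i => by
        have := hp i
        rw [natDegree_divX_eq_natDegree_tsub_one]; omega) h1
      funext i
      rw [hz i, congrFun this i]; simp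

/-- Elements of `R` independent over `F` modulo `xR` are independent over `F(x)`. -/
lemma indep_crit [FF F L] {x : L} (hx : Transcendental F x) (R : Subring L)
    (hF : ∀ c : F, algebraMap F L c ∈ R)
    (hxR : x ∈ R) {k : ℕ} (y : Fin k → L) (hy : ∀ i, y i ∈ R)
    (h : ∀ c : Fin k → F, (∃ z ∈ R, ∑ i, algebraMap F L (c i) * y i = x * z) → c = 0) :
    k ≤ ndeg F x := by
  by_contra hk
  obtain ⟨p, hp, hs⟩ := exists_dep hx (not_le.1 hk) y
  refine hp (indep_crit_aux (tr_ne_zero hx) R hF hxR y hy h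
    (Finset.univ.sup (fun i => (p i).natDegree) + 1) p (fun i => ?_) hs)
  have := Finset.le_sup (f := fun i => (p i).natDegree) (Finset.mem_univ i)
  omega

lemma mem_of_alg [Finite F] (O : ValuationSubring L) {x : L} (ha : IsAlgebraic F x) : x ∈ O := by
  by_cases hx : x = 0
  · rw [hx]; exact O.zero_mem
  obtain ⟨n, hn, h⟩ := exists_pow_eq_one hx ha
  rcases O.mem_or_inv_mem x with h1 | h1
  · exact h1
  · have : x = x⁻¹ ^ (n - 1) := by
      have : x * x ^ (n - 1) = 1 := by rw [← pow_succ', Nat.sub_add_cancel hn, h]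
      rw [inv_pow]; exact eq_inv_of_mul_eq_one_left this
    rw [this]; exact pow_mem h1 _

lemma chain_indep [Finite F] (O : ValuationSubring L) (l : List L)
    (hl : ∀ z ∈ l, z ∈ O ∧ z ≠ 0 ∧ z⁻¹ ∉ O) : ∀ c : ℕ → F,
    (∃ z ∈ O, ∑ i ∈ Finset.range l.length, algebraMap F L (c i) * (l.take i).prod = l.prod * z) →
    ∀ i < l.length, c i = 0 := by
  induction l with
  | nil => intro c _ i hi; simp at hi
  | cons z l ih =>
    rintro c ⟨w, hw, h⟩
    have hz := hl z (by simp)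
    have hF : ∀ a : F, algebraMap F L a ∈ O := fun a => mem_of_alg O (isAlgebraic_algebraMap a)
    have hlO : ∀ i, (l.take i).prod ∈ O := fun i =>
      list_prod_mem fun y hy => (hl y (by simp [List.mem_of_mem_take hy])).1
    rw [List.length_cons, Finset.sum_range_succ'] at h
    simp only [List.take_succ_cons, List.prod_cons, List.take_zero, List.prod_nil, mul_one] at h
    have e : ∑ i ∈ Finset.range l.length, algebraMap F L (c (i+1)) * (z * (l.take i).prod) =
      z * ∑ i ∈ Finset.range l.length, algebraMap F L (c (i+1)) * (l.take i).prod := by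
      rw [Finset.mul_sum]; exact Finset.sum_congr rfl fun i _ => by ring
    rw [e] at h
    have hS : ∑ i ∈ Finset.range l.length, algebraMap F L (c (i+1)) * (l.take i).prod ∈ O :=
      sum_mem fun i _ => mul_mem (hF _) (hlO i)
    have hlp : l.prod ∈ O := by simpa using hlO l.length
    have c0 : c 0 = 0 := by
      by_contra h0
      apply hz.2.2
      have h0' : algebraMap F L (c 0) ≠ 0 := by simpa using h0
      have : z⁻¹ = algebraMap F L ((c 0)⁻¹) * (l.prod * w -
          ∑ i ∈ Finset.range l.length, algebraMap F L (c (i+1)) * (l.take i).prod) := by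
        rw [map_inv₀]
        have := hz.2.1
        field_simp
        linear_combination h
      rw [this]
      exact mul_mem (hF _) (sub_mem (mul_mem hlp hw) hS)
    have h2 := ih (fun y hy => hl y (by simp [hy])) (fun i => c (i+1)) ⟨w, hw, by
      rw [c0] at h
      apply mul_left_cancel₀ hz.2.1
      simp only [map_zero] at h
      linear_combination h⟩
    intro i hi
    cases i with
    | zero => exact c0
    | succ i => exact h2 i (by simpa using hi)

lemma chain_bound [Finite F] [FF F L] (O : ValuationSubring L) {x : L} (hx : Transcendental F x)
    (hxO : x ∈ O) (l : List L)
    (hl : ∀ z ∈ l, z ∈ O ∧ z ≠ 0 ∧ z⁻¹ ∉ O) (hp : l.prod = x) : l.length ≤ ndeg F x := by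
  refine indep_crit hx O.toSubring (fun a => mem_of_alg O (isAlgebraic_algebraMap a)) hxO
    (fun i => (l.take i).prod) (fun i => list_prod_mem fun y hy =>
      (hl y (List.mem_of_mem_take hy)).1) ?_
  rintro c ⟨z, hz, h⟩
  have := chain_indep O l hl (fun i => if h : i < l.length then c ⟨i, h⟩ else 0) ⟨z, hz, by
    rw [hp, ← h, Finset.sum_range]; simp⟩
  funext i
  have := this i i.2
  simpa using this

/-- every proper valuation subring comes from a uniformizer -/
lemma exists_uniformizer [Finite F] [FF F L] (O : ValuationSubring L) (hO : O ≠ ⊤) :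
    ∃ π : L, π ≠ 0 ∧ π ∈ O ∧ π⁻¹ ∉ O ∧
      ∀ x : L, x ≠ 0 → ∃ n : ℤ, x * π ^ n ∈ O ∧ (x * π ^ n)⁻¹ ∈ O := by
  have htr : ∀ x, x ≠ 0 → x ∈ O → x⁻¹ ∉ O → Transcendental F x := by
    intro x hx h1 h2 h3
    exact h2 (mem_of_alg O h3.inv)
  obtain ⟨x0, hx0⟩ : ∃ x, x ∉ O := by
    by_contra h; push Not at h
    exact hO (by ext; simp [h])
  have hx00 : x0 ≠ 0 := fun h => hx0 (h ▸ O.zero_mem)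
  have hx1 : x0⁻¹ ∈ O := (O.mem_or_inv_mem x0).resolve_left hx0
  obtain ⟨x, hxd⟩ : ∃ x, x = x0⁻¹ := ⟨_, rfl⟩
  have hxn : x ≠ 0 := by rw [hxd]; exact inv_ne_zero hx00
  have hxO : x ∈ O := hxd ▸ hx1
  have hxi : x⁻¹ ∉ O := by rw [hxd, inv_inv]; exact hx0
  let P : ℕ → Prop := fun k => ∃ l : List L, (∀ z ∈ l, z ∈ O ∧ z ≠ 0 ∧ z⁻¹ ∉ O) ∧ l.prod = x ∧
    l.length = k
  have hP1 : P 1 := ⟨[x], by simp [hxO, hxn, hxi], by simp, rfl⟩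
  have hPb : ∀ k, P k → k ≤ ndeg F x := by
    rintro k ⟨l, h1, h2, rfl⟩
    exact chain_bound O (htr x hxn hxO hxi) hxO l h1 h2
  classical
  have hmax := Nat.findGreatest_spec (P := P) (hPb 1 hP1) hP1
  have hge : 1 ≤ Nat.findGreatest P (ndeg F x) := Nat.le_findGreatest (hPb 1 hP1) hP1
  have hno : ¬ P (Nat.findGreatest P (ndeg F x) + 1) := fun h => by
    have := Nat.le_findGreatest (hPb _ h) h
    omega
  obtain ⟨l, h1, h2, h3⟩ := hmax
  rw [← h3] at hge hno
  match l, h1, h2, hge, hno with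
  | [], _, _, hge, _ => simp at hge
  | π :: l, h1, h2, _, hno =>
  have hπ := h1 π (by simp)
  have hirr : ∀ a ∈ O, a ≠ 0 → a⁻¹ ∉ O → π⁻¹ * a ∈ O := by
    intro a ha ha0 hai
    rcases O.mem_or_inv_mem (π⁻¹ * a) with h | h
    · exact h
    by_contra hb
    refine hno ⟨a :: (π⁻¹ * a)⁻¹ :: l, ?_, ?_, by simp⟩
    · intro z hz
      simp only [List.mem_cons] at hz
      rcases hz with rfl | rfl | hz
      · exact ⟨ha, ha0, hai⟩
      · exact ⟨h, inv_ne_zero (mul_ne_zero (inv_ne_zero hπ.2.1) ha0), by rwa [inv_inv]⟩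
      · exact h1 z (by simp [hz])
    · rw [← h2]
      simp only [List.prod_cons]
      have := hπ.2.1
      field_simp
  have hfac : ∀ a ∈ O, a ≠ 0 → ∃ n : ℕ, a * (π⁻¹) ^ n ∈ O ∧ (a * (π⁻¹) ^ n)⁻¹ ∈ O := by
    intro a ha ha0
    by_contra hcon
    push Not at hcon
    have step : ∀ n : ℕ, a * (π⁻¹) ^ n ∈ O := by
      intro n
      induction n with
      | zero => simpa using ha
      | succ n ih =>
        have := hirr _ ih (mul_ne_zero ha0 (pow_ne_zero _ (inv_ne_zero hπ.2.1))) (hcon n ih)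
        rw [pow_succ]
        convert this using 1; ring
    have hai : a⁻¹ ∉ O := by simpa using hcon 0 (by simpa using ha)
    have hta := htr a ha0 ha hai
    set N := ndeg F a + 1 with hN
    have := chain_bound O hta ha (a * (π⁻¹) ^ N :: List.replicate N π) (by
      intro z hz
      simp only [List.mem_cons, List.mem_replicate] at hz
      rcases hz with rfl | ⟨_, rfl⟩
      · exact ⟨step N, mul_ne_zero ha0 (pow_ne_zero _ (inv_ne_zero hπ.2.1)), hcon N (step N)⟩
      · exact hπ) (by
      have := hπ.2.1
      simp only [List.prod_cons, List.prod_replicate]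
      rw [mul_assoc, ← mul_pow, inv_mul_cancel₀ this, one_pow, mul_one])
    simp at this
    omega
  refine ⟨π, hπ.2.1, hπ.1, hπ.2.2, fun a ha => ?_⟩
  rcases O.mem_or_inv_mem a with h | h
  · obtain ⟨n, h1, h2⟩ := hfac a h ha
    exact ⟨-n, by simpa using h1, by simpa using h2⟩
  · obtain ⟨n, h1, h2⟩ := hfac a⁻¹ h (inv_ne_zero ha)
    refine ⟨n, ?_, ?_⟩
    · simpa [mul_comm] using h2
    · simpa [mul_comm] using h1
end indep
end GFF
end PB2

section PB3
namespace GFF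
open IntermediateField Polynomial

namespace Place
variable {F L : Type*} [Field F] [Field L] [Algebra F L] (v w : Place F L)

lemma ord_one : v.ord 1 = 0 := by
  have := v.ord_mul (one_ne_zero (α := L)) one_ne_zero
  rw [mul_one] at this; omega

lemma ord_inv (x : L) : v.ord x⁻¹ = - v.ord x := by
  by_cases h : x = 0
  · simp [h, v.ord_zero]
  · have := v.ord_mul h (inv_ne_zero h)
    rw [mul_inv_cancel₀ h, v.ord_one] at this; omega

lemma ord_div {x y : L} (hx : x ≠ 0) (hy : y ≠ 0) : v.ord (x / y) = v.ord x - v.ord y := by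
  rw [div_eq_mul_inv, v.ord_mul hx (inv_ne_zero hy), ord_inv]; ring

lemma ord_pow (x : L) (n : ℕ) : v.ord (x ^ n) = n * v.ord x := by
  by_cases h : x = 0
  · subst h
    cases n with
    | zero => simp [v.ord_one]
    | succ n => simp [v.ord_zero]
  · induction n with
    | zero => simp [v.ord_one]
    | succ n ih => rw [pow_succ, v.ord_mul (pow_ne_zero _ h) h, ih]; push_cast; ring

lemma ord_zpow (x : L) (n : ℤ) : v.ord (x ^ n) = n * v.ord x := by
  cases n with
  | ofNat n => simpa using v.ord_pow x n
  | negSucc n => rw [zpow_negSucc, ord_inv, ord_pow, Int.negSucc_eq]; push_cast; ring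

lemma ord_eq_zero_of_pow {x : L} {n : ℕ} (hn : 0 < n) (h : x ^ n = 1) : v.ord x = 0 := by
  have := v.ord_pow x n
  rw [h, v.ord_one] at this
  rcases mul_eq_zero.1 this.symm with h | h
  · omega
  · exact h

lemma ord_of_alg [Finite F] {x : L} (hx : IsAlgebraic F x) : v.ord x = 0 := by
  by_cases h : x = 0
  · rw [h, v.ord_zero]
  · obtain ⟨n, hn, h⟩ := exists_pow_eq_one h hx
    exact v.ord_eq_zero_of_pow hn h

lemma ord_neg_one : v.ord (-1) = 0 := v.ord_eq_zero_of_pow (n := 2) two_pos (by ring)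

lemma ord_neg (x : L) : v.ord (-x) = v.ord x := by
  by_cases h : x = 0
  · simp [h]
  · rw [← neg_one_mul, v.ord_mul (by simp) h, ord_neg_one, zero_add]

lemma transcendental_of_ord [Finite F] {x : L} (h : v.ord x ≠ 0) : Transcendental F x :=
  fun ha => h (v.ord_of_alg ha)

lemma exists_ord (n : ℤ) : ∃ x : L, x ≠ 0 ∧ v.ord x = n := by
  obtain ⟨π, h0, h1⟩ := v.exists_unif
  exact ⟨π ^ n, zpow_ne_zero _ h0, by rw [ord_zpow, h1, mul_one]⟩

/-- the fractional ideal `{x : n ≤ ord x}` -/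
def U [Finite F] (n : ℤ) : Submodule F L where
  carrier := {x | x = 0 ∨ n ≤ v.ord x}
  zero_mem' := Or.inl rfl
  add_mem' := by
    rintro x y (rfl | hx) (rfl | hy)
    · simp
    · simp [hy]
    · simp [hx]
    · by_cases hx0 : x = 0
      · subst hx0; right; simpa using hy
      by_cases hy0 : y = 0
      · subst hy0; right; simpa using hx
      by_cases h : x + y = 0
      · exact Or.inl h
      · exact Or.inr (le_trans (le_min hx hy) (v.ord_add hx0 hy0 h))
  smul_mem' := by
    rintro c x (rfl | hx)
    · simp
    · by_cases hx0 : x = 0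
      · left; simp [hx0]
      by_cases hc : c = 0
      · left; simp [hc]
      · right
        rw [Algebra.smul_def, v.ord_mul (by simpa using hc) hx0,
          v.ord_of_alg (isAlgebraic_algebraMap c), zero_add]
        exact hx

variable [Finite F]

lemma mem_U {n : ℤ} {x : L} : x ∈ v.U n ↔ x = 0 ∨ n ≤ v.ord x := Iff.rfl

lemma mem_U_iff {n : ℤ} {x : L} (hx : x ≠ 0) : x ∈ v.U n ↔ n ≤ v.ord x := by simp [mem_U, hx]

lemma mem_U_ord (x : L) : x ∈ v.U (v.ord x) := Or.inr le_rfl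

lemma mem_U_of_le {n : ℤ} {x : L} (h : n ≤ v.ord x) : x ∈ v.U n := Or.inr h

lemma U_mono {m n : ℤ} (h : m ≤ n) : v.U n ≤ v.U m := by
  rintro x (rfl | hx)
  · exact Submodule.zero_mem _
  · exact Or.inr (h.trans hx)

lemma U_mul {m n : ℤ} {x y : L} (hx : x ∈ v.U m) (hy : y ∈ v.U n) : x * y ∈ v.U (m + n) := by
  by_cases hx0 : x = 0
  · simp [hx0]
  by_cases hy0 : y = 0
  · simp [hy0]
  rw [mem_U_iff v hx0] at hx
  rw [mem_U_iff v hy0] at hy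
  rw [mem_U_iff v (mul_ne_zero hx0 hy0), v.ord_mul hx0 hy0]; omega

lemma mul_mem_U_iff {n : ℤ} {x y : L} (hx : x ≠ 0) : x * y ∈ v.U (v.ord x + n) ↔ y ∈ v.U n := by
  by_cases hy0 : y = 0
  · simp [hy0]
  rw [mem_U_iff v hy0, mem_U_iff v (mul_ne_zero hx hy0), v.ord_mul hx hy0]; omega

lemma one_mem_U : (1 : L) ∈ v.U 0 := Or.inr (by rw [v.ord_one])

lemma U_zero_mul {n : ℤ} {x y : L} (hx : x ∈ v.U 0) (hy : y ∈ v.U n) : x * y ∈ v.U n := by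
  have := v.U_mul hx hy; rwa [zero_add] at this

lemma alg_mem_U {x : L} (hx : IsAlgebraic F x) : x ∈ v.U 0 := Or.inr (v.ord_of_alg hx).ge

lemma ne_zero_of_notMem {n : ℤ} {x : L} (h : x ∉ v.U n) : x ≠ 0 := fun h0 => h (Or.inl h0)

lemma ord_lt_of_notMem {n : ℤ} {x : L} (h : x ∉ v.U n) : v.ord x < n := by
  rw [mem_U] at h; push Not at h; exact h.2

/-- ultrametric equality -/
lemma ord_add_eq {x y : L} (hx : x ≠ 0) (hy : y ∈ v.U (v.ord x + 1)) :
    x + y ≠ 0 ∧ v.ord (x + y) = v.ord x := by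
  have h1 : x + y ∉ v.U (v.ord x + 1) := by
    intro h
    have := Submodule.sub_mem _ h hy
    rw [add_sub_cancel_right, mem_U_iff v hx] at this; omega
  have h2 : x + y ∈ v.U (v.ord x) :=
    Submodule.add_mem _ (v.mem_U_ord x) (v.U_mono (by omega) hy)
  have h0 := v.ne_zero_of_notMem h1
  refine ⟨h0, ?_⟩
  have := v.ord_lt_of_notMem h1
  rw [mem_U_iff v h0] at h2; omega

lemma ord_eq_of_sub {x y : L} (hx : x ≠ 0) (h : y - x ∈ v.U (v.ord x + 1)) :
    y ≠ 0 ∧ v.ord y = v.ord x := by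
  have := v.ord_add_eq hx h
  rwa [add_sub_cancel] at this

/-- the valuation ring -/
def O : ValuationSubring L where
  carrier := {x | x ∈ v.U 0}
  zero_mem' := Submodule.zero_mem (v.U 0)
  one_mem' := v.one_mem_U
  add_mem' := fun hx hy => Submodule.add_mem (v.U 0) hx hy
  mul_mem' := fun hx hy => v.U_zero_mul hx hy
  neg_mem' := fun {x} hx => (Submodule.neg_mem (v.U 0) hx : -x ∈ v.U 0)
  mem_or_inv_mem' := by
    intro x
    rcases le_total 0 (v.ord x) with h | h
    · exact Or.inl (Or.inr h)
    · exact Or.inr (Or.inr (by rw [ord_inv]; omega))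

lemma mem_O {x : L} : x ∈ v.O ↔ x ∈ v.U 0 := Iff.rfl

lemma O_ne_top : v.O ≠ ⊤ := by
  obtain ⟨x, h0, h1⟩ := v.exists_ord (-1)
  intro h
  have : x ∈ v.O := by rw [h]; trivial
  rw [mem_O, mem_U_iff v h0] at this; omega

lemma eq_of_O_le {v w : Place F L} (h : v.O ≤ w.O) : v = w := by
  have h1 : ∀ x, x ≠ 0 → 0 ≤ v.ord x → 0 ≤ w.ord x := fun x hx hv =>
    (w.mem_U_iff hx).1 (h ((v.mem_U_iff hx).2 hv))
  obtain ⟨π, h0, hπ⟩ := v.exists_unif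
  have h2 : ∀ x, x ≠ 0 → w.ord x = w.ord π * v.ord x := by
    intro x hx
    have a0 : x * π ^ (- v.ord x) ≠ 0 := mul_ne_zero hx (zpow_ne_zero _ h0)
    have a1 : v.ord (x * π ^ (- v.ord x)) = 0 := by
      rw [v.ord_mul hx (zpow_ne_zero _ h0), ord_zpow, hπ]; ring
    have a2 := h1 _ a0 a1.ge
    have a3 := h1 _ (inv_ne_zero a0) (by rw [ord_inv, a1]; simp)
    rw [ord_inv] at a3
    have a4 : w.ord (x * π ^ (- v.ord x)) = 0 := by omega
    rw [w.ord_mul hx (zpow_ne_zero _ h0), ord_zpow] at a4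
    linarith
  obtain ⟨y, hy0, hy⟩ := w.exists_unif
  have h3 := h2 y hy0
  rw [hy] at h3
  have h4 : 0 ≤ w.ord π := h1 π h0 (by omega)
  have h5 : w.ord π = 1 := Int.eq_one_of_dvd_one h4 ⟨_, h3⟩
  ext x
  by_cases hx : x = 0
  · rw [hx, v.ord_zero, w.ord_zero]
  · rw [h2 x hx, h5, one_mul]

lemma exists_of_O [FF F L] (A : ValuationSubring L) (hA : A ≠ ⊤) : ∃ v : Place F L, v.O = A := by
  obtain ⟨π, h0, h1, h2, h3⟩ := exists_uniformizer (F := F) A hA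
  have hpow : ∀ n : ℤ, π ^ n ∈ A ↔ 0 ≤ n := by
    intro n
    constructor
    · intro h
      by_contra hn
      obtain ⟨m, rfl⟩ : ∃ m : ℕ, n = -((m:ℤ)+1) := ⟨(-n-1).toNat, by omega⟩
      apply h2
      have : π⁻¹ = π ^ (-((m:ℤ)+1)) * π ^ m := by
        rw [← zpow_natCast, ← zpow_add₀ h0]; simp
      rw [this]
      exact mul_mem h (pow_mem h1 m)
    · intro hn
      lift n to ℕ using hn
      rw [zpow_natCast]; exact pow_mem h1 n
  have hu : ∀ x : L, x ≠ 0 → ∀ n m : ℤ, x * π ^ n ∈ A → (x * π ^ n)⁻¹ ∈ A →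
      (x * π ^ m ∈ A ↔ n ≤ m) := by
    intro x hx n m a b
    rw [← sub_nonneg, ← hpow]
    have e1 : x * π ^ m = (x * π ^ n) * π ^ (m - n) := by
      rw [mul_assoc, ← zpow_add₀ h0]; simp
    have e2 : π ^ (m - n) = (x * π ^ n)⁻¹ * (x * π ^ m) := by
      rw [e1, inv_mul_cancel_left₀ (mul_ne_zero hx (zpow_ne_zero _ h0))]
    exact ⟨fun h => by rw [e2]; exact mul_mem b h, fun h => by rw [e1]; exact mul_mem a h⟩
  choose! f hf1 hf2 using h3
  have hf : ∀ x : L, x ≠ 0 → ∀ m : ℤ, x * π ^ m ∈ A ↔ f x ≤ m := fun x hx m =>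
    hu x hx _ _ (hf1 x hx) (hf2 x hx)
  have hfu : ∀ x : L, x ≠ 0 → ∀ n, x * π ^ n ∈ A → (x * π ^ n)⁻¹ ∈ A → f x = n := by
    intro x hx n a b
    have e1 := (hf x hx n).1 a
    have e2 := (hu x hx n (f x) a b).1 (hf1 x hx)
    omega
  classical
  let v : Place F L :=
    { ord := fun x => if x = 0 then 0 else - f x
      ord_zero := by simp
      ord_mul := by
        intro x y hx hy
        simp only [hx, hy, mul_ne_zero hx hy, if_false]
        have : f (x * y) = f x + f y := by
          apply hfu _ (mul_ne_zero hx hy)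
          · rw [zpow_add₀ h0]
            convert mul_mem (hf1 x hx) (hf1 y hy) using 1; ring
          · rw [zpow_add₀ h0]
            convert mul_mem (hf2 x hx) (hf2 y hy) using 1
            rw [← mul_inv]; congr 1; ring
        omega
      ord_add := by
        intro x y hx hy hxy
        simp only [hx, hy, hxy, if_false]
        have : (x + y) * π ^ (max (f x) (f y)) ∈ A := by
          rw [add_mul]
          exact add_mem ((hf x hx _).2 (le_max_left _ _)) ((hf y hy _).2 (le_max_right _ _))
        rw [hf _ hxy] at this
        omega
      exists_unif := ⟨π, h0, by
        simp only [h0, if_false]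
        rw [hfu π h0 (-1) (by simp [h0, A.one_mem]) (by simp [h0, A.one_mem])]; simp⟩ }
  refine ⟨v, ?_⟩
  ext x
  rw [mem_O]
  by_cases hx : x = 0
  · simp [hx, A.zero_mem]
  · rw [mem_U_iff v hx]
    have := hf x hx 0
    rw [zpow_zero, mul_one] at this
    rw [this]
    simp only [v, hx, if_false]
    omega

/-! weak approximation -/

lemma exists_sep {v w : Place F L} (h : v ≠ w) : ∃ y : L, y ≠ 0 ∧ v.ord y < 0 ∧ 0 < w.ord y := by
  have h1 : ¬ v.O ≤ w.O := fun hh => h (eq_of_O_le hh)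
  have h2 : ¬ w.O ≤ v.O := fun hh => h (eq_of_O_le hh).symm
  obtain ⟨a, ha1, ha2⟩ := SetLike.not_le_iff_exists.1 h1
  obtain ⟨b, hb1, hb2⟩ := SetLike.not_le_iff_exists.1 h2
  rw [mem_O] at *
  have ha0 := w.ne_zero_of_notMem ha2
  have hb0 := v.ne_zero_of_notMem hb2
  rw [mem_U_iff _ ha0] at ha1 ha2
  rw [mem_U_iff _ hb0] at hb1 hb2
  refine ⟨b / a, div_ne_zero hb0 ha0, ?_, ?_⟩
  · rw [ord_div _ hb0 ha0]; omega
  · rw [ord_div _ hb0 ha0]; omega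

lemma exists_sep_finset (v : Place F L) (S : Finset (Place F L)) (hv : v ∉ S) :
    ∃ y : L, y ≠ 0 ∧ v.ord y < 0 ∧ ∀ w ∈ S, 0 < w.ord y := by
  classical
  induction S using Finset.induction_on with
  | empty =>
    obtain ⟨y, h0, h1⟩ := v.exists_ord (-1)
    exact ⟨y, h0, by omega, by simp⟩
  | insert w S hw ih =>
    simp only [Finset.mem_insert, not_or] at hv
    obtain ⟨y, y0, y1, y2⟩ := ih hv.2
    obtain ⟨z, z0, z1, z2⟩ := exists_sep hv.1
    obtain ⟨r, hr⟩ : ∃ r : ℕ, ∀ u ∈ S, - u.ord z < r := by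
      obtain ⟨r, hr⟩ := (S.image fun u => - u.ord z).bddAbove
      refine ⟨r.toNat + 1, fun u hu => ?_⟩
      have := hr (Finset.mem_coe.2 (Finset.mem_image_of_mem (fun u => - u.ord z) hu))
      have := Int.self_le_toNat r
      push_cast; omega
    have hru : ∀ u ∈ S, 0 < (r : ℤ) * u.ord y + u.ord z := by
      intro u hu
      have h1 := hr u hu
      have h2 := y2 u hu
      nlinarith
    have hyr := pow_ne_zero r y0
    by_cases hwy : 0 ≤ w.ord y
    · refine ⟨y ^ r * z, mul_ne_zero hyr z0, ?_, ?_⟩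
      · rw [v.ord_mul hyr z0, ord_pow]; nlinarith
      · intro u hu
        rw [u.ord_mul hyr z0, ord_pow]
        rcases Finset.mem_insert.1 hu with rfl | hu
        · nlinarith
        · exact hru u hu
    · have key : ∀ u : Place F L, u.ord y < 0 → 1 + y ^ (r+1) ≠ 0 ∧
          u.ord (1 + y ^ (r+1)) = (r+1) * u.ord y := by
        intro u hu
        have h1 : (1 : L) ∈ u.U (u.ord (y ^ (r+1)) + 1) := by
          rw [mem_U_iff u one_ne_zero, ord_one, ord_pow]; push_cast; nlinarith
        have := u.ord_add_eq (pow_ne_zero (r+1) y0) h1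
        rw [add_comm 1 _]
        refine ⟨this.1, this.2.trans ?_⟩
        rw [ord_pow]; push_cast; ring
      have n0 := (key v y1).1
      have hyr' := pow_ne_zero (r+1) y0
      have n1 : z * y ^ (r+1) ≠ 0 := mul_ne_zero z0 hyr'
      refine ⟨z * y ^ (r+1) / (1 + y ^ (r+1)), div_ne_zero n1 n0, ?_, ?_⟩
      · rw [ord_div _ n1 n0, v.ord_mul z0 hyr', ord_pow, (key v y1).2]
        push_cast; linarith
      · intro u hu
        rw [ord_div _ n1 n0, u.ord_mul z0 hyr', ord_pow]
        rcases Finset.mem_insert.1 hu with rfl | hu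
        · rw [(key u (not_le.1 hwy)).2]; push_cast; linarith
        · have h1 : y ^ (r+1) ∈ u.U (u.ord (1:L) + 1) := by
            rw [mem_U_iff u hyr', ord_one, ord_pow]; have := y2 u hu; push_cast; nlinarith
          have := (u.ord_add_eq one_ne_zero h1).2
          rw [this, ord_one]
          have := hru u hu
          have := y2 u hu
          push_cast
          nlinarith

/-- weak approximation -/
lemma weak_approx (S : Finset (Place F L)) (g : Place F L → L) (N : ℤ) :
    ∃ x : L, ∀ v ∈ S, x - g v ∈ v.U N := by
  classical
  have h1 : ∀ (v : Place F L), ∀ M : ℕ, v ∈ S → ∃ e : L, e - 1 ∈ v.U M ∧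
      ∀ u ∈ S.erase v, e ∈ u.U M := by
    intro v M hv
    obtain ⟨y, y0, y1, y2⟩ := exists_sep_finset v (S.erase v) (by simp)
    have hyr' := pow_ne_zero (M+1) y0
    have h1 : (1 : L) ∈ v.U (v.ord (y ^ (M+1)) + 1) := by
      rw [mem_U_iff v one_ne_zero, ord_one, ord_pow]; push_cast; nlinarith
    have n0 := v.ord_add_eq hyr' h1
    refine ⟨y ^ (M+1) / (y ^ (M+1) + 1), ?_, ?_⟩
    · have : y ^ (M+1) / (y ^ (M+1) + 1) - 1 = -(y ^ (M+1) + 1)⁻¹ := by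
        have := n0.1; field_simp; ring
      rw [this]
      refine Submodule.neg_mem _ (v.mem_U_of_le ?_)
      rw [ord_inv, n0.2, ord_pow]; push_cast; nlinarith
    · intro u hu
      refine u.mem_U_of_le ?_
      have h1 : y ^ (M+1) ∈ u.U (u.ord (1:L) + 1) := by
        rw [mem_U_iff u hyr', ord_one, ord_pow]; have := y2 u hu; push_cast; nlinarith
      have h2 := u.ord_add_eq one_ne_zero h1
      rw [add_comm] at h2
      rw [ord_div _ hyr' n0.1, h2.2, ord_one, ord_pow]
      have := y2 u hu
      push_cast; nlinarith
  obtain ⟨M, hM⟩ : ∃ M : ℕ, ∀ u ∈ S, ∀ v ∈ S, N - u.ord (g v) ≤ M := by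
    obtain ⟨r, hr⟩ := ((S ×ˢ S).image fun p => N - p.1.ord (g p.2)).bddAbove
    refine ⟨r.toNat, fun u hu v hv => ?_⟩
    have := hr (Finset.mem_coe.2 (Finset.mem_image_of_mem (fun p => N - p.1.ord (g p.2))
      (Finset.mem_product.2 ⟨hu, hv⟩ : (u, v) ∈ S ×ˢ S)))
    dsimp only at this
    have := Int.self_le_toNat r
    omega
  have hmul : ∀ u ∈ S, ∀ v ∈ S, ∀ e ∈ u.U M, e * g v ∈ u.U N := by
    intro u hu v hv e he
    have := u.U_mul he (u.mem_U_ord (g v))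
    exact u.U_mono (by have := hM u hu v hv; omega) this
  choose! e he1 he2 using fun v => h1 v M
  refine ⟨∑ u ∈ S, e u * g u, fun v hv => ?_⟩
  rw [← Finset.add_sum_erase S _ hv]
  have : e v * g v + ∑ x ∈ S.erase v, e x * g x - g v =
      (e v - 1) * g v + ∑ x ∈ S.erase v, e x * g x := by ring
  rw [this]
  refine Submodule.add_mem _ (hmul v hv v hv _ (he1 v hv)) (Submodule.sum_mem _ fun u hu => ?_)
  have hu' := Finset.mem_of_mem_erase hu
  exact hmul v hv u hu' _ (he2 u hu' v (by
    simp only [Finset.mem_erase] at hu ⊢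
    exact ⟨fun h => hu.1 h.symm, hv⟩))

end Place
end GFF
end PB3

section PB4
namespace GFF
set_option linter.unusedSectionVars false
set_option linter.unusedVariables false
set_option linter.unnecessarySimpa false
open IntermediateField Polynomial

/-- `A` contains `k` elements independent modulo `B`. -/
def Ind {F L : Type*} [Field F] [Field L] [Algebra F L] (A B : Submodule F L) (k : ℕ) : Prop :=
  ∃ y : Fin k → L, (∀ i, y i ∈ A) ∧ ∀ c : Fin k → F, ∑ i, c i • y i ∈ B → c = 0

section
variable {F L : Type*} [Field F] [Field L] [Algebra F L]

lemma Ind.trans {A B C : Submodule F L} {k l : ℕ} (hBA : B ≤ A) (hCB : C ≤ B)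
    (h1 : Ind A B k) (h2 : Ind B C l) : Ind A C (k + l) := by
  obtain ⟨y, y1, y2⟩ := h1
  obtain ⟨z, z1, z2⟩ := h2
  refine ⟨Fin.append y z, fun i => ?_, fun c hc => ?_⟩
  · refine Fin.addCases (fun i => ?_) (fun i => ?_) i
    · rw [Fin.append_left]; exact y1 i
    · rw [Fin.append_right]; exact hBA (z1 i)
  · rw [Fin.sum_univ_add] at hc
    simp only [Fin.append_left, Fin.append_right] at hc
    have hz : ∑ i, c (Fin.natAdd k i) • z i ∈ B :=
      Submodule.sum_mem _ fun i _ => Submodule.smul_mem _ _ (z1 i)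
    have e1 := y2 (fun i => c (Fin.castAdd l i)) (by
      have := Submodule.sub_mem _ (hCB hc) hz
      rwa [add_sub_cancel_right] at this)
    have e1' : ∀ i, c (Fin.castAdd l i) = 0 := fun i => congrFun e1 i
    simp only [e1', zero_smul, Finset.sum_const_zero, zero_add] at hc
    have e2 := z2 _ hc
    funext i
    refine Fin.addCases (fun i => ?_) (fun i => ?_) i
    · exact e1' i
    · exact congrFun e2 i

lemma Ind.zero (A B : Submodule F L) : Ind A B 0 :=
  ⟨fun i => i.elim0, fun i => i.elim0, fun c _ => funext fun i => i.elim0⟩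

lemma Ind.of_linearMap {V : Type*} [AddCommGroup V] [Module F V] [Module.Finite F V]
    {A B A' B' : Submodule F L} (f : A →ₗ[F] V) (hB : ∀ x : A, (x : L) ∈ B → f x = 0)
    (hs : ∀ y : V, ∃ x : A, f x = y ∧ (x : L) ∈ A') (hB' : A' ⊓ B' ≤ B) :
    Ind A' B' (Module.finrank F V) := by
  let b := Module.finBasis F V
  choose y hy hy' using fun i => hs (b i)
  refine ⟨fun i => y i, hy', fun c hc => ?_⟩
  have h1 : f (∑ i, c i • y i) = 0 := by
    apply hB
    apply hB'
    rw [AddSubmonoidClass.coe_finsetSum]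
    exact ⟨Submodule.sum_mem _ fun i _ => Submodule.smul_mem _ _ (hy' i), hc⟩
  rw [map_sum] at h1
  simp only [map_smul, hy] at h1
  exact funext ((Fintype.linearIndependent_iff.1 b.linearIndependent) c h1)

/-- every transcendental element has a zero -/
lemma exists_zero [Finite F] [FF F L] {x : L} (hx : Transcendental F x) :
    ∃ v : Place F L, 0 < v.ord x := by
  have hx0 := tr_ne_zero hx
  let A : Subring L := (Algebra.adjoin F {x}).toSubring
  have hxA : x ∈ A := Algebra.self_mem_adjoin_singleton F x
  have hI : Ideal.span {(⟨x, hxA⟩ : A)} ≠ ⊤ := by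
    intro h
    rw [Ideal.span_singleton_eq_top, isUnit_iff_exists_inv] at h
    obtain ⟨b, hb⟩ := h
    obtain ⟨p, hp⟩ := exists_aeval_of_mem_adjoin (F := F) x b
    have h1 : x * (b : L) = 1 := congrArg Subtype.val hb
    have h2 : aeval x (X * p - 1 : F[X]) = 0 := by
      rw [map_sub, map_mul, aeval_X, hp, h1]; simp
    have h3 : (X * p - 1 : F[X]) = 0 := (transcendental_iff_injective.1 hx) (by simpa using h2)
    have := congrArg (fun q => coeff q 0) h3
    simp at this
  obtain ⟨B, hB1, hB2⟩ := Ideal.image_subset_nonunits_valuationSubring _ hI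
  have hxB : x ∈ B.nonunits := hB2 ⟨⟨x, hxA⟩, Ideal.mem_span_singleton_self _, rfl⟩
  have hinv : x⁻¹ ∉ B := by
    rw [ValuationSubring.mem_nonunits_iff] at hxB
    rw [← ValuationSubring.valuation_le_one_iff, map_inv₀, not_le]
    exact (one_lt_inv₀ (by simpa [zero_lt_iff] using hx0)).2 hxB
  have hBt : B ≠ ⊤ := fun h => hinv (by rw [h]; trivial)
  obtain ⟨v, hv⟩ := Place.exists_of_O (F := F) B hBt
  refine ⟨v, ?_⟩
  rw [← hv, Place.mem_O] at hinv
  have := v.ord_lt_of_notMem hinv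
  rw [v.ord_inv] at this; omega

lemma isAlgebraic_of_ord [Finite F] [FF F L] {x : L} (h : ∀ v : Place F L, 0 ≤ v.ord x) :
    IsAlgebraic F x := by
  by_contra hx
  have : Transcendental F x⁻¹ := fun h => hx (by simpa using h.inv)
  obtain ⟨v, hv⟩ := exists_zero this
  rw [v.ord_inv] at hv
  have := h v; omega
end

namespace Place
variable {F L : Type*} [Field F] [Field L] [Algebra F L] [Finite F] (v w : Place F L)

noncomputable instance : Algebra F v.O :=
  RingHom.toAlgebra ((algebraMap F L).codRestrict v.O.toSubring
    fun c => v.alg_mem_U (isAlgebraic_algebraMap c))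

lemma coe_algebraMap_O (c : F) : ((algebraMap F v.O c : v.O) : L) = algebraMap F L c := rfl

/-- residue field -/
abbrev κ := IsLocalRing.ResidueField v.O

lemma mem_maximal {x : v.O} : x ∈ IsLocalRing.maximalIdeal v.O ↔ (x : L) ∈ v.U 1 := by
  rw [IsLocalRing.mem_maximalIdeal, mem_nonunits_iff, isUnit_iff_exists_inv]
  by_cases hx : (x : L) = 0
  · have : x = 0 := Subtype.ext hx
    subst this; simp
  have hx' : (x : L) ∈ v.U 0 := x.2
  rw [mem_U_iff v hx] at hx' ⊢
  constructor
  · intro h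
    by_contra hc
    apply h
    refine ⟨⟨(x : L)⁻¹, ?_⟩, Subtype.ext (mul_inv_cancel₀ hx)⟩
    rw [mem_O]; exact v.mem_U_of_le (by rw [ord_inv]; omega)
  · rintro h ⟨b, hb⟩
    have hb' : (x : L) * b = 1 := congrArg Subtype.val hb
    have := v.U_mul (v.mem_U_of_le h) (show (b : L) ∈ v.U 0 from b.2)
    rw [hb', mem_U_iff v one_ne_zero, ord_one] at this; omega

open Classical in
/-- residue map extended by zero -/
noncomputable def res (x : L) : v.κ :=
  if h : x ∈ v.O then IsLocalRing.residue v.O ⟨x, h⟩ else 0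

lemma res_of_mem {x : L} (h : x ∈ v.U 0) : v.res x = IsLocalRing.residue v.O ⟨x, h⟩ := by
  rw [res, dif_pos (show x ∈ v.O from h)]

lemma res_add {x y : L} (hx : x ∈ v.U 0) (hy : y ∈ v.U 0) :
    v.res (x + y) = v.res x + v.res y := by
  rw [res_of_mem v hx, res_of_mem v hy, res_of_mem v (Submodule.add_mem _ hx hy), ← map_add]; rfl

lemma res_mul {x y : L} (hx : x ∈ v.U 0) (hy : y ∈ v.U 0) :
    v.res (x * y) = v.res x * v.res y := by
  rw [res_of_mem v hx, res_of_mem v hy, res_of_mem v (v.U_zero_mul hx hy), ← map_mul]; rfl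

lemma res_one : v.res 1 = 1 := by
  rw [res_of_mem v v.one_mem_U]; exact map_one (IsLocalRing.residue v.O)

lemma res_pow {x : L} (hx : x ∈ v.U 0) (n : ℕ) : v.res (x ^ n) = v.res x ^ n := by
  have hp : ∀ n : ℕ, x ^ n ∈ v.U 0 := fun n => (pow_mem (show x ∈ v.O from hx) n : x ^ n ∈ v.O)
  induction n with
  | zero => simp [res_one]
  | succ n ih => rw [pow_succ, res_mul v (hp n) hx, ih, pow_succ]

lemma res_eq_zero {x : L} (hx : x ∈ v.U 0) : v.res x = 0 ↔ x ∈ v.U 1 := by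
  rw [res_of_mem v hx, IsLocalRing.residue_eq_zero_iff, mem_maximal]

lemma res_eq {x y : L} (hx : x ∈ v.U 0) (hy : y ∈ v.U 0) : v.res x = v.res y ↔ x - y ∈ v.U 1 := by
  rw [← res_eq_zero v (Submodule.sub_mem _ hx hy)]
  have : v.res x = v.res (x - y) + v.res y := by
    rw [← res_add v (Submodule.sub_mem _ hx hy) hy, sub_add_cancel]
  rw [this]; simp

lemma res_algebraMap (c : F) : v.res (algebraMap F L c) = algebraMap F v.κ c := by
  rw [res_of_mem v (v.alg_mem_U (isAlgebraic_algebraMap c))]; rfl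

lemma res_smul (c : F) {x : L} (hx : x ∈ v.U 0) : v.res (c • x) = c • v.res x := by
  rw [Algebra.smul_def, res_mul v (v.alg_mem_U (isAlgebraic_algebraMap c)) hx, res_algebraMap,
    Algebra.smul_def]

lemma res_surj (y : v.κ) : ∃ x ∈ v.U 0, v.res x = y := by
  obtain ⟨x, hx⟩ := IsLocalRing.residue_surjective y
  exact ⟨x, x.2, by rw [res_of_mem v x.2]; exact hx⟩

/-- a chosen uniformizer -/
noncomputable def π : L := v.exists_unif.choose
lemma π_ne : v.π ≠ 0 := v.exists_unif.choose_spec.1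
lemma ord_π : v.ord v.π = 1 := v.exists_unif.choose_spec.2
lemma ord_π_zpow (n : ℤ) : v.ord (v.π ^ n) = n := by rw [ord_zpow, ord_π, mul_one]
lemma π_zpow_ne (n : ℤ) : v.π ^ n ≠ 0 := zpow_ne_zero _ v.π_ne

lemma mul_π_mem {n m : ℤ} {x : L} : x * v.π ^ n ∈ v.U m ↔ x ∈ v.U (m - n) := by
  have := v.mul_mem_U_iff (n := m - n) (x := v.π ^ n) (y := x) (v.π_zpow_ne n)
  rw [ord_π_zpow, add_sub_cancel, mul_comm] at this
  exact this

/-- leading coefficient map -/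
noncomputable def lead (n : ℤ) : v.U n →ₗ[F] v.κ where
  toFun x := v.res (x * v.π ^ (-n))
  map_add' x y := by
    rw [← res_add v (by rw [mul_π_mem]; simpa using x.2) (by rw [mul_π_mem]; simpa using y.2)]
    congr 1; push_cast; ring
  map_smul' c x := by
    rw [RingHom.id_apply, ← res_smul v c (by rw [mul_π_mem]; simpa using x.2)]
    congr 1
    simp

lemma lead_eq_zero {n : ℤ} (x : v.U n) : v.lead n x = 0 ↔ (x : L) ∈ v.U (n + 1) := by
  change v.res (x * v.π ^ (-n)) = 0 ↔ _
  rw [res_eq_zero v (by rw [mul_π_mem]; simpa using x.2), mul_π_mem]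
  ring_nf

lemma lead_surj {n : ℤ} (y : v.κ) : ∃ x : v.U n, v.lead n x = y := by
  obtain ⟨x, hx, h⟩ := v.res_surj y
  refine ⟨⟨x * v.π ^ n, by rw [mul_π_mem]; simpa using hx⟩, ?_⟩
  change v.res (x * v.π ^ n * v.π ^ (-n)) = y
  rw [mul_assoc, ← zpow_add₀ v.π_ne]; simpa using h

instance [FF F L] : Module.Finite F v.κ := by
  have hπ : Transcendental F v.π := v.transcendental_of_ord (by rw [ord_π]; simp)
  have : Module.rank F v.κ ≤ (ndeg F v.π : ℕ) := by
    apply rank_le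
    intro s hs
    have hs' := hs.comp (s.equivFin.symm) (s.equivFin.symm.injective)
    choose y hy hy' using fun i => v.res_surj (s.equivFin.symm i : v.κ)
    refine indep_crit hπ v.O.toSubring (fun c => v.alg_mem_U (isAlgebraic_algebraMap c))
      (v.mem_U_of_le (by rw [ord_π]; simp)) y hy ?_
    rintro c ⟨z, hz, h⟩
    have h1 : ∑ i, algebraMap F L (c i) * y i ∈ v.U 1 := by
      rw [h]
      have := v.U_mul (v.mem_U_ord v.π) (show z ∈ v.U 0 from hz)
      rwa [ord_π, add_zero] at this
    have hyU : ∀ i, algebraMap F L (c i) * y i ∈ v.U 0 := fun i => by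
      rw [← Algebra.smul_def]; exact Submodule.smul_mem _ _ (hy i)
    have hsum : ∀ T : Finset (Fin s.card), v.res (∑ i ∈ T, algebraMap F L (c i) * y i) =
        ∑ i ∈ T, c i • (s.equivFin.symm i : v.κ) := by
      classical
      intro T
      induction T using Finset.induction_on with
      | empty => simp [(res_eq_zero v (Submodule.zero_mem _)).2 (Submodule.zero_mem _)]
      | insert a T ha ih =>
        rw [Finset.sum_insert ha, Finset.sum_insert ha, res_add v (hyU a)
          (Submodule.sum_mem _ fun i _ => hyU i), ih, ← Algebra.smul_def, res_smul v _ (hy a), hy']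
    have h2 := (res_eq_zero v (v.U_mono (by omega) h1)).2 h1
    rw [hsum] at h2
    exact funext (Fintype.linearIndependent_iff.1 hs' c h2)
  exact Module.rank_lt_aleph0_iff.1 (this.trans_lt (Cardinal.natCast_lt_aleph0))

instance [FF F L] : Finite v.κ := Module.finite_of_finite F

/-- degree of a place -/
noncomputable def δ : ℕ := Module.finrank F v.κ

lemma δ_pos [FF F L] : 0 < v.δ := Module.finrank_pos

/-- semi-local fractional ideals -/
def US (S : Finset (Place F L)) (D : Place F L → ℤ) : Submodule F L := ⨅ v ∈ S, v.U (D v)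

lemma mem_US {S : Finset (Place F L)} {D : Place F L → ℤ} {x : L} :
    x ∈ US S D ↔ ∀ v ∈ S, x ∈ v.U (D v) := by
  simp [US, Submodule.mem_iInf]

lemma US_mono {S : Finset (Place F L)} {D E : Place F L → ℤ} (h : ∀ v, D v ≤ E v) :
    US S E ≤ US S D := fun x hx => mem_US.2 fun v hv => v.U_mono (h v) (mem_US.1 hx v hv)

open Classical in
lemma ind_step [FF F L] {S : Finset (Place F L)} (D : Place F L → ℤ) (hv : v ∈ S) :
    Ind (US S D) (US S (Function.update D v (D v + 1))) v.δ := by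
  refine Ind.of_linearMap (A := v.U (D v)) (B := v.U (D v + 1)) (v.lead (D v))
    (fun x hx => (v.lead_eq_zero x).2 hx) ?_ ?_
  · intro y
    obtain ⟨x, hx⟩ := v.lead_surj (n := D v) y
    obtain ⟨N, hN⟩ : ∃ N : ℤ, ∀ u ∈ S, D u + 1 ≤ N := by
      obtain ⟨r, hr⟩ := (S.image fun u => D u + 1).bddAbove
      exact ⟨r, fun u hu => hr (Finset.mem_coe.2 (Finset.mem_image_of_mem (fun u => D u + 1) hu))⟩
    obtain ⟨z, hz⟩ := weak_approx S (fun u => if u = v then (x : L) else 0) N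
    have hzv := hz v hv
    rw [if_pos rfl] at hzv
    have hzv' := v.U_mono (hN v hv) hzv
    have hzU : z ∈ v.U (D v) := by
      have := Submodule.add_mem _ (v.U_mono (by omega) hzv') x.2
      rwa [sub_add_cancel] at this
    refine ⟨⟨z, hzU⟩, ?_, ?_⟩
    · rw [← hx, ← sub_eq_zero, ← map_sub, lead_eq_zero]; exact hzv'
    · rw [mem_US]
      intro u hu
      by_cases h : u = v
      · rw [h]; exact hzU
      · have := hz u hu
        rw [if_neg h, sub_zero] at this
        exact u.U_mono (by have := hN u hu; omega) this
  · intro x hx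
    have := mem_US.1 hx.2 v hv
    simpa using this

open Classical in
lemma ind_n [FF F L] {S : Finset (Place F L)} (D : Place F L → ℤ) (hv : v ∈ S) (n : ℕ) :
    Ind (US S D) (US S (Function.update D v (D v + n))) (n * v.δ) := by
  induction n with
  | zero => simpa using Ind.zero _ _
  | succ n ih =>
    have h2 := v.ind_step (Function.update D v (D v + n)) hv
    simp only [Function.update_self, Function.update_idem] at h2
    rw [add_mul, one_mul]
    push_cast
    rw [← add_assoc]
    refine Ind.trans ?_ ?_ ih h2
    · apply US_mono; intro u
      by_cases h : u = v
      · subst h; simp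
      · simp [h]
    · apply US_mono; intro u
      by_cases h : u = v
      · subst h; simp
      · simp [h]

open Classical in
lemma ind_sum [FF F L] {S : Finset (Place F L)} (n : Place F L → ℕ) (T : Finset (Place F L))
    (hT : T ⊆ S) : Ind (US S (fun _ => 0)) (US S (fun v => if v ∈ T then (n v : ℤ) else 0))
      (∑ v ∈ T, n v * v.δ) := by
  induction T using Finset.induction_on with
  | empty => simpa using Ind.zero _ _
  | insert a T ha ih =>
    have h1 := ih (fun x hx => hT (by simp [hx]))
    have h2 := a.ind_n (fun v => if v ∈ T then (n v : ℤ) else 0) (hT (by simp : a ∈ insert a T))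
      (n a)
    have e : (Function.update (fun v => if v ∈ T then (n v : ℤ) else 0) a
      ((if a ∈ T then (n a : ℤ) else 0) + n a)) =
        (fun v => if v ∈ insert a T then (n v : ℤ) else 0) := by
      funext u
      by_cases h : u = a
      · subst h; simp [ha]
      · simp [h]
    rw [e] at h2
    rw [Finset.sum_insert ha, add_comm]
    refine Ind.trans ?_ ?_ h1 h2
    · apply US_mono; intro u; split_ifs <;> simp
    · apply US_mono; intro u
      by_cases h : u = a
      · subst h; simp [ha]
      · simp [h]

/-- dimension bound for zeros -/
lemma sum_ord_le [FF F L] {x : L} (S : Finset (Place F L)) (hS : ∀ v ∈ S, 0 < v.ord x)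
    (hx : Transcendental F x) : ∑ v ∈ S, v.ord x * v.δ ≤ ndeg F x := by
  classical
  have hx0 := tr_ne_zero hx
  obtain ⟨y, y1, y2⟩ := ind_sum (S := S) (fun v => (v.ord x).toNat) S subset_rfl
  have h1 : ∑ v ∈ S, v.ord x * v.δ = ((∑ v ∈ S, (v.ord x).toNat * v.δ : ℕ) : ℤ) := by
    push_cast
    refine Finset.sum_congr rfl fun v hv => ?_
    rw [Int.toNat_of_nonneg (hS v hv).le]
  rw [h1]
  norm_cast
  let R : Subring L := ⨅ v ∈ S, v.O.toSubring
  have hR : ∀ z, z ∈ R ↔ ∀ v ∈ S, z ∈ v.U 0 := by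
    intro z
    simp only [R, Subring.mem_iInf]
    rfl
  refine indep_crit hx R (fun c => (hR _).2 fun v _ => v.alg_mem_U (isAlgebraic_algebraMap c))
    ((hR _).2 fun v hv => v.mem_U_of_le (hS v hv).le) y (fun i => (hR _).2 (mem_US.1 (y1 i))) ?_
  rintro c ⟨z, hz, h⟩
  apply y2
  rw [mem_US]
  intro v hv
  rw [if_pos hv]
  simp only [Algebra.smul_def]
  rw [h]
  have := v.U_mul (v.mem_U_ord x) ((hR z).1 hz v hv)
  rw [add_zero] at this
  rw [Int.toNat_of_nonneg (hS v hv).le]; exact this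

lemma finite_zeros [FF F L] (x : L) : {v : Place F L | 0 < v.ord x}.Finite := by
  by_cases hx : Transcendental F x
  · by_contra hinf
    obtain ⟨S, hS1, hS2⟩ := Set.Infinite.exists_subset_card_eq hinf (ndeg F x + 1)
    have h1 := sum_ord_le S (fun v hv => hS1 hv) hx
    have h2 : ∑ v ∈ S, (1 : ℤ) ≤ ∑ v ∈ S, v.ord x * v.δ := by
      refine Finset.sum_le_sum fun v hv => ?_
      have a1 : 0 < v.ord x := hS1 hv
      have a2 : (0 : ℤ) < v.δ := by exact_mod_cast v.δ_pos
      nlinarith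
    simp [hS2] at h2
    omega
  · have : ∀ v : Place F L, v.ord x = 0 := fun v => v.ord_of_alg (not_not.1 hx)
    simp [this]

lemma finite_ord_ne [FF F L] (x : L) : {v : Place F L | v.ord x ≠ 0}.Finite := by
  refine ((finite_zeros (F := F) x).union (finite_zeros (F := F) x⁻¹)).subset ?_
  intro v hv
  have hv' : v.ord x ≠ 0 := hv
  simp only [Set.mem_union, Set.mem_ofPred_eq, ord_inv]
  omega

end Place
end GFF
end PB4

section PB5
namespace GFF
set_option linter.unusedSectionVars false
set_option linter.unusedVariables false
set_option linter.unnecessarySimpa false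
open IntermediateField Polynomial

/-- divisors -/
abbrev Dv (F L : Type*) [Field F] [Field L] [Algebra F L] := Place F L →₀ ℤ

section
variable {F L : Type*} [Field F] [Field L] [Algebra F L] [Finite F] [FF F L]

/-- degree of divisors -/
noncomputable def ddeg : Dv F L →+ ℤ :=
  Finsupp.liftAddHom (fun v => (AddMonoidHom.mulRight (v.δ : ℤ)))

lemma ddeg_single (v : Place F L) (n : ℤ) : ddeg (Finsupp.single v n) = n * v.δ := by
  simp [ddeg]

lemma ddeg_eq (D : Dv F L) : ddeg D = D.sum fun v n => n * v.δ := by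
  simp [ddeg, Finsupp.sum]

lemma ddeg_nonneg {D : Dv F L} (h : 0 ≤ D) : 0 ≤ ddeg D := by
  rw [ddeg_eq]
  exact Finset.sum_nonneg fun v _ => mul_nonneg (h v) (by positivity)

lemma ddeg_mono {D E : Dv F L} (h : D ≤ E) : ddeg D ≤ ddeg E := by
  have := ddeg_nonneg (sub_nonneg.2 h)
  rw [map_sub] at this; omega

variable (F) in
/-- principal divisors -/
noncomputable def dv (x : L) : Dv F L :=
  Finsupp.ofSupportFinite (fun v => v.ord x) (Place.finite_ord_ne x)

@[simp] lemma dv_apply (x : L) (v : Place F L) : dv F x v = v.ord x := rfl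

lemma dv_mul {x y : L} (hx : x ≠ 0) (hy : y ≠ 0) : dv F (x * y) = dv F x + dv F y := by
  ext v; simp [v.ord_mul hx hy]

lemma dv_inv (x : L) : dv F x⁻¹ = - dv F x := by
  ext v; simp [v.ord_inv]

lemma dv_of_alg {x : L} (hx : IsAlgebraic F x) : dv F x = 0 := by
  ext v; simp [v.ord_of_alg hx]

lemma dv_one : dv F (1 : L) = 0 := by ext v; simp [v.ord_one]

lemma dv_pow (x : L) (n : ℕ) : dv F (x ^ n) = n • dv F x := by
  ext v; simp [v.ord_pow]

/-- Riemann-Roch space -/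
def LD (D : Dv F L) : Submodule F L := ⨅ v : Place F L, v.U (-(D v))

lemma mem_LD {D : Dv F L} {x : L} : x ∈ LD D ↔ ∀ v : Place F L, x ∈ v.U (-(D v)) := by
  simp [LD, Submodule.mem_iInf]

lemma mem_LD_iff {D : Dv F L} {x : L} (hx : x ≠ 0) : x ∈ LD D ↔ 0 ≤ D + dv F x := by
  rw [mem_LD]
  refine forall_congr' fun v => ?_
  rw [v.mem_U_iff hx]; simp; omega

lemma LD_mono {D E : Dv F L} (h : D ≤ E) : LD D ≤ LD E := by
  intro x hx
  rw [mem_LD] at *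
  intro v
  exact v.U_mono (by have := h v; omega) (hx v)

lemma mem_LD_zero {x : L} : x ∈ LD (0 : Dv F L) ↔ IsAlgebraic F x := by
  rw [mem_LD]
  constructor
  · intro h
    refine isAlgebraic_of_ord fun v => ?_
    rcases h v with h | h
    · rw [h, v.ord_zero]
    · simpa using h
  · intro h v
    simpa using v.alg_mem_U h

lemma LD_step (D : Dv F L) (v : Place F L) [Module.Finite F (LD D)] :
    Module.Finite F (LD (D + Finsupp.single v 1)) ∧
    Module.finrank F (LD (D + Finsupp.single v 1)) ≤ Module.finrank F (LD D) + v.δ := by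
  have hle : LD D ≤ LD (D + Finsupp.single v 1) := LD_mono (by simp)
  have hU : ∀ x ∈ LD (D + Finsupp.single v 1), x ∈ v.U (-(D v) - 1) := by
    intro x hx
    have := mem_LD.1 hx v
    simp only [Finsupp.add_apply, Finsupp.single_eq_same] at this
    convert this using 2; ring
  let f : LD (D + Finsupp.single v 1) →ₗ[F] v.κ :=
    (v.lead (-(D v) - 1)).comp (Submodule.inclusion hU)
  have hker : LinearMap.ker f = (LD D).submoduleOf (LD (D + Finsupp.single v 1)) := by
    ext x
    rw [LinearMap.mem_ker]
    change v.lead _ _ = 0 ↔ (x : L) ∈ LD D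
    rw [v.lead_eq_zero]
    simp only [Submodule.coe_inclusion, sub_add_cancel]
    constructor
    · intro h
      rw [mem_LD]
      intro w
      by_cases hw : w = v
      · rw [hw]; exact h
      · have := mem_LD.1 x.2 w
        rwa [Finsupp.add_apply, Finsupp.single_eq_of_ne hw, add_zero] at this
    · intro h; exact mem_LD.1 h v
  have hk : Module.Finite F (LinearMap.ker f) := by
    rw [hker]
    exact Module.Finite.equiv (Submodule.submoduleOfEquivOfLe hle).symm
  have hkr : Module.finrank F (LinearMap.ker f) = Module.finrank F (LD D) := by
    rw [hker]; exact (Submodule.submoduleOfEquivOfLe hle).finrank_eq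
  have hfin : Module.Finite F (LD (D + Finsupp.single v 1)) := by
    have h1 : Module.Finite F (LinearMap.range f) := inferInstance
    rw [Module.finite_def]
    refine Submodule.fg_of_fg_map_of_fg_inf_ker f ?_ ?_
    · rw [← LinearMap.range_eq_map]; exact (Submodule.fg_top _).1 (Module.finite_def.1 h1)
    · rw [top_inf_eq]; exact (Submodule.fg_top _).1 (Module.finite_def.1 hk)
  refine ⟨hfin, ?_⟩
  have := LinearMap.finrank_range_add_finrank_ker f
  have h2 : Module.finrank F (LinearMap.range f) ≤ v.δ := Submodule.finrank_le _
  omega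


lemma LD_le_aux (D : Dv F L) (hD : Module.Finite F (LD D)) (n : ℕ) : ∀ (E : Dv F L), D ≤ E →
    ddeg E - ddeg D = n → Module.Finite F (LD E) ∧
    (Module.finrank F (LD E) : ℤ) + ddeg D ≤ Module.finrank F (LD D) + ddeg E := by
  induction n using Nat.strong_induction_on with
  | _ n ih =>
  intro E hE hn
  by_cases h : D = E
  · subst h; exact ⟨hD, le_rfl⟩
  · obtain ⟨v, hv⟩ : ∃ v, D v < E v := by
      by_contra hc
      push Not at hc
      exact h (le_antisymm hE hc)
    have h1 : D ≤ E - Finsupp.single v 1 := by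
      intro u
      by_cases hu : u = v
      · subst hu; simp; omega
      · have := hE u
        rw [Finsupp.sub_apply, Finsupp.single_eq_of_ne hu]; simpa using this
    have h2 : ddeg (E - Finsupp.single v 1) = ddeg E - v.δ := by
      rw [map_sub, ddeg_single, one_mul]
    have h3 := v.δ_pos
    have h4 := ddeg_mono h1
    obtain ⟨h5, h6⟩ := ih (n - v.δ) (by omega) _ h1 (by omega)
    have h7 := LD_step (E - Finsupp.single v 1) v
    rw [sub_add_cancel] at h7
    refine ⟨h7.1, ?_⟩
    have := h7.2
    omega

lemma LD_le {D E : Dv F L} (hD : Module.Finite F (LD D)) (h : D ≤ E) : Module.Finite F (LD E) ∧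
    (Module.finrank F (LD E) : ℤ) + ddeg D ≤ Module.finrank F (LD D) + ddeg E :=
  LD_le_aux D hD (ddeg E - ddeg D).toNat E h (by have := ddeg_mono h; omega)

variable (F L) in
lemma exists_place : Nonempty (Place F L) := by
  obtain ⟨x, hx⟩ := FF.exists_tr (F := F) (L := L)
  obtain ⟨v, -⟩ := exists_zero hx
  exact ⟨v⟩

instance LD_zero_finite : Module.Finite F (LD (0 : Dv F L)) := by
  obtain ⟨v⟩ := exists_place F L
  have hU : LD (0 : Dv F L) ≤ v.U 0 := fun x hx => by simpa using mem_LD.1 hx v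
  refine Module.Finite.of_injective ((v.lead 0).comp (Submodule.inclusion hU)) ?_
  rw [injective_iff_map_eq_zero]
  intro x hx
  have h1 := (v.lead_eq_zero _).1 hx
  rw [Submodule.coe_inclusion] at h1
  by_contra hne
  have h2 : (x : L) ≠ 0 := fun h => hne (Subtype.ext h)
  rw [v.mem_U_iff h2, v.ord_of_alg (mem_LD_zero.1 x.2)] at h1
  omega

instance LD_finite (D : Dv F L) : Module.Finite F (LD D) := by
  have := (LD_le (LD_zero_finite) (le_sup_right : (0 : Dv F L) ≤ D ⊔ 0)).1
  exact Submodule.finiteDimensional_of_le (LD_mono (le_sup_left : D ≤ D ⊔ 0))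

/-- dimension of the Riemann-Roch space -/
noncomputable def ell (D : Dv F L) : ℕ := Module.finrank F (LD D)

lemma ell_le {D E : Dv F L} (h : D ≤ E) : (ell E : ℤ) + ddeg D ≤ ell D + ddeg E :=
  (LD_le (LD_finite D) h).2

lemma ell_mono {D E : Dv F L} (h : D ≤ E) : ell D ≤ ell E :=
  Submodule.finrank_mono (LD_mono h)

lemma ell_add_dv (D : Dv F L) {z : L} (hz : z ≠ 0) : ell (D + dv F z) = ell D := by
  have key : ∀ (D : Dv F L) {z : L}, z ≠ 0 → ell D ≤ ell (D + dv F z) := by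
    intro D z hz
    let f : LD D →ₗ[F] L := (LinearMap.mulLeft F z⁻¹).comp (LD D).subtype
    have hf : ∀ x, f x ∈ LD (D + dv F z) := by
      intro x
      rw [mem_LD]
      intro v
      have := mem_LD.1 x.2 v
      have h := (v.mul_mem_U_iff (n := -(D v)) (y := (x : L)) (inv_ne_zero hz)).2 this
      rw [v.ord_inv] at h
      change z⁻¹ * (x : L) ∈ _
      convert h using 2
      simp
    refine LinearMap.finrank_le_finrank_of_injective (f := f.codRestrict _ hf) ?_
    intro x y hxy
    have h1 : z⁻¹ * (x : L) = z⁻¹ * y := congrArg Subtype.val hxy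
    exact Subtype.ext (mul_left_cancel₀ (inv_ne_zero hz) h1)
  refine le_antisymm ?_ (key D hz)
  have := key (D + dv F z) (inv_ne_zero hz)
  rwa [dv_inv, add_neg_cancel_right] at this

lemma exists_of_ell_pos {D : Dv F L} (h : 0 < ell D) : ∃ z : L, z ≠ 0 ∧ 0 ≤ D + dv F z := by
  have := Module.finrank_pos_iff_exists_ne_zero.1 h
  obtain ⟨z, hz⟩ := this
  have h2 : (z : L) ≠ 0 := fun h => hz (Subtype.ext h)
  exact ⟨z, h2, (mem_LD_iff h2).1 z.2⟩

lemma ndeg_inv (x : L) : ndeg F x⁻¹ = ndeg F x := by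
  have : F⟮x⁻¹⟯ = F⟮x⟯ := by
    apply le_antisymm
    · rw [adjoin_simple_le_iff]; exact inv_mem (mem_adjoin_simple_self F x)
    · rw [adjoin_simple_le_iff]
      have := inv_mem (mem_adjoin_simple_self F x⁻¹)
      rwa [inv_inv] at this
  unfold ndeg
  rw [this]

lemma transcendental_inv {x : L} (hx : Transcendental F x) : Transcendental F x⁻¹ := by
  intro h; exact hx (by simpa using h.inv)

lemma dpos_le {x : L} (hx : Transcendental F x) : ddeg (dv F x ⊔ 0) ≤ ndeg F x := by
  classical
  have h1 := Place.sum_ord_le (F := F) ((dv F x).support.filter fun v => 0 < v.ord x)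
    (fun v hv => (Finset.mem_filter.1 hv).2) hx
  refine le_trans (le_of_eq ?_) h1
  rw [ddeg_eq, Finsupp.sum_of_support_subset (s := (dv F x).support.filter fun v => 0 < v.ord x)]
  · refine Finset.sum_congr rfl fun v hv => ?_
    have : 0 < v.ord x := (Finset.mem_filter.1 hv).2
    rw [Finsupp.sup_apply]
    simp [this.le]
  · intro v hv
    simp only [Finsupp.mem_support_iff, Finsupp.sup_apply, dv_apply, Finsupp.coe_zero, Pi.zero_apply] at hv
    have : 0 < v.ord x := by
      by_contra h
      exact hv (sup_eq_right.2 (not_lt.1 h))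
    simp only [Finset.mem_filter, Finsupp.mem_support_iff, dv_apply]
    omega
  · simp

lemma exists_big {x : L} (hx : Transcendental F x) : ∃ D0 : Dv F L, 0 ≤ D0 ∧ ∀ l : ℕ,
    ndeg F x * (l + 1) ≤ ell (l • (dv F x⁻¹ ⊔ 0) + D0) := by
  classical
  obtain ⟨u, hu⟩ := exists_indep hx
  refine ⟨∑ i, (dv F (u i)⁻¹ ⊔ 0), Finset.sum_nonneg fun i _ => le_sup_right, fun l => ?_⟩
  set D := l • (dv F x⁻¹ ⊔ 0) + ∑ i, (dv F (u i)⁻¹ ⊔ 0) with hD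
  let f : (Fin (ndeg F x) → degreeLT F (l + 1)) →ₗ[F] L :=
    { toFun := fun p => ∑ i, aeval x (p i : F[X]) * u i
      map_add' := by intro p q; simp [add_mul, Finset.sum_add_distrib]
      map_smul' := by intro c p; simp [Finset.smul_sum] }
  have hmem : ∀ i, ∀ j ≤ l, x ^ j * u i ∈ LD D := by
    intro i j hj
    rw [mem_LD]
    intro v
    by_cases hui : u i = 0
    · rw [hui, mul_zero]; exact Submodule.zero_mem _
    have hx0 := tr_ne_zero hx
    rw [v.mem_U_iff (mul_ne_zero (pow_ne_zero _ hx0) hui), v.ord_mul (pow_ne_zero _ hx0) hui,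
      v.ord_pow]
    have a1 : (dv F (u i)⁻¹ ⊔ 0) v ≤ (∑ i, (dv F (u i)⁻¹ ⊔ 0)) v := by
      rw [Finsupp.finsetSum_apply]
      exact Finset.single_le_sum (f := fun i => (dv F (u i)⁻¹ ⊔ 0) v)
        (fun i _ => (le_sup_right : (0 : Dv F L) ≤ dv F (u i)⁻¹ ⊔ 0) v) (Finset.mem_univ i)
    have a2 : -v.ord (u i) ≤ (dv F (u i)⁻¹ ⊔ 0) v := by
      rw [Finsupp.sup_apply, dv_apply, v.ord_inv]; exact le_sup_left
    have a3 : -v.ord x ≤ (dv F x⁻¹ ⊔ 0) v := by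
      rw [Finsupp.sup_apply, dv_apply, v.ord_inv]; exact le_sup_left
    have a4 : 0 ≤ (dv F x⁻¹ ⊔ 0) v := (le_sup_right : (0 : Dv F L) ≤ dv F x⁻¹ ⊔ 0) v
    rw [hD, Finsupp.add_apply, Finsupp.smul_apply, nsmul_eq_mul]
    have hj' : (j : ℤ) ≤ l := by exact_mod_cast hj
    have a5 : -(j * v.ord x) ≤ l * (dv F x⁻¹ ⊔ 0) v := by
      calc -(j * v.ord x) = j * (-v.ord x) := by ring
        _ ≤ j * (dv F x⁻¹ ⊔ 0) v := mul_le_mul_of_nonneg_left a3 (by positivity)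
        _ ≤ _ := mul_le_mul_of_nonneg_right hj' a4
    linarith
  have hf : ∀ p, f p ∈ LD D := by
    intro p
    change ∑ i, aeval x (p i : F[X]) * u i ∈ LD D
    refine Submodule.sum_mem _ fun i _ => ?_
    have hdeg : (p i : F[X]).natDegree < l + 1 := by
      have := Polynomial.mem_degreeLT.1 (p i).2
      by_cases h0 : (p i : F[X]) = 0
      · rw [h0]; simp
      · exact (natDegree_lt_iff_degree_lt h0).2 this
    rw [aeval_eq_sum_range' hdeg, Finset.sum_mul]
    refine Submodule.sum_mem _ fun j hj => ?_
    rw [smul_mul_assoc]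
    exact Submodule.smul_mem _ _ (hmem i j (by simpa [Nat.lt_succ_iff] using hj))
  have h1 := LinearMap.finrank_le_finrank_of_injective (f := f.codRestrict _ hf) (by
    rw [injective_iff_map_eq_zero]
    intro p hp
    have h2 : ∑ i, aeval x (p i : F[X]) * u i = 0 := congrArg Subtype.val hp
    have h3 := hu (fun i => (p i : F[X])) h2
    funext i
    exact Subtype.ext (congrFun h3 i))
  rw [(LinearEquiv.piCongrRight fun _ => degreeLTEquiv F (l+1)).finrank_eq,
    Module.finrank_pi_fintype] at h1
  rw [ell]; simpa using h1

lemma nat_lin {n c d : ℤ} (h : ∀ l : ℕ, n * (l + 1) ≤ c + l * d) : n ≤ d := by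
  by_contra hc
  have h1 := h (c - n).toNat.succ
  have h2 : (c - n) ≤ (c-n).toNat := Int.self_le_toNat _
  have h3 : d ≤ n - 1 := by omega
  push_cast at h1
  nlinarith [mul_le_mul_of_nonneg_left h3 (by positivity : (0:ℤ) ≤ (c-n).toNat + 1)]

lemma ddeg_poles {x : L} (hx : Transcendental F x) : ddeg (dv F x⁻¹ ⊔ 0) = ndeg F x := by
  apply le_antisymm
  · rw [← ndeg_inv]; exact dpos_le (transcendental_inv hx)
  · obtain ⟨D0, h0, h⟩ := exists_big hx
    refine nat_lin (c := ell (0 : Dv F L) + ddeg D0) fun l => ?_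
    have h1 := h l
    have h2 := ell_le (D := 0) (E := l • (dv F x⁻¹ ⊔ 0) + D0)
      (add_nonneg (nsmul_nonneg le_sup_right l) h0)
    rw [map_zero, map_add, map_nsmul, nsmul_eq_mul] at h2
    have h3 : (ndeg F x : ℤ) * (l + 1) ≤ ell (l • (dv F x⁻¹ ⊔ 0) + D0) := by exact_mod_cast h1
    linarith

lemma ddeg_dv (x : L) : ddeg (dv F x) = 0 := by
  by_cases hx : IsAlgebraic F x
  · rw [dv_of_alg hx, map_zero]
  have h1 := ddeg_poles hx
  have h2 := ddeg_poles (transcendental_inv hx)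
  rw [inv_inv, ndeg_inv] at h2
  have h3 : dv F x = (dv F x ⊔ 0) - (dv F x⁻¹ ⊔ 0) := by
    rw [dv_inv]
    ext v
    simp only [Finsupp.sub_apply, Finsupp.sup_apply, Finsupp.neg_apply, Finsupp.coe_zero, Pi.zero_apply]
    rcases le_total 0 (dv F x v) with h | h
    · rw [sup_eq_left.2 h, sup_eq_right.2 (by omega)]; simp
    · rw [sup_eq_right.2 h, sup_eq_left.2 (by omega)]; simp
  rw [h3, map_sub, h1, h2, sub_self]

variable (F L) in
lemma rr_bdd : ∃ M : ℤ, ∀ D : Dv F L, ddeg D - ell D ≤ M := by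
  obtain ⟨x, hx⟩ := FF.exists_tr (F := F) (L := L)
  obtain ⟨D0, h0, h⟩ := exists_big hx
  set B := dv F x⁻¹ ⊔ 0 with hB
  have hBd : ddeg B = ndeg F x := ddeg_poles hx
  have hBr : ∀ l : ℕ, ddeg (l • B) - ell (l • B) ≤ ddeg D0 - ndeg F x := by
    intro l
    have h1 := h l
    have h2 := ell_le (D := l • B) (E := l • B + D0) (by simpa using h0)
    have h3 : (ndeg F x : ℤ) * (l + 1) ≤ ell (l • B + D0) := by exact_mod_cast h1
    rw [map_add, map_nsmul, nsmul_eq_mul, hBd] at h2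
    rw [map_nsmul, nsmul_eq_mul, hBd]
    linarith
  have hpos : 0 < ndeg F x := by
    have := FF.findim x hx
    exact Module.finrank_pos
  refine ⟨ddeg D0 - ndeg F x, fun D => ?_⟩
  set P := D ⊔ 0
  have hP : 0 ≤ P := le_sup_right
  set M := ddeg D0 - ndeg F x
  obtain ⟨l, hl⟩ : ∃ l : ℕ, M + ddeg P < l := ⟨(M + ddeg P).toNat + 1, by push_cast; have := Int.self_le_toNat (M + ddeg P); omega⟩
  have h1 : 0 < ell (l • B - P) := by
    have a1 := ell_le (D := l • B - P) (E := l • B) (by simpa using hP)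
    have a2 := hBr l
    rw [map_sub] at a1
    have a3 : (l : ℤ) ≤ ddeg (l • B) := by
      rw [map_nsmul, nsmul_eq_mul, hBd]
      have : (1 : ℤ) ≤ ndeg F x := by exact_mod_cast hpos
      nlinarith
    omega
  obtain ⟨z, hz, hz2⟩ := exists_of_ell_pos h1
  have h2 : P ≤ l • B + dv F z := by
    have : l • B - P + dv F z = (l • B + dv F z) - P := by abel
    rw [this] at hz2
    exact sub_nonneg.1 hz2
  have h3 := ell_le ((le_sup_left : D ≤ P).trans h2)
  rw [ell_add_dv _ hz, map_add, ddeg_dv] at h3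
  have := hBr l
  linarith

variable (F L) in
/-- Riemann theorem -/
lemma rr : ∃ γ n0 : ℤ, ∀ D : Dv F L, ddeg D ≤ ell D + γ ∧ (n0 ≤ ddeg D → ddeg D = ell D + γ) := by
  obtain ⟨M, hM⟩ := rr_bdd F L
  obtain ⟨γ, ⟨D1, hD1⟩, hγ⟩ := Int.exists_greatest_of_bdd
    (P := fun r => ∃ D : Dv F L, ddeg D - ell D = r) ⟨M, by rintro _ ⟨D, rfl⟩; exact hM D⟩ ⟨_, 0, rfl⟩
  have h0 : ∀ D : Dv F L, ddeg D ≤ ell D + γ := fun D => by have := hγ _ ⟨D, rfl⟩; omega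
  refine ⟨γ, ddeg D1 + γ + 1, fun D => ⟨h0 D, fun hD => ?_⟩⟩
  have h1 := h0 (D - D1)
  rw [map_sub] at h1
  obtain ⟨z, hz, hz2⟩ := exists_of_ell_pos (D := D - D1) (by omega)
  have h2 : D1 ≤ D + dv F z := by
    have : D - D1 + dv F z = (D + dv F z) - D1 := by abel
    rw [this] at hz2
    exact sub_nonneg.1 hz2
  have h3 := ell_le h2
  rw [ell_add_dv _ hz, map_add, ddeg_dv] at h3
  have := h0 D
  omega

end
end GFF
end PB5

section PB6
namespace GFF
set_option linter.unusedSectionVars false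
set_option linter.unusedVariables false
set_option linter.unnecessarySimpa false
open IntermediateField Polynomial

section
variable {F L : Type*} [Field F] [Field L] [Algebra F L] [Finite F] [FF F L]

lemma transcendental_pow_sub {x : L} (hx : Transcendental F x) {m : ℕ} (hm : 2 ≤ m) :
    Transcendental F (x ^ m - x) := by
  rintro ⟨p, hp, hpx⟩
  apply hx
  refine ⟨p.comp (X ^ m - X), ?_, by simpa [aeval_comp] using hpx⟩
  intro h0
  have h1 : (X ^ m - X : F[X]).natDegree = m := FiniteField.X_pow_card_sub_X_natDegree_eq F (by omega)
  rcases comp_eq_zero_iff.1 h0 with h | ⟨-, h⟩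
  · exact hp h
  · rw [h, natDegree_C] at h1; omega

lemma finite_places_deg (n : ℕ) : {v : Place F L | v.δ = n}.Finite := by
  obtain ⟨x, hx⟩ := FF.exists_tr (F := F) (L := L)
  rcases Nat.eq_zero_or_pos n with rfl | hn
  · convert Set.finite_empty
    ext v; simp only [Set.mem_ofPred_eq, Set.mem_empty_iff_false, iff_false]
    exact v.δ_pos.ne'
  set q := Nat.card F ^ n
  have hq : 2 ≤ q := by
    have : 2 ≤ Nat.card F := Finite.one_lt_card
    exact this.trans (Nat.le_self_pow (by omega) _)
  refine ((Place.finite_ord_ne (F := F) x).union (Place.finite_ord_ne (F := F) (x ^ q - x))).subset ?_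
  intro v hv
  have hv' : v.δ = n := hv
  by_cases h0 : v.ord x = 0
  · right
    have hx0 : x ∈ v.U 0 := v.mem_U_of_le h0.ge
    have hmem : x ^ q - x ∈ v.U 1 := by
      have hxq : x ^ q ∈ v.U 0 := v.mem_U_of_le (by rw [v.ord_pow, h0, mul_zero])
      rw [← v.res_eq hxq hx0, v.res_pow hx0]
      have : Fintype v.κ := Fintype.ofFinite _
      have hc : Fintype.card v.κ = q := by
        rw [← Nat.card_eq_fintype_card, Module.natCard_eq_pow_finrank (K := F)]
        change Nat.card F ^ v.δ = _
        rw [hv']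
      rw [← hc]
      exact FiniteField.pow_card _
    have hne := tr_ne_zero (transcendental_pow_sub hx hq)
    rw [v.mem_U_iff hne] at hmem
    simp only [Set.mem_ofPred_eq]; omega
  · left; exact h0

lemma finite_places_le (n : ℕ) : {v : Place F L | v.δ ≤ n}.Finite := by
  refine ((Set.finite_Iic n).biUnion fun i _ => finite_places_deg (F := F) (L := L) i).subset ?_
  intro v hv
  simp only [Set.mem_iUnion]
  exact ⟨v.δ, hv, rfl⟩

/-- effective divisors of degree n -/
def Eff (F L : Type*) [Field F] [Field L] [Algebra F L] [Finite F] [FF F L] (n : ℤ) : Set (Dv F L) :=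
  {D | 0 ≤ D ∧ ddeg D = n}

lemma le_ddeg {D : Dv F L} (h : 0 ≤ D) (v : Place F L) : D v * v.δ ≤ ddeg D := by
  have h1 : Finsupp.single v (D v) ≤ D := by
    intro u
    by_cases hu : u = v
    · subst hu; simp
    · rw [Finsupp.single_eq_of_ne hu]; exact h u
  have := ddeg_mono h1
  rwa [ddeg_single] at this

lemma Eff_finite (n : ℤ) : (Eff F L n).Finite := by
  classical
  let S := (finite_places_le (F := F) (L := L) n.toNat).toFinset
  refine (Set.finite_Icc (0 : Dv F L) (∑ v ∈ S, Finsupp.single v n)).subset ?_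
  rintro D ⟨h0, h1⟩
  refine ⟨h0, fun v => ?_⟩
  rw [Finsupp.finsetSum_apply]
  have h2 := le_ddeg h0 v
  have h3 : (1 : ℤ) ≤ v.δ := by exact_mod_cast v.δ_pos
  have h4 : 0 ≤ D v := h0 v
  have hn : 0 ≤ n := h1 ▸ ddeg_nonneg h0
  have h5 : ∀ u ∈ S, 0 ≤ (Finsupp.single u n) v := by
    intro u _
    rw [Finsupp.single_apply]; split_ifs <;> omega
  by_cases hz : D v = 0
  · rw [hz]; exact Finset.sum_nonneg h5
  · have hvS : v ∈ S := by
      simp only [S, Set.Finite.mem_toFinset, Set.mem_ofPred_eq]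
      have : (v.δ : ℤ) ≤ n := by nlinarith [show (1:ℤ) ≤ D v by omega]
      omega
    refine le_trans ?_ (Finset.single_le_sum h5 hvS)
    rw [Finsupp.single_eq_same]
    nlinarith

variable (F) in
/-- Effective divisors in a class -/
def cls (D : Dv F L) : Set (Dv F L) :=
  {E | 0 ≤ E ∧ ∃ z : L, z ≠ 0 ∧ E = D + dv F z}

lemma cls_sub (D : Dv F L) : cls F D ⊆ Eff F L (ddeg D) := by
  rintro E ⟨h0, z, hz, rfl⟩
  exact ⟨h0, by rw [map_add, ddeg_dv, add_zero]⟩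

lemma card_nonzero (V : Type*) [AddCommGroup V] [Module F V] [Module.Finite F V] :
    Nat.card {x : V // x ≠ 0} = Nat.card F ^ Module.finrank F V - 1 := by
  have : Finite V := Module.finite_of_finite F
  have : Fintype V := Fintype.ofFinite V
  classical
  rw [← Module.natCard_eq_pow_finrank (K := F), Nat.card_eq_fintype_card, Nat.card_eq_fintype_card,
    Fintype.card_subtype_compl]
  simp

lemma dv_eq_zero {x : L} : dv F x = 0 ↔ IsAlgebraic F x := by
  refine ⟨fun h => isAlgebraic_of_ord fun v => ?_, dv_of_alg⟩
  rw [← dv_apply, h]; simp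

lemma card_cls (D : Dv F L) :
    Nat.card (cls F D) * (Nat.card F ^ ell (0 : Dv F L) - 1) = Nat.card F ^ ell D - 1 := by
  unfold ell
  rw [← card_nonzero (F := F) (LD D), ← card_nonzero (F := F) (LD (0 : Dv F L)), ← Nat.card_prod]
  choose z hz hzE using fun E : cls F D => E.2.2
  refine Nat.card_congr (Equiv.ofBijective (fun p => ⟨⟨(p.2.1 : L) * z p.1, ?_⟩, ?_⟩) ?_)
  · have hc : (p.2.1 : L) ≠ 0 := fun h => p.2.2 (Subtype.ext h)
    rw [mem_LD_iff (mul_ne_zero hc (hz _)), dv_mul hc (hz _), dv_of_alg (mem_LD_zero.1 p.2.1.2),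
      zero_add, ← hzE]
    exact p.1.2.1
  · have hc : (p.2.1 : L) ≠ 0 := fun h => p.2.2 (Subtype.ext h)
    intro h
    exact mul_ne_zero hc (hz _) (congrArg Subtype.val h)
  · constructor
    · rintro ⟨E, c⟩ ⟨E', c'⟩ h
      have h1 : (c.1 : L) * z E = c'.1 * z E' := congrArg (fun x => (x.1 : L)) h
      have hc : (c.1 : L) ≠ 0 := fun h => c.2 (Subtype.ext h)
      have hc' : (c'.1 : L) ≠ 0 := fun h => c'.2 (Subtype.ext h)
      have h2 : dv F (z E) = dv F (z E') := by
        have := congrArg (dv F) h1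
        rwa [dv_mul hc (hz _), dv_mul hc' (hz _), dv_of_alg (mem_LD_zero.1 c.1.2),
          dv_of_alg (mem_LD_zero.1 c'.1.2), zero_add, zero_add] at this
      have h3 : E = E' := Subtype.ext (by rw [hzE E, hzE E', h2])
      subst h3
      have h4 := mul_right_cancel₀ (hz E) h1
      have h5 : c = c' := Subtype.ext (Subtype.ext h4)
      rw [h5]
    · rintro ⟨x, hx⟩
      have hx0 : (x : L) ≠ 0 := fun h => hx (Subtype.ext h)
      let E : cls F D := ⟨D + dv F (x : L), (mem_LD_iff hx0).1 x.2, x, hx0, rfl⟩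
      have h1 : dv F ((x : L) * (z E)⁻¹) = 0 := by
        rw [dv_mul hx0 (inv_ne_zero (hz E)), dv_inv]
        have : D + dv F (x : L) = D + dv F (z E) := hzE E
        rw [add_left_cancel this]; simp
      refine ⟨⟨E, ⟨⟨(x : L) * (z E)⁻¹, mem_LD_zero.2 (dv_eq_zero.1 h1)⟩, ?_⟩⟩, ?_⟩
      · intro h
        exact mul_ne_zero hx0 (inv_ne_zero (hz E)) (congrArg Subtype.val h)
      · apply Subtype.ext; apply Subtype.ext
        change (x : L) * (z E)⁻¹ * z E = x
        rw [inv_mul_cancel_right₀ (hz E)]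

lemma ell_zero_pos : 0 < ell (0 : Dv F L) := by
  refine Module.finrank_pos_iff_exists_ne_zero.2 ⟨⟨1, mem_LD_zero.2 isAlgebraic_one⟩, ?_⟩
  intro h; exact one_ne_zero (congrArg Subtype.val h)

end
end GFF
end PB6

section PB7
namespace GFF
set_option linter.unusedSectionVars false
set_option linter.unusedVariables false
set_option linter.unnecessarySimpa false
open IntermediateField Polynomial

section qc
variable {k : Type*} [Field k] [Finite k] [NeZero (2 : k)]

lemma ringChar_ne_two : ringChar k ≠ 2 := by
  intro h
  have := ringChar.Nat.cast_ringChar (R := k)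
  rw [h] at this
  exact NeZero.ne (2 : k) (by exact_mod_cast this)

open Classical in
/-- quadratic class in a finite field -/
noncomputable def qc (y : k) : ZMod 2 := if IsSquare y then 0 else 1

lemma qc_eq_zero {y : k} : qc y = 0 ↔ IsSquare y := by
  unfold qc; split_ifs with h <;> simp [h]

lemma qc_one : qc (1 : k) = 0 := qc_eq_zero.2 IsSquare.one

lemma qc_mul {x y : k} (hx : x ≠ 0) (hy : y ≠ 0) : qc (x * y) = qc x + qc y := by
  classical
  have : Fintype k := Fintype.ofFinite k
  have h2 : ringChar k ≠ 2 := ringChar_ne_two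
  have key : ∀ z : k, z ≠ 0 → (qc z = 0 ↔ quadraticChar k z = 1) := by
    intro z hz; rw [qc_eq_zero, quadraticChar_one_iff_isSquare hz]
  have h1 := key x hx
  have h3 := key y hy
  have h4 := key _ (mul_ne_zero hx hy)
  rw [map_mul] at h4
  rcases quadraticChar_dichotomy hx with a | a <;> rcases quadraticChar_dichotomy hy with b | b <;>
    rw [a] at h1 h4 <;> rw [b] at h3 h4 <;>
    rcases z2_cases (qc x) with c | c <;> rcases z2_cases (qc y) with d | d <;>
    rcases z2_cases (qc (x * y)) with e | e <;> rw [c] at h1 <;> rw [d] at h3 <;> rw [e] at h4 <;>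
    rw [c, d, e] <;> revert h1 h3 h4 <;> decide

lemma exists_qc : ∃ y : k, y ≠ 0 ∧ qc y = 1 := by
  obtain ⟨y, hy⟩ := FiniteField.exists_nonsquare (F := k) ringChar_ne_two
  exact ⟨y, fun h => hy (h ▸ IsSquare.zero), by unfold qc; rw [if_neg hy]⟩

end qc

lemma two_ne (F : Type*) {L : Type*} [Field F] [Field L] [Algebra F L] [NeZero (2 : F)] : (2 : L) ≠ 0 := by
  have h1 : algebraMap F L 2 ≠ 0 := by
    rw [Ne, map_eq_zero]; exact NeZero.ne _
  rwa [map_ofNat] at h1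

namespace Place
variable {F L : Type*} [Field F] [Field L] [Algebra F L] [Finite F] [FF F L] [NeZero (2 : F)]
  (v : Place F L)

instance : NeZero (2 : v.κ) := ⟨two_ne F⟩

/-- the unit part -/
noncomputable def un (x : L) : L := x * v.π ^ (-v.ord x)

lemma un_ne {x : L} (hx : x ≠ 0) : v.un x ≠ 0 := mul_ne_zero hx (v.π_zpow_ne _)

lemma ord_un {x : L} (hx : x ≠ 0) : v.ord (v.un x) = 0 := by
  unfold un; rw [v.ord_mul hx (v.π_zpow_ne _), v.ord_π_zpow]; ring

lemma un_mul {x y : L} (hx : x ≠ 0) (hy : y ≠ 0) : v.un (x * y) = v.un x * v.un y := by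
  unfold un; rw [v.ord_mul hx hy, neg_add, zpow_add₀ v.π_ne]; ring

lemma un_of_unit {x : L} (h : v.ord x = 0) : v.un x = x := by unfold un; rw [h]; simp

lemma un_π : v.un v.π = 1 := by
  unfold un; rw [v.ord_π, zpow_neg, zpow_one, mul_inv_cancel₀ v.π_ne]

lemma eq_un_mul (x : L) : x = v.un x * v.π ^ v.ord x := by
  unfold un
  rw [mul_assoc, ← zpow_add₀ v.π_ne]; simp

lemma res_ne_zero {x : L} (hx : x ≠ 0) (h : v.ord x = 0) : v.res x ≠ 0 := by
  rw [Ne, v.res_eq_zero (v.mem_U_of_le h.ge), v.mem_U_iff hx]; omega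

lemma unit_mem {x : L} (h : v.ord x = 0) : x ∈ v.U 0 := v.mem_U_of_le h.ge

/-- r-part of the symbol -/
noncomputable def rr (x : L) : ZMod 2 := qc (v.res (v.un x))

lemma rr_mul {x y : L} (hx : x ≠ 0) (hy : y ≠ 0) : v.rr (x * y) = v.rr x + v.rr y := by
  unfold rr
  have a := v.ord_un hx
  have b := v.ord_un hy
  rw [v.un_mul hx hy, v.res_mul (v.unit_mem a) (v.unit_mem b), qc_mul (v.res_ne_zero (v.un_ne hx) a)
    (v.res_ne_zero (v.un_ne hy) b)]

lemma rr_unit {x : L} (h : v.ord x = 0) : v.rr x = qc (v.res x) := by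
  unfold rr; rw [v.un_of_unit h]

lemma rr_π : v.rr v.π = 0 := by unfold rr; rw [v.un_π, v.res_one, qc_one]

lemma rr_close {x y : L} (hx : x ≠ 0) (h : y - x ∈ v.U (v.ord x + 1)) :
    y ≠ 0 ∧ v.ord y = v.ord x ∧ v.rr y = v.rr x := by
  obtain ⟨hy, ho⟩ := v.ord_eq_of_sub hx h
  refine ⟨hy, ho, ?_⟩
  unfold rr
  congr 1
  rw [v.res_eq (v.unit_mem (v.ord_un hy)) (v.unit_mem (v.ord_un hx))]
  unfold un
  rw [ho, ← sub_mul, v.mul_π_mem]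
  convert h using 2; ring

lemma stein_aux {a b : L} (ha : a ≠ 0) (hb : b ≠ 0) (h : a + b = 1) (hp : 0 < v.ord a) :
    v.ord b = 0 ∧ v.rr b = 0 := by
  have h1 : b - 1 ∈ v.U (v.ord 1 + 1) := by
    have : b - 1 = -a := by linear_combination h
    rw [this, v.ord_one]
    exact v.mem_U_of_le (by rw [v.ord_neg]; omega)
  have := v.rr_close one_ne_zero h1
  rw [v.ord_one, v.rr_unit v.ord_one, v.res_one, qc_one] at this
  exact this.2

lemma stein_aux2 {a b : L} (ha : a ≠ 0) (hb : b ≠ 0) (h : a + b = 1) (hp : v.ord a < 0) :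
    v.ord b = v.ord a ∧ v.rr b = v.rr (-1) + v.rr a := by
  have h1 : b - (-1 * a) ∈ v.U (v.ord (-1 * a) + 1) := by
    have : b - (-1 * a) = 1 := by linear_combination h
    rw [this, neg_one_mul, v.ord_neg]
    exact v.mem_U_of_le (by rw [v.ord_one]; omega)
  have := v.rr_close (by simpa using ha) h1
  rw [v.rr_mul (by simp) ha, neg_one_mul, v.ord_neg] at this
  exact this.2

/-- the symbol attached to a place -/
noncomputable def sy : LSym L where
  p x := (v.ord x : ZMod 2)
  r x := v.rr x
  n := v.rr (-1)
  p_mul a b ha hb := by rw [v.ord_mul ha hb]; push_cast; ring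
  r_mul a b ha hb := v.rr_mul ha hb
  p_neg := by rw [v.ord_neg_one]; simp
  r_neg := rfl
  stein a b ha hb h := by
    have h' : b + a = 1 := by rw [add_comm]; exact h
    rcases lt_trichotomy (v.ord a) 0 with h1 | h1 | h1
    · obtain ⟨h2, h3⟩ := v.stein_aux2 ha hb h h1
      rw [h2, h3]
      generalize v.rr (-1) = A; generalize v.rr a = B; generalize ((v.ord a : ℤ) : ZMod 2) = C
      revert A B C; decide
    · rcases lt_trichotomy (v.ord b) 0 with h2 | h2 | h2
      · obtain ⟨h3, -⟩ := v.stein_aux2 hb ha h' h2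
        omega
      · rw [h1, h2]; simp
      · obtain ⟨-, h4⟩ := v.stein_aux hb ha h' h2
        rw [h1, h4]; simp
    · obtain ⟨h3, h4⟩ := v.stein_aux ha hb h h1
      rw [h3, h4]; simp

lemma sy_p (x : L) : v.sy.p x = (v.ord x : ZMod 2) := rfl
lemma sy_r (x : L) : v.sy.r x = v.rr x := rfl
lemma sy_n : v.sy.n = v.rr (-1) := rfl

lemma exists_rr (i : ZMod 2) (j : ℤ) : ∃ x : L, x ≠ 0 ∧ v.ord x = j ∧ v.rr x = i := by
  rcases z2_cases i with rfl | rfl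
  · refine ⟨v.π ^ j, v.π_zpow_ne _, v.ord_π_zpow _, ?_⟩
    unfold rr un
    rw [v.ord_π_zpow, ← zpow_add₀ v.π_ne]
    simp [v.res_one, qc_one]
  · obtain ⟨y, hy, hq⟩ := exists_qc (k := v.κ)
    obtain ⟨x, hx, rfl⟩ := v.res_surj y
    have hx0 : x ≠ 0 := by
      rintro rfl
      rw [Ne, v.res_eq_zero hx] at hy
      exact hy (Submodule.zero_mem _)
    have ho : v.ord x = 0 := by
      have a := (v.mem_U_iff hx0).1 hx
      rw [Ne, v.res_eq_zero hx, v.mem_U_iff hx0] at hy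
      omega
    refine ⟨x * v.π ^ j, mul_ne_zero hx0 (v.π_zpow_ne _), ?_, ?_⟩
    · rw [v.ord_mul hx0 (v.π_zpow_ne _), v.ord_π_zpow, ho, zero_add]
    · unfold rr un
      rw [v.ord_mul hx0 (v.π_zpow_ne _), v.ord_π_zpow, ho, mul_assoc, ← zpow_add₀ v.π_ne]
      simpa using hq

lemma exists_h {a : L} (ha : ¬ v.sy.Sq a) : ∃ b : L, b ≠ 0 ∧ v.sy.h a b = 1 := by
  unfold LSym.Sq at ha
  by_cases hp : v.sy.p a = 0
  · have hr : v.sy.r a = 1 := (z2_cases _).resolve_left fun h => ha ⟨hp, h⟩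
    refine ⟨v.π, v.π_ne, ?_⟩
    unfold LSym.h
    rw [hp, hr, v.sy_p, v.ord_π]; simp
  · have hp : v.sy.p a = 1 := (z2_cases _).resolve_left hp
    obtain ⟨b, hb, h1, h2⟩ := v.exists_rr 1 0
    refine ⟨b, hb, ?_⟩
    unfold LSym.h
    rw [hp, v.sy_p, v.sy_r b, h1, h2]; simp

/-- weak approximation for classes -/
lemma wa (S : Finset (Place F L)) (g : Place F L → L) (hg : ∀ v ∈ S, g v ≠ 0) :
    ∃ x : L, x ≠ 0 ∧ ∀ v ∈ S, v.sy.p x = v.sy.p (g v) ∧ v.sy.r x = v.sy.r (g v) := by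
  rcases S.eq_empty_or_nonempty with rfl | hS
  · exact ⟨1, one_ne_zero, by simp⟩
  obtain ⟨N, hN⟩ : ∃ N : ℤ, ∀ v ∈ S, v.ord (g v) + 1 ≤ N := by
    obtain ⟨N, hN⟩ := (S.image fun v => v.ord (g v) + 1).bddAbove
    refine ⟨N, fun v hv => hN ?_⟩
    simp only [Finset.coe_image, Set.mem_image]
    exact ⟨v, hv, rfl⟩
  obtain ⟨x, hx⟩ := weak_approx S g N
  have key : ∀ v ∈ S, x ≠ 0 ∧ v.ord x = v.ord (g v) ∧ v.rr x = v.rr (g v) :=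
    fun v hv => v.rr_close (hg v hv) (v.U_mono (hN v hv) (hx v hv))
  obtain ⟨v, hv⟩ := hS
  refine ⟨x, (key v hv).1, fun u hu => ?_⟩
  obtain ⟨-, h1, h2⟩ := key u hu
  exact ⟨by rw [u.sy_p, u.sy_p, h1], h2⟩

lemma sq_of_close {x : L} {s : L} (hx : x ≠ 0) (hs : s ≠ 0) (h : 1 - x * s ^ 2 ∈ v.U 1) : v.sy.Sq x := by
  have h1 := v.rr_close (x := 1) (y := x * s ^ 2) one_ne_zero
    (by rw [v.ord_one, zero_add, ← Submodule.neg_mem_iff, neg_sub]; exact h)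
  have h2 : v.sy.Sq (x * s ^ 2) := by
    refine ⟨by rw [v.sy_p, h1.2.1, v.ord_one]; simp, ?_⟩
    rw [v.sy_r, h1.2.2, v.rr_unit v.ord_one, v.res_one, qc_one]
  rw [v.sy.sq_mul_iff hx (pow_ne_zero _ hs), v.sy.p_sq hs, v.sy.r_sq hs] at h2
  exact h2

lemma newton {d : L} (hd : d ≠ 0) (h : v.sy.Sq d) (N : ℕ) : ∃ s : L, s ≠ 0 ∧ 1 - d * s ^ 2 ∈ v.U (N + 1) := by
  induction N with
  | zero =>
    obtain ⟨h1, h2⟩ := h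
    rw [v.sy_p, ZMod.intCast_zmod_eq_zero_iff_dvd] at h1
    obtain ⟨m, hm⟩ := h1
    rw [v.sy_r, rr, qc_eq_zero] at h2
    obtain ⟨y, hy⟩ := h2
    obtain ⟨t, ht, rfl⟩ := v.res_surj y
    have ho := v.ord_un hd
    have hne := v.res_ne_zero (v.un_ne hd) ho
    have ht0 : t ≠ 0 := by
      rintro rfl
      rw [hy, (v.res_eq_zero (Submodule.zero_mem _)).2 (Submodule.zero_mem _)] at hne
      simp at hne
    have ht1 : v.ord t = 0 := by
      have a := (v.mem_U_iff ht0).1 ht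
      by_contra hc
      have : v.res t = 0 := (v.res_eq_zero ht).2 (v.mem_U_of_le (by omega))
      rw [hy, this] at hne; simp at hne
    refine ⟨t⁻¹ * v.π ^ (-m), mul_ne_zero (inv_ne_zero ht0) (v.π_zpow_ne _), ?_⟩
    have e : 1 - d * (t⁻¹ * v.π ^ (-m)) ^ 2 = (t ^ 2)⁻¹ * (t ^ 2 - v.un d) := by
      unfold un
      have e1 : v.π ^ (-v.ord d) = (v.π ^ (-m)) ^ 2 := by
        rw [hm, ← zpow_natCast, ← zpow_mul]; congr 1; push_cast; ring
      rw [e1]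
      field_simp
    have h3 : t ^ 2 - v.un d ∈ v.U 1 := by
      rw [← v.res_eq (v.unit_mem (by rw [v.ord_pow, ht1, mul_zero])) (v.unit_mem ho), v.res_pow ht, hy, pow_two]
    rw [e]
    have := v.U_zero_mul (v.unit_mem (x := (t ^ 2)⁻¹) (by rw [v.ord_inv, v.ord_pow, ht1]; simp)) h3
    simpa using this
  | succ N ih =>
    obtain ⟨s, hs, h1⟩ := ih
    have h2 : (2 : L) ≠ 0 := two_ne F
    have h2' : (4 : L) ≠ 0 := by rw [show (4 : L) = 2 * 2 by norm_num]; exact mul_ne_zero h2 h2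
    have hc : ∀ m : ℕ, ((m : L)) ∈ v.U 0 := fun m =>
      v.alg_mem_U (by simpa using isAlgebraic_algebraMap (R := F) (A := L) (m : F))
    set ε := 1 - d * s ^ 2 with hε
    have h3 : ε ∈ v.U 0 := v.U_mono (by positivity) h1
    have h4 : (4 : L)⁻¹ ∈ v.U 0 := v.alg_mem_U (by
      have := isAlgebraic_algebraMap (R := F) (A := L) (4 : F)⁻¹
      rwa [map_inv₀, map_ofNat] at this)
    have e : 1 - d * (s * (2 + ε) / 2) ^ 2 = ((3 + ε) * 4⁻¹) * (ε * ε) := by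
      have : d * s ^ 2 = 1 - ε := by rw [hε]; ring
      have e2 : d * (s * (2 + ε) / 2) ^ 2 = (d * s ^ 2) * (2 + ε) ^ 2 / 4 := by
        field_simp; norm_num; ring
      rw [e2, this]; field_simp; ring
    refine ⟨s * (2 + ε) / 2, ?_, ?_⟩
    · refine div_ne_zero (mul_ne_zero hs ?_) h2
      intro h0
      rw [show ε = -2 by linear_combination h0] at h1
      rw [v.mem_U_iff (neg_ne_zero.2 h2), v.ord_neg, v.ord_of_alg (by have := isAlgebraic_algebraMap (R := F) (A := L) (2 : F); rwa [map_ofNat] at this)] at h1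
      omega
    · rw [e]
      refine v.U_zero_mul ?_ ?_
      · have := v.U_mul (Submodule.add_mem _ (hc 3) h3) h4
        simpa using this
      · exact v.U_mono (by push_cast; omega) (v.U_mul h1 h1)

end Place
end GFF
end PB7

section PC1
namespace GFF
set_option linter.unusedSectionVars false
set_option linter.unusedVariables false
set_option linter.unnecessarySimpa false
open IntermediateField Polynomial

section lies
variable {F K L : Type*} [Field F] [Field K] [Field L] [Algebra F K] [Algebra F L] [Finite F]
  [FF F K] [FF F L] [NeZero (2 : F)]

/-- `w` lies over `v` along `f`. -/
def Lies (f : K →+* L) (v : Place F K) (w : Place F L) : Prop := ∀ x, x ∈ v.U 0 ↔ f x ∈ w.U 0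

variable {f : K →+* L} {v : Place F K} {w : Place F L}

lemma Lies.unique {v' : Place F K} (h : Lies f v w) (h' : Lies f v' w) : v = v' :=
  Place.eq_of_O_le fun x hx => (h' x).2 ((h x).1 hx)

lemma Lies.ord_eq_zero (h : Lies f v w) {x : K} (hx : x ≠ 0) (h0 : v.ord x = 0) : w.ord (f x) = 0 := by
  have hfx : f x ≠ 0 := (map_ne_zero f).2 hx
  have h1 := (h x).1 (v.unit_mem h0)
  have h2 := (h x⁻¹).1 (v.unit_mem (by rw [v.ord_inv, h0, neg_zero]))
  rw [map_inv₀, w.mem_U_iff (inv_ne_zero hfx), w.ord_inv] at h2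
  rw [w.mem_U_iff hfx] at h1
  omega

lemma Lies.ord (h : Lies f v w) : ∃ e : ℤ, 0 < e ∧ ∀ x, w.ord (f x) = e * v.ord x := by
  refine ⟨w.ord (f v.π), ?_, fun x => ?_⟩
  · have hfx : f v.π ≠ 0 := (map_ne_zero f).2 v.π_ne
    have h1 : f (v.π)⁻¹ ∉ w.U 0 := by
      rw [← h, v.mem_U_iff (inv_ne_zero v.π_ne), v.ord_inv, v.ord_π]; omega
    rw [map_inv₀, w.mem_U_iff (inv_ne_zero hfx), w.ord_inv] at h1
    omega
  · by_cases hx : x = 0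
    · subst hx; rw [map_zero, w.ord_zero, v.ord_zero, mul_zero]
    have h1 := h.ord_eq_zero (v.un_ne hx) (v.ord_un hx)
    conv_lhs => rw [v.eq_un_mul x]
    rw [map_mul, map_zpow₀, w.ord_mul ((map_ne_zero f).2 (v.un_ne hx))
      (zpow_ne_zero _ ((map_ne_zero f).2 v.π_ne)), h1, w.ord_zpow]
    ring

lemma Lies.U_one (h : Lies f v w) {x : K} : x ∈ v.U 1 ↔ f x ∈ w.U 1 := by
  obtain ⟨e, he, h1⟩ := h.ord
  by_cases hx : x = 0
  · subst hx; simp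
  rw [v.mem_U_iff hx, w.mem_U_iff ((map_ne_zero f).2 hx), h1]
  constructor
  · intro h; nlinarith
  · intro h; by_contra hc
    nlinarith [show v.ord x ≤ 0 by omega]

lemma isSquare_res (v : Place F K) {x : K} (hx : x ∈ v.U 0) :
    IsSquare (v.res x) ↔ ∃ t ∈ v.U 0, x - t ^ 2 ∈ v.U 1 := by
  constructor
  · rintro ⟨y, hy⟩
    obtain ⟨t, ht, rfl⟩ := v.res_surj y
    refine ⟨t, ht, ?_⟩
    have : t ^ 2 ∈ v.U 0 := by rw [pow_two]; exact v.U_zero_mul ht ht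
    rw [← v.res_eq hx this, v.res_pow ht, hy, pow_two]
  · rintro ⟨t, ht, h⟩
    have h2 : t ^ 2 ∈ v.U 0 := by rw [pow_two]; exact v.U_zero_mul ht ht
    rw [← v.res_eq hx h2, v.res_pow ht] at h
    exact ⟨v.res t, by rw [h, pow_two]⟩

lemma Lies.rr_zero (h : Lies f v w) {x : K} (hx : x ≠ 0) (h0 : v.ord x = 0) (hr : v.rr x = 0) :
    w.rr (f x) = 0 := by
  rw [w.rr_unit (h.ord_eq_zero hx h0), qc_eq_zero, isSquare_res w (w.unit_mem (h.ord_eq_zero hx h0))]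
  rw [v.rr_unit h0, qc_eq_zero, isSquare_res v (v.unit_mem h0)] at hr
  obtain ⟨t, ht, h1⟩ := hr
  refine ⟨f t, (h t).1 ht, ?_⟩
  have := h.U_one.1 h1
  rwa [map_sub, map_pow] at this

lemma Lies.sy (h : Lies f v w) : ∃ e ρ R : ZMod 2, (∀ x, x ≠ 0 →
    w.sy.p (f x) = e * v.sy.p x ∧ w.sy.r (f x) = R * v.sy.p x + ρ * v.sy.r x) ∧
    w.sy.n = ρ * v.sy.n := by
  obtain ⟨e, he, h1⟩ := h.ord
  obtain ⟨u, hu, hu1, hu2⟩ := v.exists_rr 1 0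
  have hunit : ∀ x, x ≠ 0 → v.ord x = 0 → w.rr (f x) = w.rr (f u) * v.rr x := by
    intro x hx h0
    rcases z2_cases (v.rr x) with hr | hr
    · rw [h.rr_zero hx h0 hr, hr, mul_zero]
    · have := h.rr_zero (mul_ne_zero hx hu) (by rw [v.ord_mul hx hu, h0, hu1]; rfl)
        (by rw [v.rr_mul hx hu, hr, hu2]; rfl)
      rw [map_mul, w.rr_mul ((map_ne_zero f).2 hx) ((map_ne_zero f).2 hu)] at this
      rw [hr, mul_one]
      exact CharTwo.add_eq_zero.1 this
  have hz : ∀ n : ℤ, w.rr (f v.π ^ n) = w.rr (f v.π) * (n : ZMod 2) := by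
    intro n
    have hfx : f v.π ≠ 0 := (map_ne_zero f).2 v.π_ne
    have h1 : w.rr 1 = 0 := by rw [w.rr_unit w.ord_one, w.res_one, qc_one]
    induction n using Int.induction_on with
    | zero => simp [h1]
    | succ n ih =>
      rw [zpow_add_one₀ hfx, w.rr_mul (zpow_ne_zero _ hfx) hfx, ih]; push_cast; ring
    | pred n ih =>
      have : w.rr (f v.π ^ (-(n:ℤ) - 1)) + w.rr (f v.π) = w.rr (f v.π ^ (-(n:ℤ))) := by
        rw [← w.rr_mul (zpow_ne_zero _ hfx) hfx, zpow_sub_one₀ hfx, inv_mul_cancel_right₀ hfx]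
      rw [ih] at this
      rw [eq_sub_of_add_eq this]; push_cast; ring
  refine ⟨(e : ZMod 2), w.rr (f u), w.rr (f v.π), fun x hx => ⟨?_, ?_⟩, ?_⟩
  · rw [w.sy_p, v.sy_p, h1]; push_cast; ring
  · rw [w.sy_r, v.sy_r, v.sy_p]
    conv_lhs => rw [v.eq_un_mul x]
    rw [map_mul, map_zpow₀, w.rr_mul ((map_ne_zero f).2 (v.un_ne hx))
      (zpow_ne_zero _ ((map_ne_zero f).2 v.π_ne)), hz, hunit _ (v.un_ne hx) (v.ord_un hx),
      v.rr_unit (v.ord_un hx)]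
    unfold Place.rr; ring
  · rw [w.sy_n, v.sy_n, ← hunit (-1) (by simp) v.ord_neg_one, map_neg, map_one]

lemma Lies.h (h : Lies f v w) : ∃ t : ZMod 2, (∀ x y, x ≠ 0 → y ≠ 0 →
    w.sy.h (f x) (f y) = t * v.sy.h x y) ∧ (t ≠ 0 → ∀ x, x ≠ 0 → w.sy.Sq (f x) → v.sy.Sq x) := by
  obtain ⟨e, ρ, R, h1, h2⟩ := h.sy
  refine ⟨ρ * e, fun x y hx hy => ?_, fun ht x hx hs => ?_⟩
  · unfold LSym.h
    rw [(h1 x hx).1, (h1 x hx).2, (h1 y hy).1, (h1 y hy).2, h2]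
    generalize v.sy.n = n; generalize v.sy.p x = px; generalize v.sy.p y = py
    generalize v.sy.r x = rx; generalize v.sy.r y = ry
    have e1 : e * e = e := z2_mul_self e
    have e2 : (2 : ZMod 2) = 0 := rfl
    linear_combination (ρ * n * px * py) * e1 + (R * px * e * py) * e2
  · obtain ⟨he, hr⟩ : e = 1 ∧ ρ = 1 := by
      revert ht; generalize e = a; generalize ρ = b; revert a b; decide
    obtain ⟨a, b⟩ := h1 x hx
    obtain ⟨c, d⟩ := hs
    rw [c, he, one_mul] at a
    rw [d, ← a, hr] at b
    exact ⟨a.symm, by simpa using b.symm⟩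

lemma Lies.sq (h : Lies f v w) {x : K} (hx : x ≠ 0) (hs : v.sy.Sq x) : w.sy.Sq (f x) := by
  obtain ⟨e, ρ, R, h1, h2⟩ := h.sy
  obtain ⟨a, b⟩ := h1 x hx
  rw [hs.1] at a b; rw [hs.2] at b
  exact ⟨by rw [a, mul_zero], by rw [b]; simp⟩

lemma exists_under (w : Place F L) (hf : f.IsIntegral) : ∃ v : Place F K, Lies f v w := by
  have hA : w.O.comap f ≠ ⊤ := by
    intro hA
    apply w.O_ne_top
    rw [eq_top_iff]
    intro y _
    have hle : ∀ x : K, f x ∈ w.O := by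
      intro x
      have : x ∈ w.O.comap f := by rw [hA]; trivial
      exact this
    obtain ⟨p, hp, hpy⟩ := hf y
    have hintg : IsIntegral w.O y := by
      let g : K →+* w.O := f.codRestrict w.O.toSubring hle
      refine ⟨p.map g, hp.map g, ?_⟩
      rw [eval₂_map]
      exact hpy
    obtain ⟨z, hz⟩ := IsIntegrallyClosed.isIntegral_iff.1 hintg
    rw [← hz]; exact z.2
  obtain ⟨v, hv⟩ := Place.exists_of_O (F := F) _ hA
  refine ⟨v, fun x => ?_⟩
  rw [← v.mem_O, hv]; exact Iff.rfl

lemma exists_over (f : K →+* L) (v : Place F K) : ∃ w : Place F L, Lies f v w := by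
  let A : Subring L := v.O.toSubring.map f
  have hπA : f v.π ∈ A := ⟨v.π, v.mem_U_of_le (by rw [v.ord_π]; omega), rfl⟩
  let I : Ideal A := Ideal.span {⟨f v.π, hπA⟩}
  have hI : I ≠ ⊤ := by
    rw [Ne, Ideal.eq_top_iff_one, Ideal.mem_span_singleton']
    rintro ⟨⟨_, a, ha, rfl⟩, h⟩
    have h1 : f a * f v.π = 1 := congrArg Subtype.val h
    rw [← map_mul] at h1
    have h2 : a * v.π = 1 := f.injective (by rw [h1, map_one])
    have ha0 : a ≠ 0 := by rintro rfl; simp at h2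
    have h3 := v.ord_mul ha0 v.π_ne
    rw [h2, v.ord_one, v.ord_π] at h3
    have h4 : 0 ≤ v.ord a := (v.mem_U_iff ha0).1 ha
    omega
  obtain ⟨B, hB1, hB2⟩ := Ideal.image_subset_nonunits_valuationSubring I hI
  have hπB : f v.π ∈ B.nonunits := hB2 ⟨⟨f v.π, hπA⟩, Ideal.subset_span rfl, rfl⟩
  have hinv : f (v.π)⁻¹ ∉ B := by
    intro h
    rw [ValuationSubring.mem_nonunits_iff_exists_mem_maximalIdeal] at hπB
    obtain ⟨h1, h2⟩ := hπB
    rw [IsLocalRing.mem_maximalIdeal, mem_nonunits_iff] at h2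
    apply h2
    refine IsUnit.of_mul_eq_one ⟨f (v.π)⁻¹, h⟩ (Subtype.ext ?_)
    change f v.π * f (v.π)⁻¹ = 1
    rw [← map_mul, mul_inv_cancel₀ v.π_ne, map_one]
  have hBt : B ≠ ⊤ := fun h => hinv (by rw [h]; trivial)
  have hct : B.comap f ≠ ⊤ := fun h => hinv (by
    have : (v.π)⁻¹ ∈ B.comap f := by rw [h]; trivial
    exact this)
  obtain ⟨w, hw⟩ := Place.exists_of_O (F := F) B hBt
  obtain ⟨u, hu⟩ := Place.exists_of_O (F := F) _ hct
  have huv : v = u := Place.eq_of_O_le (by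
    rw [hu]
    intro x hx
    exact hB1 ⟨x, hx, rfl⟩)
  refine ⟨w, fun x => ?_⟩
  rw [← v.mem_O, huv, hu, ← w.mem_O, hw]; exact Iff.rfl

/-- transport of a place along an automorphism -/
def Place.conj (w : Place F L) (σ : L ≃+* L) : Place F L where
  ord x := w.ord (σ x)
  ord_zero := by rw [map_zero, w.ord_zero]
  ord_mul hx hy := by
    rw [map_mul, w.ord_mul ((map_ne_zero_iff σ σ.injective).2 hx) ((map_ne_zero_iff σ σ.injective).2 hy)]
  ord_add hx hy hxy := by
    have := w.ord_add ((map_ne_zero_iff σ σ.injective).2 hx) ((map_ne_zero_iff σ σ.injective).2 hy)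
      (by rw [← map_add]; exact (map_ne_zero_iff σ σ.injective).2 hxy)
    rwa [← map_add] at this
  exists_unif := by
    obtain ⟨x, hx, h⟩ := w.exists_unif
    refine ⟨σ.symm x, (map_ne_zero_iff σ.symm σ.symm.injective).2 hx, by simpa using h⟩

lemma Place.conj_ord (w : Place F L) (σ : L ≃+* L) (x : L) : (w.conj σ).ord x = w.ord (σ x) := rfl

lemma Place.conj_mem (w : Place F L) (σ : L ≃+* L) (x : L) (n : ℤ) :
    x ∈ (w.conj σ).U n ↔ σ x ∈ w.U n := by
  rw [Place.mem_U, Place.mem_U, w.conj_ord, map_eq_zero_iff σ σ.injective]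

lemma lies_conj (w : Place F L) (σ : L ≃+* L) : Lies (σ : L →+* L) (w.conj σ) w :=
  fun x => w.conj_mem σ x 0

lemma h_conj (w : Place F L) (σ : L ≃+* L) {x y : L} (hx : x ≠ 0) (hy : y ≠ 0) :
    (w.conj σ).sy.h x y = w.sy.h (σ x) (σ y) := by
  obtain ⟨t, h1, -⟩ := (lies_conj w σ).h
  have h2 : Lies (σ.symm : L →+* L) w (w.conj σ) := by
    intro x; rw [w.conj_mem]; simp
  obtain ⟨t', h3, -⟩ := h2.h
  have e1 := h1 x y hx hy
  have e2 := h3 (σ x) (σ y) ((map_ne_zero_iff σ σ.injective).2 hx) ((map_ne_zero_iff σ σ.injective).2 hy)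
  simp only [RingEquiv.coe_toRingHom, RingEquiv.symm_apply_apply] at e1 e2
  revert e1 e2
  generalize (w.conj σ).sy.h x y = A; generalize w.sy.h (σ x) (σ y) = B
  clear h1 h3
  revert A B t t'
  decide

end lies
end GFF
end PC1

section PC2
namespace GFF
set_option linter.unusedSectionVars false
set_option linter.unusedVariables false
set_option linter.unnecessarySimpa false
open IntermediateField Polynomial

section const
variable {F K : Type*} [Field F] [Field K] [Algebra F K] [Finite F] [FF F K] [NeZero (2 : F)]

lemma card_κ (v : Place F K) : Nat.card v.κ = Nat.card F ^ v.δ :=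
  Module.natCard_eq_pow_finrank (K := F)

lemma pow_card_inj {a b : ℕ} (h : Nat.card F ^ a = Nat.card F ^ b) : a = b :=
  Nat.pow_right_injective (Finite.one_lt_card (α := F)) h

variable (F K) in
/-- degree of the constant field -/
noncomputable def cdeg : ℕ := ell (0 : Dv F K)

variable (F K) in
lemma cdeg_pos : 0 < cdeg F K := ell_zero_pos

variable (F K) in
/-- constants -/
noncomputable abbrev Cst : IntermediateField F K := algebraicClosure F K

lemma mem_Cst {x : K} : x ∈ Cst F K ↔ IsAlgebraic F x := mem_algebraicClosure_iff

lemma card_Cst : Nat.card (Cst F K) = Nat.card F ^ cdeg F K := by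
  unfold cdeg ell
  rw [← Module.natCard_eq_pow_finrank (K := F)]
  exact Nat.card_congr (Equiv.subtypeEquivRight fun x => by rw [mem_Cst, mem_LD_zero])

instance : Finite (Cst F K) := Nat.finite_of_card_ne_zero (by
  rw [card_Cst]; exact pow_ne_zero _ (Nat.card_pos.ne'))

instance : NeZero (2 : Cst F K) := ⟨two_ne F⟩

/-- residue of constants -/
noncomputable def Place.cres (v : Place F K) : Cst F K →+* v.κ where
  toFun x := v.res x
  map_one' := v.res_one
  map_zero' := (v.res_eq_zero (Submodule.zero_mem _)).2 (Submodule.zero_mem _)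
  map_add' x y := v.res_add (v.alg_mem_U (mem_Cst.1 x.2)) (v.alg_mem_U (mem_Cst.1 y.2))
  map_mul' x y := v.res_mul (v.alg_mem_U (mem_Cst.1 x.2)) (v.alg_mem_U (mem_Cst.1 y.2))

lemma neg_one_pow_card {k : Type*} [Field k] [Finite k] [NeZero (2 : k)] {y : k} (hy : y ≠ 0) :
    (qc y = 0 ↔ y ^ (Nat.card k / 2) = 1) ∧ (qc y = 1 ↔ y ^ (Nat.card k / 2) = -1) := by
  have : Fintype k := Fintype.ofFinite k
  have h2 : ringChar k ≠ 2 := ringChar_ne_two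
  have hne : (1 : k) ≠ -1 := by
    intro h
    have : (2 : k) = 0 := by linear_combination h
    exact NeZero.ne _ this
  have h1 := FiniteField.isSquare_iff h2 hy
  have h3 := FiniteField.pow_dichotomy h2 hy
  rw [← Nat.card_eq_fintype_card] at h1 h3
  have h4 : qc y = 0 ↔ y ^ (Nat.card k / 2) = 1 := by rw [qc_eq_zero, h1]
  refine ⟨h4, ?_⟩
  constructor
  · intro h
    refine h3.resolve_left fun h5 => ?_
    rw [h4.2 h5] at h; exact absurd h (by decide)
  · intro h
    refine (z2_cases _).resolve_left fun h5 => ?_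
    exact hne ((h4.1 h5).symm.trans h)

lemma exists_kv (v : Place F K) : ∃ k : ℕ, v.δ = cdeg F K * k ∧
    ∀ c ∈ Cst F K, ¬ IsSquare c → v.sy.r c = k := by
  let _ := v.cres.toAlgebra
  have h1 := Module.natCard_eq_pow_finrank (K := Cst F K) (V := v.κ)
  set k := Module.finrank (Cst F K) v.κ with hk
  have h2 := h1
  rw [card_κ, card_Cst, ← pow_mul] at h1
  refine ⟨k, pow_card_inj h1, fun c hc hns => ?_⟩
  set Q := Nat.card (Cst F K)
  have hc0 : (⟨c, hc⟩ : Cst F K) ≠ 0 := by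
    intro h
    have : c = 0 := congrArg Subtype.val h
    exact hns (this ▸ IsSquare.zero)
  have hcK : c ≠ 0 := fun h => hns (h ▸ IsSquare.zero)
  have h3 : qc (⟨c, hc⟩ : Cst F K) = 1 := by
    refine (z2_cases _).resolve_left fun h => ?_
    obtain ⟨y, hy⟩ := qc_eq_zero.1 h
    exact hns ⟨y, congrArg Subtype.val hy⟩
  have h4 := (neg_one_pow_card hc0).2.1 h3
  have h5 : v.res c ^ (Q / 2) = -1 := by
    have := congrArg v.cres h4
    rwa [map_pow, map_neg, map_one] at this
  have hodd : Q % 2 = 1 := by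
    have : Fintype (Cst F K) := Fintype.ofFinite _
    have := FiniteField.odd_card_of_char_ne_two (F := Cst F K) ringChar_ne_two
    rwa [← Nat.card_eq_fintype_card] at this
  obtain ⟨m, hm⟩ : ∃ m, Q = 2 * m + 1 := ⟨Q / 2, by omega⟩
  -- parity of the exponent
  have h6 : ∃ j, Q ^ k / 2 = (Q / 2) * j ∧ (j : ZMod 2) = k := by
    refine ⟨∑ i ∈ Finset.range k, Q ^ i, ?_, ?_⟩
    · have := Nat.geomSum_eq (m := Q) (by have : 1 < Q := Finite.one_lt_card; omega) k
      have h7 : (∑ i ∈ Finset.range k, Q ^ i) * (Q - 1) = Q ^ k - 1 := by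
        have := Nat.geomSum_eq (m := Q) (by have : 1 < Q := Finite.one_lt_card; omega) k
        rw [this]
        exact Nat.div_mul_cancel (by simpa using Nat.sub_dvd_pow_sub_pow Q 1 k)
      have h8 : Q - 1 = 2 * m := by omega
      have h9 : Q / 2 = m := by omega
      have h10 : Q ^ k % 2 = 1 := by rw [Nat.pow_mod, hodd]; simp
      rw [h8] at h7
      rw [h9]
      generalize (∑ i ∈ Finset.range k, Q ^ i) = j at *
      have : j * (2 * m) = 2 * (m * j) := by ring
      omega
    · have hQ2 : (Q : ZMod 2) = 1 := by rw [hm]; push_cast; rw [show (2 : ZMod 2) = 0 from rfl]; simp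
      push_cast; simp [hQ2]
  obtain ⟨j, hj1, hj2⟩ := h6
  have ho : v.ord c = 0 := v.ord_of_alg (mem_Cst.1 hc)
  have hres := v.res_ne_zero hcK ho
  have h7 := neg_one_pow_card hres
  rw [h2, hj1, pow_mul, h5] at h7
  rw [v.sy_r, v.rr_unit ho, ← hj2]
  rcases Nat.even_or_odd j with he | he
  · rw [h7.1.2 he.neg_one_pow]
    obtain ⟨i, rfl⟩ := he
    push_cast; exact (z2_add_self _).symm
  · rw [h7.2.2 he.neg_one_pow]
    obtain ⟨i, rfl⟩ := he
    push_cast; rw [show (2 : ZMod 2) = 0 from rfl]; simp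

variable (F K) in
lemma exists_c : ∃ c ∈ Cst F K, ¬ IsSquare c := by
  obtain ⟨c, hc⟩ := FiniteField.exists_nonsquare (F := Cst F K) ringChar_ne_two
  refine ⟨c, c.2, ?_⟩
  rintro ⟨y, hy⟩
  apply hc
  have : IsAlgebraic F y := by
    have h1 := mem_Cst.1 c.2
    rw [hy, ← pow_two] at h1
    exact h1.of_pow two_pos
  exact ⟨⟨y, mem_Cst.2 this⟩, Subtype.ext hy⟩

lemma c_ne {c : K} (hns : ¬ IsSquare c) : c ≠ 0 := fun h => hns (h ▸ IsSquare.zero)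

lemma c_ord {c : K} (hc : c ∈ Cst F K) (v : Place F K) : v.ord c = 0 := v.ord_of_alg (mem_Cst.1 hc)

lemma c_p {c : K} (hc : c ∈ Cst F K) (v : Place F K) : v.sy.p c = 0 := by
  rw [v.sy_p, c_ord hc]; rfl

lemma c_h {c : K} (hc : c ∈ Cst F K) (v : Place F K) (f : K) : v.sy.h c f = v.sy.r c * v.sy.p f := by
  unfold LSym.h; rw [c_p hc]; ring

lemma c_sq {c : K} (hc : c ∈ Cst F K) (v : Place F K) : v.sy.Sq c ↔ v.sy.r c = 0 := by
  unfold LSym.Sq; rw [c_p hc]; simp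

/-- parity: degree of divisors mod 2 -/
lemma exists_par {c : K} (hc : c ∈ Cst F K) (hns : ¬ IsSquare c) (D : Dv F K) :
    ∃ m : ℤ, ddeg D = cdeg F K * m ∧ (m : ZMod 2) = D.sum fun v n => (n : ZMod 2) * v.sy.r c := by
  choose k hk1 hk2 using exists_kv (F := F) (K := K)
  refine ⟨D.sum fun v n => n * k v, ?_, ?_⟩
  · rw [ddeg_eq, Finsupp.sum, Finsupp.sum, Finset.mul_sum]
    refine Finset.sum_congr rfl fun v _ => ?_
    rw [hk1]; push_cast; ring
  · rw [Finsupp.sum, Finsupp.sum]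
    push_cast
    refine Finset.sum_congr rfl fun v _ => ?_
    rw [hk2 v c hc hns]

/-- N0 -/
lemma sum_h_c {c : K} (hc : c ∈ Cst F K) (hns : ¬ IsSquare c) (f : K) :
    ((dv F f).sum fun v n => (n : ZMod 2) * v.sy.r c) = 0 := by
  obtain ⟨m, h1, h2⟩ := exists_par hc hns (dv F f)
  rw [ddeg_dv] at h1
  have : m = 0 := by
    have := cdeg_pos F K
    rcases mul_eq_zero.1 h1.symm with h | h
    · omega
    · exact h
  rw [← h2, this]; rfl

end const
end GFF
end PC2

section PC3
namespace GFF
set_option linter.unusedSectionVars false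
set_option linter.unusedVariables false
set_option linter.unnecessarySimpa false
open IntermediateField Polynomial

/-- A quadratic extension `L = K(s)`, `s ^ 2 = d`, with its conjugation. -/
structure QE (K L : Type*) [Field K] [Field L] (d : K) where
  f : K →+* L
  s : L
  hs : s ^ 2 = f d
  gen : ∀ z, ∃ x y, z = f x + f y * s
  ind : ∀ x y, f x + f y * s = 0 → x = 0 ∧ y = 0
  σ : L ≃+* L
  σf : ∀ x, σ (f x) = f x
  σs : σ s = -s

namespace QE
section basic
variable {K L : Type*} [Field K] [Field L] {d : K} (q : QE K L d)

lemma exists_N (z : L) : ∃ n, q.f n = z * q.σ z := by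
  obtain ⟨x, y, rfl⟩ := q.gen z
  refine ⟨x ^ 2 - d * y ^ 2, ?_⟩
  simp only [map_sub, map_mul, map_pow, map_add, q.σf, q.σs]
  linear_combination (q.f y ^ 2) * q.hs

/-- the norm -/
noncomputable def N (z : L) : K := (q.exists_N z).choose
lemma f_N (z : L) : q.f (q.N z) = z * q.σ z := (q.exists_N z).choose_spec

lemma N_eq (x y : K) : q.N (q.f x + q.f y * q.s) = x ^ 2 - d * y ^ 2 := by
  apply q.f.injective
  rw [q.f_N]
  simp only [map_sub, map_mul, map_pow, map_add, q.σf, q.σs]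
  linear_combination -(q.f y ^ 2) * q.hs

lemma N_mul (x y : L) : q.N (x * y) = q.N x * q.N y := by
  apply q.f.injective
  rw [map_mul, q.f_N, q.f_N, q.f_N, map_mul]; ring

lemma N_ne {x : L} (hx : x ≠ 0) : q.N x ≠ 0 := by
  intro h
  have := q.f_N x
  rw [h, map_zero] at this
  rcases mul_eq_zero.1 this.symm with h | h
  · exact hx h
  · exact hx ((map_eq_zero q.σ).1 h)

lemma f_ne {x : K} (hx : x ≠ 0) : q.f x ≠ 0 := (map_ne_zero q.f).2 hx

lemma N_f (x : K) : q.N (q.f x) = x ^ 2 := by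
  apply q.f.injective
  rw [q.f_N, q.σf, map_pow, pow_two]

lemma σσ (z : L) : q.σ (q.σ z) = z := by
  obtain ⟨x, y, rfl⟩ := q.gen z
  simp only [map_add, map_mul, q.σf, q.σs, map_neg, neg_neg]

lemma σ_ne {z : L} (h : z ≠ 0) : q.σ z ≠ 0 := (map_ne_zero q.σ).2 h

lemma d_ne (q : QE K L d) : d ≠ 0 := by
  intro h0
  have h := q.hs.trans (congrArg q.f h0)
  rw [map_zero] at h
  have h2 := (q.ind 0 1 (by simpa using (pow_eq_zero_iff two_ne_zero).1 h)).2
  exact one_ne_zero h2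

lemma s_ne : q.s ≠ 0 := by
  intro h
  have := q.hs
  rw [h, zero_pow two_ne_zero] at this
  exact q.d_ne ((map_eq_zero q.f).1 this.symm)

lemma not_sq (q : QE K L d) : ¬ IsSquare d := by
  rintro ⟨x, hx⟩
  have : (q.s - q.f x) * (q.s + q.f x) = 0 := by
    have h1 := q.hs.trans (congrArg q.f hx)
    rw [map_mul] at h1
    linear_combination h1
  rcases mul_eq_zero.1 this with h | h
  · exact one_ne_zero (q.ind (-x) 1 (by rw [map_neg, map_one]; linear_combination h)).2
  · exact one_ne_zero (q.ind x 1 (by rw [map_one]; linear_combination h)).2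

lemma integral : q.f.IsIntegral := by
  intro z
  obtain ⟨x, y, rfl⟩ := q.gen z
  refine ⟨X ^ 2 + (C (-2 * x) * X + C (x ^ 2 - d * y ^ 2)), ?_, ?_⟩
  · refine monic_X_pow_add ?_
    calc _ ≤ (1 : WithBot ℕ) := by compute_degree
      _ < _ := by norm_num
  · simp only [eval₂_add, eval₂_mul, eval₂_pow, eval₂_X, eval₂_C]
    rw [map_mul, map_sub, map_mul, map_pow, map_pow, map_neg, map_ofNat]
    linear_combination (q.f y ^ 2) * q.hs

end basic

section loc
variable {F K L : Type*} [Field F] [Field K] [Field L] [Algebra F K] [Algebra F L] [Finite F]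
  [FF F K] [FF F L] [NeZero (2 : F)] {d : K} (q : QE K L d) {v : Place F K} {w : Place F L}

lemma lies_conj (h : Lies q.f v w) : Lies q.f v (w.conj q.σ) := by
  intro x
  rw [w.conj_mem, q.σf]; exact h x

lemma conj_conj (w : Place F L) : (w.conj q.σ).conj q.σ = w := by
  apply Place.eq_of_O_le
  intro x hx
  rw [Place.mem_O, Place.conj_mem, Place.conj_mem, q.σσ] at hx
  exact hx

lemma over_eq (h : Lies q.f v w) {w' : Place F L} (h' : Lies q.f v w') : w' = w ∨ w' = w.conj q.σ := by
  classical
  by_contra hc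
  push Not at hc
  obtain ⟨h1, h2⟩ := hc
  have h3 : w'.conj q.σ ≠ w.conj q.σ := by
    intro e; apply h1; rw [← q.conj_conj w', e, q.conj_conj]
  have h4 : w'.conj q.σ ≠ w := by
    intro e; apply h2; rw [← e, q.conj_conj]
  obtain ⟨z, hz⟩ := Place.weak_approx {w, w.conj q.σ, w', w'.conj q.σ}
    (fun u => if u = w ∨ u = w.conj q.σ then 1 else 0) 1
  have a1 := hz w (by simp)
  have a2 := hz (w.conj q.σ) (by simp)
  have a3 := hz w' (by simp)
  have a4 := hz (w'.conj q.σ) (by simp)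
  simp only [true_or, or_true, if_true, h1, h2, h3, h4, or_self, if_false, sub_zero] at a1 a2 a3 a4
  rw [Place.conj_mem, map_sub, map_one] at a2
  rw [Place.conj_mem] at a4
  have one : ∀ u : Place F L, ∀ y : L, y - 1 ∈ u.U 1 → y ≠ 0 ∧ u.ord y = 0 := by
    intro u y hy
    have := u.ord_eq_of_sub (x := 1) (y := y) one_ne_zero (by rw [u.ord_one, zero_add]; exact hy)
    rw [u.ord_one] at this
    exact this
  obtain ⟨b1, b2⟩ := one w z a1
  obtain ⟨b3, b4⟩ := one w _ a2
  have e1 : w.ord (q.f (q.N z)) = 0 := by rw [q.f_N, w.ord_mul b1 b3, b2, b4]; rfl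
  have e2 : q.f (q.N z) ∈ w'.U (1 + 1) := by rw [q.f_N]; exact w'.U_mul a3 a4
  rw [w'.mem_U_iff (q.f_ne (q.N_ne b1))] at e2
  obtain ⟨e, he, h5⟩ := h.ord
  obtain ⟨e', he', h6⟩ := h'.ord
  rw [h5] at e1
  rw [h6] at e2
  have : v.ord (q.N z) = 0 := by
    rcases mul_eq_zero.1 e1 with h | h
    · omega
    · exact h
  rw [this] at e2; omega

lemma two_ord (w : Place F L) : w.ord (2 : L) = 0 := by
  have : (2 : L) = algebraMap F L 2 := by rw [map_ofNat]
  rw [this]; exact w.ord_of_alg (isAlgebraic_algebraMap _)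

/-- split places: approximation of `s` -/
lemma split_s (h : Lies q.f v w) (hd : v.sy.Sq d) (N : ℕ) : ∃ t : K, q.s - q.f t ∈ w.U N := by
  obtain ⟨e, he, ho⟩ := h.ord
  obtain ⟨M, hM⟩ : ∃ M : ℕ, (N : ℤ) ≤ M + w.ord q.s := ⟨(N - w.ord q.s).toNat, by omega⟩
  obtain ⟨t, ht, h1⟩ := v.newton q.d_ne hd M
  have h2 : q.f (1 - d * t ^ 2) ∈ w.U (M + 1) := by
    by_cases h0 : 1 - d * t ^ 2 = 0
    · rw [h0, map_zero]; exact Submodule.zero_mem _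
    · rw [w.mem_U_iff (q.f_ne h0), ho]
      rw [v.mem_U_iff h0] at h1
      nlinarith
  have key : ∃ t : K, t ≠ 0 ∧ 1 - q.s * q.f t ∈ w.U (M + 1) := by
    have e1 : q.f (1 - d * t ^ 2) = (1 - q.s * q.f t) * (1 + q.s * q.f t) := by
      rw [map_sub, map_one, map_mul, map_pow]; linear_combination (q.f t ^ 2) * q.hs
    rw [e1] at h2
    by_cases h3 : 1 - q.s * q.f t ∈ w.U (M + 1)
    · exact ⟨t, ht, h3⟩
    by_cases h4 : 1 + q.s * q.f t ∈ w.U (M + 1)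
    · exact ⟨-t, neg_ne_zero.2 ht, by rw [map_neg]; simpa using h4⟩
    exfalso
    have n3 := w.ne_zero_of_notMem h3
    have n4 := w.ne_zero_of_notMem h4
    rw [w.mem_U_iff (mul_ne_zero n3 n4), w.ord_mul n3 n4] at h2
    rw [w.mem_U_iff n3] at h3
    rw [w.mem_U_iff n4] at h4
    have h5 : (1 - q.s * q.f t) ∈ w.U 1 := w.mem_U_of_le (by omega)
    have h6 : (1 + q.s * q.f t) ∈ w.U 1 := w.mem_U_of_le (by omega)
    have h7 := Submodule.add_mem _ h5 h6
    rw [show (1 - q.s * q.f t) + (1 + q.s * q.f t) = 2 by ring, w.mem_U_iff (two_ne F), two_ord] at h7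
    omega
  obtain ⟨t, ht, h3⟩ := key
  refine ⟨t⁻¹, ?_⟩
  have hft := q.f_ne ht
  have h4 := w.ord_eq_of_sub (x := 1) (y := q.s * q.f t) one_ne_zero (by
    rw [w.ord_one, zero_add, ← Submodule.neg_mem_iff, neg_sub]; exact w.U_mono (by omega) h3)
  rw [w.ord_mul q.s_ne hft, w.ord_one] at h4
  have e1 : q.s - q.f t⁻¹ = -((q.f t)⁻¹ * (1 - q.s * q.f t)) := by
    rw [map_inv₀]; field_simp; ring
  rw [e1, Submodule.neg_mem_iff]
  refine w.U_mono ?_ (w.U_mul (w.mem_U_ord _) h3)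
  rw [w.ord_inv]; omega

lemma split_approx (h : Lies q.f v w) (hd : v.sy.Sq d) (N : ℕ) (z : L) : ∃ y : K, z - q.f y ∈ w.U N := by
  obtain ⟨x, y, rfl⟩ := q.gen z
  obtain ⟨t, ht⟩ := q.split_s h hd ((N - w.ord (q.f y)).toNat)
  refine ⟨x + y * t, ?_⟩
  have : q.f x + q.f y * q.s - q.f (x + y * t) = q.f y * (q.s - q.f t) := by
    rw [map_add, map_mul]; ring
  rw [this]
  refine w.U_mono ?_ (w.U_mul (w.mem_U_ord _) ht)
  omega

lemma split_ne (h : Lies q.f v w) (hd : v.sy.Sq d) : w.conj q.σ ≠ w := by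
  intro e
  obtain ⟨t, ht⟩ := q.split_s h hd ((w.ord q.s + 1).toNat)
  have h2 : q.σ (q.s - q.f t) ∈ w.U ((w.ord q.s + 1).toNat) := by
    rw [← w.conj_mem, e]; exact ht
  rw [map_sub, q.σs, q.σf] at h2
  have h3 := Submodule.sub_mem _ ht h2
  rw [show q.s - q.f t - (-q.s - q.f t) = 2 * q.s by ring,
    w.mem_U_iff (mul_ne_zero (two_ne F) q.s_ne), w.ord_mul (two_ne F) q.s_ne, two_ord] at h3
  omega

lemma split_ord (h : Lies q.f v w) (hd : v.sy.Sq d) (x : K) : w.ord (q.f x) = v.ord x := by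
  obtain ⟨e, he, ho⟩ := h.ord
  obtain ⟨z, hz, hz1⟩ := w.exists_ord 1
  obtain ⟨y, hy⟩ := q.split_approx h hd 2 z
  have h4 := w.ord_eq_of_sub (x := z) (y := q.f y) hz (by
    rw [hz1, ← Submodule.neg_mem_iff, neg_sub]; exact hy)
  rw [ho, hz1] at h4
  have : e = 1 := Int.eq_one_of_mul_eq_one_right he.le h4.2
  rw [ho, this, one_mul]

lemma split_h (h : Lies q.f v w) (hd : v.sy.Sq d) {x y : K} (hx : x ≠ 0) (hy : y ≠ 0) :
    w.sy.h (q.f x) (q.f y) = v.sy.h x y := by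
  obtain ⟨t, ht, -⟩ := h.h
  obtain ⟨a, ha, ha1, ha2⟩ := w.exists_rr 1 0
  have hna : ¬ w.sy.Sq a := by
    rintro ⟨-, h2⟩; rw [w.sy_r, ha2] at h2; exact one_ne_zero h2
  obtain ⟨b, hb, hab⟩ := w.exists_h hna
  have app : ∀ z : L, z ≠ 0 → ∃ y : K, y ≠ 0 ∧ w.sy.p (q.f y) = w.sy.p z ∧ w.sy.r (q.f y) = w.sy.r z := by
    intro z hz
    obtain ⟨y, hy⟩ := q.split_approx h hd ((w.ord z + 1).toNat) z
    obtain ⟨h1, h2, h3⟩ := w.rr_close (x := z) (y := q.f y) hz (by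
      rw [← Submodule.neg_mem_iff, neg_sub]; exact w.U_mono (by omega) hy)
    refine ⟨y, fun h0 => h1 (by rw [h0, map_zero]), ?_, h3⟩
    rw [w.sy_p, w.sy_p, h2]
  obtain ⟨a', ha', ea1, ea2⟩ := app a ha
  obtain ⟨b', hb', eb1, eb2⟩ := app b hb
  have h1 : w.sy.h (q.f a') (q.f b') = 1 := by
    rw [← hab]; unfold LSym.h; rw [ea1, ea2, eb1, eb2]
  rw [ht a' b' ha' hb'] at h1
  rw [ht x y hx hy]
  rcases z2_cases t with h | h
  · rw [h, zero_mul] at h1; exact absurd h1 zero_ne_one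
  · rw [h, one_mul]

lemma split_δ (h : Lies q.f v w) (hd : v.sy.Sq d) : w.δ = v.δ := by
  apply pow_card_inj (F := F)
  rw [← card_κ, ← card_κ]
  choose l hl hl2 using v.res_surj
  refine (Nat.card_congr (Equiv.ofBijective (fun y => w.res (q.f (l y))) ⟨?_, ?_⟩)).symm
  · intro a b hab
    simp only at hab
    rw [w.res_eq ((h _).1 (hl a)) ((h _).1 (hl b)), ← map_sub, ← h.U_one, ← v.res_eq (hl a) (hl b), hl2, hl2] at hab
    exact hab
  · intro z
    obtain ⟨x, hx, rfl⟩ := w.res_surj z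
    obtain ⟨y, hy⟩ := q.split_approx h hd 1 x
    have hy0 : y ∈ v.U 0 := by
      rw [h]
      have := Submodule.sub_mem _ hx (w.U_mono (by norm_num) hy : _ ∈ w.U 0)
      rwa [sub_sub_cancel] at this
    refine ⟨v.res y, ?_⟩
    simp only
    have h1 : l (v.res y) - y ∈ v.U 1 := by rw [← v.res_eq (hl _) hy0, hl2]
    rw [h.U_one, map_sub] at h1
    rw [w.res_eq ((h _).1 (hl _)) hx]
    have := Submodule.sub_mem _ h1 hy
    convert this using 1; ring

end loc
end QE
end GFF
end PC3

section PC4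
namespace GFF
set_option linter.unusedSectionVars false
set_option linter.unusedVariables false
set_option linter.unnecessarySimpa false
open IntermediateField Polynomial

lemma exists_norm_val {k : Type*} [Field k] [Finite k] [NeZero (2 : k)] {c : k} (hc : c ≠ 0) (y : k) :
    ∃ a b : k, a ^ 2 - c * b ^ 2 = y := by
  have := Fintype.ofFinite k
  have h2 : (X ^ 2 - C y : k[X]).degree = 2 := by
    rw [degree_X_pow_sub_C (by norm_num)]; rfl
  have h3 : (C (-c) * X ^ 2 : k[X]).degree = 2 := by
    rw [degree_C_mul_X_pow _ (neg_ne_zero.2 hc)]; rfl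
  obtain ⟨a, b, h⟩ := FiniteField.exists_root_sum_quadratic h2 h3
    (FiniteField.odd_card_of_char_ne_two ringChar_ne_two)
  refine ⟨a, b, ?_⟩
  simp at h
  linear_combination h

namespace QE
section inert
variable {F K L : Type*} [Field F] [Field K] [Field L] [Algebra F K] [Algebra F L] [Finite F]
  [FF F K] [FF F L] [NeZero (2 : F)] {d : K} (q : QE K L d) {v : Place F K} {w : Place F L}

lemma inert_N (ho : v.ord d = 0) (hr : v.rr d = 1) {a b : K} (ha : a ∈ v.U 0) (hb : b ∈ v.U 0)
    (hab : a ∉ v.U 1 ∨ b ∉ v.U 1) : a ^ 2 - d * b ^ 2 ∉ v.U 1 := by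
  intro h
  have hd : d ∈ v.U 0 := v.unit_mem ho
  have ha2 : a ^ 2 ∈ v.U 0 := by rw [pow_two]; exact v.U_zero_mul ha ha
  have hb2 : b ^ 2 ∈ v.U 0 := by rw [pow_two]; exact v.U_zero_mul hb hb
  rw [← v.res_eq ha2 (v.U_zero_mul hd hb2), v.res_mul hd hb2, v.res_pow ha, v.res_pow hb] at h
  rw [v.rr_unit ho] at hr
  by_cases hb1 : b ∈ v.U 1
  · rw [(v.res_eq_zero hb).2 hb1] at h
    have : v.res a = 0 := by
      rw [← pow_eq_zero_iff two_ne_zero, h]; ring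
    rcases hab with h | h
    · exact h ((v.res_eq_zero ha).1 this)
    · exact h hb1
  · have hb3 : v.res b ≠ 0 := fun h => hb1 ((v.res_eq_zero hb).1 h)
    have : IsSquare (v.res d) := by
      refine ⟨v.res a / v.res b, ?_⟩
      field_simp; rw [h, mul_comm]
    rw [qc_eq_zero.2 this] at hr
    exact zero_ne_one hr

lemma s_ord (h : Lies q.f v w) (ho : v.ord d = 0) : w.ord q.s = 0 := by
  have := h.ord_eq_zero q.d_ne ho
  rw [← q.hs, w.ord_pow] at this
  push_cast at this; omega

lemma inert_unit (h : Lies q.f v w) (ho : v.ord d = 0) (hr : v.rr d = 1) {a b : K} (ha : a ∈ v.U 0)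
    (hb : b ∈ v.U 0) (hab : a ∉ v.U 1 ∨ b ∉ v.U 1) : w.ord (q.f a + q.f b * q.s) = 0 := by
  have h1 := inert_N ho hr ha hb hab
  have hs := w.unit_mem (q.s_ord h ho)
  have ha' := (h a).1 ha
  have hb' := w.U_zero_mul ((h b).1 hb) hs
  have h2 := Submodule.add_mem _ ha' hb'
  have h3 : q.σ (q.f a + q.f b * q.s) ∈ w.U 0 := by
    rw [map_add, map_mul, q.σf, q.σf, q.σs, mul_neg]
    exact Submodule.add_mem _ ha' ((Submodule.neg_mem_iff _).2 hb')
  have hne : q.f a + q.f b * q.s ≠ 0 := by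
    intro h0
    obtain ⟨rfl, rfl⟩ := q.ind _ _ h0
    rcases hab with h | h <;> exact h (Submodule.zero_mem _)
  rw [h.U_one, ← q.N_eq, q.f_N, w.mem_U_iff (mul_ne_zero hne (q.σ_ne hne)), w.ord_mul hne (q.σ_ne hne)] at h1
  rw [w.mem_U_iff hne] at h2
  rw [w.mem_U_iff (q.σ_ne hne)] at h3
  omega

lemma inert_scale (v : Place F K) {z : L} (hz : z ≠ 0) : ∃ (n : ℤ) (a b : K), a ∈ v.U 0 ∧ b ∈ v.U 0 ∧
    (a ∉ v.U 1 ∨ b ∉ v.U 1) ∧ z = q.f (v.π ^ n) * (q.f a + q.f b * q.s) := by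
  obtain ⟨x, y, rfl⟩ := q.gen z
  have main : ∃ n : ℤ, x ∈ v.U n ∧ y ∈ v.U n ∧ (x ∉ v.U (n + 1) ∨ y ∉ v.U (n + 1)) := by
    by_cases hx : x = 0
    · have hy : y ≠ 0 := by
        rintro rfl; apply hz; rw [hx]; simp
      refine ⟨v.ord y, Or.inl hx, v.mem_U_ord _, Or.inr ?_⟩
      rw [v.mem_U_iff hy]; omega
    by_cases hy : y = 0
    · refine ⟨v.ord x, v.mem_U_ord _, Or.inl hy, Or.inl ?_⟩
      rw [v.mem_U_iff hx]; omega
    rcases le_total (v.ord x) (v.ord y) with hh | hh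
    · refine ⟨v.ord x, v.mem_U_ord _, v.mem_U_of_le hh, Or.inl ?_⟩
      rw [v.mem_U_iff hx]; omega
    · refine ⟨v.ord y, v.mem_U_of_le hh, v.mem_U_ord _, Or.inr ?_⟩
      rw [v.mem_U_iff hy]; omega
  obtain ⟨n, h1, h2, h3⟩ := main
  refine ⟨n, x * v.π ^ (-n), y * v.π ^ (-n), ?_, ?_, ?_, ?_⟩
  · rw [v.mul_π_mem]; simpa using h1
  · rw [v.mul_π_mem]; simpa using h2
  · rw [v.mul_π_mem, v.mul_π_mem]
    rw [show (1 : ℤ) - -n = n + 1 by ring]; exact h3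
  · rw [map_mul, map_mul, zpow_neg, map_inv₀]
    have := q.f_ne (v.π_zpow_ne n)
    field_simp

lemma inert_ord (h : Lies q.f v w) (ho : v.ord d = 0) (hr : v.rr d = 1) (x : K) : w.ord (q.f x) = v.ord x := by
  obtain ⟨e, he, h1⟩ := h.ord
  obtain ⟨z, hz, hz1⟩ := w.exists_ord 1
  obtain ⟨n, a, b, ha, hb, hab, rfl⟩ := q.inert_scale v hz
  have h2 := q.inert_unit h ho hr ha hb hab
  rw [w.ord_mul (left_ne_zero_of_mul hz) (right_ne_zero_of_mul hz), h2, h1, add_zero] at hz1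
  have : e = 1 := Int.eq_one_of_mul_eq_one_right he.le hz1
  rw [h1, this, one_mul]

lemma inert_conj (h : Lies q.f v w) (ho : v.ord d = 0) (hr : v.rr d = 1) : w.conj q.σ = w := by
  apply Place.eq_of_O_le
  intro z hz
  rw [Place.mem_O] at hz ⊢
  by_cases h0 : z = 0
  · rw [h0]; exact Submodule.zero_mem _
  obtain ⟨n, a, b, ha, hb, hab, rfl⟩ := q.inert_scale v h0
  rw [Place.mem_U_iff _ h0, Place.ord_mul _ (left_ne_zero_of_mul h0) (right_ne_zero_of_mul h0)] at hz ⊢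
  rw [q.inert_unit (q.lies_conj h) ho hr ha hb hab, Place.conj_ord, q.σf] at hz
  rwa [q.inert_unit h ho hr ha hb hab]

lemma inert_mem (h : Lies q.f v w) (ho : v.ord d = 0) (hr : v.rr d = 1) {x y : K} {n : ℕ} :
    q.f x + q.f y * q.s ∈ w.U n ↔ x ∈ v.U n ∧ y ∈ v.U n := by
  have hs := q.s_ord h ho
  constructor
  · intro hz
    by_cases h0 : q.f x + q.f y * q.s = 0
    · obtain ⟨rfl, rfl⟩ := q.ind _ _ h0
      exact ⟨Submodule.zero_mem _, Submodule.zero_mem _⟩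
    obtain ⟨m, a, b, ha, hb, hab, e⟩ := q.inert_scale v h0
    rw [e] at hz h0
    rw [Place.mem_U_iff _ h0, Place.ord_mul _ (left_ne_zero_of_mul h0) (right_ne_zero_of_mul h0),
      q.inert_unit h ho hr ha hb hab, q.inert_ord h ho hr, v.ord_π_zpow, add_zero] at hz
    obtain ⟨e1, e2⟩ := q.ind (x - v.π ^ m * a) (y - v.π ^ m * b) (by
      rw [map_sub, map_sub, map_mul, map_mul]; linear_combination e)
    have hm : v.π ^ m ∈ v.U n := v.mem_U_of_le (by rwa [v.ord_π_zpow])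
    rw [sub_eq_zero.1 e1, sub_eq_zero.1 e2, mul_comm, mul_comm (v.π ^ m)]
    exact ⟨v.U_zero_mul ha hm, v.U_zero_mul hb hm⟩
  · rintro ⟨hx, hy⟩
    have up : ∀ x, x ∈ v.U n → q.f x ∈ w.U n := by
      rintro x (rfl | hx)
      · rw [map_zero]; exact Submodule.zero_mem _
      · exact w.mem_U_of_le (by rwa [q.inert_ord h ho hr])
    refine Submodule.add_mem _ (up x hx) ?_
    rw [mul_comm]
    exact w.U_zero_mul (w.unit_mem hs) (up y hy)

lemma inert_δ (h : Lies q.f v w) (ho : v.ord d = 0) (hr : v.rr d = 1) : w.δ = 2 * v.δ := by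
  apply pow_card_inj (F := F)
  rw [← card_κ, two_mul, pow_add, ← card_κ, ← Nat.card_prod]
  choose l hl hl2 using v.res_surj
  have hm : ∀ a b, a ∈ v.U 0 → b ∈ v.U 0 → q.f a + q.f b * q.s ∈ w.U 0 := fun a b ha hb =>
    (q.inert_mem h ho hr (n := 0)).2 ⟨ha, hb⟩
  refine (Nat.card_congr (Equiv.ofBijective (fun y : v.κ × v.κ => w.res (q.f (l y.1) + q.f (l y.2) * q.s)) ⟨?_, ?_⟩)).symm
  · rintro ⟨a, b⟩ ⟨a', b'⟩ hab
    simp only at hab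
    rw [w.res_eq (hm _ _ (hl a) (hl b)) (hm _ _ (hl a') (hl b')),
      show q.f (l a) + q.f (l b) * q.s - (q.f (l a') + q.f (l b') * q.s) =
        q.f (l a - l a') + q.f (l b - l b') * q.s by rw [map_sub, map_sub]; ring] at hab
    have := (q.inert_mem h ho hr (n := 1)).1 hab
    rw [Nat.cast_one, ← v.res_eq (hl a) (hl a'), ← v.res_eq (hl b) (hl b'), hl2, hl2, hl2, hl2] at this
    rw [this.1, this.2]
  · intro z
    obtain ⟨x, hx, rfl⟩ := w.res_surj z
    obtain ⟨a, b, rfl⟩ := q.gen x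
    have hab := (q.inert_mem h ho hr (n := 0)).1 hx
    rw [Nat.cast_zero] at hab
    refine ⟨(v.res a, v.res b), ?_⟩
    simp only
    rw [w.res_eq (hm _ _ (hl _) (hl _)) hx,
      show q.f (l (v.res a)) + q.f (l (v.res b)) * q.s - (q.f a + q.f b * q.s) =
        q.f (l (v.res a) - a) + q.f (l (v.res b) - b) * q.s by rw [map_sub, map_sub]; ring]
    refine (q.inert_mem h ho hr (n := 1)).2 ⟨?_, ?_⟩
    · rw [Nat.cast_one, ← v.res_eq (hl _) hab.1, hl2]
    · rw [Nat.cast_one, ← v.res_eq (hl _) hab.2, hl2]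

lemma inert_N_ord (h : Lies q.f v w) (ho : v.ord d = 0) (hr : v.rr d = 1) {z : L} (hz : z ≠ 0) :
    v.ord (q.N z) = 2 * w.ord z := by
  rw [← q.inert_ord h ho hr, q.f_N, w.ord_mul hz (q.σ_ne hz), ← w.conj_ord q.σ, q.inert_conj h ho hr]
  ring

lemma inert_rr_unit (h : Lies q.f v w) (ho : v.ord d = 0) (hr : v.rr d = 1) {u : L} (hu : u ≠ 0)
    (h0 : w.ord u = 0) : v.rr (q.N u) = w.rr u := by
  have hN0 : ∀ u : L, u ≠ 0 → w.ord u = 0 → v.ord (q.N u) = 0 := by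
    intro u hu h0; rw [q.inert_N_ord h ho hr hu, h0]; rfl
  have key : ∀ u : L, u ≠ 0 → w.ord u = 0 → w.rr u = 0 → v.rr (q.N u) = 0 := by
    intro u hu h0 hr0
    rw [w.rr_unit h0, qc_eq_zero, isSquare_res w (w.unit_mem h0)] at hr0
    obtain ⟨t, ht, h1⟩ := hr0
    have hN := hN0 u hu h0
    rw [v.rr_unit hN, qc_eq_zero, isSquare_res v (v.unit_mem hN)]
    have hmem : ∀ n : ℤ, ∀ z : L, z ∈ w.U n → q.σ z ∈ w.U n := by
      intro n z hz; rw [← w.conj_mem, q.inert_conj h ho hr]; exact hz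
    refine ⟨q.N t, ?_, ?_⟩
    · rw [h, q.f_N]; exact w.U_zero_mul ht (hmem _ _ ht)
    · rw [h.U_one, map_sub, map_pow, q.f_N, q.f_N]
      have e : u * q.σ u - (t * q.σ t) ^ 2 = q.σ u * (u - t ^ 2) + t ^ 2 * q.σ (u - t ^ 2) := by
        rw [map_sub, map_pow]; ring
      rw [e]
      have ht2 : t ^ 2 ∈ w.U 0 := by rw [pow_two]; exact w.U_zero_mul ht ht
      exact Submodule.add_mem _ (w.U_zero_mul (hmem _ _ (w.unit_mem h0)) h1) (w.U_zero_mul ht2 (hmem _ _ h1))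
  obtain ⟨u0, hu0, hu01, hu02⟩ : ∃ u : L, u ≠ 0 ∧ w.ord u = 0 ∧ v.rr (q.N u) = 1 := by
    obtain ⟨y, hy, hy1⟩ := exists_qc (k := v.κ)
    obtain ⟨a, b, hab⟩ := exists_norm_val (v.res_ne_zero q.d_ne ho) y
    obtain ⟨a, ha, rfl⟩ := v.res_surj a
    obtain ⟨b, hb, rfl⟩ := v.res_surj b
    have hd : d ∈ v.U 0 := v.unit_mem ho
    have ha2 : a ^ 2 ∈ v.U 0 := by rw [pow_two]; exact v.U_zero_mul ha ha
    have hb2 : b ^ 2 ∈ v.U 0 := by rw [pow_two]; exact v.U_zero_mul hb hb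
    have hdb := v.U_zero_mul hd hb2
    have hab1 : a ∉ v.U 1 ∨ b ∉ v.U 1 := by
      by_contra hc
      push Not at hc
      rw [(v.res_eq_zero ha).2 hc.1, (v.res_eq_zero hb).2 hc.2] at hab
      apply hy; rw [← hab]; ring
    have hun := q.inert_unit h ho hr ha hb hab1
    have hne : q.f a + q.f b * q.s ≠ 0 := by
      intro h0
      obtain ⟨rfl, rfl⟩ := q.ind _ _ h0
      rcases hab1 with h | h <;> exact h (Submodule.zero_mem _)
    refine ⟨q.f a + q.f b * q.s, hne, hun, ?_⟩
    rw [v.rr_unit (hN0 _ hne hun), q.N_eq]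
    have e1 : v.res (a ^ 2 - d * b ^ 2) = y := by
      have := v.res_add (Submodule.sub_mem _ ha2 hdb) hdb
      rw [sub_add_cancel, v.res_mul hd hb2, v.res_pow ha, v.res_pow hb] at this
      rw [← hab]; linear_combination -this
    rw [e1, hy1]
  have hu03 : w.rr u0 = 1 := by
    rcases z2_cases (w.rr u0) with h | h
    · rw [key u0 hu0 hu01 h] at hu02; exact absurd hu02 zero_ne_one
    · exact h
  rcases z2_cases (w.rr u) with h1 | h1
  · rw [h1, key u hu h0 h1]
  · have := key (u * u0) (mul_ne_zero hu hu0) (by rw [w.ord_mul hu hu0, h0, hu01]; rfl)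
      (by rw [w.rr_mul hu hu0, h1, hu03]; rfl)
    rw [q.N_mul, v.rr_mul (q.N_ne hu) (q.N_ne hu0), hu02] at this
    rw [h1, CharTwo.add_eq_zero.1 this]

lemma inert_h (h : Lies q.f v w) (ho : v.ord d = 0) (hr : v.rr d = 1) {α : K} {β : L} (hα : α ≠ 0)
    (hβ : β ≠ 0) : v.sy.h α (q.N β) = w.sy.h (q.f α) β := by
  obtain ⟨e, ρ, R, h1, h2⟩ := h.sy
  have hρ : ρ = 0 := by
    have := (h1 d q.d_ne).2
    rw [v.sy_p, ho, v.sy_r, hr, ← q.hs, w.sy.r_sq q.s_ne] at this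
    simpa using this.symm
  have hR : R = w.rr (q.f v.π) := by
    have := (h1 v.π v.π_ne).2
    rw [hρ, v.sy_p, v.ord_π] at this
    simpa [w.sy_r] using this.symm
  have he : w.sy.p (q.f α) = v.sy.p α := by rw [w.sy_p, v.sy_p, q.inert_ord h ho hr]
  have hp : v.sy.p (q.N β) = 0 := by
    rw [v.sy_p, q.inert_N_ord h ho hr hβ]; push_cast
    rw [show (2 : ZMod 2) = 0 from rfl, zero_mul]
  have hrN : v.sy.r (q.N β) = R * w.sy.p β + w.sy.r β := by
    set n := w.ord β with hn
    have hz : v.π ^ (-n) ≠ 0 := v.π_zpow_ne _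
    have hz' := q.f_ne hz
    have hu : w.ord (β * q.f (v.π ^ (-n))) = 0 := by
      rw [w.ord_mul hβ hz', q.inert_ord h ho hr, v.ord_π_zpow]; omega
    have := q.inert_rr_unit h ho hr (mul_ne_zero hβ hz') hu
    rw [q.N_mul, v.rr_mul (q.N_ne hβ) (q.N_ne hz'), q.N_f, w.rr_mul hβ hz'] at this
    have e1 : v.rr ((v.π ^ (-n)) ^ 2) = 0 := v.sy.r_sq hz
    have e2 : w.rr (q.f (v.π ^ (-n))) = R * n := by
      have := (h1 _ hz).2
      rw [hρ, v.sy_p, v.ord_π_zpow, zero_mul, add_zero] at this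
      rw [← w.sy_r, this]; push_cast
      rw [CharTwo.neg_eq]
    rw [e1, e2, add_zero] at this
    rw [v.sy_r, this, w.sy_p, w.sy_r]; ring
  unfold LSym.h
  rw [h2, hp, hrN, he, (h1 α hα).2, hρ]
  have e2 := z2_mul_self (v.sy.p α)
  ring_nf

end inert
end QE
end GFF
end PC4

section PC5
namespace GFF
set_option linter.unusedSectionVars false
set_option linter.unusedVariables false
set_option linter.unnecessarySimpa false
open IntermediateField Polynomial

section ex
universe u
variable (F : Type*) {K : Type u} [Field F] [Field K] [Algebra F K] [Finite F] [FF F K]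

lemma exists_QE {d : K} (hd : ¬ IsSquare d) : ∃ (L : Type u) (_ : Field L) (_ : Algebra F L) (_ : FF F L) (q : QE K L d),
    ∀ a : F, q.f (algebraMap F K a) = algebraMap F L a := by
  have hfact : Fact (∀ r : K, r ^ 2 ≠ d + 0 * r) := ⟨fun r hr => hd ⟨r, by rw [← pow_two, hr]; ring⟩⟩
  have : FF F (QuadraticAlgebra K d 0) := FF.of_extension (K := K)
  refine ⟨QuadraticAlgebra K d 0, inferInstance, inferInstance, this, ?_, ?_⟩
  · refine
    { f := algebraMap K _
      s := QuadraticAlgebra.omega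
      hs := ?_
      gen := ?_
      ind := ?_
      σ := starRingAut
      σf := ?_
      σs := ?_ }
    · ext <;> simp [pow_two]
    · intro z
      refine ⟨z.re, z.im, ?_⟩
      ext <;> simp
    · intro x y h
      have h1 := congrArg QuadraticAlgebra.re h
      have h2 := congrArg QuadraticAlgebra.im h
      simp at h1 h2
      exact ⟨h1, h2⟩
    · intro x
      ext <;> simp
    · ext <;> simp
  · intro a
    rw [IsScalarTower.algebraMap_apply F K (QuadraticAlgebra K d 0)]
end ex

namespace QE
section cst
variable {F K L : Type*} [Field F] [Field K] [Field L] [Algebra F K] [Algebra F L] [Finite F]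
  [FF F K] [FF F L] [NeZero (2 : F)] {d : K} (q : QE K L d)

lemma alg_iff {x : L} : IsAlgebraic F x ↔ x = 0 ∨ ∃ n : ℕ, 0 < n ∧ x ^ n = 1 := by
  constructor
  · intro h
    by_cases h0 : x = 0
    · exact Or.inl h0
    · exact Or.inr (exists_pow_eq_one h0 h)
  · rintro (rfl | ⟨n, hn, h⟩)
    · exact isAlgebraic_zero
    · exact IsAlgebraic.of_pow hn (by rw [h]; exact isAlgebraic_one)

lemma alg_map {L' : Type*} [Field L'] [Algebra F L'] [FF F L'] (g : L →+* L') {x : L} :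
    IsAlgebraic F (g x) ↔ IsAlgebraic F x := by
  rw [alg_iff, alg_iff, map_eq_zero]
  simp only [← map_pow, ← map_one g, g.injective.eq_iff]

lemma mem_Cst_iff (hd : d ∈ Cst F K) {x y : K} :
    q.f x + q.f y * q.s ∈ Cst F L ↔ x ∈ Cst F K ∧ y ∈ Cst F K := by
  have hs : q.s ∈ Cst F L := by
    rw [mem_Cst]
    refine IsAlgebraic.of_pow (n := 2) two_pos ?_
    rw [q.hs]; exact (alg_map q.f).2 (mem_Cst.1 hd)
  constructor
  · intro h
    have h2 : q.σ (q.f x + q.f y * q.s) ∈ Cst F L :=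
      mem_Cst.2 ((alg_map (F := F) (q.σ : L →+* L)).2 (mem_Cst.1 h))
    rw [map_add, map_mul, q.σf, q.σf, q.σs] at h2
    have h3 : (2 : L) ∈ Cst F L := ofNat_mem _ 2
    have h2n : (2 : L) ≠ 0 := two_ne F
    constructor
    · have := (Cst F L).div_mem ((Cst F L).add_mem h h2) h3
      rw [show (q.f x + q.f y * q.s + (q.f x + q.f y * -q.s)) / 2 = q.f x by field_simp; ring] at this
      exact mem_Cst.2 ((alg_map q.f).1 (mem_Cst.1 this))
    · have := (Cst F L).div_mem ((Cst F L).sub_mem h h2) ((Cst F L).mul_mem h3 hs)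
      have hsn := q.s_ne
      rw [show (q.f x + q.f y * q.s - (q.f x + q.f y * -q.s)) / (2 * q.s) = q.f y by field_simp; ring] at this
      exact mem_Cst.2 ((alg_map q.f).1 (mem_Cst.1 this))
  · rintro ⟨hx, hy⟩
    exact (Cst F L).add_mem (mem_Cst.2 ((alg_map q.f).2 (mem_Cst.1 hx)))
      ((Cst F L).mul_mem (mem_Cst.2 ((alg_map q.f).2 (mem_Cst.1 hy))) hs)

lemma cdeg_eq (q : QE K L d) (hd : d ∈ Cst F K) : cdeg F L = 2 * cdeg F K := by
  apply pow_card_inj (F := F)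
  rw [← card_Cst, two_mul, pow_add, ← card_Cst, ← Nat.card_prod]
  refine (Nat.card_congr (Equiv.ofBijective (fun z : Cst F K × Cst F K =>
    (⟨q.f z.1 + q.f z.2 * q.s, (q.mem_Cst_iff hd).2 ⟨z.1.2, z.2.2⟩⟩ : Cst F L)) ⟨?_, ?_⟩)).symm
  · rintro ⟨a, b⟩ ⟨a', b'⟩ h
    have h1 : q.f a + q.f b * q.s = q.f a' + q.f b' * q.s := congrArg Subtype.val h
    obtain ⟨e1, e2⟩ := q.ind (a - a') (b - b') (by rw [map_sub, map_sub]; linear_combination h1)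
    rw [Subtype.ext (sub_eq_zero.1 e1), Subtype.ext (sub_eq_zero.1 e2)]
  · rintro ⟨z, hz⟩
    obtain ⟨x, y, rfl⟩ := q.gen z
    have := (q.mem_Cst_iff hd).1 hz
    exact ⟨(⟨x, this.1⟩, ⟨y, this.2⟩), rfl⟩

/-- constants are norms of constants -/
lemma cst_norm (hd : d ∈ Cst F K) {ε : K} (hε : ε ∈ Cst F K) : ∃ η ∈ Cst F L, q.N η = ε := by
  obtain ⟨a, b, h⟩ := exists_norm_val (k := Cst F K) (c := ⟨d, hd⟩)
    (fun h => q.d_ne (congrArg Subtype.val h)) ⟨ε, hε⟩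
  refine ⟨q.f a + q.f b * q.s, (q.mem_Cst_iff hd).2 ⟨a.2, b.2⟩, ?_⟩
  rw [q.N_eq]
  exact congrArg Subtype.val h

end cst
end QE
end GFF
end PC5

section PD1
namespace GFF
set_option linter.unusedSectionVars false
set_option linter.unusedVariables false
set_option linter.unnecessarySimpa false
open IntermediateField Polynomial

/-- sign of an element of `ZMod 2` -/
def sgn (x : ZMod 2) : ℤ := if x = 0 then 1 else -1

lemma sgn_add (x y : ZMod 2) : sgn (x + y) = sgn x * sgn y := by
  revert x y; decide

lemma sgn_zero : sgn 0 = 1 := rfl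

lemma sgn_sum {ι : Type*} (s : Finset ι) (f : ι → ZMod 2) : sgn (∑ i ∈ s, f i) = ∏ i ∈ s, sgn (f i) := by
  classical
  induction s using Finset.induction_on with
  | empty => rfl
  | insert a s ha ih => rw [Finset.sum_insert ha, Finset.prod_insert ha, sgn_add, ih]

lemma sgn_icc (n : ℕ) (r : ZMod 2) : ∑ j ∈ Finset.Icc (0:ℤ) n, sgn ((j : ZMod 2) * r) =
    if r = 0 then (n : ℤ) + 1 else if (n : ZMod 2) = 0 then 1 else 0 := by
  induction n with
  | zero => rcases z2_cases r with h | h <;> simp [h, sgn_zero]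
  | succ n ih =>
    have e : Finset.Icc (0:ℤ) ((n + 1 : ℕ) : ℤ) = insert ((n : ℤ) + 1) (Finset.Icc (0:ℤ) n) := by
      ext x; simp only [Finset.mem_Icc, Finset.mem_insert]; push_cast; omega
    rw [e, Finset.sum_insert (by simp), ih]
    rcases z2_cases r with h | h
    · simp [h, sgn_zero]; ring
    · subst h
      have := z2_cases (n : ZMod 2)
      push_cast
      generalize (n : ZMod 2) = a at this
      rw [if_neg one_ne_zero, if_neg one_ne_zero]
      clear ih e
      revert a; decide

section c1
variable {F K : Type*} [Field F] [Field K] [Algebra F K] [Finite F] [FF F K]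

variable (F K) in
/-- effective divisors as a finset -/
noncomputable def EffF (n : ℤ) : Finset (Dv F K) := (Eff_finite (F := F) (L := K) n).toFinset

lemma mem_EffF {n : ℤ} {D : Dv F K} : D ∈ EffF F K n ↔ 0 ≤ D ∧ ddeg D = n := by
  simp [EffF, Eff]

lemma card_F_gt : 1 < Nat.card F := Finite.one_lt_card

open Classical in
lemma card_cls_filter (D : Dv F K) {n : ℤ} (hD : ddeg D = n) :
    ((EffF F K n).filter (· ∈ cls F D)).card = Nat.card (cls F D) := by
  have : ((EffF F K n).filter (· ∈ cls F D) : Set (Dv F K)) = cls F D := by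
    ext E
    simp only [Finset.coe_filter, Set.mem_ofPred_eq]
    refine ⟨fun h => h.2, fun h => ⟨?_, h⟩⟩
    have := cls_sub D h
    exact mem_EffF.2 ⟨this.1, this.2.trans hD⟩
  rw [← Set.ncard_coe_finset, this]
  rfl

/-- sums of nontrivial class characters vanish in large degree -/
lemma sum_char_zero (χ : Dv F K → ℤ) (D1 : Dv F K) (h0 : ddeg D1 = 0)
    (h1 : ∀ D z, z ≠ 0 → χ (D + dv F z) = χ D) (h2 : ∀ D, χ (D + D1) = - χ D) :
    ∃ N : ℕ, ∀ n : ℕ, N ≤ n → ∑ D ∈ EffF F K n, χ D = 0 := by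
  classical
  obtain ⟨γ, n0, hrr⟩ := rr F K
  refine ⟨(max n0 (γ + 1)).toNat, fun n hn => ?_⟩
  have hn1 : n0 ≤ n := by omega
  have hn2 : γ + 1 ≤ n := by omega
  rcases Finset.eq_empty_or_nonempty (EffF F K n) with hne | hne
  · rw [hne]; rfl
  set M : ℕ := (Nat.card F ^ ((n : ℤ) - γ).toNat - 1) / (Nat.card F ^ ell (0 : Dv F K) - 1) with hM
  have hq := card_F_gt (F := F)
  have hcard : ∀ D : Dv F K, ddeg D = n → Nat.card (cls F D) = M := by
    intro D hD
    have e1 := (hrr D).2 (by omega)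
    have e2 := card_cls D
    rw [show ell D = ((n : ℤ) - γ).toNat by omega] at e2
    have : 0 < Nat.card F ^ ell (0 : Dv F K) - 1 := Nat.sub_pos_of_lt (Nat.one_lt_pow ell_zero_pos.ne' hq)
    exact (Nat.div_eq_of_eq_mul_left this e2.symm).symm
  have hMpos : 0 < M := by
    obtain ⟨D, hD⟩ := hne
    have := hcard D (mem_EffF.1 hD).2
    rw [← this, Nat.card_pos_iff]
    exact ⟨⟨D, (mem_EffF.1 hD).1, 1, one_ne_zero, by rw [dv_one, add_zero]⟩,
      (Eff_finite (ddeg D)).subset (cls_sub D)⟩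
  have key : ∀ D ∈ EffF F K n, ((EffF F K n).filter (· ∈ cls F (D + D1))).card = M := by
    intro D hD
    have hd : ddeg (D + D1) = n := by rw [map_add, h0, (mem_EffF.1 hD).2, add_zero]
    rw [card_cls_filter _ hd, hcard _ hd]
  have key2 : ∀ E ∈ EffF F K n, ((EffF F K n).filter (fun D => E ∈ cls F (D + D1))).card = M := by
    intro E hE
    have hd : ddeg (E - D1) = n := by rw [map_sub, h0, (mem_EffF.1 hE).2, sub_zero]
    rw [← hcard _ hd, ← card_cls_filter _ hd]
    congr 1
    refine Finset.filter_congr fun D hD => ?_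
    constructor
    · rintro ⟨-, z, hz, e⟩
      refine ⟨(mem_EffF.1 hD).1, z⁻¹, inv_ne_zero hz, ?_⟩
      rw [dv_inv, e]; abel
    · rintro ⟨-, z, hz, e⟩
      refine ⟨(mem_EffF.1 hE).1, z⁻¹, inv_ne_zero hz, ?_⟩
      rw [dv_inv, e]; abel
  have s1 : ∑ D ∈ EffF F K n, ∑ E ∈ (EffF F K n).filter (· ∈ cls F (D + D1)), χ D = M * ∑ D ∈ EffF F K n, χ D := by
    rw [Finset.mul_sum]
    refine Finset.sum_congr rfl fun D hD => ?_
    rw [Finset.sum_const, key D hD, nsmul_eq_mul]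
  have s2 : ∑ D ∈ EffF F K n, ∑ E ∈ (EffF F K n).filter (· ∈ cls F (D + D1)), χ D = - (M * ∑ D ∈ EffF F K n, χ D) := by
    have : ∑ D ∈ EffF F K n, ∑ E ∈ (EffF F K n).filter (· ∈ cls F (D + D1)), χ D =
        ∑ D ∈ EffF F K n, ∑ E ∈ (EffF F K n).filter (· ∈ cls F (D + D1)), - χ E := by
      refine Finset.sum_congr rfl fun D hD => Finset.sum_congr rfl fun E hE => ?_
      obtain ⟨-, z, hz, e⟩ := (Finset.mem_filter.1 hE).2
      rw [e, h1 _ _ hz, h2, neg_neg]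
    rw [this]
    simp_rw [Finset.sum_filter]
    rw [Finset.sum_comm]
    simp_rw [← Finset.sum_filter]
    rw [Finset.mul_sum, ← Finset.sum_neg_distrib]
    refine Finset.sum_congr rfl fun E hE => ?_
    rw [Finset.sum_const, key2 E hE, nsmul_eq_mul, mul_neg]
  rw [s1] at s2
  have : (M : ℤ) * ∑ D ∈ EffF F K n, χ D = 0 := by linarith
  rcases mul_eq_zero.1 this with h | h
  · omega
  · exact h

/-- sum over effective subdivisors as a product -/
lemma sum_sub (r : Place F K → ZMod 2) {D : Dv F K} (hD : 0 ≤ D) :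
    ∃ T : Finset (Dv F K), (∀ E, E ∈ T ↔ 0 ≤ E ∧ E ≤ D) ∧
    ∑ E ∈ T, sgn (E.sum fun v n => (n : ZMod 2) * r v) = ∏ v ∈ D.support,
      if r v = 0 then D v + 1 else if (D v : ZMod 2) = 0 then 1 else 0 := by
  classical
  refine ⟨Finset.Icc 0 D, fun E => Finset.mem_Icc, ?_⟩
  have e1 : ∀ v ∈ D.support, (if r v = 0 then D v + 1 else if (D v : ZMod 2) = 0 then 1 else 0) =
      ∑ j ∈ Finset.Icc (0:ℤ) (D v), sgn ((j : ZMod 2) * r v) := by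
    intro v _
    obtain ⟨n, hn⟩ := Int.eq_ofNat_of_zero_le (hD v)
    rw [hn]
    have := sgn_icc n (r v)
    simp only [Int.cast_natCast] at this ⊢
    rw [this]
  rw [Finset.prod_congr rfl e1, Finset.prod_sum]
  refine Finset.sum_bij' (fun E _ => fun v _ => E v) (fun p _ => Finsupp.indicator D.support p) ?_ ?_ ?_ ?_ ?_
  · intro E hE
    rw [Finset.mem_pi]
    intro v hv
    have := Finset.mem_Icc.1 hE
    exact Finset.mem_Icc.2 ⟨this.1 v, this.2 v⟩
  · intro p hp
    rw [Finset.mem_pi] at hp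
    rw [Finset.mem_Icc]
    constructor <;> intro v <;> by_cases hv : v ∈ D.support
    · rw [Finsupp.indicator_of_mem hv]; exact (Finset.mem_Icc.1 (hp v hv)).1
    · rw [Finsupp.indicator_of_notMem hv]; rfl
    · rw [Finsupp.indicator_of_mem hv]; exact (Finset.mem_Icc.1 (hp v hv)).2
    · rw [Finsupp.indicator_of_notMem hv]; exact hD v
  · intro E hE
    ext v
    have := Finset.mem_Icc.1 hE
    by_cases hv : v ∈ D.support
    · rw [Finsupp.indicator_of_mem hv]
    · rw [Finsupp.indicator_of_notMem hv]
      have a := this.1 v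
      have b := this.2 v
      rw [Finsupp.notMem_support_iff.1 hv] at b
      exact le_antisymm a b
  · intro p hp
    funext v hv
    rw [Finsupp.indicator_of_mem hv]
  · intro E hE
    have h := Finset.mem_Icc.1 hE
    rw [Finset.prod_attach D.support (fun v => sgn ((E v : ZMod 2) * r v)), ← sgn_sum]
    congr 1
    refine Finsupp.sum_of_support_subset _ ?_ _ (by simp)
    intro v hv
    rw [Finsupp.mem_support_iff] at hv ⊢
    have a := h.1 v
    have b := h.2 v
    simp only [Finsupp.coe_zero, Pi.zero_apply] at a
    omega

variable [NeZero (2 : F)]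

/-- `ZMod 2`-valued functionals separate -/
lemma exists_functional {G : Type*} [AddCommGroup G] (H : AddSubgroup G) (h2 : ∀ x : G, x + x ∈ H) {x : G}
    (hx : x ∉ H) : ∃ φ : G →+ ZMod 2, (∀ y ∈ H, φ y = 0) ∧ φ x = 1 := by
  letI : Module (ZMod 2) (G ⧸ H) := AddCommGroup.zmodModule (n := 2) (by
    intro y
    obtain ⟨y, rfl⟩ := QuotientAddGroup.mk_surjective y
    rw [← QuotientAddGroup.mk_nsmul, two_nsmul]
    exact (QuotientAddGroup.eq_zero_iff _).2 (h2 y))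
  have hx' : (QuotientAddGroup.mk x : G ⧸ H) ≠ 0 := fun h => hx ((QuotientAddGroup.eq_zero_iff _).1 h)
  obtain ⟨φ, hφ⟩ : ∃ φ : Module.Dual (ZMod 2) (G ⧸ H), φ (QuotientAddGroup.mk x) ≠ 0 := by
    by_contra hc
    push Not at hc
    exact hx' ((Module.forall_dual_apply_eq_zero_iff (ZMod 2) _).1 hc)
  refine ⟨(φ : (G ⧸ H) →+ ZMod 2).comp (QuotientAddGroup.mk' H), fun y hy => ?_, ?_⟩
  · have : (QuotientAddGroup.mk' H) y = 0 := (QuotientAddGroup.eq_zero_iff _).2 hy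
    rw [AddMonoidHom.comp_apply, this, map_zero]
  · rcases z2_cases (φ (QuotientAddGroup.mk x)) with h | h
    · exact absurd h hφ
    · exact h

lemma conv_eq (χ lam : Dv F K → ℤ) (hχ : ∀ D E, χ (D + E) = χ D * χ E) (T : Dv F K → Finset (Dv F K))
    (hT : ∀ D, 0 ≤ D → ∀ E, E ∈ T D ↔ 0 ≤ E ∧ E ≤ D) (n : ℕ) :
    ∑ D ∈ EffF F K n, χ D * ∑ E ∈ T D, lam E = ∑ a ∈ Finset.range (n + 1),
      (∑ D ∈ EffF F K ((n - a : ℕ) : ℤ), χ D) * ∑ E ∈ EffF F K (a : ℤ), χ E * lam E := by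
  have e1 : ∀ a : ℕ, (∑ D ∈ EffF F K ((n - a : ℕ) : ℤ), χ D) * ∑ E ∈ EffF F K (a : ℤ), χ E * lam E =
      ∑ x ∈ EffF F K ((n - a : ℕ) : ℤ) ×ˢ EffF F K (a : ℤ), χ x.1 * (χ x.2 * lam x.2) := by
    intro a
    rw [Finset.sum_mul_sum, Finset.sum_product]
  simp_rw [e1, Finset.mul_sum]
  rw [Finset.sum_sigma', Finset.sum_sigma']
  refine Finset.sum_bij' (fun x _ => ⟨(ddeg x.2).toNat, (x.1 - x.2, x.2)⟩)
    (fun y _ => ⟨y.2.1 + y.2.2, y.2.2⟩) ?_ ?_ ?_ ?_ ?_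
  · rintro ⟨D, E⟩ h
    rw [Finset.mem_sigma] at h
    obtain ⟨h1, h2⟩ := h
    dsimp only at h1 h2 ⊢
    obtain ⟨h1, h3⟩ := mem_EffF.1 h1
    obtain ⟨h4, h5⟩ := (hT D h1 E).1 h2
    have h6 := ddeg_nonneg h4
    have h7 := ddeg_mono h5
    simp only [Finset.mem_sigma, Finset.mem_range, Finset.mem_product, mem_EffF, map_sub]
    refine ⟨by omega, ⟨sub_nonneg.2 h5, by omega⟩, h4, by omega⟩
  · rintro ⟨a, D, E⟩ h
    simp only [Finset.mem_sigma, Finset.mem_range, Finset.mem_product, mem_EffF] at h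
    obtain ⟨h1, ⟨h2, h3⟩, h4, h5⟩ := h
    have h6 := add_nonneg h2 h4
    simp only [Finset.mem_sigma, mem_EffF, map_add, hT _ h6]
    refine ⟨⟨h6, by omega⟩, h4, le_add_of_nonneg_left h2⟩
  · rintro ⟨D, E⟩ h
    simp
  · rintro ⟨a, D, E⟩ h
    simp only [Finset.mem_sigma, Finset.mem_range, Finset.mem_product, mem_EffF] at h
    obtain ⟨h1, ⟨h2, h3⟩, h4, h5⟩ := h
    simp [h5]
  · rintro ⟨D, E⟩ h
    dsimp only
    rw [← mul_assoc, ← hχ, sub_add_cancel]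

lemma C1 {c : K} (hc : c ∈ Cst F K) (hns : ¬ IsSquare c) (D1 : Dv F K) (h0 : ddeg D1 = 0) :
    ∃ f : K, f ≠ 0 ∧ ∀ v : Place F K, v.sy.r c = 1 → Even ((D1 + dv F f) v) := by
  classical
  by_contra hcon
  let H : AddSubgroup (Dv F K) :=
    { carrier := {D | ∃ f : K, f ≠ 0 ∧ ∀ v : Place F K, v.sy.r c = 1 → Even ((D + dv F f) v)}
      zero_mem' := ⟨1, one_ne_zero, fun v _ => by rw [dv_one]; simp⟩
      add_mem' := by
        rintro D E ⟨f, hf, h⟩ ⟨g, hg, h'⟩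
        refine ⟨f * g, mul_ne_zero hf hg, fun v hv => ?_⟩
        rw [dv_mul hf hg, add_add_add_comm, Finsupp.add_apply]
        exact (h v hv).add (h' v hv)
      neg_mem' := by
        rintro D ⟨f, hf, h⟩
        refine ⟨f⁻¹, inv_ne_zero hf, fun v hv => ?_⟩
        rw [dv_inv, ← neg_add, Finsupp.neg_apply]
        exact (h v hv).neg }
  have hH : ∀ D, D ∈ H ↔ ∃ f : K, f ≠ 0 ∧ ∀ v : Place F K, v.sy.r c = 1 → Even ((D + dv F f) v) := fun D => Iff.rfl
  obtain ⟨φ, hφ, hφ1⟩ := exists_functional H (fun D => (hH _).2 ⟨1, one_ne_zero, fun v _ => by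
    rw [dv_one, add_zero, Finsupp.add_apply]; exact ⟨_, rfl⟩⟩) (x := D1) hcon
  have hφdv : ∀ z : K, z ≠ 0 → φ (dv F z) = 0 := by
    intro z hz
    refine hφ _ ((hH _).2 ⟨z⁻¹, inv_ne_zero hz, fun v _ => ?_⟩)
    rw [dv_inv, add_neg_cancel]; simp
  have hφev : ∀ D : Dv F K, (∀ v, v.sy.r c = 1 → Even (D v)) → φ D = 0 := by
    intro D hD
    refine hφ _ ((hH _).2 ⟨1, one_ne_zero, fun v hv => ?_⟩)
    rw [dv_one, add_zero]; exact hD v hv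
  have hmul : ∀ D E, sgn (φ (D + E)) = sgn (φ D) * sgn (φ E) := fun D E => by rw [map_add, sgn_add]
  obtain ⟨N, hN⟩ := sum_char_zero (fun D => sgn (φ D)) D1 h0 (fun D z hz => by
    rw [hmul, hφdv z hz, sgn_zero, mul_one]) (fun D => by
    rw [hmul, hφ1]; simp [sgn])
  set lam : Dv F K → ℤ := fun E => sgn (E.sum fun v n => (n : ZMod 2) * v.sy.r c) with hlam
  have hN2 : ∀ n : ℕ, N ≤ n → ∑ E ∈ EffF F K n, sgn (φ E) * lam E = 0 := by
    intro n hn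
    rcases Finset.eq_empty_or_nonempty (EffF F K n) with hne | ⟨D0, hD0⟩
    · rw [hne]; rfl
    have : ∀ E ∈ EffF F K n, sgn (φ E) * lam E = sgn (φ E) * lam D0 := by
      intro E hE
      obtain ⟨m, e1, e2⟩ := exists_par hc hns E
      obtain ⟨m', e1', e2'⟩ := exists_par hc hns D0
      rw [(mem_EffF.1 hE).2] at e1
      rw [(mem_EffF.1 hD0).2, e1] at e1'
      have : m = m' := mul_left_cancel₀ (by have := cdeg_pos F K; positivity) e1'
      simp only [hlam]
      rw [← e2, ← e2', this]
    rw [Finset.sum_congr rfl this, ← Finset.sum_mul, hN n hn, zero_mul]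
  have hT : ∀ D : Dv F K, ∃ T : Finset (Dv F K), 0 ≤ D → (∀ E, E ∈ T ↔ 0 ≤ E ∧ E ≤ D) ∧
    ∑ E ∈ T, lam E = ∏ v ∈ D.support,
      if v.sy.r c = 0 then D v + 1 else if (D v : ZMod 2) = 0 then 1 else 0 := by
    intro D
    by_cases hD : 0 ≤ D
    · obtain ⟨T, hT⟩ := sum_sub (fun v : Place F K => v.sy.r c) hD
      exact ⟨T, fun _ => hT⟩
    · exact ⟨∅, fun h => absurd h hD⟩
  choose T hT using hT
  have hconv := fun n => conv_eq (fun D => sgn (φ D)) lam hmul T (fun D hD => (hT D hD).1) n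
  have hnn : ∀ D : Dv F K, 0 ≤ D → ∀ v ∈ D.support,
      0 ≤ (if v.sy.r c = 0 then D v + 1 else if (D v : ZMod 2) = 0 then 1 else 0) := by
    intro D hD v _
    have := hD v
    simp only [Finsupp.coe_zero, Pi.zero_apply] at this
    split_ifs <;> omega
  have hpos : ∀ D : Dv F K, 0 ≤ D → 0 ≤ sgn (φ D) * ∑ E ∈ T D, lam E := by
    intro D hD
    rw [(hT D hD).2]
    by_cases hev : ∀ v : Place F K, v.sy.r c = 1 → Even (D v)
    · rw [hφev D hev, sgn_zero, one_mul]
      exact Finset.prod_nonneg (hnn D hD)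
    · push Not at hev
      obtain ⟨v, hv, hv2⟩ := hev
      have hv3 : (D v : ZMod 2) ≠ 0 := by
        rw [Ne, ZMod.intCast_zmod_eq_zero_iff_dvd]; rwa [even_iff_two_dvd] at hv2
      rw [Finset.prod_eq_zero (i := v) (Finsupp.mem_support_iff.2 fun h => hv3 (by rw [h]; rfl))
        (by rw [if_neg (by rw [hv]; exact one_ne_zero), if_neg hv3]), mul_zero]
  obtain ⟨v0⟩ := exists_place F K
  set D0 : Dv F K := Finsupp.single v0 (2 * N) with hD0
  have hD0n : 0 ≤ D0 := by rw [hD0, Finsupp.single_nonneg]; positivity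
  set n : ℕ := 2 * N * v0.δ with hn
  have hD0m : D0 ∈ EffF F K n := mem_EffF.2 ⟨hD0n, by rw [hD0, ddeg_single, hn]; push_cast; ring⟩
  have hD0pos : 0 < sgn (φ D0) * ∑ E ∈ T D0, lam E := by
    have hev : ∀ v : Place F K, v.sy.r c = 1 → Even (D0 v) := by
      intro v hv
      rw [hD0, Finsupp.single_apply]; split_ifs
      · exact ⟨N, by ring⟩
      · exact ⟨0, rfl⟩
    rw [hφev D0 hev, sgn_zero, one_mul, (hT D0 hD0n).2]
    refine Finset.prod_pos fun v hv => lt_of_le_of_ne (hnn D0 hD0n v hv) (Ne.symm ?_)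
    have := hD0n v
    simp only [Finsupp.coe_zero, Pi.zero_apply] at this
    split_ifs with h1 h2
    · omega
    · norm_num
    · rcases z2_cases (v.sy.r c) with h | h
      · exact absurd h h1
      · exact absurd ((ZMod.intCast_zmod_eq_zero_iff_dvd _ _).2 (by simpa using (hev v h).two_dvd)) h2
  have hlhs : 0 < ∑ D ∈ EffF F K n, sgn (φ D) * ∑ E ∈ T D, lam E :=
    Finset.sum_pos' (fun D hD => hpos D (mem_EffF.1 hD).1) ⟨D0, hD0m, hD0pos⟩
  rw [hconv n] at hlhs
  refine hlhs.ne' (Finset.sum_eq_zero fun a ha => ?_)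
  have hδ := v0.δ_pos
  have : 2 * N ≤ n := Nat.le_mul_of_pos_right _ hδ
  rcases le_total N a with h | h
  · rw [hN2 a h, mul_zero]
  · rw [hN (n - a) (by omega), zero_mul]

end c1
end GFF
end PD1

section PD2
namespace GFF
set_option linter.unusedSectionVars false
set_option linter.unusedVariables false
set_option linter.unnecessarySimpa false
open IntermediateField Polynomial

section sq
variable {F K : Type*} [Field F] [Field K] [Algebra F K] [Finite F] [FF F K]

lemma card_cls_le (D : Dv F K) : Nat.card (cls F D) ≤ Nat.card F ^ ell D := by
  have e := card_cls D
  have hq := card_F_gt (F := F)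
  have : 1 ≤ Nat.card F ^ ell (0 : Dv F K) - 1 :=
    Nat.sub_pos_of_lt (Nat.one_lt_pow ell_zero_pos.ne' hq)
  calc Nat.card (cls F D) ≤ Nat.card (cls F D) * (Nat.card F ^ ell (0 : Dv F K) - 1) := Nat.le_mul_of_pos_right _ this
    _ ≤ _ := by rw [e]; omega

/-- lower bound for the number of effective divisors -/
lemma eff_lower (v : Place F K) : ∃ G : ℕ, ∀ i : ℕ,
    Nat.card F ^ (i * v.δ) ≤ (EffF F K ((i * v.δ : ℕ) : ℤ)).card * Nat.card F ^ G := by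
  classical
  obtain ⟨γ, n0, hrr⟩ := rr F K
  have hq := card_F_gt (F := F)
  refine ⟨ell (0 : Dv F K) + γ.toNat + 1, fun i => ?_⟩
  set D : Dv F K := Finsupp.single v (i : ℤ) with hD
  have hdeg : ddeg D = ((i * v.δ : ℕ) : ℤ) := by rw [hD, ddeg_single]; push_cast; ring
  set n := i * v.δ with hn
  have hDm : D ∈ EffF F K n := mem_EffF.2 ⟨by rw [hD, Finsupp.single_nonneg]; positivity, hdeg⟩
  have h1 : 1 ≤ (EffF F K n).card := Finset.card_pos.2 ⟨D, hDm⟩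
  rcases le_or_gt (n : ℤ) γ with h | h
  · calc Nat.card F ^ n ≤ Nat.card F ^ (ell (0 : Dv F K) + γ.toNat + 1) := Nat.pow_le_pow_right hq.le (by omega)
      _ ≤ _ := Nat.le_mul_of_pos_left _ h1
  · have h2 : Nat.card (cls F D) ≤ (EffF F K n).card := by
      rw [← card_cls_filter D hdeg]; exact Finset.card_filter_le _ _
    have h3 := (hrr D).1
    have h4 := card_cls D
    rw [hdeg] at h3
    have h5 : 1 ≤ ell D := by omega
    have h6 : Nat.card F ^ (ell D - 1) ≤ Nat.card F ^ ell D - 1 := by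
      have : Nat.card F ^ ell D = Nat.card F ^ (ell D - 1) * Nat.card F := by
        rw [← pow_succ]; congr 1; omega
      have h7 : 0 < Nat.card F ^ (ell D - 1) := by positivity
      have : Nat.card F ^ (ell D - 1) * 2 ≤ Nat.card F ^ ell D := by
        rw [this]; exact Nat.mul_le_mul_left _ hq
      omega
    calc Nat.card F ^ n ≤ Nat.card F ^ (ell D - 1 + (γ.toNat + 1)) := Nat.pow_le_pow_right hq.le (by omega)
      _ = Nat.card F ^ (ell D - 1) * Nat.card F ^ (γ.toNat + 1) := pow_add _ _ _
      _ ≤ (Nat.card (cls F D) * (Nat.card F ^ ell (0 : Dv F K) - 1)) * Nat.card F ^ (γ.toNat + 1) := by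
          rw [h4]; exact Nat.mul_le_mul_right _ h6
      _ ≤ ((EffF F K n).card * Nat.card F ^ ell (0 : Dv F K)) * Nat.card F ^ (γ.toNat + 1) := by
          gcongr; omega
      _ = _ := by rw [mul_assoc, ← pow_add, add_assoc]

/-- upper bound for the number of effective divisors -/
lemma eff_upper (v : Place F K) : ∃ C M : ℕ, ∀ i : ℕ, M ≤ i →
    (EffF F K ((i * v.δ : ℕ) : ℤ)).card ≤ C * Nat.card F ^ (i * v.δ) := by
  classical
  obtain ⟨γ, n0, hrr⟩ := rr F K
  have hq := card_F_gt (F := F)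
  have hδ := v.δ_pos
  set M : ℕ := (γ + 1).toNat with hM
  refine ⟨(EffF F K ((M * v.δ : ℕ) : ℤ)).card * Nat.card F ^ ell (0 : Dv F K), M, fun i hi => ?_⟩
  set P : Dv F K := Finsupp.single v ((i : ℤ) - M) with hP
  have hP0 : 0 ≤ P := by rw [hP, Finsupp.single_nonneg]; omega
  have hPd : ddeg P = ((i : ℤ) - M) * v.δ := ddeg_single _ _
  have hsub : EffF F K ((i * v.δ : ℕ) : ℤ) ⊆ (EffF F K ((M * v.δ : ℕ) : ℤ)).biUnion
      (fun E => (EffF F K ((i * v.δ : ℕ) : ℤ)).filter (· ∈ cls F (E + P))) := by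
    intro D hD
    obtain ⟨hD0, hDd⟩ := mem_EffF.1 hD
    have hd : ddeg (D - P) = ((M * v.δ : ℕ) : ℤ) := by rw [map_sub, hDd, hPd]; push_cast; ring
    have h1 := (hrr (D - P)).1
    have h2 : (M : ℤ) ≤ M * v.δ := by
      have : (1 : ℤ) ≤ v.δ := by omega
      nlinarith
    rw [hd] at h1; push_cast at h1
    obtain ⟨z, hz, h3⟩ := exists_of_ell_pos (D := D - P) (by omega)
    rw [Finset.mem_biUnion]
    refine ⟨D - P + dv F z, mem_EffF.2 ⟨h3, by rw [map_add, ddeg_dv, hd, add_zero]⟩, ?_⟩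
    rw [Finset.mem_filter]
    refine ⟨hD, hD0, z⁻¹, inv_ne_zero hz, ?_⟩
    rw [dv_inv]; abel
  calc _ ≤ _ := Finset.card_le_card hsub
    _ ≤ (EffF F K ((M * v.δ : ℕ) : ℤ)).card * Nat.card F ^ (ell (0 : Dv F K) + i * v.δ) := by
        refine Finset.card_biUnion_le_card_mul _ _ _ fun E hE => ?_
        obtain ⟨hE0, hEd⟩ := mem_EffF.1 hE
        have hd : ddeg (E + P) = ((i * v.δ : ℕ) : ℤ) := by rw [map_add, hEd, hPd]; push_cast; ring
        rw [card_cls_filter _ hd]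
        refine (card_cls_le _).trans (Nat.pow_le_pow_right hq.le ?_)
        have := ell_le (add_nonneg hE0 hP0)
        rw [hd, map_zero] at this
        omega
    _ = _ := by rw [pow_add, mul_assoc]

variable [NeZero (2 : F)]

theorem SQ {d : K} (hd : ¬ IsSquare d) : ∃ v : Place F K, ¬ v.sy.Sq d := by
  classical
  by_contra hcon
  push Not at hcon
  obtain ⟨L, _, _, _, q, -⟩ := exists_QE F hd
  choose w hw using fun v : Place F K => exists_over (F := F) q.f v
  have hinj : Function.Injective w := fun v v' h => (hw v).unique (h ▸ hw v')
  have hinj2 : Function.Injective (fun v => (w v).conj q.σ) := fun v v' h =>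
    by
    have h' : (w v).conj q.σ = (w v').conj q.σ := h
    exact (q.lies_conj (hw v)).unique (by rw [h']; exact q.lies_conj (hw v'))
  have hdis : ∀ v v', w v ≠ (w v').conj q.σ := by
    intro v v' h
    have : v = v' := (hw v).unique (h ▸ q.lies_conj (hw v'))
    subst this
    exact q.split_ne (hw v) (hcon v) h.symm
  have hdeg1 : ∀ D : Dv F K, ddeg (D.mapDomain w) = ddeg D := by
    intro D
    rw [ddeg_eq, ddeg_eq, Finsupp.sum_mapDomain_index (by simp) (by intros; ring)]
    simp_rw [fun v => q.split_δ (hw v) (hcon v)]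
  have hdeg2 : ∀ D : Dv F K, ddeg (D.mapDomain (fun v => (w v).conj q.σ)) = ddeg D := by
    intro D
    rw [ddeg_eq, ddeg_eq, Finsupp.sum_mapDomain_index (by simp) (by intros; ring)]
    simp_rw [fun v => q.split_δ (q.lies_conj (hw v)) (hcon v)]
  have hnn : ∀ (g : Place F K → Place F L), Function.Injective g → ∀ D : Dv F K, 0 ≤ D → 0 ≤ D.mapDomain g := by
    intro g hg D hD u
    by_cases hu : u ∈ Set.range g
    · obtain ⟨v, rfl⟩ := hu
      rw [Finsupp.mapDomain_apply hg]; exact hD v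
    · rw [Finsupp.mapDomain_of_notMem_range _ _ hu]; rfl
  set Φ : Dv F K × Dv F K → Dv F L := fun x => x.1.mapDomain w + x.2.mapDomain (fun v => (w v).conj q.σ) with hΦ
  have hΦ1 : ∀ x v, Φ x (w v) = x.1 v := by
    intro x v
    rw [hΦ]; simp only
    rw [Finsupp.add_apply, Finsupp.mapDomain_apply hinj, Finsupp.mapDomain_of_notMem_range, add_zero]
    rintro ⟨v', h⟩; exact hdis v v' h.symm
  have hΦ2 : ∀ x v, Φ x ((w v).conj q.σ) = x.2 v := by
    intro x v
    rw [hΦ]; simp only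
    rw [Finsupp.add_apply, Finsupp.mapDomain_of_notMem_range, zero_add]
    · exact Finsupp.mapDomain_apply hinj2 _ v
    · rintro ⟨v', h⟩; exact hdis v' v h
  have hΦinj : Function.Injective Φ := by
    rintro ⟨a, b⟩ ⟨a', b'⟩ h
    have h1 : a = a' := by ext v; rw [← hΦ1 (a, b) v, h, hΦ1]
    have h2 : b = b' := by ext v; rw [← hΦ2 (a, b) v, h, hΦ2]
    rw [h1, h2]
  obtain ⟨v0⟩ := exists_place F K
  obtain ⟨G, hG⟩ := eff_lower v0
  obtain ⟨C, M, hC⟩ := eff_upper (w v0)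
  rw [q.split_δ (hw v0) (hcon v0)] at hC
  have hδ := v0.δ_pos
  have hq := card_F_gt (F := F)
  have hsum : ∀ k : ℕ, ∑ i ∈ Finset.range (k + 1), (EffF F K ((i * v0.δ : ℕ) : ℤ)).card *
      (EffF F K (((k - i) * v0.δ : ℕ) : ℤ)).card ≤ (EffF F L ((k * v0.δ : ℕ) : ℤ)).card := by
    intro k
    simp_rw [← Finset.card_product]
    rw [← Finset.card_sigma]
    refine Finset.card_le_card_of_injOn (fun x => Φ x.2) ?_ ?_
    · rintro ⟨i, a, b⟩ h
      simp only [Finset.coe_sigma, Set.mem_sigma_iff, Finset.mem_coe, Finset.mem_product, mem_EffF, Finset.mem_range] at h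
      obtain ⟨h1, ⟨h2, h3⟩, h4, h5⟩ := h
      refine mem_EffF.2 ⟨add_nonneg (hnn _ hinj _ h2) (hnn _ hinj2 _ h4), ?_⟩
      rw [hΦ]; simp only
      rw [map_add, hdeg1, hdeg2, h3, h5, ← Nat.cast_add, ← add_mul]
      congr 3; omega
    · rintro ⟨i, a, b⟩ h ⟨i', a', b'⟩ h' e
      have e1 := hΦinj e
      simp only [Finset.coe_sigma, Set.mem_sigma_iff, Finset.mem_coe, Finset.mem_product, mem_EffF, Finset.mem_range] at h h'
      obtain ⟨rfl, rfl⟩ := Prod.mk.inj e1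
      have : i * v0.δ = i' * v0.δ := by
        have := h.2.1.2.symm.trans h'.2.1.2
        exact_mod_cast this
      rw [Nat.eq_of_mul_eq_mul_right hδ this]
  have hfin : ∀ k : ℕ, M ≤ k → k + 1 ≤ C * Nat.card F ^ (2 * G) := by
    intro k hk
    have h1 : (k + 1) * Nat.card F ^ (k * v0.δ) ≤ (C * Nat.card F ^ (2 * G)) * Nat.card F ^ (k * v0.δ) := by
      calc (k + 1) * Nat.card F ^ (k * v0.δ) = ∑ i ∈ Finset.range (k + 1), Nat.card F ^ (k * v0.δ) := by simp
        _ ≤ ∑ i ∈ Finset.range (k + 1), ((EffF F K ((i * v0.δ : ℕ) : ℤ)).card *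
          (EffF F K (((k - i) * v0.δ : ℕ) : ℤ)).card) * Nat.card F ^ (2 * G) := by
            refine Finset.sum_le_sum fun i hi => ?_
            rw [Finset.mem_range] at hi
            have e : k * v0.δ = i * v0.δ + (k - i) * v0.δ := by rw [← add_mul]; congr 1; omega
            rw [e, pow_add, two_mul, pow_add]
            calc _ ≤ _ := Nat.mul_le_mul (hG i) (hG (k - i))
              _ = _ := by ring
        _ ≤ (EffF F L ((k * v0.δ : ℕ) : ℤ)).card * Nat.card F ^ (2 * G) := by
            rw [← Finset.sum_mul]; exact Nat.mul_le_mul_right _ (hsum k)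
        _ ≤ (C * Nat.card F ^ (k * v0.δ)) * Nat.card F ^ (2 * G) := Nat.mul_le_mul_right _ (hC k hk)
        _ = _ := by ring
    exact Nat.le_of_mul_le_mul_right h1 (by positivity)
  have := hfin (M + C * Nat.card F ^ (2 * G)) (by omega)
  omega

end sq
end GFF
end PD2

section PD3
namespace GFF
set_option linter.unusedSectionVars false
set_option linter.unusedVariables false
set_option linter.unnecessarySimpa false
open IntermediateField Polynomial

lemma cnt0 {A B : Type*} [AddCommGroup A] [AddCommGroup B] [Finite A] (I : A →+ A) (N : A →+ B) (j : B → A)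
    (hN : Function.Surjective N) (hj : ∀ a, I a = 0 → ∃ b, j b = a) (hNI : ∀ a, N (I a) = 0) {a : A} (ha : N a = 0) :
    ∃ b, I b = a := by
  have : Finite B := Finite.of_surjective N hN
  have h1 : Nat.card I.ker * Nat.card I.range = Nat.card A := by
    have := AddSubgroup.card_mul_index I.ker
    rwa [AddSubgroup.index_ker] at this
  have h2 : Nat.card N.ker * Nat.card B = Nat.card A := by
    have := AddSubgroup.card_mul_index N.ker
    rw [AddSubgroup.index_ker, AddMonoidHom.range_eq_top.2 hN] at this
    simpa using this
  have h3 : Nat.card I.ker ≤ Nat.card B := by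
    choose g hg using fun a : I.ker => hj a a.2
    exact Nat.card_le_card_of_injective g fun a b h => Subtype.ext (by rw [← hg a, ← hg b, h])
  have h4 : Nat.card N.ker ≤ Nat.card I.range := by
    have hpos : 0 < Nat.card B := Nat.card_pos
    by_contra hcon
    push Not at hcon
    have h5 : 0 < Nat.card I.range := Nat.card_pos
    nlinarith
  have h5 : I.range = N.ker := by
    apply AddSubgroup.eq_of_le_of_card_ge _ h4
    rintro _ ⟨x, rfl⟩
    exact hNI x
  have : a ∈ I.range := h5 ▸ ha
  exact this

lemma cnt {G G' : Type*} [AddCommGroup G] [AddCommGroup G'] (P : AddSubgroup G) (P' : AddSubgroup G')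
    [Finite (G ⧸ P)] (s : G →+ G) (N : G →+ G') (j : G' →+ G) (hsP : ∀ x ∈ P, s x ∈ P) (hNP : ∀ x ∈ P, N x ∈ P')
    (hjP : ∀ x ∈ P', j x ∈ P) (hN : ∀ x, ∃ y, N y - x ∈ P') (hj : ∀ x, x - s x ∈ P → ∃ b, x - j b ∈ P)
    (hNs : ∀ x, N (s x) = N x) {x : G} (hx : N x ∈ P') : ∃ y, x - (y - s y) ∈ P := by
  let I : G ⧸ P →+ G ⧸ P := QuotientAddGroup.map P P (AddMonoidHom.id G - s) (by
    intro x hx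
    exact P.sub_mem hx (hsP x hx))
  let M : G ⧸ P →+ G' ⧸ P' := QuotientAddGroup.map P P' N hNP
  let J : G' ⧸ P' →+ G ⧸ P := QuotientAddGroup.map P' P j hjP
  obtain ⟨y, hy⟩ := cnt0 I M J (by
      intro b
      obtain ⟨b, rfl⟩ := QuotientAddGroup.mk_surjective b
      obtain ⟨y, hy⟩ := hN b
      refine ⟨(y : G ⧸ P), ?_⟩
      change ((N y : G') : G' ⧸ P') = b
      rw [eq_comm, QuotientAddGroup.eq]
      rwa [neg_add_eq_sub]) (by
      intro a ha
      obtain ⟨a, rfl⟩ := QuotientAddGroup.mk_surjective a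
      have : ((a - s a : G) : G ⧸ P) = 0 := ha
      rw [QuotientAddGroup.eq_zero_iff] at this
      obtain ⟨b, hb⟩ := hj a this
      refine ⟨(b : G' ⧸ P'), ?_⟩
      change ((j b : G) : G ⧸ P) = a
      rw [QuotientAddGroup.eq]
      rwa [neg_add_eq_sub]) (by
      intro a
      obtain ⟨a, rfl⟩ := QuotientAddGroup.mk_surjective a
      change ((N (a - s a) : G') : G' ⧸ P') = 0
      rw [map_sub, hNs, sub_self]; rfl) (a := (x : G ⧸ P)) (by
      change ((N x : G') : G' ⧸ P') = 0
      rwa [QuotientAddGroup.eq_zero_iff])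
  obtain ⟨y, rfl⟩ := QuotientAddGroup.mk_surjective y
  refine ⟨y, ?_⟩
  have : ((y - s y : G) : G ⧸ P) = x := hy
  rw [QuotientAddGroup.eq] at this
  rwa [neg_add_eq_sub] at this

section
variable (F K : Type*) [Field F] [Finite F] [Field K] [Algebra F K] [FF F K]

/-- principal divisors among the divisors of degree zero -/
noncomputable def PD : AddSubgroup (ddeg (F := F) (L := K)).ker where
  carrier := {D | ∃ z : K, z ≠ 0 ∧ (D : Dv F K) = dv F z}
  zero_mem' := ⟨1, one_ne_zero, by rw [dv_one]; rfl⟩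
  add_mem' := by
    rintro a b ⟨z, hz, h⟩ ⟨z', hz', h'⟩
    exact ⟨z * z', mul_ne_zero hz hz', by rw [dv_mul hz hz', ← h, ← h']; rfl⟩
  neg_mem' := by
    rintro a ⟨z, hz, h⟩
    exact ⟨z⁻¹, inv_ne_zero hz, by rw [dv_inv, ← h]; rfl⟩

instance : Finite ((ddeg (F := F) (L := K)).ker ⧸ PD F K) := by
  obtain ⟨γ, n0, hrr⟩ := rr F K
  obtain ⟨P⟩ := exists_place F K
  set M : ℕ := (γ.toNat + 1)
  have hM : γ < M * P.δ := by
    have := P.δ_pos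
    have h1 : γ < M := by omega
    have h2 : (1 : ℤ) ≤ P.δ := by exact_mod_cast this
    nlinarith
  have : Finite (Eff F K (M * P.δ)) := (Eff_finite _)
  let g : Eff F K (M * P.δ) → (ddeg (F := F) (L := K)).ker := fun E => ⟨E.1 - Finsupp.single P (M : ℤ), by
    rw [AddMonoidHom.mem_ker, map_sub, E.2.2, ddeg_single, sub_self]⟩
  refine Finite.of_surjective (fun E => ((g E : (ddeg (F := F) (L := K)).ker) : (ddeg (F := F) (L := K)).ker ⧸ PD F K)) ?_
  intro D
  obtain ⟨D, rfl⟩ := QuotientAddGroup.mk_surjective D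
  have hD : ddeg (D : Dv F K) = 0 := D.2
  have hdeg : ddeg (D.1 + Finsupp.single P (M : ℤ)) = M * P.δ := by
    rw [map_add, hD, ddeg_single, zero_add]
  have := (hrr (D.1 + Finsupp.single P (M : ℤ))).1
  obtain ⟨z, hz, hz2⟩ := exists_of_ell_pos (D := D.1 + Finsupp.single P (M : ℤ)) (by omega)
  refine ⟨⟨_, hz2, by rw [map_add, ddeg_dv, hdeg, add_zero]⟩, ?_⟩
  simp only
  rw [eq_comm, QuotientAddGroup.eq]
  refine ⟨z, hz, ?_⟩
  simp only [g, AddSubgroup.coe_add, AddSubgroup.coe_neg]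
  abel

end

namespace QE
variable {F K L : Type*} [Field F] [Finite F] [Field K] [Algebra F K] [FF F K] [NeZero (2 : F)]
    [Field L] [Algebra F L] [FF F L] {c : K} (q : QE K L c)

lemma c_cases (q : QE K L c) (hc : c ∈ Cst F K) (v : Place F K) : v.sy.Sq c ∨ (v.ord c = 0 ∧ v.rr c = 1) := by
  rcases z2_cases (v.sy.r c) with h | h
  · exact Or.inl ((c_sq hc v).2 h)
  · exact Or.inr ⟨c_ord hc v, h⟩

lemma c_ord_f (hc : c ∈ Cst F K) {v : Place F K} {w : Place F L} (h : Lies q.f v w) (x : K) :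
    w.ord (q.f x) = v.ord x := by
  rcases q.c_cases hc v with h1 | ⟨h1, h2⟩
  · exact q.split_ord h h1 x
  · exact q.inert_ord h h1 h2 x

lemma c_δ (hc : c ∈ Cst F K) (w : Place F L) : (w.conj q.σ).δ = w.δ := by
  obtain ⟨v, h⟩ := exists_under w q.integral
  rcases q.c_cases hc v with h1 | ⟨h1, h2⟩
  · rw [q.split_δ h h1, q.split_δ (q.lies_conj h) h1]
  · rw [q.inert_conj h h1 h2]

variable (F) in
/-- conjugation of divisors -/
noncomputable def sd : Dv F L →+ Dv F L := Finsupp.mapDomain.addMonoidHom (fun w => w.conj q.σ)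

lemma sd_apply (D : Dv F L) (w : Place F L) : q.sd F D w = D (w.conj q.σ) := by
  have hinj : Function.Injective (fun w : Place F L => w.conj q.σ) := fun w w' h => by
    have h' : w.conj q.σ = w'.conj q.σ := h
    rw [← q.conj_conj w, h', q.conj_conj]
  have := Finsupp.mapDomain_apply hinj D (w.conj q.σ)
  rw [q.conj_conj] at this
  exact this

lemma ddeg_sd (hc : c ∈ Cst F K) (D : Dv F L) : ddeg (q.sd F D) = ddeg D := by
  change ddeg (Finsupp.mapDomain _ D) = _
  rw [ddeg_eq, ddeg_eq, Finsupp.sum_mapDomain_index (by simp) (by intros; ring)]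
  simp_rw [q.c_δ hc]

lemma sd_dv (z : L) : q.sd F (dv F z) = dv F (q.σ z) := by
  ext w
  rw [sd_apply, dv_apply, dv_apply, Place.conj_ord]

variable (F) in
/-- a place above -/
noncomputable def ov (v : Place F K) : Place F L := (exists_over (F := F) q.f v).choose
lemma lies_ov (v : Place F K) : Lies q.f v (q.ov F v) := (exists_over (F := F) q.f v).choose_spec
/-- the place below -/
noncomputable def und (w : Place F L) : Place F K := (exists_under w q.integral).choose
lemma lies_und (w : Place F L) : Lies q.f (q.und w) w := (exists_under w q.integral).choose_spec
lemma ov_inj : Function.Injective (q.ov F) := fun v v' h =>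
  (q.lies_ov v).unique (by rw [h]; exact q.lies_ov v')
lemma und_eq {v : Place F K} {w : Place F L} (h : Lies q.f v w) : q.und w = v := (q.lies_und w).unique h
lemma und_cases (w : Place F L) : w = q.ov F (q.und w) ∨ w = (q.ov F (q.und w)).conj q.σ :=
  q.over_eq (q.lies_ov _) (q.lies_und w)

lemma jd_fin (D : Dv F K) : (Function.support fun w : Place F L => D (q.und w)).Finite := by
  classical
  refine ((D.support.image (q.ov F)) ∪ (D.support.image fun v => (q.ov F v).conj q.σ)).finite_toSet.subset ?_
  intro w hw
  simp only [Finset.coe_union, Finset.coe_image, Set.mem_union, Set.mem_image, Finset.mem_coe, Finsupp.mem_support_iff]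
  rcases q.und_cases w with h | h
  · exact Or.inl ⟨_, hw, h.symm⟩
  · exact Or.inr ⟨_, hw, h.symm⟩

variable (F) in
/-- pullback of divisors -/
noncomputable def jd : Dv F K →+ Dv F L where
  toFun D := Finsupp.ofSupportFinite (fun w => D (q.und w)) (q.jd_fin D)
  map_zero' := by ext w; rfl
  map_add' D E := by ext w; rfl

lemma jd_apply (D : Dv F K) (w : Place F L) : q.jd F D w = D (q.und w) := rfl

lemma ddeg_jd (hc : c ∈ Cst F K) (D : Dv F K) : ddeg (q.jd F D) = 2 * ddeg D := by
  classical
  induction D using Finsupp.induction_linear with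
  | zero => simp
  | add f g hf hg => rw [map_add, map_add, hf, hg, map_add]; ring
  | single v n =>
    rw [ddeg_single]
    rcases q.c_cases hc v with h1 | ⟨h1, h2⟩
    · have : q.jd F (Finsupp.single v n) = Finsupp.single (q.ov F v) n + Finsupp.single ((q.ov F v).conj q.σ) n := by
        ext w
        rw [jd_apply, Finsupp.add_apply, Finsupp.single_apply, Finsupp.single_apply, Finsupp.single_apply]
        by_cases hv : v = q.und w
        · rw [if_pos hv]
          have hne := q.split_ne (q.lies_ov v) h1
          rcases q.und_cases w with h | h
          · rw [← hv] at h
            subst h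
            rw [if_pos rfl, if_neg hne, add_zero]
          · rw [← hv] at h
            subst h
            rw [if_pos rfl, if_neg hne.symm, zero_add]
        · rw [if_neg hv, if_neg, if_neg, add_zero]
          · rintro rfl
            exact hv (q.und_eq (q.lies_conj (q.lies_ov v))).symm
          · rintro rfl
            exact hv (q.und_eq (q.lies_ov v)).symm
      rw [this, map_add, ddeg_single, ddeg_single, q.split_δ (q.lies_ov v) h1,
        q.split_δ (q.lies_conj (q.lies_ov v)) h1]
      ring
    · have : q.jd F (Finsupp.single v n) = Finsupp.single (q.ov F v) n := by
        ext w
        rw [jd_apply, Finsupp.single_apply, Finsupp.single_apply]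
        by_cases hv : v = q.und w
        · rw [if_pos hv]
          have hne := q.inert_conj (q.lies_ov v) h1 h2
          rcases q.und_cases w with h | h
          · rw [← hv] at h
            subst h
            rw [if_pos rfl]
          · rw [← hv, hne] at h
            subst h
            rw [if_pos rfl]
        · rw [if_neg hv, if_neg]
          rintro rfl
          exact hv (q.und_eq (q.lies_ov v)).symm
      rw [this, ddeg_single, q.inert_δ (q.lies_ov v) h1 h2]
      push_cast; ring

lemma jd_dv (hc : c ∈ Cst F K) (x : K) : q.jd F (dv F x) = dv F (q.f x) := by
  ext w
  rw [jd_apply, dv_apply, dv_apply, q.c_ord_f hc (q.lies_und w)]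

variable (F) in
/-- norm of divisors -/
noncomputable def nd : Dv F L →+ Dv F K :=
  (Finsupp.comapDomain.addMonoidHom (q.ov_inj (F := F))).comp (AddMonoidHom.id _ + q.sd F)

lemma nd_apply (D : Dv F L) (v : Place F K) : q.nd F D v = D (q.ov F v) + D ((q.ov F v).conj q.σ) := by
  rw [← sd_apply]; rfl

lemma jd_inv {D : Dv F L} (hD : q.sd F D = D) : q.jd F (D.comapDomain (q.ov F) (q.ov_inj (F := F)).injOn) = D := by
  ext w
  rw [jd_apply, Finsupp.comapDomain_apply]
  rcases q.und_cases w with h | h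
  · rw [← h]
  · conv_rhs => rw [h, ← sd_apply, hD]

lemma jd_inj {D E : Dv F K} (h : q.jd F D = q.jd F E) : D = E := by
  ext v
  have := DFunLike.congr_fun h (q.ov F v)
  rwa [jd_apply, jd_apply, q.und_eq (q.lies_ov v)] at this

lemma jd_nd (D : Dv F L) : q.jd F (q.nd F D) = D + q.sd F D := by
  refine q.jd_inv (D := D + q.sd F D) ?_
  ext w
  rw [sd_apply, Finsupp.add_apply, Finsupp.add_apply, sd_apply, sd_apply, q.conj_conj, add_comm]

lemma sd_jd (D : Dv F K) : q.sd F (q.jd F D) = q.jd F D := by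
  ext w
  rw [sd_apply, jd_apply, jd_apply, q.und_eq (q.lies_conj (q.lies_und w))]

lemma ddeg_nd (hc : c ∈ Cst F K) (D : Dv F L) : ddeg (q.nd F D) = ddeg D := by
  have := q.ddeg_jd hc (q.nd F D)
  rw [jd_nd, map_add, q.ddeg_sd hc] at this
  omega

lemma nd_dv (hc : c ∈ Cst F K) {z : L} (hz : z ≠ 0) : q.nd F (dv F z) = dv F (q.N z) := by
  apply q.jd_inj
  rw [jd_nd, q.jd_dv hc, f_N, dv_mul hz (q.σ_ne hz), sd_dv]

lemma nd_sd (D : Dv F L) : q.nd F (q.sd F D) = q.nd F D := by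
  ext v
  rw [nd_apply, nd_apply, sd_apply, sd_apply, q.conj_conj, add_comm]

/-- a divisor with even entries at odd places is a norm -/
lemma exists_nd (hc : c ∈ Cst F K) (D : Dv F K) (hD : ∀ v : Place F K, v.sy.r c = 1 → Even (D v)) :
    ∃ E : Dv F L, q.nd F E = D := by
  classical
  let g : Place F K → ℤ := fun v => if v.sy.r c = 1 then D v / 2 else D v
  let D' : Dv F K := Finsupp.ofSupportFinite g (D.support.finite_toSet.subset fun v hv => by
    simp only [Finset.mem_coe, Finsupp.mem_support_iff]
    intro h
    apply hv
    simp [g, h])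
  refine ⟨D'.mapDomain (q.ov F), ?_⟩
  ext v
  rw [nd_apply, Finsupp.mapDomain_apply q.ov_inj]
  have hg : D' v = g v := rfl
  rcases q.c_cases hc v with h1 | ⟨h1, h2⟩
  · have h0 := (c_sq hc v).1 h1
    rw [Finsupp.mapDomain_of_notMem_range, hg]
    · simp [g, h0]
    · rintro ⟨v', h⟩
      have : v' = v := (q.lies_ov v').unique (by rw [h]; exact q.lies_conj (q.lies_ov v))
      subst this
      exact q.split_ne (q.lies_ov v') h1 h.symm
  · rw [q.inert_conj (q.lies_ov v) h1 h2, Finsupp.mapDomain_apply q.ov_inj, hg]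
    have h3 : v.sy.r c = 1 := h2
    obtain ⟨k, hk⟩ := hD v h3
    simp only [g, h3, if_true]
    omega

lemma hilbert90 {g : L} (hg : q.N g = 1) : ∃ h : L, h ≠ 0 ∧ g * q.σ h = h := by
  have h1 : g * q.σ g = 1 := by rw [← f_N, hg, map_one]
  by_cases h : g = -1
  · exact ⟨q.s, q.s_ne, by rw [q.σs, h]; ring⟩
  · refine ⟨1 + g, fun h' => h (by linear_combination h'), ?_⟩
    rw [map_add, map_one]
    linear_combination h1

theorem N1 (hc : c ∈ Cst F K) {x : K} (hx : x ≠ 0) (hev : ∀ v : Place F K, v.sy.r c = 1 → Even (v.ord x)) :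
    ∃ z : L, q.N z = x := by
  obtain ⟨D, hD⟩ := q.exists_nd hc (dv F x) hev
  have hD0 : D ∈ (ddeg (F := F) (L := L)).ker := by
    rw [AddMonoidHom.mem_ker, ← q.ddeg_nd hc, hD, ddeg_dv]
  let s : (ddeg (F := F) (L := L)).ker →+ (ddeg (F := F) (L := L)).ker :=
    ((q.sd F).comp (ddeg (F := F) (L := L)).ker.subtype).codRestrict _ (by
      intro y
      change ddeg (q.sd F y) = 0
      rw [q.ddeg_sd hc]; exact y.2)
  let n : (ddeg (F := F) (L := L)).ker →+ (ddeg (F := F) (L := K)).ker :=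
    ((q.nd F).comp (ddeg (F := F) (L := L)).ker.subtype).codRestrict _ (by
      intro y
      change ddeg (q.nd F y) = 0
      rw [q.ddeg_nd hc]; exact y.2)
  let j : (ddeg (F := F) (L := K)).ker →+ (ddeg (F := F) (L := L)).ker :=
    ((q.jd F).comp (ddeg (F := F) (L := K)).ker.subtype).codRestrict _ (by
      intro y
      change ddeg (q.jd F y) = 0
      rw [q.ddeg_jd hc, show ddeg (y : Dv F K) = 0 from y.2, mul_zero])
  have key := cnt (PD F L) (PD F K) s n j ?_ ?_ ?_ ?_ ?_ ?_ (x := ⟨D, hD0⟩) ?_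
  · obtain ⟨y, z, hz, hy⟩ := key
    have hy' : D - ((y : Dv F L) - q.sd F y) = dv F z := hy
    have h1 : D = (y : Dv F L) - q.sd F y + dv F z := by rw [← hy']; abel
    have h2 : dv F x = dv F (q.N z) := by
      rw [← hD, h1, map_add, map_sub, nd_sd, sub_self, zero_add, q.nd_dv hc hz]
    have h3 : dv F (x * (q.N z)⁻¹) = 0 := by
      rw [dv_mul hx (inv_ne_zero (q.N_ne hz)), dv_inv, h2, add_neg_cancel]
    obtain ⟨η, -, hη⟩ := q.cst_norm hc (mem_Cst.2 (dv_eq_zero.1 h3))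
    refine ⟨η * z, ?_⟩
    rw [N_mul, hη]
    have := q.N_ne hz
    field_simp
  · rintro y ⟨z, hz, hy⟩
    exact ⟨q.σ z, q.σ_ne hz, by change q.sd F y = _; rw [hy, sd_dv]⟩
  · rintro y ⟨z, hz, hy⟩
    exact ⟨q.N z, q.N_ne hz, by change q.nd F y = _; rw [hy, q.nd_dv hc hz]⟩
  · rintro y ⟨z, hz, hy⟩
    exact ⟨q.f z, q.f_ne hz, by change q.jd F y = _; rw [hy, q.jd_dv hc]⟩
  · intro y
    obtain ⟨f, hf, hfe⟩ := C1 hc q.not_sq (y : Dv F K) y.2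
    obtain ⟨E, hE⟩ := q.exists_nd hc _ hfe
    refine ⟨⟨E, ?_⟩, f, hf, ?_⟩
    · rw [AddMonoidHom.mem_ker, ← q.ddeg_nd hc, hE, map_add, ddeg_dv, add_zero]; exact y.2
    · change q.nd F E - (y : Dv F K) = _
      rw [hE]; abel
  · rintro y ⟨g, hg, hy⟩
    have hy' : (y : Dv F L) - q.sd F y = dv F g := hy
    have h1 : dv F (q.N g) = 0 := by
      rw [← q.nd_dv hc hg, ← hy', map_sub, nd_sd, sub_self]
    obtain ⟨η, hη, hη2⟩ := q.cst_norm hc (mem_Cst.2 (dv_eq_zero.1 h1))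
    have hη0 : η ≠ 0 := by
      rintro rfl
      have := q.N_ne hg
      rw [← hη2] at this
      apply this
      have := q.N_f 0
      rw [map_zero] at this
      rw [this]; ring
    have hN : q.N (g * η⁻¹) = 1 := by
      have h3 : q.N (g * η⁻¹) * q.N η = q.N g := by rw [← N_mul]; congr 1; field_simp
      rw [hη2] at h3
      exact mul_right_cancel₀ (q.N_ne hg) (by rw [h3, one_mul])
    obtain ⟨h, hh, hh2⟩ := q.hilbert90 hN
    have h4 : dv F h = dv F g + q.sd F (dv F h) := by
      conv_lhs => rw [← hh2]
      rw [dv_mul (mul_ne_zero hg (inv_ne_zero hη0)) (q.σ_ne hh), dv_mul hg (inv_ne_zero hη0), dv_inv,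
        dv_of_alg (mem_Cst.1 hη), sd_dv]
      simp
    have h5 : q.sd F ((y : Dv F L) - dv F h) = y - dv F h := by
      rw [map_sub]
      rw [← hy'] at h4
      have : q.sd F (dv F h) = dv F h - (y - q.sd F y) := by rw [eq_sub_iff_add_eq, add_comm]; exact h4.symm
      rw [this]; abel
    obtain ⟨B, h6⟩ : ∃ B, q.jd F B = (y : Dv F L) - dv F h := ⟨_, q.jd_inv h5⟩
    have hB : ddeg B = 0 := by
      have := q.ddeg_jd hc B
      rw [h6, map_sub, ddeg_dv, show ddeg (y : Dv F L) = 0 from y.2] at this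
      omega
    refine ⟨⟨B, hB⟩, h, hh, ?_⟩
    change (y : Dv F L) - q.jd F B = _
    rw [h6]; abel
  · intro y
    apply Subtype.ext
    change q.nd F (q.sd F y) = q.nd F y
    exact q.nd_sd _
  · exact ⟨x, hx, hD⟩

end QE
end GFF
end PD3

section PE1
namespace GFF
set_option linter.unusedSectionVars false
set_option linter.unusedVariables false
set_option linter.unnecessarySimpa false
open IntermediateField Polynomial

/-- systems of quadrics have nontrivial zeros -/
def Solver (k : Type*) [Field k] (ρ : ℕ) : Prop :=
  ∀ (σ ι : Type) [Fintype σ] [Fintype ι] (Q : ι → MvPolynomial σ k), (∀ i, (Q i).IsHomogeneous 2) →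
    ρ * Fintype.card ι < Fintype.card σ → ∃ x : σ → k, x ≠ 0 ∧ ∀ i, MvPolynomial.eval x (Q i) = 0

lemma hom_eval_zero {k σ : Type*} [Field k] {Q : MvPolynomial σ k} (h : Q.IsHomogeneous 2) :
    MvPolynomial.eval (0 : σ → k) Q = 0 := by
  rw [MvPolynomial.eval_zero]
  exact h.coeff_eq_zero (d := 0) (by simp)

lemma solver_finite (k : Type*) [Field k] [Finite k] : Solver k 2 := by
  classical
  intro σ ι _ _ Q hQ hc
  have := Fintype.ofFinite k
  obtain ⟨p, hp⟩ := CharP.exists k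
  have hpp : p.Prime := (CharP.char_is_prime_or_zero k p).resolve_right (CharP.char_ne_zero_of_finite k p)
  have h1 := char_dvd_card_solutions_of_fintype_sum_lt p (f := Q) (by
    refine lt_of_le_of_lt (Finset.sum_le_card_nsmul _ _ 2 fun i _ => (hQ i).totalDegree_le) ?_
    simp only [Finset.card_univ, smul_eq_mul]; omega)
  have h0 : ∀ i, MvPolynomial.eval (0 : σ → k) (Q i) = 0 := fun i => hom_eval_zero (hQ i)
  by_contra hcon
  push Not at hcon
  have h2 : Fintype.card {x : σ → k // ∀ i, MvPolynomial.eval x (Q i) = 0} = 1 := by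
    rw [Fintype.card_eq_one_iff]
    refine ⟨⟨0, h0⟩, fun y => Subtype.ext ?_⟩
    by_contra hy
    obtain ⟨i, hi⟩ := hcon y.1 hy
    exact hi (y.2 i)
  rw [h2] at h1
  exact hpp.one_lt.ne' (Nat.dvd_one.1 h1)

section
variable {k σ : Type*} [Field k]
open Classical in
/-- set some variables to zero -/
noncomputable def zr (k : Type*) [Field k] (s : Finset σ) : MvPolynomial σ k →ₐ[k] MvPolynomial σ k :=
  MvPolynomial.aeval fun i => if i ∈ s then 0 else MvPolynomial.X i

lemma zr_height (s : Finset σ) : (s.card : ℕ∞) ≤ (RingHom.ker (zr k s)).height := by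
  classical
  induction s using Finset.induction_on with
  | empty => simp
  | insert a s ha ih =>
    rw [Finset.card_insert_of_notMem ha]
    have hlt : RingHom.ker (zr k s) < RingHom.ker (zr k (insert a s)) := by
      rw [SetLike.lt_iff_le_and_exists]
      have hcomp : (zr k (insert a s)) = (zr k (insert a s)).comp (zr k s) := by
        apply MvPolynomial.algHom_ext
        intro i
        by_cases hi : i ∈ s
        · simp [zr, hi]
        · simp [zr, hi]
      refine ⟨fun x hx => ?_, MvPolynomial.X a, ?_, ?_⟩
      · rw [RingHom.mem_ker] at hx ⊢
        rw [hcomp, AlgHom.comp_apply, hx, map_zero]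
      · rw [RingHom.mem_ker]; simp [zr]
      · rw [RingHom.mem_ker]; simp [zr, ha]
    have h1 : (RingHom.ker (zr k s)).IsPrime := RingHom.ker_isPrime _
    have h2 : (RingHom.ker (zr k (insert a s))).IsPrime := RingHom.ker_isPrime _
    have := Ideal.height_add_one_le_of_lt_of_isPrime hlt
    push_cast
    exact le_trans (by gcongr) this
end

lemma solver_closed (k : Type*) [Field k] [IsAlgClosed k] : Solver k 1 := by
  classical
  intro σ ι _ _ Q hQ hc
  by_contra hcon
  push Not at hcon
  have h0 : ∀ i, MvPolynomial.eval (0 : σ → k) (Q i) = 0 := fun i => hom_eval_zero (hQ i)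
  set I : Ideal (MvPolynomial σ k) := Ideal.span (Set.range Q)
  have hz : MvPolynomial.zeroLocus k I = {0} := by
    ext x
    rw [MvPolynomial.zeroLocus_span]
    constructor
    · intro hx
      by_contra hx0
      obtain ⟨i, hi⟩ := hcon x hx0
      exact hi (by simpa [MvPolynomial.aeval_eq_eval] using hx (Q i) ⟨i, rfl⟩)
    · rintro rfl
      rintro _ ⟨i, rfl⟩
      simpa [MvPolynomial.aeval_eq_eval] using h0 i
  have hr := MvPolynomial.vanishingIdeal_zeroLocus_eq_radical (K := k) I
  rw [hz] at hr
  set m := MvPolynomial.vanishingIdeal k ({0} : Set (σ → k)) with hm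
  have hmem : ∀ f, f ∈ m ↔ MvPolynomial.eval (0 : σ → k) f = 0 := by
    intro f
    rw [hm, MvPolynomial.mem_vanishingIdeal_singleton_iff]
    simp
  have hmk : m = RingHom.ker (MvPolynomial.eval (0 : σ → k)) := by
    ext f; rw [hmem, RingHom.mem_ker]
  have hp : m.IsPrime := by rw [hmk]; exact RingHom.ker_isPrime _
  have hmin : m ∈ I.minimalPrimes := by
    rw [← Ideal.radical_minimalPrimes, ← hr, Ideal.minimalPrimes_eq_subsingleton_self]; rfl
  have h1 := Ideal.height_le_card_of_mem_minimalPrimes_span (Set.finite_range Q) hmin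
  have h2 : (Set.range Q).ncard ≤ Fintype.card ι := by
    rw [← Set.image_univ]
    refine (Set.ncard_image_le Set.finite_univ).trans ?_
    simp [Set.ncard_univ]
  have h3 : RingHom.ker (zr k (Finset.univ : Finset σ)) ≤ m := by
    intro f hf
    rw [hmem]
    rw [RingHom.mem_ker] at hf
    have e : (MvPolynomial.aeval (0 : σ → k)) = ((MvPolynomial.aeval (0 : σ → k)).comp (zr k (Finset.univ : Finset σ))) := by
      apply MvPolynomial.algHom_ext
      intro i
      simp [zr]
    have := DFunLike.congr_fun e f
    rw [AlgHom.comp_apply, hf, map_zero] at this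
    simpa [MvPolynomial.aeval_eq_eval] using this
  have h4 := (zr_height (k := k) (Finset.univ : Finset σ)).trans ((Ideal.height_mono h3).trans h1)
  rw [Finset.card_univ] at h4
  have h5 : Fintype.card σ ≤ (Set.range Q).ncard := by exact_mod_cast h4
  omega

/-- abstract linear algebra step -/
lemma solve_of_spaces {k K : Type*} [Field k] [Field K] [Algebra k K] {ρ : ℕ} (hs : Solver k ρ) {m n : ℕ}
    (a : Fin m → K) (v : Fin n → K) (hv : LinearIndependent k v) (W : Submodule k K) [FiniteDimensional k W]
    (hW : ∀ i j l, a i * (v j * v l) ∈ W) (hc : ρ * Module.finrank k W < m * n) :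
    ∃ x : Fin m → K, x ≠ 0 ∧ ∑ i, a i * x i ^ 2 = 0 := by
  classical
  let b := Module.finBasis k W
  let Q : Fin (Module.finrank k W) → MvPolynomial (Fin m × Fin n) k := fun s =>
    ∑ i, ∑ j, ∑ l, MvPolynomial.C (b.repr ⟨_, hW i j l⟩ s) * (MvPolynomial.X (i, j) * MvPolynomial.X (i, l))
  obtain ⟨x, hx0, hx⟩ := hs (Fin m × Fin n) (Fin (Module.finrank k W)) Q (by
    intro s
    refine MvPolynomial.IsHomogeneous.sum _ _ _ fun i _ => MvPolynomial.IsHomogeneous.sum _ _ _ fun j _ =>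
      MvPolynomial.IsHomogeneous.sum _ _ _ fun l _ => ?_
    have h1 := ((MvPolynomial.isHomogeneous_X k (i, j)).mul (MvPolynomial.isHomogeneous_X k (i, l)))
    have h2 := (MvPolynomial.isHomogeneous_C (Fin m × Fin n) (b.repr ⟨_, hW i j l⟩ s)).mul h1
    simpa using h2) (by simpa using hc)
  refine ⟨fun i => ∑ j, x (i, j) • v j, fun h => hx0 ?_, ?_⟩
  · funext ⟨i, j⟩
    have := congrFun h i
    exact Fintype.linearIndependent_iff.1 hv _ this j
  · have e : ∑ i, a i * (∑ j, x (i, j) • v j) ^ 2 =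
        ((∑ i, ∑ j, ∑ l, (x (i, j) * x (i, l)) • (⟨_, hW i j l⟩ : W) : W) : K) := by
      simp only [AddSubmonoidClass.coe_finsetSum, Submodule.coe_smul]
      refine Finset.sum_congr rfl fun i _ => ?_
      rw [pow_two, Finset.sum_mul_sum, Finset.mul_sum]
      refine Finset.sum_congr rfl fun j _ => ?_
      rw [Finset.mul_sum]
      refine Finset.sum_congr rfl fun l _ => ?_
      simp only [Algebra.smul_def, map_mul]; ring
    rw [e]
    have : (∑ i, ∑ j, ∑ l, (x (i, j) * x (i, l)) • (⟨_, hW i j l⟩ : W) : W) = 0 := by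
      apply b.repr.injective
      ext s
      rw [map_zero]
      have h1 := hx s
      simp only [Q, map_sum, map_mul, MvPolynomial.eval_C, MvPolynomial.eval_X] at h1
      simp only [map_sum, map_smul, Finsupp.finsetSum_apply, Finsupp.smul_apply, smul_eq_mul]
      rw [Finsupp.zero_apply, ← h1]
      refine Finset.sum_congr rfl fun i _ => Finset.sum_congr rfl fun j _ => Finset.sum_congr rfl fun l _ => ?_
      ring
    rw [this]; rfl

section
variable {k K : Type*} [Field k] [Field K] [Algebra k K]

/-- polynomials in `t` of bounded degree combined with `u` -/
def SN (k : Type*) {K : Type*} [Field k] [Field K] [Algebra k K] (t : K) {n : ℕ} (u : Fin n → K) (N : ℕ) :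
    Submodule k K := Submodule.span k (Set.range fun x : Fin (N + 1) × Fin n => t ^ (x.1 : ℕ) * u x.2)

instance (t : K) {n : ℕ} (u : Fin n → K) (N : ℕ) : FiniteDimensional k (SN k t u N) := by
  unfold SN; exact FiniteDimensional.span_of_finite k (Set.finite_range _)

lemma SN_finrank (t : K) {n : ℕ} (u : Fin n → K) (N : ℕ) : Module.finrank k (SN k t u N) ≤ (N + 1) * n := by
  unfold SN
  refine (finrank_range_le_card _).trans ?_
  simp

lemma SN_poly (t : K) {n : ℕ} (u : Fin n → K) {N : ℕ} {p : k[X]} (hp : p.natDegree ≤ N) (j : Fin n) :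
    aeval t p * u j ∈ SN k t u N := by
  rw [aeval_eq_sum_range, Finset.sum_mul]
  refine Submodule.sum_mem _ fun i hi => ?_
  rw [smul_mul_assoc]
  refine Submodule.smul_mem _ _ (Submodule.subset_span ⟨(⟨i, ?_⟩, j), rfl⟩)
  have := Finset.mem_range.1 hi; omega

lemma SN_pow {t : K} {n : ℕ} {u : Fin n → K} {N : ℕ} (s : ℕ) {z : K} (hz : z ∈ SN k t u N) :
    t ^ s * z ∈ SN k t u (N + s) := by
  induction hz using Submodule.span_induction with
  | mem x h =>
    obtain ⟨⟨i, j⟩, rfl⟩ := h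
    refine Submodule.subset_span ⟨(⟨i + s, by omega⟩, j), ?_⟩
    simp only
    ring
  | zero => simp
  | add x y _ _ hx hy => rw [mul_add]; exact Submodule.add_mem _ hx hy
  | smul c x _ hx => rw [mul_smul_comm]; exact Submodule.smul_mem _ _ hx

lemma SN_mono {t : K} {n : ℕ} {u : Fin n → K} {N M : ℕ} (h : N ≤ M) : SN k t u N ≤ SN k t u M := by
  refine Submodule.span_mono ?_
  rintro _ ⟨⟨i, j⟩, rfl⟩
  exact ⟨(⟨i, by omega⟩, j), rfl⟩

lemma SN_mul_poly {t : K} {n : ℕ} {u : Fin n → K} {N : ℕ} (p : k[X]) {z : K} (hz : z ∈ SN k t u N) :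
    aeval t p * z ∈ SN k t u (N + p.natDegree) := by
  rw [aeval_eq_sum_range, Finset.sum_mul]
  refine Submodule.sum_mem _ fun i hi => ?_
  rw [smul_mul_assoc]
  refine Submodule.smul_mem _ _ (SN_mono ?_ (SN_pow i hz))
  have := Finset.mem_range.1 hi; omega

lemma exists_den [FF k K] {t : K} (ht : Transcendental k t) {n : ℕ} (hn : ndeg k t ≤ n) {u : Fin n → K}
    (hu : ∀ p : Fin n → k[X], ∑ i, aeval t (p i) * u i = 0 → p = 0) {τ : Type*} (S : Finset τ) (z : τ → K) :
    ∃ (D : k[X]) (e : ℕ), D ≠ 0 ∧ ∀ i ∈ S, aeval t D * z i ∈ SN k t u e := by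
  classical
  induction S using Finset.induction_on with
  | empty => exact ⟨1, 0, one_ne_zero, by simp⟩
  | insert a S ha ih =>
    obtain ⟨D, e, hD, hDe⟩ := ih
    obtain ⟨p, hp0, hp⟩ := exists_dep ht (Nat.lt_succ_of_le hn) (Fin.cons (z a) u)
    rw [Fin.sum_univ_succ] at hp
    simp only [Fin.cons_zero, Fin.cons_succ] at hp
    have hpz : p 0 ≠ 0 := by
      intro h
      rw [h, map_zero, zero_mul, zero_add] at hp
      apply hp0
      have := hu _ hp
      funext i
      refine Fin.cases h (fun i => ?_) i
      exact congrFun this i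
    have h1 : aeval t (p 0) * z a ∈ SN k t u (∑ i, (p i).natDegree) := by
      rw [eq_neg_of_add_eq_zero_left hp]
      refine Submodule.neg_mem _ (Submodule.sum_mem _ fun i _ => SN_poly t u ?_ i)
      exact Finset.single_le_sum (f := fun i => (p i).natDegree) (fun _ _ => Nat.zero_le _) (Finset.mem_univ _)
    refine ⟨D * p 0, (e + (p 0).natDegree) + ((∑ i, (p i).natDegree) + D.natDegree), mul_ne_zero hD hpz, ?_⟩
    intro i hi
    rcases Finset.mem_insert.1 hi with rfl | hi
    · rw [map_mul, mul_assoc]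
      exact SN_mono (by omega) (SN_mul_poly D h1)
    · rw [map_mul, mul_comm (aeval t D), mul_assoc]
      exact SN_mono (by omega) (SN_mul_poly (p 0) (hDe i hi))

theorem tsen [FF k K] {ρ : ℕ} (hs : Solver k ρ) {m : ℕ} (hm : 2 * ρ < m) (a : Fin m → K) :
    ∃ x : Fin m → K, x ≠ 0 ∧ ∑ i, a i * x i ^ 2 = 0 := by
  classical
  obtain ⟨t, ht⟩ := FF.exists_tr (F := k) (L := K)
  have := FF.findim t ht
  obtain ⟨n, hnn, hn, u, hu⟩ : ∃ n : ℕ, ndeg k t ≤ n ∧ 0 < n ∧ ∃ u : Fin n → K,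
      ∀ p : Fin n → k[X], ∑ i, aeval t (p i) * u i = 0 → p = 0 :=
    ⟨_, le_rfl, Module.finrank_pos, exists_indep (F := k) ht⟩
  obtain ⟨D, e, hD, hDe⟩ := exists_den ht hnn hu (Finset.univ : Finset (Fin m × Fin n × Fin n))
    (fun x => a x.1 * (u x.2.1 * u x.2.2))
  have hD' : aeval t D ≠ 0 := fun h => hD ((transcendental_iff.1 ht) D h)
  let N := ρ * e
  let ε := finProdFinEquiv (m := N + 1) (n := n)
  have hli : LinearIndependent k (fun x : Fin (N + 1) × Fin n => t ^ (x.1 : ℕ) * u x.2) := by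
    rw [Fintype.linearIndependent_iff]
    intro g hg
    let p : Fin n → k[X] := fun j => ∑ i : Fin (N + 1), C (g (i, j)) * X ^ (i : ℕ)
    have h1 : p = 0 := by
      apply hu
      rw [← hg, Fintype.sum_prod_type, Finset.sum_comm]
      refine Finset.sum_congr rfl fun j _ => ?_
      simp only [p, map_sum, map_mul, aeval_C, map_pow, aeval_X, Finset.sum_mul]
      refine Finset.sum_congr rfl fun i _ => ?_
      rw [Algebra.smul_def]; ring
    rintro ⟨i, j⟩
    have h2 := congrArg (fun P => coeff P (i : ℕ)) (congrFun h1 j)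
    simp only [p, Pi.zero_apply, coeff_zero, finsetSum_coeff, coeff_C_mul, coeff_X_pow] at h2
    simpa [Fin.val_inj] using h2
  obtain ⟨x, hx0, hx⟩ := solve_of_spaces hs (fun i => aeval t D * a i) (fun y => t ^ ((ε.symm y).1 : ℕ) * u (ε.symm y).2)
    (hli.comp _ ε.symm.injective) (SN k t u (e + 2 * N)) (by
      intro i j l
      have h1 := SN_pow ((ε.symm j).1 + (ε.symm l).1) (hDe (i, (ε.symm j).2, (ε.symm l).2) (Finset.mem_univ _))
      have e1 : aeval t D * a i * (t ^ ((ε.symm j).1 : ℕ) * u (ε.symm j).2 * (t ^ ((ε.symm l).1 : ℕ) * u (ε.symm l).2))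
          = t ^ (((ε.symm j).1 : ℕ) + (ε.symm l).1) * (aeval t D * (a i * (u (ε.symm j).2 * u (ε.symm l).2))) := by
        rw [pow_add]; ring
      rw [e1]
      exact SN_mono (by omega) h1) (by
      have h1 := SN_finrank (k := k) t u (e + 2 * N)
      have h2 : ρ * ((e + 2 * N) + 1) < m * (N + 1) := by
        simp only [N]
        have : (2 * ρ + 1) * (ρ * e + 1) ≤ m * (ρ * e + 1) := Nat.mul_le_mul_right _ hm
        nlinarith
      calc _ ≤ ρ * ((e + 2 * N + 1) * n) := Nat.mul_le_mul_left _ h1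
        _ = ρ * ((e + 2 * N) + 1) * n := by ring
        _ < m * (N + 1) * n := Nat.mul_lt_mul_of_pos_right h2 hn
        _ = _ := by ring)
  refine ⟨x, hx0, ?_⟩
  have : aeval t D * ∑ i, a i * x i ^ 2 = 0 := by
    rw [← hx, Finset.mul_sum]
    refine Finset.sum_congr rfl fun i _ => by ring
  exact (mul_eq_zero.1 this).resolve_left hD'

end
end GFF
end PE1

section PE2
namespace GFF
set_option linter.unusedSectionVars false
set_option linter.unusedVariables false
set_option linter.unnecessarySimpa false
open IntermediateField Polynomial

lemma FF_adjoin {k Ω : Type*} [Field k] [Field Ω] [Algebra k Ω] {t : Ω} (ht : Transcendental k t) : FF k k⟮t⟯ := by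
  have ht' : Transcendental k (AdjoinSimple.gen k t) := by
    rw [← transcendental_algebraMap_iff (A := Ω) (algebraMap k⟮t⟯ Ω).injective]
    exact ht
  refine FF.of_finite _ ht' ?_
  have htop : ∀ y : k⟮t⟯, y ∈ k⟮AdjoinSimple.gen k t⟯ := by
    rintro ⟨y, hy⟩
    have h1 : y ∈ (k⟮AdjoinSimple.gen k t⟯).map (k⟮t⟯).val := by
      rw [adjoin_map, Set.image_singleton]
      exact hy
    obtain ⟨z, hz, h⟩ := h1
    have : z = ⟨y, hy⟩ := Subtype.ext h
    exact this ▸ hz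
  refine ⟨⟨{1}, ?_⟩⟩
  rw [eq_top_iff]
  intro y _
  have : y = (⟨y, htop y⟩ : k⟮AdjoinSimple.gen k t⟯) • (1 : k⟮t⟯) := by
    rw [Algebra.smul_def, mul_one]; rfl
  rw [this]
  exact Submodule.smul_mem _ _ (Submodule.subset_span (by simp))

universe u
variable {F : Type*} {K : Type u} [Field F] [Finite F] [Field K] [Algebra F K] [FF F K]

/-- Tsen: every ternary form becomes isotropic over a constant extension -/
lemma exists_const_split (a b c : K) : ∃ ζ : AlgebraicClosure K, IsAlgebraic F ζ ∧
    ∃ X Y Z : K⟮ζ⟯, ¬ (X = 0 ∧ Y = 0 ∧ Z = 0) ∧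
      algebraMap K K⟮ζ⟯ a * X ^ 2 + algebraMap K K⟮ζ⟯ b * Y ^ 2 + algebraMap K K⟮ζ⟯ c * Z ^ 2 = 0 := by
  classical
  let Ω := AlgebraicClosure K
  let Fb := algebraicClosure F Ω
  have hcl : IsAlgClosed Fb := (algebraicClosure.isAlgClosure F Ω).isAlgClosed
  obtain ⟨t, ht⟩ := FF.exists_tr (F := F) (L := K)
  have hfin := FF.findim t ht
  let t' : Ω := algebraMap K Ω t
  have ht1 : Transcendental F t' := (transcendental_algebraMap_iff (algebraMap K Ω).injective).2 ht
  have ht2 : Transcendental Fb t' := by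
    intro h
    exact ht1 (h.restrictScalars F)
  have := FF_adjoin ht2
  let E := Fb⟮t'⟯
  obtain ⟨s, hs⟩ := (Module.finite_def (R := F⟮t⟯) (M := K)).1 inferInstance
  have hFt : ∀ y ∈ F⟮t⟯, algebraMap K Ω y ∈ E := by
    intro y hy
    have h1 : algebraMap K Ω y ∈ (F⟮t⟯).map (IsScalarTower.toAlgHom F K Ω) := ⟨y, hy, rfl⟩
    rw [adjoin_map, Set.image_singleton] at h1
    have h2 : adjoin F {(IsScalarTower.toAlgHom F K Ω) t} ≤ E.restrictScalars F := by
      rw [adjoin_le_iff]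
      rintro _ rfl
      exact mem_adjoin_simple_self Fb t'
    exact h2 h1
  let M := adjoin E (algebraMap K Ω '' (s : Set K))
  have hKM : ∀ y : K, algebraMap K Ω y ∈ M := by
    intro y
    have hy : y ∈ Submodule.span F⟮t⟯ (s : Set K) := by rw [hs]; trivial
    induction hy using Submodule.span_induction with
    | mem x h => exact subset_adjoin _ _ ⟨x, h, rfl⟩
    | zero => rw [map_zero]; exact zero_mem _
    | add x y _ _ hx hy => rw [map_add]; exact add_mem hx hy
    | smul c x _ hx =>
      have : c • x = (c : K) * x := rfl
      rw [this, map_mul]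
      exact mul_mem (M.algebraMap_mem ⟨_, hFt c c.2⟩) hx
  have hKalg : ∀ y : K, IsIntegral E (algebraMap K Ω y) := by
    intro y
    have h1 : IsAlgebraic F⟮t⟯ y := Algebra.IsAlgebraic.isAlgebraic y
    let φ : F⟮t⟯ →+* E := ((algebraMap K Ω).comp (algebraMap F⟮t⟯ K)).codRestrict E.toSubring (fun x => hFt x x.2)
    obtain ⟨p, hp, hp2⟩ := h1.isIntegral
    refine ⟨p.map φ, hp.map φ, ?_⟩
    rw [eval₂_map]
    have : (algebraMap E Ω).comp φ = (algebraMap K Ω).comp (algebraMap F⟮t⟯ K) := by ext x; rfl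
    rw [this, ← hom_eval₂, hp2, map_zero]
  have hMfin : FiniteDimensional E M := by
    refine finiteDimensional_adjoin (S := algebraMap K Ω '' (s : Set K)) ?_
    rintro _ ⟨y, -, rfl⟩
    exact hKalg y
  have hFF : FF Fb M := FF.of_extension (K := E)
  obtain ⟨x, hx0, hx⟩ := tsen (K := M) (solver_closed Fb) (m := 3) (by norm_num)
    ![⟨_, hKM a⟩, ⟨_, hKM b⟩, ⟨_, hKM c⟩]
  have hM : ∀ y : M, (y : Ω) ∈ adjoin K (Fb : Set Ω) := by
    have hE : ∀ y ∈ E, y ∈ adjoin K (Fb : Set Ω) := by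
      intro y hy
      induction hy using adjoin_induction with
      | mem x h => rw [Set.mem_singleton_iff.1 h]; exact (adjoin K (Fb : Set Ω)).algebraMap_mem t
      | algebraMap x => exact subset_adjoin _ _ x.2
      | add x y _ _ hx hy => exact add_mem hx hy
      | inv x _ hx => exact inv_mem hx
      | mul x y _ _ hx hy => exact mul_mem hx hy
    rintro ⟨y, hy⟩
    simp only
    induction hy using adjoin_induction with
    | mem x h => obtain ⟨x, -, rfl⟩ := h; exact (adjoin K (Fb : Set Ω)).algebraMap_mem x
    | algebraMap x => exact hE _ x.2
    | add x y _ _ hx hy => exact add_mem hx hy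
    | inv x _ hx => exact inv_mem hx
    | mul x y _ _ hx hy => exact mul_mem hx hy
  choose T hT1 hT2 using fun i => exists_finset_of_mem_adjoin (hM (x i))
  let T' : Finset Ω := Finset.univ.biUnion T
  have hTalg : ∀ y ∈ T', IsAlgebraic F y := by
    intro y hy
    obtain ⟨i, -, hi⟩ := Finset.mem_biUnion.1 hy
    exact mem_algebraicClosure_iff.1 (hT1 i hi)
  have hfd : FiniteDimensional F (adjoin F (T' : Set Ω)) :=
    finiteDimensional_adjoin fun y hy => (hTalg y hy).isIntegral
  obtain ⟨ζ, hζ⟩ := Field.exists_primitive_element_of_finite_bot F (adjoin F (T' : Set Ω))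
  refine ⟨(ζ : Ω), ?_, ?_⟩
  · exact (isAlgebraic_algebraMap_iff (algebraMap (adjoin F (T' : Set Ω)) Ω).injective).2
      (Algebra.IsAlgebraic.isAlgebraic ζ)
  · have hsub : ∀ y ∈ adjoin F (T' : Set Ω), y ∈ K⟮(ζ : Ω)⟯ := by
      intro y hy
      have h1 : (⟨y, hy⟩ : adjoin F (T' : Set Ω)) ∈ F⟮ζ⟯ := by rw [hζ]; trivial
      have h2 : y ∈ (F⟮ζ⟯).map (adjoin F (T' : Set Ω)).val := ⟨_, h1, rfl⟩
      rw [adjoin_map, Set.image_singleton] at h2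
      have h3 : adjoin F {(adjoin F (T' : Set Ω)).val ζ} ≤ (K⟮(ζ : Ω)⟯).restrictScalars F := by
        rw [adjoin_le_iff]
        rintro _ rfl
        exact mem_adjoin_simple_self K (ζ : Ω)
      exact h3 h2
    have hx' : ∀ i, (x i : Ω) ∈ K⟮(ζ : Ω)⟯ := by
      intro i
      have h1 : adjoin K (T i : Set Ω) ≤ K⟮(ζ : Ω)⟯ := by
        rw [adjoin_le_iff]
        intro y hy
        exact hsub y (subset_adjoin _ _ (Finset.mem_biUnion.2 ⟨i, Finset.mem_univ _, hy⟩))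
      exact h1 (hT2 i)
    refine ⟨⟨_, hx' 0⟩, ⟨_, hx' 1⟩, ⟨_, hx' 2⟩, ?_, ?_⟩
    · rintro ⟨h0, h1, h2⟩
      apply hx0
      funext i
      apply Subtype.ext
      fin_cases i
      · change (x 0 : Ω) = 0
        exact congrArg Subtype.val h0
      · change (x 1 : Ω) = 0
        exact congrArg Subtype.val h1
      · change (x 2 : Ω) = 0
        exact congrArg Subtype.val h2
    · apply Subtype.ext
      have := congrArg Subtype.val hx
      rw [Fin.sum_univ_three] at this
      exact this

end GFF
end PE2

section PE3
namespace GFF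
set_option linter.unusedSectionVars false
set_option linter.unusedVariables false
set_option linter.unnecessarySimpa false
open IntermediateField Polynomial

section forms3
variable {K : Type*} [Field K]

lemma norm_of_sq (h2 : (2 : K) ≠ 0) {a t : K} (ht : t ≠ 0) (ha : a = t ^ 2) (b : K) :
    ∃ u w, b = u ^ 2 - a * w ^ 2 := by
  refine ⟨(b + 1) / 2, (b - 1) / (2 * t), ?_⟩
  subst ha
  field_simp
  ring

lemma norm_div {a b p q x y : K} (hN : p ^ 2 - a * q ^ 2 ≠ 0)
    (h : b * (p ^ 2 - a * q ^ 2) = x ^ 2 - a * y ^ 2) : ∃ u w, b = u ^ 2 - a * w ^ 2 := by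
  refine ⟨(x * p - a * y * q) / (p ^ 2 - a * q ^ 2), (x * q - y * p) / (p ^ 2 - a * q ^ 2), ?_⟩
  have : b = (x ^ 2 - a * y ^ 2) / (p ^ 2 - a * q ^ 2) := by rw [← h]; field_simp
  rw [this]
  field_simp
  ring

/-- if a norm form vanishes nontrivially then `a` is a square -/
lemma sq_of_norm_zero {a Y Z : K} (ha : a ≠ 0) (h : Y ^ 2 - a * Z ^ 2 = 0) (hn : ¬ (Y = 0 ∧ Z = 0)) :
    ∃ t, t ≠ 0 ∧ a = t ^ 2 := by
  have hZ : Z ≠ 0 := by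
    rintro rfl
    apply hn
    simpa using h
  refine ⟨Y / Z, ?_, ?_⟩
  · refine div_ne_zero ?_ hZ
    rintro rfl
    have : a * Z ^ 2 = 0 := by linear_combination -h
    exact mul_ne_zero ha (pow_ne_zero 2 hZ) this
  · field_simp
    linear_combination -h

lemma norm_of_rep (h2 : (2 : K) ≠ 0) {a b : K} (ha : a ≠ 0) (hr : Rep a b 1) :
    ∃ u w, b = u ^ 2 - a * w ^ 2 := by
  obtain ⟨X, Y, Z, h⟩ := hr
  by_cases hN : Y ^ 2 - a * Z ^ 2 = 0
  · by_cases h0 : Y = 0 ∧ Z = 0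
    · obtain ⟨rfl, rfl⟩ := h0
      obtain ⟨t, ht, h'⟩ := sq_of_norm_zero (Y := 1) (Z := X) ha (by linear_combination h) (by simp)
      exact norm_of_sq h2 ht h' b
    · obtain ⟨t, ht, h'⟩ := sq_of_norm_zero ha hN h0
      exact norm_of_sq h2 ht h' b
  · refine norm_div hN (x := 1) (y := X) ?_
    linear_combination -h

/-- the slot lemma, with descent of splitting -/
lemma rep_back (h2 : (2 : K) ≠ 0) {a b d : K} (ha : a ≠ 0) (hb : b ≠ 0) (hd : d ≠ 0) (hr : Rep a b d) :
    ∃ f, f ≠ 0 ∧ (∀ S : LSym K, S.h d f = S.h a b) ∧ (Rep d f 1 → Rep a b 1) := by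
  obtain ⟨X, Y, Z, h⟩ := hr
  by_cases hN : Y ^ 2 - a * Z ^ 2 = 0
  · by_cases h0 : Y = 0 ∧ Z = 0
    · obtain ⟨rfl, rfl⟩ := h0
      have hX : X ≠ 0 := by
        rintro rfl
        apply hd
        rw [h]; ring
      have hd' : d = a * X ^ 2 := by rw [h]; ring
      refine ⟨b, hb, fun S => ?_, fun hR => ?_⟩
      · rw [hd', S.h_mul_left ha (pow_ne_zero 2 hX), S.h_of_sq_left (S.sq_sq hX), add_zero]
      · obtain ⟨u, w, h'⟩ := norm_of_rep h2 hd hR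
        refine rep_one_of_norm hb (x := u) (y := X * w) ?_
        rw [h', hd']; ring
    · obtain ⟨t, ht, h'⟩ := sq_of_norm_zero ha hN h0
      refine ⟨1, one_ne_zero, fun S => ?_, fun _ => ?_⟩
      · rw [S.h_one_right, h', S.h_of_sq_left (S.sq_sq ht)]
      · obtain ⟨u, w, h''⟩ := norm_of_sq h2 ht h' b
        exact rep_one_of_norm hb h''
  · set e := b * (Y ^ 2 - a * Z ^ 2) with he
    have he0 : e ≠ 0 := mul_ne_zero hb hN
    have hde : d = a * X ^ 2 + e := by rw [h, he]; ring
    refine ⟨-(a * e), neg_ne_zero.2 (mul_ne_zero ha he0), fun S => ?_, fun hR => ?_⟩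
    · by_cases hX : X = 0
      · have : d = e := by rw [hde, hX]; ring
        rw [this, show -(a * e) = a * (-e) by ring, S.h_mul_right ha (neg_ne_zero.2 he0), S.h_neg_self he0, add_zero,
          S.h_comm, he, S.h_mul_right hb hN, S.h_norm ha hN, add_zero]
      · have h1 := S.h_add (a := a * X ^ 2) (e := e) (mul_ne_zero ha (pow_ne_zero 2 hX)) he0 (by rw [← hde]; exact hd)
        have h3 : S.h d (-(a * e)) = S.h a e := by
          have hs := S.sq_sq hX
          have hX2 := pow_ne_zero 2 hX
          rw [← hde] at h1
          have e1 : S.h (a * X ^ 2) e = S.h a e := by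
            rw [S.h_mul_left ha hX2, S.h_of_sq_left hs, add_zero]
          have e2 : S.h d (-(a * X ^ 2 * e)) = S.h d (-(a * e)) := by
            rw [show -(a * X ^ 2 * e) = -(a * e) * X ^ 2 by ring,
              S.h_mul_right (neg_ne_zero.2 (mul_ne_zero ha he0)) hX2, S.h_of_sq_right hs, add_zero]
          rw [← e2, ← e1, h1]
        rw [h3, he, S.h_mul_right hb hN, S.h_norm ha hN, add_zero]
    · obtain ⟨x, y, h'⟩ := norm_of_rep h2 hd hR
      have key : e * (y ^ 2 - a * 1 ^ 2) = x ^ 2 - a * (y * X) ^ 2 := by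
        linear_combination h' - y ^ 2 * hde
      by_cases hM : y ^ 2 - a * 1 ^ 2 = 0
      · obtain ⟨t, ht, h''⟩ := sq_of_norm_zero ha hM (by simp)
        obtain ⟨u, w, h''⟩ := norm_of_sq h2 ht h'' b
        exact rep_one_of_norm hb h''
      · obtain ⟨u, w, h4⟩ := norm_div hM key
        rw [he] at h4
        obtain ⟨u, w, h4⟩ := norm_div hN h4
        exact rep_one_of_norm hb h4

/-- odd degree descent -/
lemma rep_odd (h2 : (2 : K) ≠ 0) {L : Type*} [Field L] {a b : K} (ha : a ≠ 0) (hb : b ≠ 0) (q : QE K L a)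
    {M : Type*} [Field M] [Algebra K M] [FiniteDimensional K M] (hodd : Odd (Module.finrank K M))
    (hr : Rep (algebraMap K M a) (algebraMap K M b) 1) : Rep a b 1 := by
  classical
  have h2M : (2 : M) ≠ 0 := by
    intro h
    apply h2
    apply (algebraMap K M).injective
    rw [map_ofNat, map_zero, h]
  obtain ⟨u, w, h⟩ := norm_of_rep h2M ((_root_.map_ne_zero _).2 ha) hr
  let B := Module.finBasis K M
  let φ := Algebra.leftMulMatrix B
  have hbm : φ (algebraMap K M b) = φ u * φ u - a • (φ w * φ w) := by
    rw [h, map_sub, ← Algebra.smul_def, map_smul, map_pow, map_pow, pow_two, pow_two]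
  rw [AlgHom.commutes] at hbm
  have hcomm : φ u * φ w = φ w * φ u := by rw [← map_mul, ← map_mul, mul_comm]
  let z : L := ((φ u).map q.f + q.s • (φ w).map q.f).det
  have hσ : q.σ z = ((φ u).map q.f - q.s • (φ w).map q.f).det := by
    change (q.σ : L →+* L) z = _
    rw [RingHom.map_det]
    congr 1
    ext i j
    simp [q.σf, q.σs, sub_eq_add_neg]
  have hmul : z * q.σ z = q.f (b ^ Module.finrank K M) := by
    rw [hσ, ← Matrix.det_mul]
    have : ((φ u).map q.f + q.s • (φ w).map q.f) * ((φ u).map q.f - q.s • (φ w).map q.f) =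
        (φ u * φ u - a • (φ w * φ w)).map q.f := by
      have e1 : (φ u).map q.f * (φ w).map q.f = (φ w).map q.f * (φ u).map q.f := by
        rw [← Matrix.map_mul, hcomm, Matrix.map_mul]
      have e2 : (φ u * φ u - a • (φ w * φ w)).map q.f =
          (φ u).map q.f * (φ u).map q.f - (q.s * q.s) • ((φ w).map q.f * (φ w).map q.f) := by
        rw [← pow_two q.s, q.hs, ← Matrix.map_mul, ← Matrix.map_mul]
        ext i j
        rw [Matrix.map_apply, Matrix.sub_apply, Matrix.sub_apply, Matrix.smul_apply, Matrix.smul_apply,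
          Matrix.map_apply, Matrix.map_apply, map_sub, smul_eq_mul, smul_eq_mul, map_mul]
      rw [e2, add_mul, mul_sub, mul_sub, smul_mul_assoc, smul_mul_assoc, mul_smul_comm, mul_smul_comm, e1, smul_smul]
      abel
    rw [this, ← hbm]
    have e3 : (algebraMap K (Matrix (Fin (Module.finrank K M)) (Fin (Module.finrank K M)) K) b).map q.f =
        Matrix.scalar _ (q.f b) := by
      ext i j
      simp [Matrix.algebraMap_matrix_apply, Matrix.diagonal_apply]
      split_ifs <;> simp
    rw [e3, Matrix.scalar_apply, Matrix.det_diagonal, Finset.prod_const, map_pow]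
    simp
  obtain ⟨x, y, hz⟩ := q.gen z
  have hN : x ^ 2 - a * y ^ 2 = b ^ Module.finrank K M := by
    apply q.f.injective
    rw [← hmul, ← q.f_N, hz, q.N_eq]
  obtain ⟨k, hk⟩ := hodd
  rw [hk] at hN
  refine rep_one_of_norm hb (x := x / b ^ k) (y := y / b ^ k) ?_
  field_simp
  linear_combination -hN
end forms3
end GFF
end PE3

section PE4
namespace GFF
set_option linter.unusedSectionVars false
set_option linter.unusedVariables false
set_option linter.unnecessarySimpa false
open IntermediateField Polynomial

section cs
variable {F K M : Type*} [Field F] [Finite F] [Field K] [Algebra F K] [FF F K] [NeZero (2 : F)]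
  [Field M] [Algebra K M] [Algebra F M] [IsScalarTower F K M]

lemma const_natDegree {ζ : M} (hζ : IsAlgebraic F ζ) :
    (minpoly (Cst F K) ζ).natDegree = (minpoly K ζ).natDegree := by
  have hF : IsIntegral F ζ := hζ.isIntegral
  have hC : IsIntegral (Cst F K) ζ := hF.tower_top
  have hK : IsIntegral K ζ := hF.tower_top
  apply le_antisymm
  · have h1 : minpoly K ζ ∣ (minpoly F ζ).map (algebraMap F K) := minpoly.dvd_map_of_isScalarTower F K ζ
    have h2 := integralClosure.mem_lifts_of_monic_of_dvd_map K (minpoly.monic hF) (minpoly.monic hK) h1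
    have h3 : minpoly K ζ ∈ lifts (algebraMap (Cst F K) K) := by
      rw [lifts_iff_coeff_lifts] at h2 ⊢
      intro n
      obtain ⟨y, hy⟩ := h2 n
      have h4 : IsIntegral F (y : K) := y.2
      exact ⟨⟨(y : K), mem_Cst.2 h4.isAlgebraic⟩, hy⟩
    obtain ⟨p, hp, hdeg, hmon⟩ := lifts_and_natDegree_eq_and_monic h3 (minpoly.monic hK)
    rw [← hdeg]
    refine natDegree_le_natDegree (minpoly.min _ _ hmon ?_)
    rw [← Polynomial.aeval_map_algebraMap K, hp, minpoly.aeval]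
  · rw [← (minpoly.monic hC).natDegree_map (algebraMap (Cst F K) K)]
    refine natDegree_le_natDegree (minpoly.min _ _ ((minpoly.monic hC).map _) ?_)
    rw [Polynomial.aeval_map_algebraMap, minpoly.aeval]

lemma const_sq [FiniteDimensional K M] {ζ : M} (hζ : IsAlgebraic F ζ) (htop : K⟮ζ⟯ = ⊤)
    (hev : Even (Module.finrank K M)) {c : K} (hc : c ∈ Cst F K) : ∃ s : M, s ^ 2 = algebraMap K M c := by
  by_cases hc0 : c = 0
  · exact ⟨0, by simp [hc0]⟩
  have hF : IsIntegral F ζ := hζ.isIntegral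
  have hC : IsIntegral (Cst F K) ζ := hF.tower_top
  have hK : IsIntegral K ζ := hF.tower_top
  have hn : Module.finrank (Cst F K) (Cst F K)⟮ζ⟯ = Module.finrank K M := by
    rw [adjoin.finrank hC, const_natDegree hζ, ← adjoin.finrank hK, htop, finrank_top']
  have hfd : FiniteDimensional (Cst F K) (Cst F K)⟮ζ⟯ := adjoin.finiteDimensional hC
  have hfin : Finite (Cst F K)⟮ζ⟯ := Module.finite_of_finite (Cst F K)
  let := Fintype.ofFinite (Cst F K)⟮ζ⟯
  let := Fintype.ofFinite (Cst F K)
  let c' : Cst F K := ⟨c, hc⟩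
  have hc' : c' ≠ 0 := fun h => hc0 (congrArg Subtype.val h)
  have hch : ringChar (Cst F K) ≠ 2 := by
    intro h
    have h2 : (2 : Cst F K) = 0 := by
      have := ringChar.Nat.cast_ringChar (R := Cst F K)
      rw [h] at this
      exact_mod_cast this
    exact NeZero.ne (2 : Cst F K) h2
  have hch' : ringChar (Cst F K)⟮ζ⟯ ≠ 2 := by
    intro h
    have h2 : (2 : (Cst F K)⟮ζ⟯) = 0 := by
      have := ringChar.Nat.cast_ringChar (R := (Cst F K)⟮ζ⟯)
      rw [h] at this
      exact_mod_cast this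
    apply NeZero.ne (2 : Cst F K)
    apply (algebraMap (Cst F K) (Cst F K)⟮ζ⟯).injective
    rw [map_ofNat, map_zero, h2]
  have hsq : IsSquare (algebraMap (Cst F K) (Cst F K)⟮ζ⟯ c') := by
    rw [FiniteField.isSquare_iff hch' ((_root_.map_ne_zero _).2 hc'), ← map_pow]
    obtain ⟨k, hk⟩ := hev
    have hcard : Fintype.card (Cst F K)⟮ζ⟯ = Fintype.card (Cst F K) ^ (k + k) := by
      rw [← Nat.card_eq_fintype_card, ← Nat.card_eq_fintype_card,
        Module.natCard_eq_pow_finrank (K := Cst F K), hn, hk]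
    have hodd : Odd (Fintype.card (Cst F K)) := Nat.odd_iff.2 (FiniteField.odd_card_of_char_ne_two hch)
    set Q := Fintype.card (Cst F K) with hQ
    obtain ⟨j, hj⟩ := Nat.sub_one_dvd_pow_sub_one Q k
    obtain ⟨m, hm⟩ := hodd.pow (n := k)
    have hpos : 0 < Q ^ k := Nat.pow_pos Fintype.card_pos
    have hhalf : Fintype.card (Cst F K)⟮ζ⟯ / 2 = (Q - 1) * (j * (m + 1)) := by
      rw [hcard, pow_add, ← mul_assoc, ← hj, hm]
      have : (2 * m + 1) * (2 * m + 1) = 2 * ((2 * m + 1 - 1) * (m + 1)) + 1 := by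
        rw [Nat.add_sub_cancel]; ring
      omega
    rw [hhalf, pow_mul, hQ, FiniteField.pow_card_sub_one_eq_one c' hc', one_pow, map_one]
  obtain ⟨s, hs⟩ := hsq
  refine ⟨(s : M), ?_⟩
  have := congrArg (algebraMap (Cst F K)⟮ζ⟯ M) hs
  rw [map_mul] at this
  rw [pow_two]
  exact this.symm
end cs

section hm3
universe u
variable {F : Type*} [Field F] [Finite F] [NeZero (2 : F)]

lemma rep_one_of_sq {K : Type*} [Field K] (h2 : (2 : K) ≠ 0) {a b : K} (ha : a ≠ 0) (hb : b ≠ 0) (hs : IsSquare a) :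
    Rep a b 1 := by
  obtain ⟨t, ht⟩ := hs
  have h0 : t ≠ 0 := by
    rintro rfl
    exact ha (by simpa using ht)
  obtain ⟨u, w, h⟩ := norm_of_sq h2 h0 (a := a) (by rw [ht, pow_two]) b
  exact rep_one_of_norm hb h

lemma hm3_const {K : Type u} [Field K] [Algebra F K] [FF F K] {c f : K} (hc : c ∈ Cst F K)
    (hns : ¬ IsSquare c) (hf : f ≠ 0) (h : ∀ v : Place F K, v.sy.h c f = 0) : Rep c f 1 := by
  obtain ⟨L, _, _, _, q, hq⟩ := exists_QE F hns
  obtain ⟨z, hz⟩ := q.N1 (F := F) hc hf (fun v hv => by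
    have := h v
    rw [c_h hc v f, hv, one_mul, Place.sy_p] at this
    exact (ZMod.intCast_zmod_eq_zero_iff_dvd _ 2).1 this |>.elim fun k hk => ⟨k, by rw [hk]; push_cast; ring⟩)
  obtain ⟨x, y, rfl⟩ := q.gen z
  rw [q.N_eq] at hz
  exact rep_one_of_norm hf hz.symm

lemma quad_adjoin {K M : Type*} [Field K] [Field M] [Algebra K M] [FiniteDimensional K M] {c : K} (hns : ¬ IsSquare c)
    {s : M} (hs : s ^ 2 = algebraMap K M c) :
    (∀ z : K⟮s⟯, ∃ x y : K, z = algebraMap K K⟮s⟯ x + algebraMap K K⟮s⟯ y * AdjoinSimple.gen K s) ∧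
    (∀ x y : K, algebraMap K K⟮s⟯ x + algebraMap K K⟮s⟯ y * AdjoinSimple.gen K s = 0 → x = 0 ∧ y = 0) ∧
    2 ≤ Module.finrank K K⟮s⟯ := by
  have hintg : IsIntegral K s := IsIntegral.of_finite K s
  have hnot : ∀ x : K, algebraMap K M x ≠ s := by
    intro x hx
    apply hns
    refine ⟨x, (algebraMap K M).injective ?_⟩
    rw [← hs, ← hx, map_mul, pow_two]
  refine ⟨?_, ?_, ?_⟩
  · rintro ⟨z, hz⟩
    have hz' : z ∈ Algebra.adjoin K {s} := by
      rw [← adjoin_simple_toSubalgebra_of_isAlgebraic hintg.isAlgebraic]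
      exact hz
    have : ∃ x y : K, z = algebraMap K M x + algebraMap K M y * s := by
      clear hz
      induction hz' using Algebra.adjoin_induction with
      | mem x h => exact ⟨0, 1, by rw [Set.mem_singleton_iff.1 h]; simp⟩
      | algebraMap r => exact ⟨r, 0, by simp⟩
      | add x y _ _ hx hy =>
        obtain ⟨x1, y1, rfl⟩ := hx
        obtain ⟨x2, y2, rfl⟩ := hy
        exact ⟨x1 + x2, y1 + y2, by rw [map_add, map_add]; ring⟩
      | mul x y _ _ hx hy =>
        obtain ⟨x1, y1, rfl⟩ := hx
        obtain ⟨x2, y2, rfl⟩ := hy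
        refine ⟨x1 * x2 + c * (y1 * y2), x1 * y2 + x2 * y1, ?_⟩
        simp only [map_add, map_mul]
        linear_combination (algebraMap K M y1) * (algebraMap K M y2) * hs
    obtain ⟨x, y, h⟩ := this
    exact ⟨x, y, Subtype.ext h⟩
  · intro x y h
    have h' : algebraMap K M x + algebraMap K M y * s = 0 := congrArg Subtype.val h
    have hy : y = 0 := by
      by_contra hy
      apply hnot (-(x / y))
      have hy' : algebraMap K M y ≠ 0 := (_root_.map_ne_zero _).2 hy
      rw [map_neg, map_div₀]
      field_simp
      linear_combination -h'
    subst hy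
    refine ⟨?_, rfl⟩
    rw [map_zero, zero_mul, add_zero] at h'
    exact (map_eq_zero _).1 h'
  · have h1 : Module.finrank K K⟮s⟯ ≠ 1 := by
      intro h
      rw [IntermediateField.finrank_eq_one_iff, adjoin_simple_eq_bot_iff, mem_bot] at h
      obtain ⟨x, hx⟩ := h
      exact hnot x hx
    have h0 : 0 < Module.finrank K K⟮s⟯ := Module.finrank_pos
    omega

lemma adjoin_top {K M : Type*} [Field K] [Field M] [Algebra K M] (E : IntermediateField K M) {ζ : M}
    (htop : K⟮ζ⟯ = ⊤) : E⟮ζ⟯ = ⊤ := by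
  rw [eq_top_iff]
  intro y _
  have hy : y ∈ K⟮ζ⟯ := by rw [htop]; trivial
  have h3 : K⟮ζ⟯ ≤ (E⟮ζ⟯).restrictScalars K := by
    rw [adjoin_le_iff]
    exact Set.singleton_subset_iff.2 (mem_adjoin_simple_self E ζ)
  exact h3 hy

lemma quad_exists {K M : Type*} [Field K] [Field M] [Algebra K M] [FiniteDimensional K M] {c : K} (hns : ¬ IsSquare c)
    {s : M} (hs : s ^ 2 = algebraMap K M c) : ∃ (E : IntermediateField K M) (g : E), g ^ 2 = algebraMap K E c ∧
    (∀ z : E, ∃ x y : K, z = algebraMap K E x + algebraMap K E y * g) ∧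
    (∀ x y : K, algebraMap K E x + algebraMap K E y * g = 0 → x = 0 ∧ y = 0) ∧
    2 ≤ Module.finrank K E := by
  obtain ⟨hgen, hind, hdim⟩ := quad_adjoin hns hs
  exact ⟨K⟮s⟯, AdjoinSimple.gen K s, Subtype.ext hs, hgen, hind, hdim⟩

theorem hm3_aux (n : ℕ) : ∀ (K M : Type u) [Field K] [Algebra F K] [FF F K] [Field M] [Algebra K M]
    [Algebra F M] [IsScalarTower F K M] [FiniteDimensional K M] (ζ : M) (hζ : IsAlgebraic F ζ)
    (htop : K⟮ζ⟯ = ⊤) (hn : Module.finrank K M = n) (a b : K) (ha : a ≠ 0) (hb : b ≠ 0)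
    (hloc : ∀ v : Place F K, v.sy.h a b = 0) (hr : Rep (algebraMap K M a) (algebraMap K M b) 1),
    Rep a b 1 := by
  induction n using Nat.strong_induction_on with
  | _ n ih =>
  intro K M _ _ _ _ _ _ _ _ ζ hζ htop hn a b ha hb hloc hr
  have h2 : (2 : K) ≠ 0 := two_ne F
  rcases Nat.even_or_odd n with hev | hodd
  · obtain ⟨c, hc, hns⟩ := exists_c F K
    have hc0 : c ≠ 0 := by rintro rfl; exact hns ⟨0, by simp⟩
    obtain ⟨s, hs⟩ := const_sq (F := F) hζ htop (hn ▸ hev) hc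
    obtain ⟨E, g, hg, hgen, hind, hdim⟩ := quad_exists hns hs
    have : FF F E := FF.of_extension (K := K)
    have : IsScalarTower F E M := IsScalarTower.of_algebraMap_eq fun x => by
      rw [IsScalarTower.algebraMap_apply F K E, ← IsScalarTower.algebraMap_apply K E M,
        ← IsScalarTower.algebraMap_apply F K M]
    have hmul := Module.finrank_mul_finrank K E M
    have hpos : 0 < Module.finrank E M := Module.finrank_pos
    have hlt : Module.finrank E M < n := by
      rw [← hn, ← hmul]
      nlinarith
    have hE := ih _ hlt E M ζ hζ (adjoin_top E htop) rfl (algebraMap K E a) (algebraMap K E b)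
      ((_root_.map_ne_zero _).2 ha) ((_root_.map_ne_zero _).2 hb) (fun w => by
        obtain ⟨v, hv⟩ := exists_under (F := F) (f := algebraMap K E) w
          (algebraMap_isIntegral_iff.2 inferInstance)
        obtain ⟨t, ht, -⟩ := hv.h
        rw [ht a b ha hb, hloc v, mul_zero]) hr
    have hR : Rep a b c := rep_of_rep_quadratic h2 hg hgen hind ha hb hE
    obtain ⟨f, hf, hsym, hback⟩ := rep_back h2 ha hb hc0 hR
    exact hback (hm3_const hc hns hf fun v => by rw [hsym, hloc v])
  · by_cases hsq : IsSquare a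
    · exact rep_one_of_sq h2 ha hb hsq
    · obtain ⟨L, _, _, _, q, hq⟩ := exists_QE F hsq
      exact rep_odd h2 ha hb q (hn ▸ hodd) hr

variable {K : Type u} [Field K] [Algebra F K] [FF F K]

theorem HM3 {a b : K} (ha : a ≠ 0) (hb : b ≠ 0) (hloc : ∀ v : Place F K, v.sy.h a b = 0) : Rep a b 1 := by
  obtain ⟨ζ, hζ, X, Y, Z, hn, h⟩ := exists_const_split (F := F) a b (-(a * b))
  have hintg : IsIntegral K ζ := hζ.isIntegral.tower_top
  have := adjoin.finiteDimensional hintg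
  have h2 : (2 : K⟮ζ⟯) ≠ 0 := by
    intro h
    apply two_ne F (L := K)
    apply (algebraMap K K⟮ζ⟯).injective
    rw [map_ofNat, map_zero, h]
  have : IsScalarTower F K⟮ζ⟯ (AlgebraicClosure K) := IsScalarTower.of_algebraMap_eq fun x => rfl
  refine hm3_aux (F := F) _ K K⟮ζ⟯ (AdjoinSimple.gen K ζ) ?_ ?_ rfl a b ha hb hloc ?_
  · rw [← isAlgebraic_algebraMap_iff (A := AlgebraicClosure K) (algebraMap K⟮ζ⟯ (AlgebraicClosure K)).injective]
    exact hζ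
  · rw [eq_top_iff]
    rintro ⟨y, hy⟩ -
    have h1 : y ∈ (K⟮AdjoinSimple.gen K ζ⟯).map (K⟮ζ⟯).val := by
      rw [adjoin_map, Set.image_singleton]
      exact hy
    obtain ⟨z, hz, h⟩ := h1
    have : z = ⟨y, hy⟩ := Subtype.ext h
    exact this ▸ hz
  · refine rep_of_pure_isotropic h2 ((_root_.map_ne_zero _).2 ha) ((_root_.map_ne_zero _).2 hb) hn ?_ 1
    rw [map_neg, map_mul] at h
    linear_combination h
end hm3
end GFF
end PE4

section PF1
namespace GFF
set_option linter.unusedSectionVars false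
set_option linter.unusedVariables false
set_option linter.unnecessarySimpa false
open IntermediateField Polynomial

section hm4
universe u
variable {F : Type*} [Field F] [Finite F] [NeZero (2 : F)] {K : Type u} [Field K] [Algebra F K] [FF F K]

lemma z2_ne {x : ZMod 2} (h : x ≠ 0) : x = 1 := (z2_cases x).resolve_left h

theorem HM4 {a b d : K} (ha : a ≠ 0) (hb : b ≠ 0) (hd : d ≠ 0)
    (hloc : ∀ v : Place F K, v.sy.h a b = 1 → ¬ v.sy.Sq d) : Rep a b d := by
  by_cases hs : IsSquare d
  · obtain ⟨t, ht⟩ := hs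
    have ht' : d = t ^ 2 := by rw [ht, pow_two]
    have ht0 : t ≠ 0 := by rintro rfl; exact hd (by simpa using ht)
    have h1 : Rep a b 1 := HM3 (F := F) ha hb fun v => by
      by_contra h
      exact hloc v (z2_ne h) (ht' ▸ v.sy.sq_sq ht0)
    rw [ht', ← one_mul (t ^ 2)]
    exact rep_mul_sq h1
  · obtain ⟨L, _, _, _, q, hq⟩ := exists_QE F hs
    let := q.f.toAlgebra
    refine rep_of_rep_quadratic (two_ne F) (E := L) (s := q.s) q.hs q.gen q.ind ha hb ?_
    refine HM3 (F := F) (q.f_ne ha) (q.f_ne hb) fun w => ?_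
    obtain ⟨v, hv⟩ := exists_under (F := F) (f := q.f) w q.integral
    obtain ⟨t, ht, ht2⟩ := hv.h
    by_contra h
    change w.sy.h (q.f a) (q.f b) ≠ 0 at h
    rw [ht a b ha hb] at h
    refine hloc v (z2_ne (right_ne_zero_of_mul h)) (ht2 (left_ne_zero_of_mul h) d hd ?_)
    rw [← q.hs]
    exact w.sy.sq_sq q.s_ne

theorem rep_iff {a b d : K} (ha : a ≠ 0) (hb : b ≠ 0) (hd : d ≠ 0) :
    Rep a b d ↔ ∀ v : Place F K, v.sy.h a b = 1 → ¬ v.sy.Sq d :=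
  ⟨fun h v hv => LSym.not_sq_of_rep _ ha hb hd h (by rw [hv]; exact one_ne_zero), HM4 ha hb hd⟩

lemma slot {a b d : K} (ha : a ≠ 0) (hb : b ≠ 0) (hd : d ≠ 0)
    (hloc : ∀ v : Place F K, v.sy.h a b = 1 → ¬ v.sy.Sq d) :
    ∃ f, f ≠ 0 ∧ ∀ v : Place F K, v.sy.h d f = v.sy.h a b := by
  obtain ⟨f, hf, h⟩ := LSym.h_ne_of_rep ha hb hd (HM4 ha hb hd hloc)
  exact ⟨f, hf, fun v => h _⟩

lemma sum_h {c : K} (hc : c ∈ Cst F K) (hns : ¬ IsSquare c) {f : K} (hf : f ≠ 0) {v0 : Place F K}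
    (h : ∀ v : Place F K, v.sy.h c f = 1 ↔ v = v0) : False := by
  have h1 := sum_h_c hc hns f
  have h2 : ∀ v : Place F K, ((dv F f v : ℤ) : ZMod 2) * v.sy.r c = v.sy.h c f := fun v => by
    rw [c_h hc, dv_apply, Place.sy_p, mul_comm]
  rw [Finsupp.sum, Finset.sum_eq_single v0] at h1
  · rw [h2, (h v0).2 rfl] at h1
    exact one_ne_zero h1
  · intro v _ hv
    rw [h2]
    by_contra h3
    exact hv ((h v).1 (z2_ne h3))
  · intro h3
    rw [Finsupp.notMem_support_iff.1 h3]
    simp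

theorem REC {c : K} (hc : c ∈ Cst F K) (hns : ¬ IsSquare c) {v0 : Place F K} (h0 : v0.sy.r c = 1)
    {a b : K} (ha : a ≠ 0) (hb : b ≠ 0) (h : ∀ v : Place F K, v.sy.h a b = 1 ↔ v = v0) : False := by
  obtain ⟨f, hf, h1⟩ := slot (F := F) ha hb (c_ne hns) fun v hv hs => by
    rw [(h v).1 hv, c_sq hc, h0] at hs
    exact one_ne_zero hs
  exact sum_h hc hns hf (v0 := v0) fun v => by rw [h1, h]

lemma odd_infinite {c : K} (hc : c ∈ Cst F K) (hns : ¬ IsSquare c) :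
    {v : Place F K | v.sy.r c = 1}.Infinite := by
  classical
  intro hfin
  obtain ⟨v0, h0⟩ := SQ (F := F) hns
  rw [c_sq hc] at h0
  obtain ⟨x, hx, hx1⟩ := Place.exists_ord v0 1
  obtain ⟨f, hf, h⟩ := Place.wa hfin.toFinset (fun v => if v = v0 then x else 1) (fun v _ => by
    split_ifs
    · assumption
    · exact one_ne_zero)
  refine sum_h hc hns hf (v0 := v0) fun v => ?_
  rw [c_h hc]
  by_cases hv : v = v0
  · subst hv
    have h0' := z2_ne h0
    have := (h v (hfin.mem_toFinset.2 h0')).1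
    rw [if_pos rfl, Place.sy_p _ x] at this
    rw [this, h0']
    simp [hx1]
  · simp only [hv, iff_false]
    intro h1
    have hr := z2_ne (left_ne_zero_of_mul (h1 ▸ one_ne_zero : v.sy.r c * v.sy.p f ≠ 0))
    have := (h v (hfin.mem_toFinset.2 hr)).1
    rw [if_neg hv, LSym.p_one] at this
    rw [this, mul_zero] at h1
    exact zero_ne_one h1
end hm4

section ex
universe u
variable {F : Type*} [Field F] [Finite F] [NeZero (2 : F)]

lemma EX_odd {K : Type u} [Field K] [Algebra F K] [FF F K] {c : K} (hc : c ∈ Cst F K) (hns : ¬ IsSquare c)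
    {v v0 : Place F K} (hv : v.sy.r c = 1) (h0 : v0.sy.r c = 1) (hne : v ≠ v0) :
    ∃ f, f ≠ 0 ∧ ∀ u : Place F K, u.sy.h c f = 1 ↔ u = v ∨ u = v0 := by
  classical
  obtain ⟨k, hk, hk'⟩ := exists_kv v
  obtain ⟨k0, hk0, hk0'⟩ := exists_kv v0
  have e1 := (hk' c hc hns).symm.trans hv
  have e2 := (hk0' c hc hns).symm.trans h0
  obtain ⟨f, hf, h⟩ := C1 hc hns (Finsupp.single v (k0 : ℤ) - Finsupp.single v0 (k : ℤ)) (by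
    rw [map_sub, ddeg_single, ddeg_single, hk, hk0]
    push_cast
    ring)
  refine ⟨f, hf, fun u => ?_⟩
  rw [c_h hc]
  have h2 := h u
  rcases z2_cases (u.sy.r c) with hu | hu
  · rw [hu, zero_mul]
    simp only [zero_ne_one, false_iff]
    rintro (rfl | rfl)
    · rw [hv] at hu; exact one_ne_zero hu
    · rw [h0] at hu; exact one_ne_zero hu
  · have h3 := h2 hu
    rw [hu, one_mul, Place.sy_p]
    rw [← ZMod.intCast_eq_zero_iff_even, Finsupp.add_apply, dv_apply, Finsupp.sub_apply] at h3
    push_cast at h3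
    by_cases h4 : u = v
    · subst h4
      rw [Finsupp.single_eq_same, Finsupp.single_eq_of_ne (by tauto)] at h3
      simp only [true_or, iff_true]
      push_cast at h3
      rw [e2] at h3
      rcases z2_cases ((u.ord f : ℤ) : ZMod 2) with h5 | h5
      · rw [h5] at h3; simp at h3
      · exact h5
    · by_cases h5 : u = v0
      · subst h5
        rw [Finsupp.single_eq_same, Finsupp.single_eq_of_ne (by tauto)] at h3
        simp only [or_true, iff_true]
        push_cast at h3
        rw [e1] at h3
        rcases z2_cases ((u.ord f : ℤ) : ZMod 2) with h5 | h5
        · rw [h5] at h3; simp at h3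
        · exact h5
      · rw [Finsupp.single_eq_of_ne (by tauto), Finsupp.single_eq_of_ne (by tauto)] at h3
        simp only [h4, h5, or_self, iff_false]
        simp at h3
        rw [h3]
        exact zero_ne_one

theorem EX_aux (m : ℕ) : ∀ {K : Type u} [Field K] [Algebra F K] [FF F K] {c : K} (hc : c ∈ Cst F K) (hns : ¬ IsSquare c)
    {v v0 : Place F K} (h0 : v0.sy.r c = 1) (hne : v ≠ v0) (hm : v.δ = cdeg F K * m),
    ∃ a b, a ≠ 0 ∧ b ≠ 0 ∧ ∀ u : Place F K, u.sy.h a b = 1 ↔ u = v ∨ u = v0 := by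
  induction m using Nat.strong_induction_on with
  | _ m ih =>
  intro K _ _ _ c hc hns v v0 h0 hne hm
  classical
  rcases z2_cases (v.sy.r c) with hv | hv
  swap
  · obtain ⟨f, hf, h⟩ := EX_odd hc hns hv h0 hne
    exact ⟨c, f, c_ne hns, hf, h⟩
  have hvs : v.sy.Sq c := (c_sq hc v).2 hv
  obtain ⟨L, _, _, _, q, hq⟩ := exists_QE F hns
  have hinert : ∀ u : Place F K, u.sy.r c = 1 → u.ord c = 0 ∧ u.rr c = 1 := fun u hu =>
    (q.c_cases hc u).resolve_left fun h => by
      rw [c_sq hc, hu] at h; exact one_ne_zero h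
  obtain ⟨w, hw⟩ := exists_over (F := F) q.f v
  obtain ⟨w0, hw0⟩ := exists_over (F := F) q.f v0
  have hcd := q.cdeg_eq hc
  have hgp := cdeg_pos F K
  -- the residue degree of `v` is even
  obtain ⟨k, hk, hk'⟩ := exists_kv v
  obtain ⟨k0, hk0, hk0'⟩ := exists_kv v0
  have ekm : k = m := Nat.eq_of_mul_eq_mul_left hgp (hk.symm.trans hm)
  have hkc := (hk' c hc hns).symm.trans hv
  rw [ekm, ZMod.natCast_eq_zero_iff_even] at hkc
  obtain ⟨m', hm'⟩ := hkc
  have hmp : 0 < m := by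
    rcases Nat.eq_zero_or_pos m with h | h
    · have := v.δ_pos
      rw [hm, h] at this
      simp at this
    · exact h
  -- constants upstairs
  obtain ⟨c', hc', hns'⟩ := exists_c F L
  have hδ0 : w0.δ = cdeg F L * k0 := by
    rw [q.inert_δ hw0 (hinert v0 h0).1 (hinert v0 h0).2, hk0, hcd]; ring
  have h0' : w0.sy.r c' = 1 := by
    obtain ⟨k1, hk1, hk1'⟩ := exists_kv w0
    have : k1 = k0 := Nat.eq_of_mul_eq_mul_left (cdeg_pos F L) (hk1.symm.trans hδ0)
    rw [hk1' c' hc' hns', this, ← hk0' c hc hns, h0]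
  have hwne : w ≠ w0 := by
    rintro rfl
    exact hne (hw.unique hw0)
  obtain ⟨a', b', ha', hb', hab'⟩ := ih m' (by omega) hc' hns' h0' hwne (by
    rw [q.split_δ hw hvs, hm, hcd, hm']; ring)
  obtain ⟨x, hx, hx1⟩ := Place.exists_ord v 1
  obtain ⟨x0, hx0, hx01⟩ := Place.exists_ord v0 1
  obtain ⟨α, hα, hαl⟩ := Place.wa {v, v0} (fun u => if u = v then x else x0) (fun u _ => by
    split_ifs <;> assumption)
  have p1 : v.sy.p α = 1 := by
    rw [(hαl v (by simp)).1, if_pos rfl, Place.sy_p, hx1]; rfl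
  have p0 : v0.sy.p α = 1 := by
    rw [(hαl v0 (by simp)).1, if_neg (Ne.symm hne), Place.sy_p, hx01]; rfl
  obtain ⟨β, hβ, hαβ⟩ := slot (F := F) ha' hb' (q.f_ne hα) fun u hu hs => by
    rcases (hab' u).1 hu with rfl | rfl
    · obtain ⟨b, hb, hb1⟩ := Place.exists_h v (a := α) (by rintro ⟨h, -⟩; rw [p1] at h; exact one_ne_zero h)
      rw [← q.split_h hw hvs hα hb, LSym.h_of_sq_left _ hs] at hb1
      exact zero_ne_one hb1
    · have := hs.1
      rw [Place.sy_p, q.inert_ord hw0 (hinert v0 h0).1 (hinert v0 h0).2, ← Place.sy_p, p0] at this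
      exact one_ne_zero this
  refine ⟨α, q.N β, hα, q.N_ne hβ, fun u => ?_⟩
  obtain ⟨w', hw'⟩ := exists_over (F := F) q.f u
  rcases z2_cases (u.sy.r c) with hu | hu
  · have hus : u.sy.Sq c := (c_sq hc u).2 hu
    have hu0 : u ≠ v0 := by
      rintro rfl
      rw [h0] at hu
      exact one_ne_zero hu
    have key : u.sy.h α (q.N β) = w'.sy.h (q.f α) β + (w'.conj q.σ).sy.h (q.f α) β := by
      rw [← q.split_h hw' hus hα (q.N_ne hβ), q.f_N, LSym.h_mul_right _ hβ (q.σ_ne hβ),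
        h_conj _ _ (q.f_ne hα) hβ, q.σf]
    rw [key, hαβ, hαβ]
    have n1 : w'.sy.h a' b' = 1 ↔ w' = w := by
      rw [hab']
      constructor
      · rintro (h | rfl)
        · exact h
        · exact absurd (hw'.unique hw0) hu0
      · exact Or.inl
    have n2 : (w'.conj q.σ).sy.h a' b' = 1 ↔ w'.conj q.σ = w := by
      rw [hab']
      constructor
      · rintro (h | h)
        · exact h
        · exact absurd ((q.lies_conj hw').unique (h ▸ hw0)) hu0
      · exact Or.inl
    have hnn := q.split_ne hw' hus
    by_cases hu1 : u = v
    · subst hu1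
      simp only [true_or, iff_true]
      rcases q.over_eq hw' hw with h | h
      · rw [n1.2 h.symm]
        have : (w'.conj q.σ).sy.h a' b' ≠ 1 := fun h' => hnn ((n2.1 h').trans h)
        rw [(z2_cases _).resolve_right this, add_zero]
      · rw [n2.2 h.symm]
        have : w'.sy.h a' b' ≠ 1 := fun h' => hnn ((n1.1 h').trans h).symm
        rw [(z2_cases _).resolve_right this, zero_add]
    · simp only [hu1, hu0, or_self, iff_false]
      have t1 : w'.sy.h a' b' ≠ 1 := fun h' => hu1 (hw'.unique ((n1.1 h') ▸ hw))
      have t2 : (w'.conj q.σ).sy.h a' b' ≠ 1 := fun h' => hu1 ((q.lies_conj hw').unique ((n2.1 h') ▸ hw))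
      rw [(z2_cases _).resolve_right t1, (z2_cases _).resolve_right t2, add_zero]
      exact zero_ne_one
  · have hui := hinert u hu
    rw [q.inert_h hw' hui.1 hui.2 hα hβ, hαβ, hab']
    have hu1 : u ≠ v := by
      rintro rfl
      rw [hv] at hu
      exact zero_ne_one hu
    simp only [hu1, false_or]
    constructor
    · rintro (rfl | rfl)
      · exact absurd (hw'.unique hw) hu1
      · exact hw'.unique hw0
    · rintro rfl
      right
      rcases q.over_eq hw0 hw' with h | h
      · exact h
      · rw [h, q.inert_conj hw0 hui.1 hui.2]

theorem EX {K : Type u} [Field K] [Algebra F K] [FF F K] {c : K} (hc : c ∈ Cst F K) (hns : ¬ IsSquare c)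
    {v v0 : Place F K} (h0 : v0.sy.r c = 1) (hne : v ≠ v0) :
    ∃ a b, a ≠ 0 ∧ b ≠ 0 ∧ ∀ u : Place F K, u.sy.h a b = 1 ↔ u = v ∨ u = v0 := by
  obtain ⟨k, hk, -⟩ := exists_kv v
  exact EX_aux k hc hns h0 hne hk
end ex
end GFF
end PF1

section PF2
namespace GFF
set_option linter.unusedSectionVars false
set_option linter.unusedVariables false
set_option linter.unnecessarySimpa false
open IntermediateField Polynomial

section defs
variable {K : Type*} [Field K]

/-- `z` is a square at all places where the algebra `(c,x)` ramifies -/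
def SqC (c x z : K) : Prop := ∃ y : Fin 2 → K, y 0 ≠ 0 ∧ y 1 ≠ 0 ∧ Rep c x (y 0) ∧ Rep c x (y 1) ∧
  Rep c x (y 0 * y 1) ∧ Rep c x (z * y 0) ∧ Rep c x (z * y 1) ∧ Rep c x (z * (y 0 * y 1))

/-- the algebras `(c,x)` and `(e,f)` agree -/
def SymEq (c x e f : K) : Prop := ∃ y : Fin 1 → K, y 0 ≠ 0 ∧ Rep c (x * y 0) 1 ∧ Rep (c * e) (y 0) 1 ∧
  Rep e (f * y 0) 1

/-- the certificate; the variables are `c, x1, x2, e, f, s, t, s2, t2, w1, w2, σ, τ` -/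
def Phi (e0 f0 z0 z1 a b d : K) : Prop := ∃ y : Fin 13 → K, (∏ j, y j) ≠ 0 ∧
  SymEq (y 0) (y 1 * y 2) e0 f0 ∧ SymEq (y 0) (y 1) (y 3) (y 4) ∧
  SqC (y 0) (y 1) (y 11) ∧ SqC (y 0) (y 2) (y 12) ∧ d = y 11 * y 12 ∧ SqC (y 0) (y 1) (y 5) ∧ SqC (y 0) (y 1) (y 7) ∧ SqC (y 0) (y 1) (y 9) ∧
  SqC (y 0) (y 2) (y 6) ∧ SqC (y 0) (y 2) (y 8) ∧ SqC (y 0) (y 2) (y 10) ∧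
  a * y 3 = y 5 * y 6 ∧ b * y 4 = y 7 * y 8 ∧ SqC e0 f0 (y 9 * z1) ∧ SqC e0 f0 (y 10 * z0)
end defs

section cert
universe u
variable {F : Type*} [Field F] [Finite F] [NeZero (2 : F)] {K : Type u} [Field K] [Algebra F K] [FF F K]

lemma h_finite (a b : K) : {v : Place F K | v.sy.h a b = 1}.Finite := by
  refine ((Place.finite_ord_ne (F := F) a).union (Place.finite_ord_ne (F := F) b)).subset ?_
  intro v hv
  by_contra h
  rw [Set.mem_union, not_or] at h
  have h1 : v.ord a = 0 := by simpa using h.1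
  have h2 : v.ord b = 0 := by simpa using h.2
  have hv' : v.sy.h a b = 1 := hv
  unfold LSym.h at hv'
  rw [Place.sy_p, Place.sy_p, h1, h2] at hv'
  simp at hv'

lemma rep_one_iff {a b : K} (ha : a ≠ 0) (hb : b ≠ 0) : Rep a b 1 ↔ ∀ v : Place F K, v.sy.h a b = 0 := by
  rw [rep_iff (F := F) ha hb one_ne_zero]
  constructor
  · intro h v
    by_contra h'
    exact h v (z2_ne h') v.sy.sq_one
  · intro h v hv
    rw [h v] at hv
    exact absurd hv zero_ne_one

lemma SqC_iff {c x z : K} (hc : c ≠ 0) (hx : x ≠ 0) (hz : z ≠ 0) :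
    SqC c x z ↔ ∀ v : Place F K, v.sy.h c x = 1 → v.sy.Sq z := by
  constructor
  · rintro ⟨y, h0, h1, r0, r1, r2, r3, r4, r5⟩ v hv
    have h01 := mul_ne_zero h0 h1
    have q0 := (rep_iff (F := F) hc hx h0).1 r0 v hv
    have q1 := (rep_iff (F := F) hc hx h1).1 r1 v hv
    have q2 := (rep_iff (F := F) hc hx h01).1 r2 v hv
    have q3 := (rep_iff (F := F) hc hx (mul_ne_zero hz h0)).1 r3 v hv
    have q4 := (rep_iff (F := F) hc hx (mul_ne_zero hz h1)).1 r4 v hv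
    have q5 := (rep_iff (F := F) hc hx (mul_ne_zero hz h01)).1 r5 v hv
    rw [LSym.sq_mul_iff _ hz h01, v.sy.p_mul _ _ h0 h1, v.sy.r_mul _ _ h0 h1] at q5
    rw [LSym.sq_mul_iff _ h0 h1] at q2
    rw [LSym.sq_mul_iff _ hz h0] at q3
    rw [LSym.sq_mul_iff _ hz h1] at q4
    unfold LSym.Sq at q0 q1 ⊢
    revert q0 q1 q2 q3 q4 q5
    generalize v.sy.p (y 0) = p0
    generalize v.sy.r (y 0) = r0
    generalize v.sy.p (y 1) = p1
    generalize v.sy.r (y 1) = r1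
    generalize v.sy.p z = p
    generalize v.sy.r z = r
    revert p0 r0 p1 r1 p r
    decide
  · intro h
    choose g1 hg1 hg1o hg1r using fun v : Place F K => v.exists_rr 0 1
    choose g2 hg2 hg2o hg2r using fun v : Place F K => v.exists_rr 1 0
    have hfin := h_finite (F := F) c x
    obtain ⟨y0, h0, hy0⟩ := Place.wa hfin.toFinset g1 (fun v _ => hg1 v)
    obtain ⟨y1, h1, hy1⟩ := Place.wa hfin.toFinset g2 (fun v _ => hg2 v)
    have e0 : ∀ v : Place F K, v.sy.h c x = 1 → v.sy.p y0 = 1 ∧ v.sy.r y0 = 0 := fun v hv => by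
      have := hy0 v (hfin.mem_toFinset.2 hv)
      rw [Place.sy_p _ (g1 v), hg1o, Place.sy_r _ (g1 v), hg1r] at this
      simpa using this
    have e1 : ∀ v : Place F K, v.sy.h c x = 1 → v.sy.p y1 = 0 ∧ v.sy.r y1 = 1 := fun v hv => by
      have := hy1 v (hfin.mem_toFinset.2 hv)
      rw [Place.sy_p _ (g2 v), hg2o, Place.sy_r _ (g2 v), hg2r] at this
      simpa using this
    have h01 := mul_ne_zero h0 h1
    refine ⟨![y0, y1], h0, h1, HM4 (F := F) hc hx h0 ?_, HM4 (F := F) hc hx h1 ?_, HM4 (F := F) hc hx h01 ?_,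
      HM4 (F := F) hc hx (mul_ne_zero hz h0) ?_, HM4 (F := F) hc hx (mul_ne_zero hz h1) ?_,
      HM4 (F := F) hc hx (mul_ne_zero hz h01) ?_⟩ <;> intro v hv
    · change ¬ v.sy.Sq y0
      unfold LSym.Sq
      rw [(e0 v hv).1]; simp
    · change ¬ v.sy.Sq y1
      unfold LSym.Sq
      rw [(e1 v hv).2]; simp
    · change ¬ v.sy.Sq (y0 * y1)
      rw [LSym.sq_mul_iff _ h0 h1, (e0 v hv).1, (e1 v hv).1]; simp
    · change ¬ v.sy.Sq (z * y0)
      rw [LSym.sq_mul_iff _ hz h0, (e0 v hv).1, (h v hv).1]; simp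
    · change ¬ v.sy.Sq (z * y1)
      rw [LSym.sq_mul_iff _ hz h1, (e1 v hv).2, (h v hv).2]; simp
    · change ¬ v.sy.Sq (z * (y0 * y1))
      rw [LSym.sq_mul_iff _ hz h01, v.sy.p_mul _ _ h0 h1, (e0 v hv).1, (e1 v hv).1, (h v hv).1]; simp

lemma SymEq_iff {c x e f : K} (hc : c ≠ 0) (hx : x ≠ 0) (he : e ≠ 0) (hf : f ≠ 0) :
    SymEq c x e f ↔ ∀ v : Place F K, v.sy.h c x = v.sy.h e f := by
  constructor
  · rintro ⟨y, hy, r1, r2, r3⟩ v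
    have q1 := (rep_one_iff (F := F) hc (mul_ne_zero hx hy)).1 r1 v
    have q2 := (rep_one_iff (F := F) (mul_ne_zero hc he) hy).1 r2 v
    have q3 := (rep_one_iff (F := F) he (mul_ne_zero hf hy)).1 r3 v
    rw [LSym.h_mul_right _ hx hy] at q1
    rw [LSym.h_mul_left _ hc he] at q2
    rw [LSym.h_mul_right _ hf hy] at q3
    revert q1 q2 q3
    generalize v.sy.h c x = a1
    generalize v.sy.h c (y 0) = a2
    generalize v.sy.h e (y 0) = a3
    generalize v.sy.h e f = a4
    revert a1 a2 a3 a4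
    decide
  · intro h
    have hR : Rep c (x * f) (c * e) := by
      refine HM4 (F := F) hc (mul_ne_zero hx hf) (mul_ne_zero hc he) fun v hv hs => ?_
      rw [LSym.sq_mul_iff _ hc he] at hs
      rw [LSym.h_mul_right _ hx hf, h v, LSym.h_congr_left _ hs.1 hs.2, z2_add_self] at hv
      exact zero_ne_one hv
    obtain ⟨y, hy, hl⟩ := exists_link hc hx he hf hR
    refine ⟨![y], hy, (rep_one_iff (F := F) hc (mul_ne_zero hx hy)).2 fun v => ?_,
      (rep_one_iff (F := F) (mul_ne_zero hc he) hy).2 fun v => ?_,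
      (rep_one_iff (F := F) he (mul_ne_zero hf hy)).2 fun v => ?_⟩
    · change v.sy.h c (x * y) = 0
      rw [LSym.h_mul_right _ hx hy, (hl _ (h v)).1, z2_add_self]
    · change v.sy.h (c * e) y = 0
      rw [LSym.h_mul_left _ hc he, (hl _ (h v)).1, (hl _ (h v)).2, h v, z2_add_self]
    · change v.sy.h e (f * y) = 0
      rw [LSym.h_mul_right _ hf hy, (hl _ (h v)).2, z2_add_self]

/-- the data needed for the certificate -/
structure Config (c : K) (o i : Place F K) (e0 f0 z0 z1 : K) : Prop where
  ne : o ≠ i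
  he0 : e0 ≠ 0
  hf0 : f0 ≠ 0
  hz0 : z0 ≠ 0
  hz1 : z1 ≠ 0
  h : ∀ v : Place F K, v.sy.h e0 f0 = 1 ↔ v = o ∨ v = i
  a0 : o.sy.Sq z0
  a1 : ¬ i.sy.Sq z0
  b0 : i.sy.Sq z1
  b1 : ¬ o.sy.Sq z1
  hc : c ∈ Cst F K
  hns : ¬ IsSquare c
  ro : o.sy.r c = 1
  ri : i.sy.r c = 1

lemma wa3 {v o i : Place F K} (h1 : v ≠ o) (h2 : v ≠ i) (h3 : o ≠ i) {g1 g2 g3 : K} (hg1 : g1 ≠ 0) (hg2 : g2 ≠ 0)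
    (hg3 : g3 ≠ 0) : ∃ x, x ≠ 0 ∧ (v.sy.p x = v.sy.p g1 ∧ v.sy.r x = v.sy.r g1) ∧
      (o.sy.p x = o.sy.p g2 ∧ o.sy.r x = o.sy.r g2) ∧ (i.sy.p x = i.sy.p g3 ∧ i.sy.r x = i.sy.r g3) := by
  classical
  obtain ⟨x, hx, h⟩ := Place.wa {v, o, i} (fun u => if u = v then g1 else if u = o then g2 else g3) (by
    intro u _
    split_ifs <;> assumption)
  refine ⟨x, hx, ?_, ?_, ?_⟩
  · simpa using h v (by simp)
  · simpa [h1.symm] using h o (by simp)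
  · simpa [h2.symm, h3.symm] using h i (by simp)

lemma exists_nsq (v : Place F K) : ∃ x : K, x ≠ 0 ∧ ¬ v.sy.Sq x := by
  obtain ⟨x, hx, h⟩ := v.exists_ord 1
  refine ⟨x, hx, fun hs => ?_⟩
  have := hs.1
  rw [Place.sy_p, h] at this
  simp at this

lemma sq_congr {S : LSym K} {x y : K} (h : S.p x = S.p y ∧ S.r x = S.r y) : S.Sq x ↔ S.Sq y := by
  unfold LSym.Sq
  rw [h.1, h.2]

lemma exists_config {c : K} (hc : c ∈ Cst F K) (hns : ¬ IsSquare c) {o i : Place F K} (ne : o ≠ i)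
    (ho : o.sy.r c = 1) (hi : i.sy.r c = 1) : ∃ e0 f0 z0 z1, Config c o i e0 f0 z0 z1 := by
  classical
  obtain ⟨f, hf, h⟩ := EX_odd hc hns ho hi ne
  have key : ∀ {o i : Place F K}, o ≠ i → ∃ z : K, z ≠ 0 ∧ o.sy.Sq z ∧ ¬ i.sy.Sq z := by
    intro o i ne
    obtain ⟨x, hx, hxs⟩ := exists_nsq i
    obtain ⟨z, hz, hzl⟩ := Place.wa {o, i} (fun u => if u = o then 1 else x) (by
      intro u _
      split_ifs
      · exact one_ne_zero
      · exact hx)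
    refine ⟨z, hz, ?_, ?_⟩
    · have := hzl o (by simp)
      rw [if_pos rfl] at this
      exact (sq_congr this).2 o.sy.sq_one
    · have := hzl i (by simp)
      rw [if_neg ne.symm] at this
      rwa [sq_congr this]
  obtain ⟨z0, hz0, a0, a1⟩ := key ne
  obtain ⟨z1, hz1, b0, b1⟩ := key ne.symm
  exact ⟨c, f, z0, z1, ne, c_ne hns, hf, hz0, hz1, h, a0, a1, b0, b1, hc, hns, ho, hi⟩

lemma h_kernel {v : Place F K} {a y : K} (ha : a ≠ 0) (hy : y ≠ 0) (h1 : ¬ v.sy.Sq a) (h2 : ¬ v.sy.Sq (-a))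
    (h : v.sy.h a y = 0) : v.sy.Sq y ∨ v.sy.Sq (y * (-a)) := by
  have hn : (-1 : K) ≠ 0 := neg_ne_zero.2 one_ne_zero
  rw [LSym.sq_mul_iff _ hy (neg_ne_zero.2 ha)]
  rw [show -a = (-1) * a by ring] at h2 ⊢
  unfold LSym.Sq at *
  unfold LSym.h at h
  rw [v.sy.p_mul _ _ hn ha, v.sy.r_mul _ _ hn ha, v.sy.p_neg, v.sy.r_neg] at h2 ⊢
  clear hn ha hy
  revert h1 h2 h
  generalize v.sy.p a = p0
  generalize v.sy.r a = r0
  generalize v.sy.p y = p1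
  generalize v.sy.r y = r1
  generalize v.sy.n = n
  clear * -
  rcases z2_cases n with rfl | rfl <;> rcases z2_cases p0 with rfl | rfl <;> rcases z2_cases r0 with rfl | rfl <;>
    revert p1 r1 <;> decide

lemma cert_sound {o i : Place F K} {c₀ e0 f0 z0 z1 : K} (C : Config c₀ o i e0 f0 z0 z1) {a b d : K} (ha : a ≠ 0)
    (hb : b ≠ 0) (hd : d ≠ 0) (h : Phi e0 f0 z0 z1 a b d) : ¬ Rep a b d := by
  obtain ⟨y, hy, s1, s2, q1, q1', hdd, q2, q3, q4, q5, q6, q7, hae, hbf, q8, q9⟩ := h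
  have hy' : ∀ j, y j ≠ 0 := fun j => Finset.prod_ne_zero_iff.1 hy j (Finset.mem_univ j)
  rw [SymEq_iff (F := F) (hy' _) (mul_ne_zero (hy' _) (hy' _)) C.he0 C.hf0] at s1
  rw [SymEq_iff (F := F) (hy' _) (hy' _) (hy' _) (hy' _)] at s2
  rw [SqC_iff (F := F) (hy' _) (hy' _) (hy' _)] at q1 q1'
  rw [SqC_iff (F := F) (hy' _) (hy' _) (hy' _)] at q2 q3 q4 q5 q6 q7
  rw [SqC_iff (F := F) C.he0 C.hf0 (mul_ne_zero (hy' _) C.hz1)] at q8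
  rw [SqC_iff (F := F) C.he0 C.hf0 (mul_ne_zero (hy' _) C.hz0)] at q9
  have s1' : ∀ v : Place F K, v.sy.h (y 0) (y 1) + v.sy.h (y 0) (y 2) = v.sy.h e0 f0 := fun v => by
    rw [← s1, LSym.h_mul_right _ (hy' _) (hy' _)]
  have hso : o.sy.h e0 f0 = 1 := (C.h o).2 (Or.inl rfl)
  have hsi : i.sy.h e0 f0 = 1 := (C.h i).2 (Or.inr rfl)
  have hex : ∃ v : Place F K, v.sy.h (y 0) (y 1) = 1 ∧ v.sy.h (y 0) (y 2) = 1 := by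
    by_contra hcon
    push Not at hcon
    have hoff : ∀ v : Place F K, v ≠ o → v ≠ i → v.sy.h (y 0) (y 1) ≠ 1 := by
      intro v h1 h2 h3
      have h4 : v.sy.h e0 f0 ≠ 1 := fun h => by
        rcases (C.h v).1 h with h | h
        · exact h1 h
        · exact h2 h
      have h5 := (z2_cases _).resolve_right (hcon v h3)
      have := s1' v
      rw [h3, h5, add_zero] at this
      exact h4 this.symm
    by_cases ho : o.sy.h (y 0) (y 1) = 1
    · by_cases hi : i.sy.h (y 0) (y 1) = 1
      · have w1 := q4 o ho
        have w2 := (LSym.sq_mul_iff _ (hy' _) C.hz1).1 (q8 o hso)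
        exact C.b1 ((sq_congr w2).1 w1)
      · refine REC C.hc C.hns C.ro (hy' 0) (hy' 1) fun v => ⟨fun hv => ?_, fun hv => hv ▸ ho⟩
        by_contra hvo
        exact hoff v hvo (fun h => hi (h ▸ hv)) hv
    · by_cases hi : i.sy.h (y 0) (y 1) = 1
      · refine REC C.hc C.hns C.ri (hy' 0) (hy' 1) fun v => ⟨fun hv => ?_, fun hv => hv ▸ hi⟩
        by_contra hvi
        exact hoff v (fun h => ho (h ▸ hv)) hvi hv
      · have h5 := s1' i
        rw [(z2_cases _).resolve_right hi, zero_add, hsi] at h5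
        have w1 := q7 i h5
        have w2 := (LSym.sq_mul_iff _ (hy' _) C.hz0).1 (q9 i hsi)
        exact C.a1 ((sq_congr w2).1 w1)
  obtain ⟨v, hv1, hv2⟩ := hex
  intro hR
  refine (rep_iff (F := F) ha hb hd).1 hR v ?_ (hdd ▸ LSym.sq_mul _ (hy' _) (hy' _) (q1 v hv1) (q1' v hv2))
  have k1 : v.sy.Sq (a * y 3) := hae ▸ LSym.sq_mul _ (hy' _) (hy' _) (q2 v hv1) (q5 v hv2)
  have k2 : v.sy.Sq (b * y 4) := hbf ▸ LSym.sq_mul _ (hy' _) (hy' _) (q3 v hv1) (q6 v hv2)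
  rw [LSym.sq_mul_iff _ ha (hy' _)] at k1
  rw [LSym.sq_mul_iff _ hb (hy' _)] at k2
  rw [LSym.h_congr_left _ k1.1 k1.2, LSym.h_congr_right _ k2.1 k2.2, ← s2, hv1]

lemma cert_complete {o i : Place F K} {c₀ e0 f0 z0 z1 : K} (C : Config c₀ o i e0 f0 z0 z1) {a b d : K} (ha : a ≠ 0)
    (hb : b ≠ 0) (hd : d ≠ 0) {v : Place F K} (hvo : v ≠ o) (hvi : v ≠ i) (hab : v.sy.h a b = 1)
    (hds : v.sy.Sq d) (hneg : ¬ v.sy.Sq (-a)) : Phi e0 f0 z0 z1 a b d := by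
  obtain ⟨a1, b1, ha1, hb1, hQ1⟩ := EX C.hc C.hns C.ri hvi
  obtain ⟨a2, b2, ha2, hb2, hQ2⟩ := EX C.hc C.hns C.ro hvo
  obtain ⟨n1, hn1, hn1s⟩ := exists_nsq v
  obtain ⟨n2, hn2, hn2s⟩ := exists_nsq o
  obtain ⟨n3, hn3, hn3s⟩ := exists_nsq i
  have has : ¬ v.sy.Sq a := fun h => by
    rw [LSym.h_of_sq_left _ h] at hab
    exact zero_ne_one hab
  obtain ⟨c, hc, c1, c2, c3⟩ := wa3 hvo hvi C.ne hn1 hn2 hn3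
  obtain ⟨x1, hx1, hx1l⟩ := slot (F := F) ha1 hb1 hc fun u hu => by
    rcases (hQ1 u).1 hu with rfl | rfl
    · rwa [sq_congr c1]
    · rwa [sq_congr c3]
  obtain ⟨x2, hx2, hx2l⟩ := slot (F := F) ha2 hb2 hc fun u hu => by
    rcases (hQ2 u).1 hu with rfl | rfl
    · rwa [sq_congr c1]
    · rwa [sq_congr c2]
  have D1 : ∀ u : Place F K, u.sy.h c x1 = 1 ↔ u = v ∨ u = i := fun u => by rw [hx1l, hQ1]
  have D2 : ∀ u : Place F K, u.sy.h c x2 = 1 ↔ u = v ∨ u = o := fun u => by rw [hx2l, hQ2]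
  obtain ⟨e, he, e1, e2, e3⟩ := wa3 hvo hvi C.ne ha one_ne_zero hn3
  obtain ⟨f1, hf1, hf1l⟩ := slot (F := F) hc hx1 he fun u hu => by
    rcases (D1 u).1 hu with rfl | rfl
    · rwa [sq_congr e1]
    · rwa [sq_congr e3]
  have hf : ∃ f, f ≠ 0 ∧ (∀ u : Place F K, u.sy.h e f = u.sy.h c x1) ∧ v.sy.Sq (b * f) := by
    have hk : v.sy.h a (b * f1) = 0 := by
      rw [LSym.h_mul_right _ hb hf1, hab, ← LSym.h_congr_left _ e1.1 e1.2, hf1l, (D1 v).2 (Or.inl rfl),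
        z2_add_self]
    rcases h_kernel ha (mul_ne_zero hb hf1) has hneg hk with h | h
    · exact ⟨f1, hf1, hf1l, h⟩
    · have hne := neg_ne_zero.2 he
      refine ⟨f1 * (-e), mul_ne_zero hf1 hne, fun u => ?_, ?_⟩
      · rw [LSym.h_mul_right _ hf1 hne, LSym.h_neg_self _ he, add_zero, hf1l]
      · have hn : (-1 : K) ≠ 0 := neg_ne_zero.2 one_ne_zero
        rw [← mul_assoc]
        rw [LSym.sq_mul_iff _ (mul_ne_zero hb hf1) (neg_ne_zero.2 ha)] at h
        rw [LSym.sq_mul_iff _ (mul_ne_zero hb hf1) hne, h.1, h.2, show -a = (-1) * a by ring,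
          show -e = (-1) * e by ring, v.sy.p_mul _ _ hn ha, v.sy.r_mul _ _ hn ha, v.sy.p_mul _ _ hn he,
          v.sy.r_mul _ _ hn he, e1.1, e1.2]
        exact ⟨rfl, rfl⟩
  obtain ⟨f, hf, hfl, hbf⟩ := hf
  have hae : v.sy.Sq (a * e) := (LSym.sq_mul_iff _ ha he).2 ⟨e1.1.symm, e1.2.symm⟩
  have split : ∀ g : K, g ≠ 0 → v.sy.Sq g → ∃ s t : K, s ≠ 0 ∧ t ≠ 0 ∧ g = s * t ∧
      v.sy.Sq s ∧ i.sy.Sq s ∧ v.sy.Sq t ∧ o.sy.Sq t := by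
    intro g hg hgs
    obtain ⟨s, hs, s1, s2, s3⟩ := wa3 hvo hvi C.ne one_ne_zero hg one_ne_zero
    have hsv := (sq_congr s1).2 v.sy.sq_one
    have ht := mul_ne_zero hg (inv_ne_zero hs)
    have hgt : g = s * (g * s⁻¹) := by field_simp
    refine ⟨s, g * s⁻¹, hs, ht, hgt, hsv, (sq_congr s3).2 i.sy.sq_one, ?_, ?_⟩
    · have h1 := hgs
      rw [hgt, LSym.sq_mul_iff _ hs ht] at h1
      exact (sq_congr h1).1 hsv
    · have h1 := s2
      have h2 : g * s⁻¹ * s ^ 2 = s * g := by field_simp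
      have h3 : o.sy.Sq (g * s⁻¹ * s ^ 2) := by
        rw [h2, LSym.sq_mul_iff _ hs hg]; exact h1
      rw [LSym.sq_mul_iff _ ht (pow_ne_zero 2 hs)] at h3
      exact (sq_congr h3).2 (o.sy.sq_sq hs)
  obtain ⟨s, t, hs, ht, hst, sv, si, tv, tO⟩ := split _ (mul_ne_zero ha he) hae
  obtain ⟨s', t', hs', ht', hst', sv', si', tv', tO'⟩ := split _ (mul_ne_zero hb hf) hbf
  obtain ⟨w1, hw1, w11, w12, w13⟩ := wa3 hvo hvi C.ne one_ne_zero C.hz1 one_ne_zero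
  obtain ⟨w2, hw2, w21, w22, w23⟩ := wa3 hvo hvi C.ne one_ne_zero one_ne_zero C.hz0
  have L1 : ∀ g : K, g ≠ 0 → v.sy.Sq g → i.sy.Sq g → SqC c x1 g := fun g hg h1 h2 =>
    (SqC_iff (F := F) hc hx1 hg).2 fun u hu => by
      rcases (D1 u).1 hu with rfl | rfl <;> assumption
  have L2 : ∀ g : K, g ≠ 0 → v.sy.Sq g → o.sy.Sq g → SqC c x2 g := fun g hg h1 h2 =>
    (SqC_iff (F := F) hc hx2 hg).2 fun u hu => by
      rcases (D2 u).1 hu with rfl | rfl <;> assumption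
  have L0 : ∀ g : K, g ≠ 0 → o.sy.Sq g → i.sy.Sq g → SqC e0 f0 g := fun g hg h1 h2 =>
    (SqC_iff (F := F) C.he0 C.hf0 hg).2 fun u hu => by
      rcases (C.h u).1 hu with rfl | rfl <;> assumption
  obtain ⟨σ, τ, hσ, hτ, hdd, σv, σi, τv, τo⟩ := split _ hd hds
  have w1v := (sq_congr w11).2 v.sy.sq_one
  have w1i := (sq_congr w13).2 i.sy.sq_one
  have w2v := (sq_congr w21).2 v.sy.sq_one
  have w2o := (sq_congr w22).2 o.sy.sq_one
  have hy : ∀ j, ![c, x1, x2, e, f, s, t, s', t', w1, w2, σ, τ] j ≠ 0 := by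
    intro j
    fin_cases j <;> assumption
  refine ⟨![c, x1, x2, e, f, s, t, s', t', w1, w2, σ, τ], Finset.prod_ne_zero_iff.2 fun j _ => hy j, ?_⟩
  change SymEq c (x1 * x2) e0 f0 ∧ SymEq c x1 e f ∧
    SqC c x1 σ ∧ SqC c x2 τ ∧ d = σ * τ ∧ SqC c x1 s ∧ SqC c x1 s' ∧ SqC c x1 w1 ∧
    SqC c x2 t ∧ SqC c x2 t' ∧ SqC c x2 w2 ∧
    a * e = s * t ∧ b * f = s' * t' ∧ SqC e0 f0 (w1 * z1) ∧ SqC e0 f0 (w2 * z0)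
  refine ⟨?_,
    (SymEq_iff (F := F) hc hx1 he hf).2 (fun u => (hfl u).symm), L1 σ hσ σv σi, L2 τ hτ τv τo, hdd,
    L1 s hs sv si, L1 s' hs' sv' si', L1 w1 hw1 w1v w1i, L2 t ht tv tO, L2 t' ht' tv' tO', L2 w2 hw2 w2v w2o,
    hst, hst', L0 _ (mul_ne_zero hw1 C.hz1) ((LSym.sq_mul_iff _ hw1 C.hz1).2 w12)
      (LSym.sq_mul _ hw1 C.hz1 w1i C.b0),
    L0 _ (mul_ne_zero hw2 C.hz0) (LSym.sq_mul _ hw2 C.hz0 w2o C.a0) ((LSym.sq_mul_iff _ hw2 C.hz0).2 w23)⟩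
  · refine (SymEq_iff (F := F) hc (mul_ne_zero hx1 hx2) C.he0 C.hf0).2 fun u => ?_
    change u.sy.h c (x1 * x2) = _
    rw [LSym.h_mul_right _ hx1 hx2]
    have k0 := C.h u
    have k1 := D1 u
    have k2 := D2 u
    by_cases huv : u = v
    · subst huv
      rw [k1.2 (Or.inl rfl), k2.2 (Or.inl rfl), z2_add_self]
      by_contra h
      rcases k0.1 (z2_ne (Ne.symm h)) with h | h
      · exact hvo h
      · exact hvi h
    · by_cases huo : u = o
      · subst huo
        rw [k2.2 (Or.inr rfl), k0.2 (Or.inl rfl), (z2_cases (u.sy.h c x1)).resolve_right, zero_add]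
        rw [k1]
        rintro (h | h)
        · exact huv h
        · exact C.ne h
      · have n2 : u.sy.h c x2 = 0 := (z2_cases _).resolve_right (by rw [k2]; exact fun h => h.elim huv huo)
        rw [n2, add_zero]
        by_cases hui : u = i
        · rw [k1.2 (Or.inr hui), k0.2 (Or.inr hui)]
        · rw [(z2_cases (u.sy.h c x1)).resolve_right (by rw [k1]; exact fun h => h.elim huv hui),
            (z2_cases (u.sy.h e0 f0)).resolve_right (by rw [k0]; exact fun h => h.elim huo hui)]
end cert
end GFF
end PF2

section PF3
namespace GFF
set_option linter.unusedSectionVars false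
set_option linter.unusedVariables false
set_option linter.unnecessarySimpa false
open IntermediateField Polynomial

/-- the existential certificate for non-representability -/
def NR {K : Type*} [Field K] (g g' : Fin 4 → K) (a b d : K) : Prop :=
  (Phi (g 0) (g 1) (g 2) (g 3) a b d ∨ Phi (g 0) (g 1) (g 2) (g 3) b a d) ∨
  (Phi (g' 0) (g' 1) (g' 2) (g' 3) a b d ∨ Phi (g' 0) (g' 1) (g' 2) (g' 3) b a d)

section main
universe u
variable {F : Type*} [Field F] [Finite F] [NeZero (2 : F)] {K : Type u} [Field K] [Algebra F K] [FF F K]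

lemma rep_symm {a b d : K} (h : Rep a b d) : Rep b a d := by
  obtain ⟨X, Y, Z, h⟩ := h
  exact ⟨Y, X, Z, by rw [h]; ring⟩

lemma neg_or {v : Place F K} {a b : K} (ha : a ≠ 0) (hb : b ≠ 0) (h : v.sy.h a b = 1) :
    ¬ v.sy.Sq (-a) ∨ ¬ v.sy.Sq (-b) := by
  by_contra hcon
  push Not at hcon
  have hn : (-1 : K) ≠ 0 := neg_ne_zero.2 one_ne_zero
  have h1 := hcon.1.1
  have h2 := hcon.2.1
  rw [show -a = (-1) * a by ring, v.sy.p_mul _ _ hn ha, v.sy.p_neg, zero_add] at h1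
  rw [show -b = (-1) * b by ring, v.sy.p_mul _ _ hn hb, v.sy.p_neg, zero_add] at h2
  unfold LSym.h at h
  rw [h1, h2] at h
  simp at h

theorem exists_NR (F : Type*) [Field F] [Finite F] [NeZero (2 : F)] {K : Type u} [Field K] [Algebra F K] [FF F K] :
    ∃ g g' : Fin 4 → K, ∀ a b d : K, a ≠ 0 → b ≠ 0 → d ≠ 0 → (¬ Rep a b d ↔ NR g g' a b d) := by
  obtain ⟨c, hc, hns⟩ := exists_c F K
  have hinf := odd_infinite (F := F) hc hns
  let em := hinf.natEmbedding
  have hem : ∀ n, (em n : Place F K).sy.r c = 1 := fun n => (em n).2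
  have hne : ∀ {n k : ℕ}, n ≠ k → (em n : Place F K) ≠ em k := fun h h' => h (em.injective (Subtype.ext h'))
  obtain ⟨e0, f0, z0, z1, C⟩ := exists_config hc hns (hne (show 0 ≠ 1 by decide)) (hem 0) (hem 1)
  obtain ⟨e0', f0', z0', z1', C'⟩ := exists_config hc hns (hne (show 2 ≠ 3 by decide)) (hem 2) (hem 3)
  refine ⟨![e0, f0, z0, z1], ![e0', f0', z0', z1'], fun a b d ha hb hd => ?_⟩
  change _ ↔ (Phi e0 f0 z0 z1 a b d ∨ Phi e0 f0 z0 z1 b a d) ∨ (Phi e0' f0' z0' z1' a b d ∨ Phi e0' f0' z0' z1' b a d)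
  constructor
  · intro h
    rw [rep_iff (F := F) ha hb hd] at h
    push Not at h
    obtain ⟨v, hv, hvd⟩ := h
    have hv' : v.sy.h b a = 1 := by rw [LSym.h_comm, hv]
    by_cases hv0 : v ≠ em 0 ∧ v ≠ em 1
    · left
      rcases neg_or ha hb hv with hn | hn
      · left
        exact cert_complete C ha hb hd hv0.1 hv0.2 hv hvd hn
      · right
        exact cert_complete C hb ha hd hv0.1 hv0.2 hv' hvd hn
    · have hv1 : v ≠ em 2 ∧ v ≠ em 3 := by
        rw [not_and_or, not_not, not_not] at hv0
        rcases hv0 with h | h <;> rw [h]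
        · exact ⟨hne (by decide), hne (by decide)⟩
        · exact ⟨hne (by decide), hne (by decide)⟩
      right
      rcases neg_or ha hb hv with hn | hn
      · left
        exact cert_complete C' ha hb hd hv1.1 hv1.2 hv hvd hn
      · right
        exact cert_complete C' hb ha hd hv1.1 hv1.2 hv' hvd hn
  · rintro ((h | h) | (h | h))
    · exact cert_sound C ha hb hd h
    · exact fun hr => cert_sound C hb ha hd h (rep_symm hr)
    · exact cert_sound C' ha hb hd h
    · exact fun hr => cert_sound C' hb ha hd h (rep_symm hr)

lemma aniso4 (two : (2 : K) ≠ 0) {a : Fin 4 → K} (ha : ∀ i, a i ≠ 0) : (∀ x : Fin 4 → K, ∑ i, a i * x i ^ 2 = 0 → x = 0) ↔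
    ¬ Rep (-(a 0 * a 1)) (-(a 0 * a 2)) (a 0 * a 1 * a 2 * a 3) := by
  rw [← iso4_iff_rep two (ha 0) (ha 1) (ha 2) (ha 3)]
  constructor
  · rintro h ⟨x, y, z, w, hn, he⟩
    have := h ![x, y, z, w] (by simpa [Fin.sum_univ_four] using he)
    apply hn
    refine ⟨congrFun this 0, congrFun this 1, congrFun this 2, congrFun this 3⟩
  · intro h x hx
    by_contra h0
    refine h ⟨x 0, x 1, x 2, x 3, ?_, by rw [← hx, Fin.sum_univ_four]⟩
    rintro ⟨h1, h2, h3, h4⟩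
    apply h0
    funext j
    fin_cases j <;> assumption

lemma aniso3 (two : (2 : K) ≠ 0) {a : Fin 3 → K} (ha : ∀ i, a i ≠ 0) : (∀ x : Fin 3 → K, ∑ i, a i * x i ^ 2 = 0 → x = 0) ↔
    ¬ Rep (-(a 0 * a 1)) (-(a 0 * a 2)) 1 := by
  have h0 := ha 0
  have h1 := ha 1
  have h2 := ha 2
  have n1 : -(a 0 * a 1) ≠ 0 := neg_ne_zero.2 (mul_ne_zero h0 h1)
  have n2 : -(a 0 * a 2) ≠ 0 := neg_ne_zero.2 (mul_ne_zero h0 h2)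
  constructor
  · intro h hr
    obtain ⟨X, Y, Z, hn, he⟩ := pure_isotropic_of_rep_one n1 n2 hr
    have := h ![Z, Y / a 1, X / a 2] (by
      rw [Fin.sum_univ_three]
      change a 0 * Z ^ 2 + a 1 * (Y / a 1) ^ 2 + a 2 * (X / a 2) ^ 2 = 0
      field_simp
      have : a 0 * (a 0 * Z ^ 2 * a 1 * a 2 + Y ^ 2 * a 2 + a 1 * X ^ 2) = 0 := by linear_combination -he
      have := (mul_eq_zero.1 this).resolve_left h0
      linear_combination this)
    apply hn
    have k1 : Z = 0 := congrFun this 0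
    have k2 : Y / a 1 = 0 := congrFun this 1
    have k3 : X / a 2 = 0 := congrFun this 2
    exact ⟨(div_eq_zero_iff.1 k3).resolve_right h2, (div_eq_zero_iff.1 k2).resolve_right h1, k1⟩
  · intro h x hx
    by_contra hx0
    refine h (rep_of_pure_isotropic two n1 n2 (X := a 2 * x 2) (Y := a 1 * x 1) (Z := x 0) ?_ ?_ 1)
    · rintro ⟨k1, k2, k3⟩
      apply hx0
      funext j
      fin_cases j
      · exact k3
      · exact (mul_eq_zero.1 k2).resolve_left h1
      · exact (mul_eq_zero.1 k1).resolve_left h2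
    · rw [Fin.sum_univ_three] at hx
      linear_combination (-(a 0 * a 1 * a 2)) * hx

lemma aniso2 (F : Type*) [Field F] [Finite F] [NeZero (2 : F)] {K : Type u} [Field K] [Algebra F K] [FF F K]
    {a : Fin 2 → K} (ha : ∀ i, a i ≠ 0) : (∀ x : Fin 2 → K, ∑ i, a i * x i ^ 2 = 0 → x = 0) ↔
    ∃ y : Fin 2 → K, (y 0 ≠ 0 ∧ y 1 ≠ 0) ∧
      ¬ Rep (-(a 0 * a 1)) (-(a 0 * y 0)) (a 0 * a 1 * y 0 * y 1) := by
  have h0 := ha 0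
  have h1 := ha 1
  constructor
  · intro h
    have hns : ¬ IsSquare (-(a 0 * a 1)) := by
      rintro ⟨s, hs⟩
      have := h ![s, a 0] (by
        rw [Fin.sum_univ_two]
        change a 0 * s ^ 2 + a 1 * (a 0) ^ 2 = 0
        linear_combination (-a 0) * hs)
      exact h0 (congrFun this 1)
    obtain ⟨v, hv⟩ := SQ (F := F) hns
    obtain ⟨g, hg, hvg⟩ := Place.exists_h v hv
    have e1 : -(a 0 * (-(g / a 0))) = g := by field_simp
    have hy : -(g / a 0) ≠ 0 := neg_ne_zero.2 (div_ne_zero hg h0)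
    have hy1 : a 0 * a 1 * (-(g / a 0)) ≠ 0 := mul_ne_zero (mul_ne_zero h0 h1) hy
    refine ⟨![-(g / a 0), a 0 * a 1 * (-(g / a 0))], ⟨hy, hy1⟩, ?_⟩
    change ¬ Rep (-(a 0 * a 1)) (-(a 0 * (-(g / a 0)))) (a 0 * a 1 * (-(g / a 0)) * (a 0 * a 1 * (-(g / a 0))))
    rw [e1, ← pow_two, rep_iff (F := F) (neg_ne_zero.2 (mul_ne_zero h0 h1)) hg (pow_ne_zero 2 hy1)]
    intro h
    exact h v hvg (v.sy.sq_sq hy1)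
  · rintro ⟨y, ⟨hy0, hy1⟩, hr⟩ x hx
    by_contra hx0
    apply hr
    rw [← iso4_iff_rep (two_ne F) h0 h1 hy0 hy1]
    rw [Fin.sum_univ_two] at hx
    refine ⟨x 0, x 1, 0, 0, ?_, by linear_combination hx⟩
    rintro ⟨k1, k2, -⟩
    apply hx0
    funext j
    fin_cases j <;> assumption
end main
end GFF
end PF3

section PG
namespace GFF
set_option linter.unusedSectionVars false
set_option linter.unusedVariables false
set_option linter.unnecessarySimpa false

section dio
variable {K : Type*} [Field K] {σ : Type}

/-- polynomial functions -/
def IsPoly (g : (σ → K) → K) : Prop := ∃ p : MvPolynomial σ K, ∀ a, g a = MvPolynomial.eval a p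

/-- diophantine predicates -/
def Dio (P : (σ → K) → Prop) : Prop := ∃ (τ : Type) (_ : Finite τ) (f : MvPolynomial (σ ⊕ τ) K),
  ∀ a, P a ↔ ∃ x : τ → K, MvPolynomial.eval (Sum.elim a x) f = 0

lemma IsPoly.const (c : K) : IsPoly (fun _ : σ → K => c) := ⟨MvPolynomial.C c, fun a => by simp⟩

lemma IsPoly.var (i : σ) : IsPoly (fun a : σ → K => a i) := ⟨MvPolynomial.X i, fun a => by simp⟩

lemma IsPoly.add {f g : (σ → K) → K} (hf : IsPoly f) (hg : IsPoly g) : IsPoly (fun a => f a + g a) := by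
  obtain ⟨p, hp⟩ := hf
  obtain ⟨q, hq⟩ := hg
  exact ⟨p + q, fun a => by simp [hp, hq]⟩

lemma IsPoly.mul {f g : (σ → K) → K} (hf : IsPoly f) (hg : IsPoly g) : IsPoly (fun a => f a * g a) := by
  obtain ⟨p, hp⟩ := hf
  obtain ⟨q, hq⟩ := hg
  exact ⟨p * q, fun a => by simp [hp, hq]⟩

lemma IsPoly.neg {f : (σ → K) → K} (hf : IsPoly f) : IsPoly (fun a => - f a) := by
  obtain ⟨p, hp⟩ := hf
  exact ⟨-p, fun a => by simp [hp]⟩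

lemma IsPoly.sub {f g : (σ → K) → K} (hf : IsPoly f) (hg : IsPoly g) : IsPoly (fun a => f a - g a) := by
  obtain ⟨p, hp⟩ := hf
  obtain ⟨q, hq⟩ := hg
  exact ⟨p - q, fun a => by simp [hp, hq]⟩

lemma IsPoly.pow {f : (σ → K) → K} (hf : IsPoly f) (n : ℕ) : IsPoly (fun a => f a ^ n) := by
  obtain ⟨p, hp⟩ := hf
  exact ⟨p ^ n, fun a => by simp [hp]⟩

lemma IsPoly.prod {ι : Type*} (s : Finset ι) {f : ι → (σ → K) → K} (hf : ∀ j, IsPoly (f j)) :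
    IsPoly (fun a => ∏ j ∈ s, f j a) := by
  choose p hp using hf
  exact ⟨∏ j ∈ s, p j, fun a => by simp [hp, map_prod]⟩

lemma IsPoly.lift {ρ : Type} {f : (σ → K) → K} (hf : IsPoly f) :
    IsPoly (fun b : σ ⊕ ρ → K => f (fun i => b (Sum.inl i))) := by
  obtain ⟨p, hp⟩ := hf
  exact ⟨MvPolynomial.rename Sum.inl p, fun a => by rw [MvPolynomial.eval_rename]; exact hp _⟩

lemma Dio.congr {P Q : (σ → K) → Prop} (h : Dio P) (hpq : ∀ a, Q a ↔ P a) : Dio Q := by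
  have : Q = P := funext fun a => propext (hpq a)
  rwa [this]

lemma Dio.zero {f : (σ → K) → K} (hf : IsPoly f) : Dio (fun a => f a = 0) := by
  obtain ⟨p, hp⟩ := hf
  refine ⟨Empty, inferInstance, MvPolynomial.rename Sum.inl p, fun a => ?_⟩
  simp only [MvPolynomial.eval_rename, Sum.elim_comp_inl, hp]
  simp

lemma Dio.eq {f g : (σ → K) → K} (hf : IsPoly f) (hg : IsPoly g) : Dio (fun a => f a = g a) :=
  (Dio.zero (hf.sub hg)).congr fun a => by rw [sub_eq_zero]

lemma Dio.ex {ρ : Type} [Finite ρ] {Q : (σ → K) → (ρ → K) → Prop}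
    (h : Dio (fun b : σ ⊕ ρ → K => Q (fun i => b (Sum.inl i)) (fun j => b (Sum.inr j)))) :
    Dio (fun a => ∃ y : ρ → K, Q a y) := by
  obtain ⟨τ, _, f, hf⟩ := h
  refine ⟨ρ ⊕ τ, inferInstance, MvPolynomial.rename (Equiv.sumAssoc σ ρ τ) f, fun a => ?_⟩
  have key : ∀ (y : ρ → K) (x : τ → K), (Sum.elim a (Sum.elim y x)) ∘ (Equiv.sumAssoc σ ρ τ)
      = Sum.elim (Sum.elim a y) x := by
    intro y x
    funext j
    rcases j with (j | j) | j <;> rfl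
  constructor
  · rintro ⟨y, hy⟩
    obtain ⟨x, hx⟩ := (hf (Sum.elim a y)).1 hy
    exact ⟨Sum.elim y x, by rw [MvPolynomial.eval_rename, key, hx]⟩
  · rintro ⟨x, hx⟩
    refine ⟨fun j => x (Sum.inl j), (hf (Sum.elim a fun j => x (Sum.inl j))).2 ⟨fun j => x (Sum.inr j), ?_⟩⟩
    rw [← key, ← MvPolynomial.eval_rename, ← hx]
    congr 2
    funext j
    rcases j with j | j | j <;> rfl

lemma Dio.or {P Q : (σ → K) → Prop} (hP : Dio P) (hQ : Dio Q) : Dio (fun a => P a ∨ Q a) := by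
  obtain ⟨τ, _, f, hf⟩ := hP
  obtain ⟨τ', _, g, hg⟩ := hQ
  refine ⟨τ ⊕ τ', inferInstance, MvPolynomial.rename (Sum.map id Sum.inl) f *
    MvPolynomial.rename (Sum.map id Sum.inr) g, fun a => ?_⟩
  simp only [map_mul, MvPolynomial.eval_rename, mul_eq_zero, Sum.elim_comp_map, Function.comp_id]
  rw [hf, hg]
  constructor
  · rintro (⟨x, hx⟩ | ⟨x, hx⟩)
    · exact ⟨Sum.elim x 0, Or.inl (by simpa using hx)⟩
    · exact ⟨Sum.elim 0 x, Or.inr (by simpa using hx)⟩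
  · rintro ⟨x, hx | hx⟩
    · exact Or.inl ⟨_, hx⟩
    · exact Or.inr ⟨_, hx⟩

lemma Dio.ne {f g : (σ → K) → K} (hf : IsPoly f) (hg : IsPoly g) : Dio (fun a => f a ≠ g a) := by
  refine (Dio.ex (ρ := Fin 1) (Q := fun a y => (f a - g a) * y 0 = 1)
    (Dio.eq ((hf.lift.sub hg.lift).mul (IsPoly.var (Sum.inr 0))) (IsPoly.const 1))).congr fun a => ?_
  rw [← sub_ne_zero]
  constructor
  · intro h
    exact ⟨fun _ => (f a - g a)⁻¹, mul_inv_cancel₀ h⟩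
  · rintro ⟨y, hy⟩ h
    rw [h, zero_mul] at hy
    exact zero_ne_one hy

section withc
variable {c : K} (hns : ¬ IsSquare c)

lemma and_zero (hns : ¬ IsSquare c) {x y : K} : x ^ 2 - c * y ^ 2 = 0 ↔ x = 0 ∧ y = 0 := by
  constructor
  · intro h
    by_cases hy : y = 0
    · refine ⟨?_, hy⟩
      rw [hy] at h
      simpa using h
    · exact absurd ⟨x / y, by field_simp; linear_combination -h⟩ hns
  · rintro ⟨rfl, rfl⟩
    simp

lemma Dio.and (hns : ¬ IsSquare c) {P Q : (σ → K) → Prop} (hP : Dio P) (hQ : Dio Q) : Dio (fun a => P a ∧ Q a) := by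
  obtain ⟨τ, _, f, hf⟩ := hP
  obtain ⟨τ', _, g, hg⟩ := hQ
  refine ⟨τ ⊕ τ', inferInstance, MvPolynomial.rename (Sum.map id Sum.inl) f ^ 2 -
    MvPolynomial.C c * MvPolynomial.rename (Sum.map id Sum.inr) g ^ 2, fun a => ?_⟩
  simp only [map_sub, map_pow, map_mul, MvPolynomial.eval_C, MvPolynomial.eval_rename, and_zero hns,
    Sum.elim_comp_map, Function.comp_id]
  rw [hf, hg]
  constructor
  · rintro ⟨⟨x, hx⟩, ⟨x', hx'⟩⟩
    exact ⟨Sum.elim x x', by simpa using hx, by simpa using hx'⟩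
  · rintro ⟨x, hx, hx'⟩
    exact ⟨⟨_, hx⟩, ⟨_, hx'⟩⟩

lemma Dio.rep {f g h : (σ → K) → K} (hf : IsPoly f) (hg : IsPoly g) (hh : IsPoly h) :
    Dio (fun a => Rep (f a) (g a) (h a)) := by
  refine (Dio.ex (ρ := Fin 3) (Q := fun a y => h a = f a * y 0 ^ 2 + g a * y 1 ^ 2 - f a * g a * y 2 ^ 2)
    (Dio.eq hh.lift (((hf.lift.mul ((IsPoly.var (Sum.inr 0)).pow 2)).add
      (hg.lift.mul ((IsPoly.var (Sum.inr 1)).pow 2))).sub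
      ((hf.lift.mul hg.lift).mul ((IsPoly.var (Sum.inr 2)).pow 2))))).congr fun a => ?_
  constructor
  · rintro ⟨X, Y, Z, h⟩
    exact ⟨![X, Y, Z], h⟩
  · rintro ⟨y, h⟩
    exact ⟨_, _, _, h⟩

lemma Dio.sqC (hns : ¬ IsSquare c) {f g h : (σ → K) → K} (hf : IsPoly f) (hg : IsPoly g) (hh : IsPoly h) :
    Dio (fun a => SqC (f a) (g a) (h a)) := by
  have v0 : IsPoly (fun b : σ ⊕ Fin 2 → K => b (Sum.inr 0)) := IsPoly.var _
  have v1 : IsPoly (fun b : σ ⊕ Fin 2 → K => b (Sum.inr 1)) := IsPoly.var _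
  have k0 := IsPoly.const (σ := σ ⊕ Fin 2) (0 : K)
  have f' := hf.lift (ρ := Fin 2)
  have g' := hg.lift (ρ := Fin 2)
  have h' := hh.lift (ρ := Fin 2)
  exact Dio.ex (Dio.and hns (Dio.ne v0 k0) (Dio.and hns (Dio.ne v1 k0) (Dio.and hns (Dio.rep f' g' v0)
    (Dio.and hns (Dio.rep f' g' v1) (Dio.and hns (Dio.rep f' g' (v0.mul v1))
    (Dio.and hns (Dio.rep f' g' (h'.mul v0)) (Dio.and hns (Dio.rep f' g' (h'.mul v1))
      (Dio.rep f' g' (h'.mul (v0.mul v1))))))))))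

lemma Dio.symEq (hns : ¬ IsSquare c) {f g h l : (σ → K) → K} (hf : IsPoly f) (hg : IsPoly g) (hh : IsPoly h)
    (hl : IsPoly l) : Dio (fun a => SymEq (f a) (g a) (h a) (l a)) := by
  have v0 : IsPoly (fun b : σ ⊕ Fin 1 → K => b (Sum.inr 0)) := IsPoly.var _
  have k0 := IsPoly.const (σ := σ ⊕ Fin 1) (0 : K)
  have k1 := IsPoly.const (σ := σ ⊕ Fin 1) (1 : K)
  have f' := hf.lift (ρ := Fin 1)
  have g' := hg.lift (ρ := Fin 1)
  have h' := hh.lift (ρ := Fin 1)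
  have l' := hl.lift (ρ := Fin 1)
  exact Dio.ex (Dio.and hns (Dio.ne v0 k0) (Dio.and hns (Dio.rep f' (g'.mul v0) k1)
    (Dio.and hns (Dio.rep (f'.mul h') v0 k1) (Dio.rep h' (l'.mul v0) k1))))

lemma Dio.phi (hns : ¬ IsSquare c) (e0 f0 z0 z1 : K) {f g h : (σ → K) → K} (hf : IsPoly f) (hg : IsPoly g)
    (hh : IsPoly h) : Dio (fun a => Phi e0 f0 z0 z1 (f a) (g a) (h a)) := by
  have v : ∀ j, IsPoly (fun b : σ ⊕ Fin 13 → K => b (Sum.inr j)) := fun j => IsPoly.var _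
  have k := IsPoly.const (K := K) (σ := σ ⊕ Fin 13)
  have f' := hf.lift (ρ := Fin 13)
  have g' := hg.lift (ρ := Fin 13)
  have h' := hh.lift (ρ := Fin 13)
  have A : ∀ {P Q : (σ ⊕ Fin 13 → K) → Prop}, Dio P → Dio Q → Dio (fun a => P a ∧ Q a) := fun h1 h2 =>
    Dio.and hns h1 h2
  have S : ∀ {f g h : (σ ⊕ Fin 13 → K) → K}, IsPoly f → IsPoly g → IsPoly h →
    Dio (fun a => SqC (f a) (g a) (h a)) := fun h1 h2 h3 => Dio.sqC hns h1 h2 h3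
  exact Dio.ex (A (Dio.ne (IsPoly.prod Finset.univ v) (k 0))
    (A (Dio.symEq hns (v 0) ((v 1).mul (v 2)) (k e0) (k f0)) (A (Dio.symEq hns (v 0) (v 1) (v 3) (v 4))
    (A (S (v 0) (v 1) (v 11)) (A (S (v 0) (v 2) (v 12)) (A (Dio.eq h' ((v 11).mul (v 12)))
    (A (S (v 0) (v 1) (v 5)) (A (S (v 0) (v 1) (v 7)) (A (S (v 0) (v 1) (v 9))
    (A (S (v 0) (v 2) (v 6)) (A (S (v 0) (v 2) (v 8)) (A (S (v 0) (v 2) (v 10))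
    (A (Dio.eq (f'.mul (v 3)) ((v 5).mul (v 6))) (A (Dio.eq (g'.mul (v 4)) ((v 7).mul (v 8)))
    (A (S (k e0) (k f0) ((v 9).mul (k z1))) (S (k e0) (k f0) ((v 10).mul (k z0))))))))))))))))))

lemma Dio.nr (hns : ¬ IsSquare c) (g g' : Fin 4 → K) {f1 f2 f3 : (σ → K) → K} (h1 : IsPoly f1) (h2 : IsPoly f2)
    (h3 : IsPoly f3) : Dio (fun a => NR g g' (f1 a) (f2 a) (f3 a)) :=
  ((Dio.phi hns _ _ _ _ h1 h2 h3).or (Dio.phi hns _ _ _ _ h2 h1 h3)).or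
    ((Dio.phi hns _ _ _ _ h1 h2 h3).or (Dio.phi hns _ _ _ _ h2 h1 h3))
end withc

lemma Dio.nonzero {m : ℕ} : Dio (fun a : Fin m → K => ∀ i, a i ≠ 0) :=
  (Dio.ne (IsPoly.prod Finset.univ IsPoly.var) (IsPoly.const 0)).congr fun a => by
    rw [Finset.prod_ne_zero_iff]
    simp

lemma Dio.fin {P : (σ → K) → Prop} (h : Dio P) : ∃ (k : ℕ) (f : MvPolynomial (σ ⊕ Fin k) K),
    ∀ a, P a ↔ ∃ x : Fin k → K, MvPolynomial.eval (Sum.elim a x) f = 0 := by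
  obtain ⟨τ, _, f, hf⟩ := h
  obtain ⟨k, ⟨e⟩⟩ := Finite.exists_equiv_fin τ
  refine ⟨k, MvPolynomial.rename (Sum.map id e) f, fun a => ?_⟩
  simp only [MvPolynomial.eval_rename, Sum.elim_comp_map, Function.comp_id]
  rw [hf]
  constructor
  · rintro ⟨x, hx⟩
    refine ⟨x ∘ e.symm, ?_⟩
    rw [Function.comp_assoc, Equiv.symm_comp_self, Function.comp_id, hx]
  · rintro ⟨x, hx⟩
    exact ⟨_, hx⟩
end dio

section final
variable (F : Type*) [Field F] [Finite F] [NeZero (2 : F)] (K : Type*) [Field K] [Algebra F K] [FF F K]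

theorem final (F : Type*) [Field F] [Finite F] [NeZero (2 : F)] (K : Type*) [Field K] [Algebra F K] [FF F K]
    (m : ℕ) (hm : 1 ≤ m) : Dio (fun a : Fin m → K => (∀ i, a i ≠ 0) ∧
      ∀ x : Fin m → K, (∑ i, a i * x i ^ 2) = 0 → x = 0) := by
  obtain ⟨c, -, hns⟩ := exists_c F K
  obtain ⟨g, g', hg⟩ := exists_NR F (K := K)
  have two : (2 : K) ≠ 0 := two_ne F
  have V : ∀ {m : ℕ} (i : Fin m), IsPoly (fun a : Fin m → K => a i) := fun i => IsPoly.var i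
  by_cases h5 : 5 ≤ m
  · refine (Dio.eq (IsPoly.const 0) (IsPoly.const 1)).congr fun a => ?_
    simp only [zero_ne_one, iff_false, not_and]
    intro _ h
    obtain ⟨x, hx, hx'⟩ := tsen (solver_finite F) (show 2 * 2 < m by omega) a
    exact hx (h x hx')
  · interval_cases m
    · refine Dio.nonzero.congr fun a => ⟨fun h => h.1, fun h => ⟨h, fun x hx => ?_⟩⟩
      rw [Fin.sum_univ_one] at hx
      funext j
      have := pow_eq_zero_iff (two_ne_zero) |>.1 ((mul_eq_zero.1 hx).resolve_left (h 0))
      rw [Subsingleton.elim j 0, this]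
      rfl
    · have v0 : IsPoly (fun b : Fin 2 ⊕ Fin 2 → K => b (Sum.inr 0)) := IsPoly.var _
      have v1 : IsPoly (fun b : Fin 2 ⊕ Fin 2 → K => b (Sum.inr 1)) := IsPoly.var _
      have u0 : IsPoly (fun b : Fin 2 ⊕ Fin 2 → K => b (Sum.inl 0)) := IsPoly.var _
      have u1 : IsPoly (fun b : Fin 2 ⊕ Fin 2 → K => b (Sum.inl 1)) := IsPoly.var _
      have k0 := IsPoly.const (σ := Fin 2 ⊕ Fin 2) (0 : K)
      refine (Dio.and hns Dio.nonzero (Dio.ex (ρ := Fin 2) (Q := fun a y => (y 0 ≠ 0 ∧ y 1 ≠ 0) ∧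
        NR g g' (-(a 0 * a 1)) (-(a 0 * y 0)) (a 0 * a 1 * y 0 * y 1))
        (Dio.and hns (Dio.and hns (Dio.ne v0 k0) (Dio.ne v1 k0))
          (Dio.nr hns g g' (u0.mul u1).neg (u0.mul v0).neg (((u0.mul u1).mul v0).mul v1))))).congr fun a =>
            and_congr_right fun ha => ?_
      rw [aniso2 F ha]
      refine exists_congr fun y => and_congr_right fun hy => ?_
      have h01 := mul_ne_zero (ha 0) (ha 1)
      exact hg _ _ _ (neg_ne_zero.2 h01) (neg_ne_zero.2 (mul_ne_zero (ha 0) hy.1))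
        (mul_ne_zero (mul_ne_zero h01 hy.1) hy.2)
    · refine (Dio.and hns Dio.nonzero (Dio.nr hns g g' ((V 0).mul (V 1)).neg ((V 0).mul (V 2)).neg
        (IsPoly.const 1))).congr fun a => and_congr_right fun ha => ?_
      rw [aniso3 two ha]
      exact hg _ _ _ (neg_ne_zero.2 (mul_ne_zero (ha 0) (ha 1))) (neg_ne_zero.2 (mul_ne_zero (ha 0) (ha 2)))
        one_ne_zero
    · refine (Dio.and hns Dio.nonzero (Dio.nr hns g g' ((V 0).mul (V 1)).neg ((V 0).mul (V 2)).neg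
        ((((V 0).mul (V 1)).mul (V 2)).mul (V 3)))).congr fun a => and_congr_right fun ha => ?_
      rw [aniso4 two ha]
      exact hg _ _ _ (neg_ne_zero.2 (mul_ne_zero (ha 0) (ha 1))) (neg_ne_zero.2 (mul_ne_zero (ha 0) (ha 2)))
        (mul_ne_zero (mul_ne_zero (mul_ne_zero (ha 0) (ha 1)) (ha 2)) (ha 3))
end final
end GFF
end PG

/-- Over a global function field `K` of odd characteristic (a finite extension of `𝔽_q(t)`
with `q` odd), the set of `m`-tuples of nonzero coefficients whose associated diagonal
quadratic form is anisotropic is diophantine over `K`. -/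
theorem anisotropic_diagonal_diophantine_functionField
    (Fq K : Type*) [Field Fq] [Fintype Fq] [Field K] [Algebra (RatFunc Fq) K]
    [FunctionField Fq K] (hq : Odd (Fintype.card Fq)) (m : ℕ) (hm : 1 ≤ m) :
    IsDiophantine {a : Fin m → K |
      (∀ i, a i ≠ 0) ∧
      ∀ x : Fin m → K, (∑ i, a i * x i ^ 2) = 0 → x = 0} := by
  let _ : Algebra Fq K := ((algebraMap (RatFunc Fq) K).comp (algebraMap Fq (RatFunc Fq))).toAlgebra
  have _ : IsScalarTower Fq (RatFunc Fq) K := IsScalarTower.of_algebraMap_eq fun _ => rfl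
  have _ : FiniteDimensional (RatFunc Fq) K := ‹FunctionField Fq K›
  have _ : GFF.FF Fq K := GFF.FF.of_ratFunc
  have _ : NeZero (2 : Fq) := ⟨by
    have h := FiniteField.odd_card_of_char_ne_two (F := Fq)
    intro h2
    have hdvd : ringChar Fq ∣ 2 := (ringChar.spec Fq 2).1 (by exact_mod_cast h2)
    have hchar : ringChar Fq = 2 := ((Nat.dvd_prime Nat.prime_two).1 hdvd).resolve_left
      (CharP.ringChar_ne_one)
    have := FiniteField.even_card_of_char_two hchar
    rw [Nat.odd_iff] at hq
    omega⟩
  exact GFF.Dio.fin (GFF.final Fq K m hm)
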